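/- Let m, r, s be integers with r ≥ 2, s ≥ 1 and m > s. Let Λ_{r,s}(m) be the algebra of all polynomials P ∈ C[y_1,...,y_r, z_1,...,z_s] that are symmetric in the variables z_1,...,z_s and satisfy: (a) ((m∂_{z_l} − ∂_{y_j})P)|_{y_j = z_l} = 0 for all 1 ≤ j ≤ r, 1 ≤ l ≤ s; and (b) for all 1 ≤ j < k ≤ r, the difference P(...,y_j,...,y_k,...) − P(...,y_k,...,y_j,...) (swapping y_j and y_k) is divisible by (y_j − y_k)^{2m+1}. Then Λ_{r,s}(m) is Cohen–Macaulay; in fact it is a free module of finite rank over its polynomial subalgebra C[Q_1,...,Q_{r+s}], where Q_i := m(y_1^i + ... + y_r^i) + z_1^i + ... + z_s^i. -/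

import Mathlib

open MvPolynomial

set_option synthInstance.maxHeartbeats 1000000
set_option maxHeartbeats 1000000

noncomputable section

/-- The polynomial ring `ℂ[y_1,...,y_r,z_1,...,z_s]`, with `y_j = X (inl j)`,
`z_l = X (inr l)`. -/
abbrev Rrs (r s : ℕ) := MvPolynomial (Fin r ⊕ Fin s) ℂ

/-- The deformed Newton sum `Q_i = m(y_1^i + ... + y_r^i) + z_1^i + ... + z_s^i`. -/
def Qm (r s m : ℕ) (i : ℕ) : Rrs r s :=
  C (m : ℂ) * ∑ j : Fin r, X (Sum.inl j) ^ i + ∑ l : Fin s, X (Sum.inr l) ^ i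

/-- The space `Λ_{r,s}(m)` of `m`-quasi-invariants of type `(r,s)`: polynomials symmetric
in the `z`'s, satisfying `((m∂_{z_l} − ∂_{y_j})P)|_{y_j = z_l} = 0` for all `j, l`, and
such that for all `j < k` the difference of `P` and `P` with `y_j, y_k` swapped is
divisible by `(y_j − y_k)^{2m+1}`. -/
def QIset (r s m : ℕ) : Set (Rrs r s) :=
  {f | (∀ τ : Equiv.Perm (Fin s), rename (Sum.map id (⇑τ)) f = f) ∧
    (∀ (j : Fin r) (l : Fin s), ∀ v : Fin r ⊕ Fin s → ℂ,
      v (Sum.inl j) = v (Sum.inr l) →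
      eval v (C (m : ℂ) * pderiv (Sum.inr l) f - pderiv (Sum.inl j) f) = 0) ∧
    ∀ j k : Fin r, j ≠ k → ∃ g : Rrs r s,
      f - rename (Sum.map (⇑(Equiv.swap j k)) id) f =
        (X (Sum.inl j) - X (Sum.inl k)) ^ (2 * m + 1) * g}

/-- The polynomial subalgebra `ℂ[Q_1,...,Q_{r+s}]`. -/
def Bm (r s m : ℕ) : Subalgebra ℂ (Rrs r s) :=
  Algebra.adjoin ℂ {f : Rrs r s | ∃ i : ℕ, 1 ≤ i ∧ i ≤ r + s ∧ f = Qm r s m i}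

/-- `Λ_{r,s}(m)` viewed as a module over `ℂ[Q_1,...,Q_{r+s}]` (as its span, which
coincides with it since `Λ_{r,s}(m)` contains the `Q_i` and is closed under products). -/
def QImod (r s m : ℕ) : Submodule ↥(Bm r s m) (Rrs r s) :=
  Submodule.span (Bm r s m) (QIset r s m)

set_option linter.unusedSectionVars false

namespace QI
open Equiv

section Comb
variable {A : Type*} [Fintype A] [DecidableEq A]

/-- The sign of the restriction of `w` to `M` if `w` preserves `M`, and `0` otherwise. -/
def chi (M : Finset A) (w : Perm A) : ℤ :=
  if h : ∀ a, w a ∈ M ↔ a ∈ M then (Perm.sign (w.subtypePerm (p := (· ∈ M)) h) : ℤ) else 0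

lemma chi_of_not {M : Finset A} {w : Perm A} {a : A} (h : ¬ (w a ∈ M ↔ a ∈ M)) :
    chi M w = 0 := by
  unfold chi
  rw [dif_neg]
  exact fun h' => h (h' a)

lemma chi_one (M : Finset A) : chi M 1 = 1 := by
  unfold chi
  rw [dif_pos (by simp)]
  have : (1 : Perm A).subtypePerm (p := (· ∈ M)) (by simp) = 1 := by ext x; rfl
  rw [this, Perm.sign_one]; rfl

lemma chi_mul {M : Finset A} (w : Perm A) {v : Perm A} (hv : ∀ a, v a ∈ M ↔ a ∈ M) :
    chi M (w * v) = chi M w * chi M v := by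
  unfold chi
  rw [dif_pos hv]
  by_cases hw : ∀ a, w a ∈ M ↔ a ∈ M
  · have hwv : ∀ a, (w * v) a ∈ M ↔ a ∈ M := fun a => (hw _).trans (hv a)
    rw [dif_pos hw, dif_pos hwv]
    have : (w * v).subtypePerm (p := (· ∈ M)) hwv =
        w.subtypePerm (p := (· ∈ M)) hw * v.subtypePerm (p := (· ∈ M)) hv := by
      ext x; rfl
    rw [this, Perm.sign_mul]; push_cast; rfl
  · rw [dif_neg hw, dif_neg, zero_mul]
    intro h
    apply hw
    intro a
    have := h (v⁻¹ a)
    have h2 := hv (v⁻¹ a)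
    simp at this h2
    rw [this, h2]

omit [Fintype A] in
lemma swap_mem_iff {M : Finset A} {a b : A} (h : a ∈ M ↔ b ∈ M) (x : A) :
    swap a b x ∈ M ↔ x ∈ M := by
  by_cases hxa : x = a
  · subst hxa; simp [h]
  by_cases hxb : x = b
  · subst hxb; simp [h]
  rw [swap_apply_of_ne_of_ne hxa hxb]

lemma chi_swap_mem {M : Finset A} {a b : A} (ha : a ∈ M) (hb : b ∈ M) (hab : a ≠ b) :
    chi M (swap a b) = -1 := by
  unfold chi
  rw [dif_pos (swap_mem_iff (by simp [ha, hb]))]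
  have : (swap a b).subtypePerm (p := (· ∈ M)) (swap_mem_iff (by simp [ha, hb])) =
      swap ⟨a, ha⟩ ⟨b, hb⟩ := by
    ext ⟨x, hx⟩
    simp only [Perm.subtypePerm_apply]
    by_cases hxa : x = a
    · subst hxa; simp
    by_cases hxb : x = b
    · subst hxb; simp
    rw [swap_apply_of_ne_of_ne hxa hxb, swap_apply_of_ne_of_ne] <;> simpa
  rw [this, Perm.sign_swap]
  · rfl
  · simpa using hab

lemma chi_swap_not_mem {M : Finset A} {a b : A} (ha : a ∉ M) (hb : b ∉ M) :
    chi M (swap a b) = 1 := by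
  unfold chi
  rw [dif_pos (swap_mem_iff (by simp [ha, hb]))]
  have : (swap a b).subtypePerm (p := (· ∈ M)) (swap_mem_iff (by simp [ha, hb])) = 1 := by
    ext ⟨x, hx⟩
    have hxa : x ≠ a := fun h => ha (h ▸ hx)
    have hxb : x ≠ b := fun h => hb (h ▸ hx)
    simp [swap_apply_of_ne_of_ne hxa hxb]
  rw [this, Perm.sign_one]; rfl

variable {B : Type*} [DecidableEq B] (blk : A → B)

/-- Permutations preserving the blocks and fixing everything outside of `S`. -/
def young (S : Finset A) : Finset (Perm A) :=
  Finset.univ.filter fun w => (∀ a, blk (w a) = blk a) ∧ ∀ a ∉ S, w a = a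

lemma young_sum_insert {E : Type*} [AddCommMonoid E] (S : Finset A) (a : A) (ha : a ∉ S)
    (f : Perm A → E) :
    ∑ w ∈ young blk (insert a S), f w =
      ∑ b ∈ (insert a S).filter (fun b => blk b = blk a),
        ∑ w ∈ young blk S, f (w * swap a b) := by
  rw [Finset.sum_sigma']
  refine Finset.sum_bij' (fun w _ => ⟨w.symm a, w * swap a (w.symm a)⟩)
    (fun p _ => p.2 * swap a p.1) ?_ ?_ ?_ ?_ ?_
  · intro w hw
    simp only [young, Finset.mem_filter, Finset.mem_univ, true_and] at hw
    obtain ⟨h1, h2⟩ := hw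
    have hb : blk (w.symm a) = blk a := by rw [← h1 (w.symm a)]; simp
    simp only [Finset.mem_sigma, Finset.mem_filter, young, Finset.mem_univ, true_and]
    refine ⟨⟨?_, hb⟩, ?_, ?_⟩
    · by_contra hn
      have := h2 _ hn
      simp at this
      apply hn
      rw [← this]; simp
    · intro x
      rw [Perm.mul_apply, h1]
      by_cases hxa : x = a
      · subst hxa; simp [hb]
      by_cases hxb : x = w.symm a
      · rw [hxb]; simp [hb]
      rw [swap_apply_of_ne_of_ne hxa hxb]
    · intro x hx
      rw [Perm.mul_apply]
      by_cases hxa : x = a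
      · subst hxa; simp
      have hxS : w x = x := h2 x (by simp [hxa, hx])
      have hxb : x ≠ w.symm a := by
        rintro h
        have : w x = a := by rw [h]; simp
        exact hxa (hxS ▸ this)
      rw [swap_apply_of_ne_of_ne hxa hxb, hxS]
  · rintro ⟨b, w⟩ hp
    simp only [Finset.mem_sigma, Finset.mem_filter, young, Finset.mem_univ, true_and] at hp ⊢
    obtain ⟨⟨hb, hba⟩, h1, h2⟩ := hp
    refine ⟨fun x => ?_, fun x hx => ?_⟩
    · rw [Perm.mul_apply, h1]
      by_cases hxa : x = a
      · subst hxa; simp [hba]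
      by_cases hxb : x = b
      · rw [hxb]; simp [hba]
      rw [swap_apply_of_ne_of_ne hxa hxb]
    · have hxa : x ≠ a := fun h => hx (by simp [h])
      have hxb : x ≠ b := fun h => hx (h ▸ hb)
      rw [Perm.mul_apply, swap_apply_of_ne_of_ne hxa hxb]
      exact h2 x (fun h => hx (Finset.mem_insert_of_mem h))
  · intro w _
    simp [mul_assoc]
  · rintro ⟨b, w⟩ hp
    simp only [Finset.mem_sigma, Finset.mem_filter, young, Finset.mem_univ, true_and] at hp ⊢
    obtain ⟨⟨hb, hba⟩, h1, h2⟩ := hp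
    have hw : w.symm a = a := by rw [symm_apply_eq, h2 a ha]
    have : (w * swap a b).symm a = b := by
      rw [symm_apply_eq]; simp [h2 a ha]
    rw [this]
    simp [mul_assoc]
  · intro w _
    simp [mul_assoc]

lemma young_sum_ne_zero {K : Type*} [Field K] [CharZero K] (τ : Perm A → K) (M : Finset A)
    (κ : B → K)
    (hτ : ∀ (g : Perm A) (a b : A), (∀ x, blk (g x) = blk x) → g a = a → a ≠ b → blk b = blk a →
      τ (g * swap a b) * κ (blk a) = τ g)
    (h1 : τ 1 ≠ 0) (hκ0 : ∀ b, κ b ≠ 0)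
    (hκ1 : ∀ (b : B) (k : ℕ), κ b + k ≠ 0)
    (hκ2 : ∀ (b : B) (k : ℕ), k < (M.filter (fun a => blk a = b)).card → κ b ≠ k) :
    ∑ w ∈ Finset.univ.filter (fun w : Perm A => ∀ a, blk (w a) = blk a),
      (chi M w : K) * τ w ≠ 0 := by
  have key : ∀ S : Finset A, ∑ w ∈ young blk S, (chi M w : K) * τ w ≠ 0 := by
    intro S
    induction S using Finset.induction_on with
    | empty =>
      have : young blk (∅ : Finset A) = {1} := by
        ext w
        simp only [young, Finset.mem_filter, Finset.mem_univ, true_and, Finset.mem_singleton]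
        constructor
        · rintro ⟨_, h⟩; ext x; simpa using h x (by simp)
        · rintro rfl; simp
      rw [this]; simpa [chi_one] using h1
    | insert a S ha ih =>
      rw [young_sum_insert blk S a ha]
      rw [Finset.filter_insert, if_pos rfl, Finset.sum_insert (by simp [ha])]
      have e1 : ∑ w ∈ young blk S, (chi M (w * swap a a) : K) * τ (w * swap a a) =
          ∑ w ∈ young blk S, (chi M w : K) * τ w := by
        simp only [swap_self]; rfl
      rw [e1]
      set F := ∑ w ∈ young blk S, (chi M w : K) * τ w with hF
      set ε : K := if a ∈ M then -1 else 1 with hε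
      have e2 : ∀ b ∈ S.filter (fun b => blk b = blk a),
          ∑ w ∈ young blk S, (chi M (w * swap a b) : K) * τ (w * swap a b) =
          if (b ∈ M ↔ a ∈ M) then ε * (κ (blk a))⁻¹ * F else 0 := by
        intro b hb
        simp only [Finset.mem_filter] at hb
        have hab : a ≠ b := fun h => ha (h ▸ hb.1)
        split_ifs with hM
        · rw [hF, Finset.mul_sum]
          refine Finset.sum_congr rfl fun w hw => ?_
          simp only [young, Finset.mem_filter, Finset.mem_univ, true_and] at hw
          have := hτ w a b hw.1 (hw.2 a ha) hab hb.2
          rw [chi_mul w (swap_mem_iff hM.symm), ← this]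
          have : (chi M (swap a b) : K) = ε := by
            by_cases haM : a ∈ M
            · rw [chi_swap_mem haM (hM.2 haM) hab]; simp [hε, haM]
            · rw [chi_swap_not_mem haM (fun h => haM (hM.1 h))]; simp [hε, haM]
          push_cast
          rw [this]
          field_simp [hκ0 (blk a)]
        · refine Finset.sum_eq_zero fun w hw => ?_
          simp only [young, Finset.mem_filter, Finset.mem_univ, true_and] at hw
          rw [chi_of_not (a := b)]
          · simp
          · simp only [Perm.mul_apply, swap_apply_right, hw.2 a ha]
            exact fun h => hM h.symm
      rw [Finset.sum_congr rfl e2, ← Finset.sum_filter, Finset.sum_const, nsmul_eq_mul]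
      set k := ((S.filter (fun b => blk b = blk a)).filter (fun b => b ∈ M ↔ a ∈ M)).card with hk
      have : F + k * (ε * (κ (blk a))⁻¹ * F) = F * (κ (blk a))⁻¹ * (κ (blk a) + ε * k) := by
        field_simp [hκ0 (blk a)]
      rw [this]
      refine mul_ne_zero (mul_ne_zero ih (inv_ne_zero (hκ0 _))) ?_
      by_cases haM : a ∈ M
      · simp only [hε, haM, if_true]
        intro h
        refine hκ2 (blk a) k ?_ (by linear_combination h)
        refine lt_of_lt_of_le (Finset.card_lt_card (t := insert a
          ((S.filter (fun b => blk b = blk a)).filter (fun b => b ∈ M ↔ a ∈ M))) ?_)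
          (Finset.card_le_card ?_)
        · exact Finset.ssubset_insert (by simp [ha])
        · intro x
          simp only [Finset.mem_insert, Finset.mem_filter]
          rintro (rfl | ⟨⟨_, h2⟩, h3⟩)
          · exact ⟨haM, rfl⟩
          · exact ⟨h3.2 haM, h2⟩
      · simp only [hε, haM, if_false, one_mul]
        exact hκ1 _ _
  have := key Finset.univ
  simpa [young] using this

end Comb

section DD
variable {A : Type*} [DecidableEq A]

omit [DecidableEq A] in
lemma X_sub_X_ne_zero {a b : A} (hab : a ≠ b) : (X a - X b : MvPolynomial A ℂ) ≠ 0 := by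
  intro h
  exact hab (X_injective (R := ℂ) (sub_eq_zero.1 h))

lemma X_sub_X_dvd_swap (a b : A) (f : MvPolynomial A ℂ) :
    (X a - X b : MvPolynomial A ℂ) ∣ f - rename (swap a b) f := by
  induction f using MvPolynomial.induction_on with
  | C z => simp
  | add p q hp hq =>
    rw [map_add, add_sub_add_comm]
    exact dvd_add hp hq
  | mul_X p i hp =>
    have : p * X i - rename (swap a b) (p * X i) =
      (p - rename (swap a b) p) * X i + rename (swap a b) p * (X i - X (swap a b i)) := by
      simp; ring
    rw [this]
    refine dvd_add (Dvd.dvd.mul_right hp _) (Dvd.dvd.mul_left ?_ _)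
    by_cases hia : i = a
    · subst hia; simp
    by_cases hib : i = b
    · rw [hib, swap_apply_right]; exact ⟨-1, by ring⟩
    simp [swap_apply_of_ne_of_ne hia hib]

/-- The divided difference of a polynomial with respect to two variables. -/
def dd (a b : A) (f : MvPolynomial A ℂ) : MvPolynomial A ℂ :=
  if a = b then 0 else (X_sub_X_dvd_swap a b f).choose

lemma dd_self (a : A) (f : MvPolynomial A ℂ) : dd a a f = 0 := by simp [dd]

lemma dd_spec (a b : A) (f : MvPolynomial A ℂ) :
    (X a - X b) * dd a b f = f - rename (swap a b) f := by
  unfold dd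
  split_ifs with h
  · subst h; simp
  · exact (X_sub_X_dvd_swap a b f).choose_spec.symm

lemma dd_eq {a b : A} (hab : a ≠ b) {f g : MvPolynomial A ℂ}
    (h : (X a - X b) * g = f - rename (swap a b) f) : dd a b f = g :=
  mul_left_cancel₀ (X_sub_X_ne_zero hab) ((dd_spec a b f).trans h.symm)

lemma dd_C (a b : A) (z : ℂ) : dd a b (C z) = 0 := by
  by_cases hab : a = b
  · subst hab; exact dd_self _ _
  · exact dd_eq hab (by simp)

lemma dd_add (a b : A) (f g : MvPolynomial A ℂ) : dd a b (f + g) = dd a b f + dd a b g := by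
  by_cases hab : a = b
  · subst hab; simp [dd_self]
  · exact dd_eq hab (by rw [mul_add, dd_spec, dd_spec, map_add]; ring)

lemma dd_mul (a b : A) (f g : MvPolynomial A ℂ) :
    dd a b (f * g) = f * dd a b g + dd a b f * rename (swap a b) g := by
  by_cases hab : a = b
  · subst hab; simp [dd_self]
  · refine dd_eq hab ?_
    have h1 := dd_spec a b f
    have h2 := dd_spec a b g
    rw [map_mul]
    linear_combination f * h2 + rename (swap a b) g * h1

lemma dd_X_left {a b : A} (hab : a ≠ b) : dd a b (X a) = 1 := dd_eq hab (by simp)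
lemma dd_X_right {a b : A} (hab : a ≠ b) : dd a b (X b) = -1 := dd_eq hab (by simp)
lemma dd_X_of_ne {a b i : A} (ha : i ≠ a) (hb : i ≠ b) : dd a b (X i) = 0 := by
  by_cases hab : a = b
  · subst hab; exact dd_self _ _
  · exact dd_eq hab (by simp [swap_apply_of_ne_of_ne ha hb])

lemma dd_of_invariant {a b : A} {f : MvPolynomial A ℂ} (h : rename (swap a b) f = f) :
    dd a b f = 0 := by
  by_cases hab : a = b
  · subst hab; exact dd_self _ _
  · exact dd_eq hab (by simp [h])

end DD

/-- A representation of the rational Cherednik algebra of type `A`. -/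
structure HRep (A V : Type*) [Fintype A] [DecidableEq A] [AddCommGroup V] [Module ℂ V]
    [Module (MvPolynomial A ℂ) V] (c : ℂ) where
  ρ : Perm A →* Module.End ℂ V
  T : A → Module.End ℂ V
  ρ_smul : ∀ (w : Perm A) (f : MvPolynomial A ℂ) (v : V), ρ w (f • v) = rename w f • ρ w v
  ρ_T : ∀ (w : Perm A) (a : A) (v : V), ρ w (T a v) = T (w a) (ρ w v)
  T_ne : ∀ (a b : A) (v : V), a ≠ b →
    T a ((X b : MvPolynomial A ℂ) • v) = (X b : MvPolynomial A ℂ) • T a v + c • ρ (swap a b) v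
  T_self : ∀ (a : A) (v : V), T a ((X a : MvPolynomial A ℂ) • v) =
    (X a : MvPolynomial A ℂ) • T a v + v - c • ∑ b ∈ Finset.univ.erase a, ρ (swap a b) v

namespace HRep
variable {A V : Type*} [Fintype A] [DecidableEq A] [AddCommGroup V] [Module ℂ V]
    [Module (MvPolynomial A ℂ) V] [IsScalarTower ℂ (MvPolynomial A ℂ) V] {c : ℂ} (H : HRep A V c)
include H

lemma T_smul (a : A) (f : MvPolynomial A ℂ) (v : V) :
    H.T a (f • v) = f • H.T a v + pderiv a f • v -
      c • ∑ b ∈ Finset.univ.erase a, dd a b f • H.ρ (swap a b) v := by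
  induction f using MvPolynomial.induction_on generalizing v with
  | C z =>
    have : ∀ u : V, (C z : MvPolynomial A ℂ) • u = z • u := fun u => by
      rw [← algebraMap_eq, algebraMap_smul]
    simp [dd_C, this]
  | add p q hp hq =>
    simp only [add_smul, map_add, hp, hq, dd_add, Finset.sum_add_distrib, smul_add]
    abel
  | mul_X p i hp =>
    rw [mul_smul, hp]
    have hX : H.T a ((X i : MvPolynomial A ℂ) • v) = (X i : MvPolynomial A ℂ) • H.T a v +
      pderiv a (X i : MvPolynomial A ℂ) • v -
      c • ∑ b ∈ Finset.univ.erase a, dd a b (X i) • H.ρ (swap a b) v := by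
      by_cases hia : i = a
      · subst hia
        rw [H.T_self, pderiv_X_self, one_smul]
        congr 2
        refine Finset.sum_congr rfl fun b hb => ?_
        rw [dd_X_left (Finset.ne_of_mem_erase hb).symm, one_smul]
      · rw [H.T_ne a i v (Ne.symm hia), pderiv_X_of_ne hia, zero_smul, add_zero]
        rw [Finset.sum_eq_single i]
        · rw [dd_X_right (Ne.symm hia)]; simp
        · intro b _ hbi
          rw [dd_X_of_ne hia hbi.symm, zero_smul]
        · simp [hia]
    rw [hX]
    have e : ∀ b, dd a b (p * X i) • H.ρ (swap a b) v = p • (dd a b (X i) • H.ρ (swap a b) v) +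
       dd a b p • H.ρ (swap a b) ((X i : MvPolynomial A ℂ) • v) := by
      intro b
      rw [dd_mul, add_smul, mul_smul, mul_smul, H.ρ_smul]
    simp only [e, Finset.sum_add_distrib, smul_add, smul_sub, Derivation.leibniz, add_smul,
      smul_eq_mul, mul_smul, Finset.smul_sum]
    simp only [smul_comm c p]
    rw [smul_comm (X i : MvPolynomial A ℂ) (pderiv a p) v]
    abel

end HRep

section Ext
variable {R V E : Type*} [CommRing R] [Algebra ℂ R] [AddCommGroup V] [Module R V] [Module ℂ V]
  [IsScalarTower ℂ R V] [AddCommGroup E] [Module R E] [Module ℂ E] [IsScalarTower ℂ R E]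
  (S : Submonoid R) (l : V →ₗ[R] E) [IsLocalizedModule S l]
include S l

omit [Algebra ℂ R] [Module ℂ V] [IsScalarTower ℂ R V] [Module ℂ E] [IsScalarTower ℂ R E] in
lemma smul_inj_of_mem {s : R} (hs : s ∈ S) {x y : E} (h : s • x = s • y) : x = y :=
  IsLocalizedModule.smul_injective l ⟨s, hs⟩ h

omit [Algebra ℂ R] [Module ℂ V] [IsScalarTower ℂ R V] [Module ℂ E] [IsScalarTower ℂ R E] in
lemma exists_smul_eq {s : R} (hs : s ∈ S) (x : E) : ∃ y : E, s • y = x := by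
  have := (Module.End.isUnit_iff _).1 (IsLocalizedModule.map_units l ⟨s, hs⟩)
  exact this.2 x

lemma ext_aux (θ : V →ₗ[ℂ] E) (d : Derivation ℂ R R)
    (hθ : ∀ f ∈ S, ∀ v, θ (f • v) = f • θ v + d f • l v) (y : E) :
    ∃ e : E, ∀ s ∈ S, ∀ v, s • y = l v → s • e + d s • y = θ v := by
  obtain ⟨⟨v0, s0⟩, h0⟩ := IsLocalizedModule.surj S l y
  obtain ⟨e, he⟩ := exists_smul_eq S l s0.2 (θ v0 - d s0 • y)
  refine ⟨e, fun s hs v hv => ?_⟩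
  have h0' : (s0 : R) • y = l v0 := h0
  have : l ((s0 : R) • v) = l (s • v0) := by
    rw [map_smul, map_smul, ← hv, ← h0', smul_comm]
  obtain ⟨u, hu⟩ := (IsLocalizedModule.eq_iff_exists S l).1 this
  have hu' : ((u : R) * s0) • v = ((u : R) * s) • v0 := by
    rw [mul_smul, mul_smul]; exact hu
  have h1 := congrArg θ hu'
  rw [hθ _ (mul_mem u.2 s0.2), hθ _ (mul_mem u.2 hs), ← hv, ← h0'] at h1
  simp only [Derivation.leibniz, smul_eq_mul] at h1
  apply smul_inj_of_mem S l (mul_mem u.2 s0.2)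
  have h2 : ((u : R) * s0) • s • e = ((u : R) * s) • (θ v0 - d s0 • y) := by
    rw [← he]; simp only [smul_smul]; congr 1; ring
  rw [smul_add, h2]
  have h3 : ((u : R) * s0) • θ v = ((u : R) * s) • θ v0 + ((u * d s + s * d u) • (s0:R) • y) -
    ((u * d s0 + s0 * d u) • s • y) := by rw [← h1]; abel
  rw [h3]
  module

lemma exists_ext (θ : V →ₗ[ℂ] E) (d : Derivation ℂ R R)
    (hθ : ∀ f ∈ S, ∀ v, θ (f • v) = f • θ v + d f • l v) :
    ∃ θ' : E →ₗ[ℂ] E, (∀ v, θ' (l v) = θ v) ∧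
      ∀ f ∈ S, ∀ y, θ' (f • y) = f • θ' y + d f • y := by
  choose e he using ext_aux S l θ d hθ
  have hl : ∀ v, e (l v) = θ v := fun v => by
    have := he (l v) 1 S.one_mem v (one_smul _ _)
    simpa using this
  have sc : ∀ (z : ℂ) (f : R) (x : E), f • z • x = z • f • x := fun z f x => by
    rw [smul_comm]
  refine ⟨⟨⟨e, fun x y => ?_⟩, fun z x => ?_⟩, hl, fun f hf y => ?_⟩
  · obtain ⟨⟨v, s⟩, hx⟩ := IsLocalizedModule.surj S l x
    obtain ⟨⟨v', s'⟩, hy⟩ := IsLocalizedModule.surj S l y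
    have hx' : (s : R) • x = l v := hx
    have hy' : (s' : R) • y = l v' := hy
    have h1 := he x _ (mul_mem s.2 s'.2) ((s' : R) • v) (by
      rw [map_smul, ← hx', smul_smul, mul_comm])
    have h2 := he y _ (mul_mem s.2 s'.2) ((s : R) • v') (by
      rw [map_smul, ← hy', smul_smul])
    have h3 := he (x + y) _ (mul_mem s.2 s'.2) ((s' : R) • v + (s : R) • v') (by
      rw [map_add, map_smul, map_smul, ← hx', ← hy', smul_add, smul_smul, smul_smul, mul_comm])
    apply smul_inj_of_mem S l (mul_mem s.2 s'.2)
    rw [map_add, ← h1, ← h2, smul_add] at h3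
    rw [smul_add]
    have := congrArg (fun z => z - (d (s * s')) • x - (d (s * s')) • y) h3
    convert this using 1 <;> abel
  · obtain ⟨⟨v, s⟩, hx⟩ := IsLocalizedModule.surj S l x
    have hx' : (s : R) • x = l v := hx
    have h1 := he x _ s.2 v hx'
    have h3 := he (z • x) _ s.2 (z • v) (by
      rw [sc, hx', LinearMap.map_smul_of_tower])
    apply smul_inj_of_mem S l s.2
    rw [map_smul, ← h1, smul_add, sc] at h3
    simp only [RingHom.id_apply]
    rw [sc]
    exact add_right_cancel h3
  · obtain ⟨⟨v, s⟩, hx⟩ := IsLocalizedModule.surj S l y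
    have hx' : (s : R) • y = l v := hx
    have h1 := he y _ s.2 v hx'
    have h2 := he (f • y) _ s.2 (f • v) (by rw [smul_comm, hx', map_smul])
    rw [hθ f hf, ← hx', ← h1] at h2
    apply smul_inj_of_mem S l s.2
    have h3 : (s : R) • e (f • y) = f • ((s : R) • e y + d ↑s • y) + d f • (s : R) • y
      - d (s : R) • f • y := by rw [← h2]; abel
    change (s : R) • e (f • y) = (s : R) • (f • e y + d f • y)
    rw [h3]; module

end Ext

section Blocks
variable {A B : Type*} [Fintype A] [DecidableEq A] [DecidableEq B]
  (P : Ideal (MvPolynomial A ℂ)) [hP : P.IsPrime]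
  (blk : A → B) (hblk : ∀ a b, blk a = blk b ↔ (X a - X b : MvPolynomial A ℂ) ∈ P)
include hblk

omit [Fintype A] [DecidableEq A] [DecidableEq B] hP in
lemma sub_rename_mem (w : A → A) (hw : ∀ a, blk (w a) = blk a) (f : MvPolynomial A ℂ) :
    f - rename w f ∈ P := by
  induction f using MvPolynomial.induction_on with
  | C z => simp
  | add p q hp hq =>
    rw [map_add, add_sub_add_comm]
    exact add_mem hp hq
  | mul_X p i hp =>
    have : p * X i - rename w (p * X i) =
      (p - rename w p) * X i + rename w p * (X i - X (w i)) := by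
      simp; ring
    rw [this]
    exact add_mem (P.mul_mem_right _ hp) (P.mul_mem_left _ ((hblk _ _).1 (hw i).symm))

omit [Fintype A] [DecidableEq A] [DecidableEq B] hP in
lemma rename_mem_iff (w : A → A) (hw : ∀ a, blk (w a) = blk a) (f : MvPolynomial A ℂ) :
    rename w f ∈ P ↔ f ∈ P := by
  have := sub_rename_mem P blk hblk w hw f
  constructor
  · intro h; simpa using add_mem this h
  · intro h; simpa using sub_mem h this

omit hblk in
/-- Block-invariant polynomials outside of `P`. -/
def invSub : Submonoid (MvPolynomial A ℂ) where
  carrier := {f | f ∉ P ∧ ∀ w : Perm A, (∀ a, blk (w a) = blk a) → rename w f = f}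
  one_mem' := ⟨fun h => hP.ne_top ((Ideal.eq_top_iff_one _).2 h), fun w _ => map_one _⟩
  mul_mem' := fun {f g} hf hg => ⟨fun h => (hP.mem_or_mem h).elim hf.1 hg.1,
    fun w hw => by rw [map_mul, hf.2 w hw, hg.2 w hw]⟩

lemma exists_mul_mem_invSub {f : MvPolynomial A ℂ} (hf : f ∉ P) :
    ∃ h, f * h ∈ invSub P blk := by
  classical
  set W := Finset.univ.filter (fun w : Perm A => ∀ a, blk (w a) = blk a) with hW
  have h1 : (1 : Perm A) ∈ W := by simp [hW]
  refine ⟨∏ w ∈ W.erase 1, rename w f, ?_⟩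
  have e : f * ∏ w ∈ W.erase 1, rename w f = ∏ w ∈ W, rename w f := by
    rw [← Finset.mul_prod_erase W _ h1]
    simp
  rw [e]
  refine ⟨fun h => ?_, fun v hv => ?_⟩
  · obtain ⟨w, hw, hwf⟩ := (hP.prod_mem_iff).1 h
    exact hf ((rename_mem_iff P blk hblk w (by simpa [hW] using hw) f).1 hwf)
  · rw [map_prod]
    refine Finset.prod_bij' (fun w _ => v * w) (fun w _ => v⁻¹ * w) ?_ ?_ ?_ ?_ ?_
    · intro w hw
      simp only [hW, Finset.mem_filter, Finset.mem_univ, true_and] at hw ⊢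
      intro a; rw [Perm.mul_apply, hv, hw]
    · intro w hw
      simp only [hW, Finset.mem_filter, Finset.mem_univ, true_and] at hw ⊢
      intro a; rw [← hv]; simp [hw]
    · intro w _; simp
    · intro w _; simp
    · intro w _; rw [rename_rename]; rfl

end Blocks

lemma exists_mul_pow_mem {R : Type*} [CommRing R] {I P : Ideal R} (hP : P ∈ I.minimalPrimes)
    {f : R} (hf : f ∈ P) : ∃ g, g ∉ P ∧ ∃ k : ℕ, g * f ^ k ∈ I := by
  by_contra! hcon
  have hPp : P.IsPrime := hP.1.1
  let S : Submonoid R :=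
    { carrier := {x | ∃ g, g ∉ P ∧ ∃ k : ℕ, x = g * f ^ k}
      one_mem' := ⟨1, fun h => hPp.ne_top ((Ideal.eq_top_iff_one _).2 h), 0, by simp⟩
      mul_mem' := by
        rintro _ _ ⟨g, hg, k, rfl⟩ ⟨g', hg', k', rfl⟩
        exact ⟨g * g', fun h => (hPp.mem_or_mem h).elim hg hg', k + k', by ring⟩ }
  have hdis : Disjoint (I : Set R) (S : Set R) := by
    rw [Set.disjoint_left]
    rintro _ hx ⟨g, hg, k, rfl⟩
    exact hcon g hg k hx
  obtain ⟨Q, hQ, hIQ, hQS⟩ := Ideal.exists_le_prime_disjoint I S hdis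
  have hQP : Q ≤ P := by
    intro x hx
    by_contra hxP
    exact Set.disjoint_left.1 hQS hx ⟨x, hxP, 0, by simp⟩
  have := hP.2 ⟨hQ, hIQ⟩ hQP hf
  exact Set.disjoint_left.1 hQS this
    ⟨1, fun h => hPp.ne_top ((Ideal.eq_top_iff_one _).2 h), 1, by simp⟩

/-- The structure obtained on the localization of a representation at a prime ideal. -/
structure LRep {A B : Type*} [Fintype A] [DecidableEq A] [DecidableEq B]
    (P : Ideal (MvPolynomial A ℂ)) (blk : A → B) (c : ℂ)
    (E : Type*) [AddCommGroup E] [Module (MvPolynomial A ℂ) E] [Module ℂ E] where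
  ρ : Perm A → Module.End ℂ E
  θ : A → Module.End ℂ E
  ρ_one : ρ 1 = 1
  ρ_mul : ∀ v w, (∀ a, blk (v a) = blk a) → (∀ a, blk (w a) = blk a) → ρ (v * w) = ρ v * ρ w
  ρ_smul : ∀ w, (∀ a, blk (w a) = blk a) → ∀ (f : MvPolynomial A ℂ) y,
    ρ w (f • y) = rename w f • ρ w y
  ρ_θ : ∀ w, (∀ a, blk (w a) = blk a) → ∀ a y, ρ w (θ a y) = θ (w a) (ρ w y)
  θ_smul : ∀ a (f : MvPolynomial A ℂ) y, θ a (f • y) = f • θ a y + pderiv a f • y -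
      c • ∑ b ∈ (Finset.univ.erase a).filter (fun b => blk b = blk a),
        dd a b f • ρ (swap a b) y
  unit : ∀ f, f ∉ P → Function.Bijective (fun y : E => f • y)
  nil : ∃ k : ℕ, ∀ f ∈ P ^ k, ∀ y : E, f • y = 0

section Loc
variable {A B V E : Type*} [Fintype A] [DecidableEq A] [DecidableEq B] [AddCommGroup V] [Module ℂ V]
    [Module (MvPolynomial A ℂ) V] [IsScalarTower ℂ (MvPolynomial A ℂ) V]
    [AddCommGroup E] [Module (MvPolynomial A ℂ) E] [Module ℂ E]
    [IsScalarTower ℂ (MvPolynomial A ℂ) E]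
    {c : ℂ} (H : HRep A V c)
    (P : Ideal (MvPolynomial A ℂ)) [hP : P.IsPrime]
    (hPmin : P ∈ (Module.annihilator (MvPolynomial A ℂ) V).minimalPrimes)
    (blk : A → B) (hblk : ∀ a b, blk a = blk b ↔ (X a - X b : MvPolynomial A ℂ) ∈ P)
    (l : V →ₗ[MvPolynomial A ℂ] E) [IsLocalizedModule (invSub P blk) l]

omit [IsScalarTower ℂ (MvPolynomial A ℂ) V] in
include l in
lemma eq_of_eq_on (φ ψ : Module.End ℂ E)
    (h : ∀ f ∈ invSub P blk, ∀ y, φ (f • y) - ψ (f • y) = f • (φ y - ψ y))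
    (hl : ∀ v, φ (l v) = ψ (l v)) : φ = ψ := by
  ext y
  obtain ⟨⟨v, s⟩, hx⟩ := IsLocalizedModule.surj (invSub P blk) l y
  have hx' : (s : MvPolynomial A ℂ) • y = l v := hx
  have := h s s.2 y
  rw [hx', hl, sub_self] at this
  rw [← sub_eq_zero]
  apply smul_inj_of_mem (invSub P blk) l s.2
  rw [← this, smul_zero]

include hblk l in
lemma smul_bijective {f : MvPolynomial A ℂ} (hf : f ∉ P) :
    Function.Bijective (fun y : E => f • y) := by
  obtain ⟨h, hh⟩ := exists_mul_mem_invSub P blk hblk hf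
  constructor
  · intro x y hxy
    apply smul_inj_of_mem _ l hh
    rw [mul_comm, mul_smul, mul_smul]
    exact congrArg _ hxy
  · intro x
    obtain ⟨y, hy⟩ := exists_smul_eq _ l hh x
    exact ⟨h • y, by simpa [smul_smul] using hy⟩

include hPmin hblk l in
lemma nilpotent_aux : ∃ k : ℕ, ∀ f ∈ P ^ k, ∀ y : E, f • y = 0 := by
  have h1 : P ≤ (Module.annihilator (MvPolynomial A ℂ) E).radical := by
    intro f hf
    obtain ⟨k, hk1, g, hk2⟩ := exists_mul_pow_mem hPmin hf
    refine ⟨g, Module.mem_annihilator.2 fun y => ?_⟩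
    obtain ⟨⟨v, s⟩, hx⟩ := IsLocalizedModule.surj (invSub P blk) l y
    have hx' : (s : MvPolynomial A ℂ) • y = l v := hx
    apply smul_inj_of_mem _ l s.2
    apply (smul_bijective P blk hblk l hk1).1
    have h0 := Module.mem_annihilator.1 hk2 v
    change k • (s : MvPolynomial A ℂ) • f ^ g • y = k • (s : MvPolynomial A ℂ) • 0
    rw [smul_comm (s : MvPolynomial A ℂ), hx', ← map_smul, ← map_smul, smul_smul]
    rw [h0, map_zero, smul_zero, smul_zero]
  obtain ⟨k, hk⟩ := Ideal.exists_pow_le_of_le_radical_of_fg h1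
    (IsNoetherian.noetherian P)
  exact ⟨k, fun f hf y => Module.mem_annihilator.1 (hk hf) y⟩

include hPmin hblk in
theorem exists_LRep : ∃ L : LRep P blk c E, ∀ w, (∀ a, blk (w a) = blk a) → ∀ v,
    L.ρ w (l v) = l (H.ρ w v) := by
  classical
  set S := invSub P blk with hS
  have unit := fun f (hf : f ∉ P) => smul_bijective P blk hblk l hf
  have lsm : ∀ (z : ℂ) (v : V), l (z • v) = z • l v := fun z v =>
    LinearMap.map_smul_of_tower l z v
  let lC : V →ₗ[ℂ] E := l.restrictScalars ℂ
  have cs : ∀ (z : ℂ) (f : MvPolynomial A ℂ) (y : E), f • z • y = z • f • y :=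
    fun z f y => smul_comm _ _ _
  -- extension of the permutations
  have hρ : ∀ w : Perm A, ∃ φ : E →ₗ[ℂ] E, (∀ a, blk (w a) = blk a) →
      (∀ v, φ (l v) = l (H.ρ w v)) ∧ ∀ f ∈ S, ∀ y, φ (f • y) = f • φ y := by
    intro w
    by_cases hw : ∀ a, blk (w a) = blk a
    · obtain ⟨φ, h1, h2⟩ := exists_ext S l (lC ∘ₗ H.ρ w) 0 (by
        intro f hf v
        simp [lC, H.ρ_smul, hf.2 w hw])
      exact ⟨φ, fun _ => ⟨h1, fun f hf y => by simpa using h2 f hf y⟩⟩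
    · exact ⟨0, fun h => absurd h hw⟩
  choose ρ' hρ' using hρ
  have hsw : ∀ a b, blk b = blk a → ∀ x, blk (swap a b x) = blk x := by
    intro a b hab x
    by_cases hxa : x = a
    · subst hxa; simp [hab]
    by_cases hxb : x = b
    · rw [hxb]; simp [hab]
    rw [swap_apply_of_ne_of_ne hxa hxb]
  have E1 : ∀ w, (∀ a, blk (w a) = blk a) → ∀ (f : MvPolynomial A ℂ) y,
      ρ' w (f • y) = rename w f • ρ' w y := by
    intro w hw f
    have := eq_of_eq_on P blk l (ρ' w ∘ₗ (LinearMap.lsmul _ E f).restrictScalars ℂ)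
      ((LinearMap.lsmul _ E (rename w f)).restrictScalars ℂ ∘ₗ ρ' w) (by
        intro g hg y
        simp only [LinearMap.comp_apply, LinearMap.coe_restrictScalars, LinearMap.lsmul_apply]
        rw [smul_comm f g, (hρ' w hw).2 g hg, (hρ' w hw).2 g hg, smul_sub, smul_comm g])
      (by
        intro v
        simp only [LinearMap.comp_apply, LinearMap.coe_restrictScalars, LinearMap.lsmul_apply]
        rw [← map_smul, (hρ' w hw).1, (hρ' w hw).1, H.ρ_smul, map_smul])
    exact fun y => LinearMap.congr_fun this y
  -- inverse operators
  have hiv : ∀ f : MvPolynomial A ℂ, ∃ φ : E →ₗ[MvPolynomial A ℂ] E, f ∉ P →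
      ∀ y, f • φ y = y := by
    intro f
    by_cases hf : f ∉ P
    · let e := LinearEquiv.ofBijective (LinearMap.lsmul (MvPolynomial A ℂ) E f) (unit f hf)
      refine ⟨e.symm, fun _ y => ?_⟩
      exact e.apply_symm_apply y
    · exact ⟨0, fun h => absurd h hf⟩
  choose iv hiv using hiv
  have hnot : ∀ a b, ¬ blk b = blk a → (X a - X b : MvPolynomial A ℂ) ∉ P := fun a b h h' =>
    h ((hblk a b).2 h').symm
  let θ0 : A → (V →ₗ[ℂ] E) := fun a => lC ∘ₗ H.T a -
    c • ∑ b ∈ (Finset.univ.erase a).filter (fun b => ¬ blk b = blk a),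
      (iv (X a - X b)).restrictScalars ℂ ∘ₗ lC ∘ₗ H.ρ (swap a b)
  have θ0_apply : ∀ a v, θ0 a v = l (H.T a v) -
    c • ∑ b ∈ (Finset.univ.erase a).filter (fun b => ¬ blk b = blk a),
      iv (X a - X b) (l (H.ρ (swap a b) v)) := by
    intro a v
    simp [θ0, lC, LinearMap.sum_apply]
  have θ0_smul : ∀ a (f : MvPolynomial A ℂ) v, θ0 a (f • v) = f • θ0 a v + pderiv a f • l v -
      c • ∑ b ∈ (Finset.univ.erase a).filter (fun b => blk b = blk a),
        dd a b f • l (H.ρ (swap a b) v) := by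
    intro a f v
    rw [θ0_apply, θ0_apply, H.T_smul]
    have e : ∀ b ∈ (Finset.univ.erase a).filter (fun b => ¬ blk b = blk a),
        iv (X a - X b) (l (H.ρ (swap a b) (f • v))) =
        f • iv (X a - X b) (l (H.ρ (swap a b) v)) - dd a b f • l (H.ρ (swap a b) v) := by
      intro b hb
      have hb' := hnot a b (Finset.mem_filter.1 hb).2
      apply (unit _ hb').1
      simp only
      rw [hiv _ hb', smul_sub, smul_comm _ f, hiv _ hb', smul_smul, dd_spec, H.ρ_smul, map_smul,
        sub_smul]
      abel
    rw [Finset.sum_congr rfl e, Finset.sum_sub_distrib,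
      ← Finset.sum_filter_add_sum_filter_not (Finset.univ.erase a) (fun b => blk b = blk a)]
    simp only [map_add, map_sub, lsm, map_sum, map_smul, smul_sub, cs, smul_add, ← Finset.smul_sum]
    abel
  have hθ : ∀ a, ∃ φ : E →ₗ[ℂ] E, (∀ v, φ (l v) = θ0 a v) ∧
      ∀ f ∈ S, ∀ y, φ (f • y) = f • φ y + pderiv a f • y := by
    intro a
    refine exists_ext S l (θ0 a) (pderiv a) fun f hf v => ?_
    rw [θ0_smul, Finset.sum_eq_zero, smul_zero, sub_zero]
    intro b hb
    rw [dd_of_invariant (hf.2 _ (hsw a b (Finset.mem_filter.1 hb).2)), zero_smul]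
  choose θ hθl hθS using hθ
  have E2 : ∀ v w, (∀ a, blk (v a) = blk a) → (∀ a, blk (w a) = blk a) →
      ρ' (v * w) = ρ' v * ρ' w := by
    intro v w hv hw
    have hvw : ∀ a, blk ((v * w) a) = blk a := fun a => by rw [Perm.mul_apply, hv, hw]
    refine eq_of_eq_on P blk l _ _ (fun f hf y => ?_) (fun x => ?_)
    · simp only [Module.End.mul_apply]
      rw [(hρ' _ hvw).2 f hf, (hρ' _ hw).2 f hf, (hρ' _ hv).2 f hf, smul_sub]
    · simp only [Module.End.mul_apply]
      rw [(hρ' _ hvw).1, (hρ' _ hw).1, (hρ' _ hv).1, map_mul, Module.End.mul_apply]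
  have E3 : ∀ w, (∀ a, blk (w a) = blk a) → ∀ a y, ρ' w (θ a y) = θ (w a) (ρ' w y) := by
    intro w hw a
    have := eq_of_eq_on P blk l (ρ' w ∘ₗ θ a) (θ (w a) ∘ₗ ρ' w) (by
        intro g hg y
        simp only [LinearMap.comp_apply]
        rw [hθS a g hg, map_add, (hρ' w hw).2 g hg, (hρ' w hw).2 g hg, hθS _ g hg, E1 w hw,
          ← pderiv_rename w.injective, hg.2 w hw, smul_sub]
        abel) (by
        intro v
        simp only [LinearMap.comp_apply]
        rw [hθl, θ0_apply, (hρ' w hw).1, hθl, θ0_apply, map_sub, (hρ' w hw).1, H.ρ_T, map_smul,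
          map_sum]
        congr 2
        refine Finset.sum_bij' (fun b _ => w b) (fun b _ => w.symm b) ?_ ?_ ?_ ?_ ?_
        · intro b hb
          simp only [Finset.mem_filter, Finset.mem_erase, Finset.mem_univ, and_true] at hb ⊢
          exact ⟨fun h => hb.1 (w.injective h), by rw [hw, hw]; exact hb.2⟩
        · intro b hb
          simp only [Finset.mem_filter, Finset.mem_erase, Finset.mem_univ, and_true] at hb ⊢
          refine ⟨fun h => hb.1 (by rw [← h]; simp), ?_⟩
          rw [← hw (w.symm b)]; simpa [hw] using hb.2
        · intro b _; simp
        · intro b _; simp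
        · intro b hb
          have hb' := (Finset.mem_filter.1 hb).2
          have h1 := hnot a b hb'
          have h2 := hnot (w a) (w b) (by rw [hw, hw]; exact hb')
          apply (unit _ h2).1
          simp only
          rw [hiv _ h2]
          have : (X (w a) - X (w b) : MvPolynomial A ℂ) = rename w (X a - X b) := by simp
          rw [this, ← E1 w hw, hiv _ h1, (hρ' w hw).1, ← Module.End.mul_apply,
            ← Module.End.mul_apply, ← map_mul, ← map_mul, Equiv.mul_swap_eq_swap_mul])
    exact fun y => LinearMap.congr_fun this y
  have E4 : ∀ a (f : MvPolynomial A ℂ) y, θ a (f • y) = f • θ a y + pderiv a f • y -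
      c • ∑ b ∈ (Finset.univ.erase a).filter (fun b => blk b = blk a),
        dd a b f • ρ' (swap a b) y := by
    intro a f
    have := eq_of_eq_on P blk l (θ a ∘ₗ (LinearMap.lsmul _ E f).restrictScalars ℂ)
      ((LinearMap.lsmul _ E f).restrictScalars ℂ ∘ₗ θ a +
        (LinearMap.lsmul _ E (pderiv a f)).restrictScalars ℂ -
        c • ∑ b ∈ (Finset.univ.erase a).filter (fun b => blk b = blk a),
        (LinearMap.lsmul _ E (dd a b f)).restrictScalars ℂ ∘ₗ ρ' (swap a b)) (by
        intro g hg y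
        simp only [LinearMap.comp_apply, LinearMap.coe_restrictScalars, LinearMap.lsmul_apply,
          LinearMap.sub_apply, LinearMap.add_apply, LinearMap.smul_apply, LinearMap.sum_apply]
        rw [smul_comm f g, hθS a g hg, hθS a g hg]
        have e : ∀ b ∈ (Finset.univ.erase a).filter (fun b => blk b = blk a),
            dd a b f • ρ' (swap a b) (g • y) = g • (dd a b f • ρ' (swap a b) y) := by
          intro b hb
          rw [(hρ' _ (hsw a b (Finset.mem_filter.1 hb).2)).2 g hg, smul_comm]
        rw [Finset.sum_congr rfl e, ← Finset.smul_sum]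
        simp only [smul_sub, smul_add, cs]
        rw [smul_comm f g, smul_comm (pderiv a f) g, smul_comm f (pderiv a g)]
        abel)
      (by
        intro v
        simp only [LinearMap.comp_apply, LinearMap.coe_restrictScalars, LinearMap.lsmul_apply,
          LinearMap.sub_apply, LinearMap.add_apply, LinearMap.smul_apply, LinearMap.sum_apply]
        rw [← map_smul, hθl, hθl, θ0_smul]
        congr 2
        refine Finset.sum_congr rfl fun b hb => ?_
        rw [(hρ' _ (hsw a b (Finset.mem_filter.1 hb).2)).1])
    intro y
    have h := LinearMap.congr_fun this y
    simp only [LinearMap.comp_apply, LinearMap.coe_restrictScalars, LinearMap.lsmul_apply,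
          LinearMap.sub_apply, LinearMap.add_apply, LinearMap.smul_apply, LinearMap.sum_apply] at h
    exact h
  refine ⟨⟨ρ', θ, ?_, E2, E1, E3, E4, unit, nilpotent_aux P hPmin blk hblk l⟩,
    fun w hw => (hρ' w hw).1⟩
  refine eq_of_eq_on P blk l _ _ (fun f hf y => ?_) (fun x => ?_)
  · rw [(hρ' 1 (fun _ => rfl)).2 f hf, smul_sub]; rfl
  · rw [(hρ' 1 (fun _ => rfl)).1]; simp

end Loc

lemma eq_zero_of_pderiv_stable {B : Type*} (I : Ideal (MvPolynomial B ℂ)) (hI : I ≠ ⊤)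
    (hd : ∀ b, ∀ f ∈ I, pderiv b f ∈ I) : ∀ f ∈ I, f = 0 := by
  classical
  have hC : ∀ z : ℂ, (C z : MvPolynomial B ℂ) ∈ I → z = 0 := by
    intro z hz
    by_contra h
    apply hI
    rw [Ideal.eq_top_iff_one]
    have := I.mul_mem_left (C z⁻¹) hz
    rwa [← C_mul, inv_mul_cancel₀ h, C_1] at this
  have key : ∀ (d : ℕ), ∀ f ∈ I, (∀ m, coeff m f ≠ 0 → m.degree ≤ d) → f = 0 := by
    intro d
    induction d with
    | zero =>
      intro f hf hm
      have : f = C (coeff 0 f) := by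
        ext m
        rw [coeff_C]
        split_ifs with h
        · rw [h]
        · by_contra h'
          have := hm m h'
          exact h ((Finsupp.degree_eq_zero_iff m).1 (Nat.le_zero.1 this)).symm
      rw [this] at hf ⊢
      rw [hC _ hf, C_0]
    | succ d ih =>
      intro f hf hm
      have h0 : ∀ b, pderiv b f = 0 := by
        intro b
        refine ih _ (hd b f hf) fun m h => ?_
        rw [coeff_pderiv] at h
        have := hm _ (left_ne_zero_of_mul h)
        rw [map_add] at this
        simpa using this
      have h1 : ∀ m, m ≠ 0 → coeff m f = 0 := by
        intro m hm0
        obtain ⟨b, hb⟩ := Finsupp.ne_iff.1 hm0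
        have := coeff_pderiv (i := b) f (m - Finsupp.single b 1)
        rw [h0, coeff_zero] at this
        have e : m - Finsupp.single b 1 + Finsupp.single b 1 = m := by
          apply tsub_add_cancel_of_le
          rw [Finsupp.single_le_iff]
          exact Nat.one_le_iff_ne_zero.2 hb
        rw [e] at this
        refine (mul_eq_zero.1 this.symm).resolve_right ?_
        exact Nat.cast_add_one_ne_zero _
      have : f = C (coeff 0 f) := by
        ext m
        rw [coeff_C]
        split_ifs with h
        · rw [h]
        · exact h1 m (Ne.symm h)
      rw [this] at hf ⊢
      rw [hC _ hf, C_0]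
  intro f hf
  refine key (f.support.sup Finsupp.degree) f hf fun m hm => ?_
  exact Finset.le_sup (f := Finsupp.degree) (mem_support_iff.2 hm)

lemma dd_comm {A : Type*} [DecidableEq A] (a b : A) (f : MvPolynomial A ℂ) :
    dd a b f = - dd b a f := by
  by_cases hab : a = b
  · subst hab; simp [dd_self]
  · refine dd_eq hab ?_
    rw [swap_comm, ← dd_spec]; ring

namespace LRep
variable {A B E : Type*} [Fintype A] [DecidableEq A] [DecidableEq B]
    [AddCommGroup E] [Module (MvPolynomial A ℂ) E] [Module ℂ E]
    [IsScalarTower ℂ (MvPolynomial A ℂ) E]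
    {c : ℂ} {P : Ideal (MvPolynomial A ℂ)} [hP : P.IsPrime]
    {blk : A → B} (L : LRep P blk c E)

/-- The sum of the Dunkl operators over a block. -/
def pB (b : B) : Module.End ℂ E := ∑ a ∈ Finset.univ.filter (fun a => blk a = b), L.θ a

lemma pB_smul (b : B) (f : MvPolynomial A ℂ) (y : E) : L.pB b (f • y) = f • L.pB b y +
    (∑ a ∈ Finset.univ.filter (fun a => blk a = b), pderiv a f) • y := by
  unfold pB
  simp only [LinearMap.sum_apply, L.θ_smul, Finset.sum_sub_distrib, Finset.sum_add_distrib,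
    Finset.smul_sum, Finset.sum_smul]
  rw [sub_eq_self]
  simp only [← Finset.smul_sum]
  set G : A → A → E := fun a a' => dd a a' f • L.ρ (swap a a') y with hG
  have e : ∀ a ∈ Finset.univ.filter (fun a => blk a = b),
      ∑ a' ∈ (Finset.univ.erase a).filter (fun b => blk b = blk a), G a a' =
      ∑ a' ∈ Finset.univ.filter (fun a => blk a = b), G a a' := by
    intro a ha
    have ha' := (Finset.mem_filter.1 ha).2
    rw [ha']
    refine Finset.sum_subset (fun x hx => ?_) (fun x hx hx' => ?_)
    · simp at hx ⊢; exact hx.2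
    · have : x = a := by
        by_contra h
        apply hx'
        simp at hx ⊢
        exact ⟨h, hx⟩
      simp [hG, this, dd_self]
  rw [Finset.sum_congr rfl e]
  have h1 : ∀ a a', G a a' = - G a' a := by
    intro a a'
    simp only [hG]
    rw [dd_comm, swap_comm, neg_smul]
  set t := ∑ a ∈ Finset.univ.filter (fun a => blk a = b),
    ∑ a' ∈ Finset.univ.filter (fun a => blk a = b), G a a' with ht
  have h2 : t = - t := by
    conv_lhs => rw [ht, Finset.sum_comm]
    rw [ht, ← Finset.sum_neg_distrib]
    refine Finset.sum_congr rfl fun a _ => ?_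
    rw [← Finset.sum_neg_distrib]
    exact Finset.sum_congr rfl fun a' _ => h1 _ _
  have h3 : (2 : ℂ) • t = 0 := by
    rw [two_smul]; nth_rw 1 [h2]; simp
  have : t = 0 := by
    have := congrArg (fun x => (2 : ℂ)⁻¹ • x) h3
    simpa [smul_smul] using this
  rw [this, smul_zero]

include L in
lemma sum_pderiv_mem [Nontrivial E] (b : B) {f : MvPolynomial A ℂ} (hf : f ∈ P) :
    ∑ a ∈ Finset.univ.filter (fun a => blk a = b), pderiv a f ∈ P := by
  by_contra hcon
  set D := ∑ a ∈ Finset.univ.filter (fun a => blk a = b), pderiv a f with hD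
  obtain ⟨k, hk⟩ := L.nil
  have step : ∀ j : ℕ, (∀ y : E, f ^ j • y = 0) → False := by
    intro j
    induction j with
    | zero =>
      intro h
      obtain ⟨y, hy⟩ := exists_ne (0 : E)
      exact hy (by simpa using h y)
    | succ j ih =>
      intro h
      apply ih
      intro y
      have h1 := L.pB_smul b (f ^ (j + 1)) y
      have h2 : ∑ a ∈ Finset.univ.filter (fun a => blk a = b), pderiv a (f ^ (j + 1)) =
          ((j : ℂ) + 1) • (D * f ^ j) := by
        rw [hD, Finset.sum_mul, Finset.smul_sum]
        refine Finset.sum_congr rfl fun a _ => ?_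
        rw [Derivation.leibniz_pow, Nat.add_sub_cancel, smul_eq_mul, smul_eq_C_mul, nsmul_eq_mul]
        push_cast
        simp only [map_add, map_natCast, map_one, smul_eq_mul]
        ring
      rw [h, h, map_zero, zero_add, h2, smul_assoc, mul_smul] at h1
      have h3 : ((j : ℂ) + 1) ≠ 0 := by exact_mod_cast Nat.succ_ne_zero j
      have h4 := congrArg (fun x => ((j : ℂ) + 1)⁻¹ • x) h1.symm
      simp only [smul_smul, inv_mul_cancel₀ h3, one_smul, smul_zero] at h4
      rw [mul_smul] at h4
      exact (L.unit D hcon).1 (h4.trans (smul_zero D).symm)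
  exact step k fun y => hk _ (Ideal.pow_mem_pow hf k) y

include L in
theorem mem_iff [Nontrivial E] (hs : Function.Surjective blk)
    (hblk : ∀ a b, blk a = blk b ↔ (X a - X b : MvPolynomial A ℂ) ∈ P) (f : MvPolynomial A ℂ) :
    f ∈ P ↔ rename blk f = 0 := by
  classical
  obtain ⟨sec, hsec⟩ := hs.hasRightInverse
  have hw : ∀ a, blk ((sec ∘ blk) a) = blk a := fun a => hsec (blk a)
  have h1 := sub_rename_mem P blk hblk (sec ∘ blk) hw f
  rw [← rename_rename] at h1
  have hf1 : f ∈ P ↔ rename sec (rename blk f) ∈ P := by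
    constructor
    · intro h; simpa using sub_mem h h1
    · intro h; simpa using add_mem h1 h
  rw [hf1]
  constructor
  swap
  · intro h; rw [h, map_zero]; exact zero_mem _
  intro h
  refine eq_zero_of_pderiv_stable (P.comap (rename sec : MvPolynomial B ℂ →ₐ[ℂ] _)) ?_ ?_ _ h
  · exact Ideal.comap_ne_top _ hP.ne_top
  · intro b g hg
    rw [Ideal.mem_comap] at hg ⊢
    have := L.sum_pderiv_mem b hg
    rw [Finset.sum_eq_single (sec b)] at this
    · change pderiv (sec b) (rename sec g) ∈ P at this
      rwa [pderiv_rename hsec.injective] at this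
    · intro a ha hab
      apply pderiv_eq_zero_of_notMem_vars
      intro hv
      have := vars_rename sec g hv
      obtain ⟨b', _, rfl⟩ := Finset.mem_image.1 this
      have := (Finset.mem_filter.1 ha).2
      rw [hsec] at this
      exact hab (by rw [this])
    · intro hn; exact absurd (by simp [hsec b]) hn

end LRep

section Kstr
variable {A B E : Type*} [Fintype A] [DecidableEq A] [DecidableEq B]
    [AddCommGroup E] [Module (MvPolynomial A ℂ) E]

/-- A module on which the nonzero elements of a domain act bijectively is a vector space over
the fraction field. -/
lemma exists_fractionRing_module {R₀ R : Type*} [CommRing R₀] [IsDomain R₀] [CommRing R]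
    [Module R E] (j : R₀ →+* R) (hj : ∀ g, g ≠ 0 → Function.Bijective (fun y : E => j g • y)) :
    ∃ _ : Module (FractionRing R₀) E, ∀ (g : R₀) (y : E),
      algebraMap R₀ (FractionRing R₀) g • y = j g • y := by
  let F : R₀ →+* Module.End ℤ E := (Module.toModuleEnd ℤ (S := R) E).comp j
  have hF : ∀ g y, F g y = j g • y := fun g y => rfl
  have hu : ∀ g : nonZeroDivisors R₀, IsUnit (F g) := fun g => by
    rw [Module.End.isUnit_iff]
    exact hj g (nonZeroDivisors.ne_zero g.2)
  let fS : nonZeroDivisors R₀ →* (Module.End ℤ E)ˣ :=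
    IsUnit.liftRight ((F : R₀ →* Module.End ℤ E).comp (nonZeroDivisors R₀).subtype) hu
  have hfS : ∀ g : nonZeroDivisors R₀, F g = fS g := fun g => rfl
  let Ψ : FractionRing R₀ →+* Module.End ℤ E := OreLocalization.universalHom F fS hfS
  have hΨ : ∀ g : R₀, Ψ (algebraMap R₀ (FractionRing R₀) g) = F g := fun g =>
    OreLocalization.universalHom_commutes F fS hfS
  refine ⟨Module.compHom E Ψ, fun g y => ?_⟩
  change Ψ (algebraMap R₀ (FractionRing R₀) g) y = _
  rw [hΨ]; rfl

end Kstr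

namespace LRep
variable {A B E : Type*} [Fintype A] [DecidableEq A] [Fintype B] [DecidableEq B]
    [AddCommGroup E] [Module (MvPolynomial A ℂ) E] [Module ℂ E]
    [IsScalarTower ℂ (MvPolynomial A ℂ) E]
    {c : ℂ} {P : Ideal (MvPolynomial A ℂ)} [hP : P.IsPrime]
    {blk : A → B} (L : LRep P blk c E)

/-- The size of a block. -/
def bN (blk : A → B) (b : B) : ℕ := (Finset.univ.filter (fun a => blk a = b)).card

lemma bN_ne (hs : Function.Surjective blk) (b : B) : (bN blk b : ℂ) ≠ 0 := by
  obtain ⟨a, ha⟩ := hs b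
  exact Nat.cast_ne_zero.2 (Finset.card_ne_zero_of_mem (a := a) (by simp [ha]))

/-- Block averages. -/
def avg (blk : A → B) : MvPolynomial B ℂ →ₐ[ℂ] MvPolynomial A ℂ :=
  aeval fun b => C ((bN blk b : ℂ)⁻¹) * ∑ a ∈ Finset.univ.filter (fun a => blk a = b), X a

lemma rename_avg (hs : Function.Surjective blk) (g : MvPolynomial B ℂ) :
    rename blk (avg blk g) = g := by
  have : (rename blk).comp (avg blk) = AlgHom.id ℂ (MvPolynomial B ℂ) := by
    ext b : 1
    simp only [avg, AlgHom.comp_apply, aeval_X, map_mul, rename_C, map_sum, rename_X,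
      AlgHom.id_apply]
    rw [Finset.sum_congr rfl (fun a ha => by rw [(Finset.mem_filter.1 ha).2]), Finset.sum_const,
      nsmul_eq_mul, ← mul_assoc, ← C_eq_coe_nat, ← C_mul]
    change C ((bN blk b : ℂ)⁻¹ * (bN blk b : ℂ)) * _ = _
    rw [inv_mul_cancel₀ (bN_ne hs b), C_1, one_mul]
  exact DFunLike.congr_fun this g

lemma rename_perm_avg (w : Perm A) (hw : ∀ a, blk (w a) = blk a) (g : MvPolynomial B ℂ) :
    rename w (avg blk g) = avg blk g := by
  have : (rename w).comp (avg blk) = avg blk := by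
    ext b : 1
    simp only [avg, AlgHom.comp_apply, aeval_X, map_mul, rename_C, map_sum, rename_X]
    congr 1
    refine Finset.sum_bij (fun a _ => w a) ?_ ?_ ?_ ?_
    · intro a ha; simpa [hw] using ha
    · intro a _ b _ h; exact w.injective h
    · intro a ha
      exact ⟨w.symm a, by rw [Finset.mem_filter, ← hw]; simpa using ha, by simp⟩
    · intro a _; rfl
  exact DFunLike.congr_fun this g

lemma pderiv_avg {a a' : A} (h : blk a = blk a') (g : MvPolynomial B ℂ) :
    pderiv a (avg blk g) = pderiv a' (avg blk g) := by
  induction g using MvPolynomial.induction_on with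
  | C z => simp
  | add p q hp hq => rw [map_add, map_add, map_add, hp, hq]
  | mul_X p i hp =>
    rw [map_mul, Derivation.leibniz, Derivation.leibniz, hp]
    congr 2
    simp only [avg, aeval_X, Derivation.leibniz, pderiv_C, map_sum, pderiv_X, smul_zero, add_zero]
    congr 1
    simp only [Pi.single_apply, Finset.sum_ite_eq', Finset.mem_filter,
      Finset.mem_univ, true_and, h]

include L in
lemma sub_avg_mem [Nontrivial E] (hs : Function.Surjective blk)
    (hblk : ∀ a b, blk a = blk b ↔ (X a - X b : MvPolynomial A ℂ) ∈ P) (f : MvPolynomial A ℂ) :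
    f - avg blk (rename blk f) ∈ P := by
  rw [L.mem_iff hs hblk, map_sub, rename_avg hs, sub_self]

include L in
lemma avg_smul_bijective [Nontrivial E] (hs : Function.Surjective blk)
    (hblk : ∀ a b, blk a = blk b ↔ (X a - X b : MvPolynomial A ℂ) ∈ P) (g : MvPolynomial B ℂ)
    (hg : g ≠ 0) : Function.Bijective (fun y : E => avg blk g • y) := by
  apply L.unit
  rwa [L.mem_iff hs hblk, rename_avg hs]

section Kmod
variable [Module (FractionRing (MvPolynomial B ℂ)) E]
  (hK : ∀ (g : MvPolynomial B ℂ) (y : E),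
    algebraMap (MvPolynomial B ℂ) (FractionRing (MvPolynomial B ℂ)) g • y = avg blk g • y)

local notation "KB" => FractionRing (MvPolynomial B ℂ)

omit [Module ℂ E] [IsScalarTower ℂ (MvPolynomial A ℂ) E] in
include hK in
/-- An additive map commuting with block averages is linear over the field. -/
lemma map_smul_of_avg (φ : E →+ E) (h : ∀ g y, φ (avg blk g • y) = avg blk g • φ y)
    (k : KB) (y : E) : φ (k • y) = k • φ y := by
  obtain ⟨n, d, hd, rfl⟩ := IsFractionRing.div_surjective (A := MvPolynomial B ℂ) k
  have hd0 : algebraMap (MvPolynomial B ℂ) KB d ≠ 0 :=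
    IsFractionRing.to_map_ne_zero_of_mem_nonZeroDivisors hd
  set D := algebraMap (MvPolynomial B ℂ) KB d with hD
  set N := algebraMap (MvPolynomial B ℂ) KB n with hN
  have e : ∀ y, φ (D • y) = D • φ y := fun y => by rw [hD, hK, hK, h]
  have e' : ∀ y, φ (N • y) = N • φ y := fun y => by rw [hN, hK, hK, h]
  have : D • φ ((N / D) • y) = D • (N / D) • φ y := by
    rw [← e, smul_smul, smul_smul, mul_div_cancel₀ _ hd0, e']
  have h2 := congrArg (fun x => D⁻¹ • x) this
  simpa only [smul_smul, ← mul_assoc, inv_mul_cancel₀ hd0, one_smul, one_mul] using h2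

include hK in
lemma smul_comm_K (f : MvPolynomial A ℂ) (k : KB) (y : E) : f • k • y = k • f • y :=
  map_smul_of_avg hK (DistribSMul.toAddMonoidHom E f) (fun _ y => smul_comm f _ y) k y

/-- Multiplication by a polynomial, linear over the field of block averages. -/
def mulK (f : MvPolynomial A ℂ) : E →ₗ[KB] E where
  toFun y := f • y
  map_add' := smul_add f
  map_smul' k y := smul_comm_K hK f k y

include hK L in
lemma span_orbit_fd [Nontrivial E] (hs : Function.Surjective blk)
    (hblk : ∀ a b, blk a = blk b ↔ (X a - X b : MvPolynomial A ℂ) ∈ P) (y : E) :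
    FiniteDimensional KB
      (Submodule.span KB (Set.range fun f : MvPolynomial A ℂ => f • y)) := by
  obtain ⟨G, hG⟩ := (isNoetherianRing_iff_ideal_fg (MvPolynomial A ℂ)).1 inferInstance P
  obtain ⟨k, hk⟩ := L.nil
  have key : ∀ i : ℕ, ∀ y : E, (∀ f ∈ P ^ i, f • y = 0) → FiniteDimensional KB
      (Submodule.span KB (Set.range fun f : MvPolynomial A ℂ => f • y)) := by
    intro i
    induction i with
    | zero =>
      intro y hy
      have : y = 0 := by simpa using hy 1 (by simp)
      subst this
      have : (Set.range fun f : MvPolynomial A ℂ => f • (0 : E)) = {0} := by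
        ext; simp
      rw [this, Submodule.span_zero_singleton]
      infer_instance
    | succ i ih =>
      intro y hy
      have h1 : ∀ g : G, FiniteDimensional KB (Submodule.span KB
          (Set.range fun f : MvPolynomial A ℂ => f • (g : MvPolynomial A ℂ) • y)) := by
        intro g
        apply ih
        intro f hf
        rw [smul_smul]
        refine hy _ ?_
        rw [pow_succ]
        refine Ideal.mul_mem_mul hf ?_
        rw [← hG]; exact Ideal.subset_span g.2
      set W := Submodule.span KB {y} ⊔ ⨆ g : G, Submodule.span KB
          (Set.range fun f : MvPolynomial A ℂ => f • (g : MvPolynomial A ℂ) • y) with hW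
      have hfd : FiniteDimensional KB W := by
        rw [hW]; infer_instance
      refine Submodule.finiteDimensional_of_le (S₂ := W) ?_
      rw [Submodule.span_le]
      rintro _ ⟨f, rfl⟩
      have h2 : ∀ p ∈ Ideal.span (G : Set (MvPolynomial A ℂ)), ∀ h, (h * p) • y ∈ W := by
        intro p hp
        induction hp using Submodule.span_induction with
        | mem g hg =>
          intro h
          rw [mul_smul]
          exact Submodule.mem_sup_right (Submodule.mem_iSup_of_mem ⟨g, hg⟩
            (Submodule.subset_span ⟨h, rfl⟩))
        | zero => intro h; simp
        | add p q _ _ hp hq => intro h; rw [mul_add, add_smul]; exact W.add_mem (hp h) (hq h)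
        | smul a p _ hp => intro h; rw [smul_eq_mul, ← mul_assoc]; exact hp _
      have := W.add_mem (h2 (f - avg blk (rename blk f)) (by rw [hG]; exact L.sub_avg_mem hs hblk f) 1)
        (show avg blk (rename blk f) • y ∈ W from ?_)
      · rw [← add_smul, one_mul, sub_add_cancel] at this; exact this
      · rw [← hK]
        exact W.smul_mem _ (Submodule.mem_sup_left (Submodule.mem_span_singleton_self y))
  exact key k y fun f hf => hk f hf y

include hK L in
theorem finiteDimensional [Nontrivial E] (hs : Function.Surjective blk)
    (hblk : ∀ a b, blk a = blk b ↔ (X a - X b : MvPolynomial A ℂ) ∈ P)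
    (F : Finset E) (hF : ∀ y : E, ∃ f, f ∉ P ∧ f • y ∈
      Submodule.span (MvPolynomial A ℂ) (F : Set E)) : FiniteDimensional KB E := by
  set W := ⨆ v : F, Submodule.span KB (Set.range fun f : MvPolynomial A ℂ => f • (v : E)) with hW
  have hfd : FiniteDimensional KB W := by
    have := fun v : F => L.span_orbit_fd hK hs hblk (v : E)
    rw [hW]; infer_instance
  have hst : ∀ (f : MvPolynomial A ℂ), W ≤ W.comap (mulK hK f) := by
    intro f
    rw [hW, iSup_le_iff]
    intro v
    rw [Submodule.span_le]
    rintro _ ⟨g, rfl⟩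
    refine Submodule.mem_iSup_of_mem v (Submodule.subset_span ⟨f * g, ?_⟩)
    exact mul_smul f g (v : E)
  have hFW : ∀ y ∈ Submodule.span (MvPolynomial A ℂ) (F : Set E), y ∈ W := by
    intro y hy
    induction hy using Submodule.span_induction with
    | mem v hv =>
      exact Submodule.mem_iSup_of_mem ⟨v, hv⟩ (Submodule.subset_span ⟨1, one_smul _ _⟩)
    | zero => exact zero_mem _
    | add p q _ _ hp hq => exact W.add_mem hp hq
    | smul a p _ hp => exact hst a hp
  have htop : W = ⊤ := by
    rw [Submodule.eq_top_iff']
    intro y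
    obtain ⟨f, hf, hfy⟩ := hF y
    let φ : W →ₗ[KB] W := (mulK hK f).restrict (hst f)
    have hφ : Function.Injective φ := by
      intro x x' h
      exact Subtype.ext ((L.unit f hf).1 (congrArg Subtype.val h))
    obtain ⟨x, hx⟩ := (LinearMap.injective_iff_surjective.1 hφ) ⟨f • y, hFW _ hfy⟩
    have : f • (x : E) = f • y := congrArg Subtype.val hx
    rw [← (L.unit f hf).1 this]
    exact x.2
  rw [htop] at hfd
  exact Module.Finite.equiv (Submodule.topEquiv)

/-- The permutations, linear over the field of block averages. -/
def ρK (w : Perm A) : E →ₗ[KB] E :=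
  if hw : ∀ a, blk (w a) = blk a then
    { toFun := L.ρ w
      map_add' := map_add _
      map_smul' := fun k y => map_smul_of_avg hK (L.ρ w).toAddMonoidHom (fun g y => by
        change L.ρ w (avg blk g • y) = _
        rw [L.ρ_smul w hw, rename_perm_avg w hw]; rfl) k y }
  else 0

lemma ρK_apply {w : Perm A} (hw : ∀ a, blk (w a) = blk a) (y : E) : L.ρK hK w y = L.ρ w y := by
  rw [ρK, dif_pos hw]; rfl

omit [Fintype A] [Fintype B] [DecidableEq B] in
lemma blk_swap {a b : A} (h : blk b = blk a) (x : A) : blk (swap a b x) = blk x := by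
  by_cases hxa : x = a
  · subst hxa; simp [h]
  by_cases hxb : x = b
  · subst hxb; simp [h]
  rw [swap_apply_of_ne_of_ne hxa hxb]

/-- The reduced Dunkl operators. -/
def θt (a : A) : Module.End ℂ E := L.θ a - (bN blk (blk a) : ℂ)⁻¹ • L.pB (blk a)

lemma θt_avg (hs : Function.Surjective blk) (a : A) (g : MvPolynomial B ℂ) (y : E) :
    L.θt a (avg blk g • y) = avg blk g • L.θt a y := by
  have h1 : ∑ b ∈ (Finset.univ.erase a).filter (fun b => blk b = blk a),
      dd a b (avg blk g) • L.ρ (swap a b) y = 0 := by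
    refine Finset.sum_eq_zero fun b hb => ?_
    rw [dd_of_invariant, zero_smul]
    exact rename_perm_avg _ (blk_swap (Finset.mem_filter.1 hb).2) g
  have h2 : ∑ a' ∈ Finset.univ.filter (fun a' => blk a' = blk a), pderiv a' (avg blk g) =
      (bN blk (blk a) : ℂ) • pderiv a (avg blk g) := by
    rw [Finset.sum_congr rfl (fun a' ha' => pderiv_avg (Finset.mem_filter.1 ha').2 g),
      Finset.sum_const, bN, Nat.cast_smul_eq_nsmul]
  have h0 := bN_ne hs (blk a)
  simp only [θt, LinearMap.sub_apply, LinearMap.smul_apply, L.θ_smul, L.pB_smul, h1, h2,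
    smul_zero, sub_zero, smul_add, smul_assoc, inv_smul_smul₀ h0, smul_sub]
  rw [smul_comm (avg blk g)]
  abel

lemma θt_X {a b : A} (hab : a ≠ b) (h : blk b = blk a) (y : E) :
    L.θt a ((X b : MvPolynomial A ℂ) • y) = (X b : MvPolynomial A ℂ) • L.θt a y +
      c • L.ρ (swap a b) y - (bN blk (blk a) : ℂ)⁻¹ • y := by
  have h1 : ∑ b' ∈ (Finset.univ.erase a).filter (fun b => blk b = blk a),
      dd a b' (X b) • L.ρ (swap a b') y = - L.ρ (swap a b) y := by
    rw [Finset.sum_eq_single b]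
    · rw [dd_X_right hab, neg_smul, one_smul]
    · intro b' hb' hne
      rw [dd_X_of_ne hab.symm hne.symm, zero_smul]
    · intro hn; exact absurd (by simp [hab.symm, h]) hn
  have h2 : ∑ a' ∈ Finset.univ.filter (fun a' => blk a' = blk a),
      pderiv a' (X b : MvPolynomial A ℂ) = 1 := by
    simp [pderiv_X, Pi.single_apply, h]
  have h3 : pderiv a (X b : MvPolynomial A ℂ) = 0 := by
    rw [pderiv_X, Pi.single_apply, if_neg hab.symm]
  simp only [θt, LinearMap.sub_apply, LinearMap.smul_apply, L.θ_smul, L.pB_smul, h1, h2, h3,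
    zero_smul, smul_add, smul_neg, smul_sub, one_smul]
  rw [smul_comm (X b : MvPolynomial A ℂ) ((bN blk (blk a) : ℂ)⁻¹)]
  abel

lemma ρ_pB {w : Perm A} (hw : ∀ a, blk (w a) = blk a) (b : B) (y : E) :
    L.ρ w (L.pB b y) = L.pB b (L.ρ w y) := by
  simp only [pB, LinearMap.sum_apply, map_sum, L.ρ_θ w hw]
  refine Finset.sum_bij (fun a _ => w a) ?_ ?_ ?_ ?_
  · intro a ha; simpa [hw] using ha
  · intro a _ b _ h; exact w.injective h
  · intro a ha
    exact ⟨w.symm a, by rw [Finset.mem_filter, ← hw]; simpa using ha, by simp⟩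
  · intro a _; rfl

lemma ρ_θt {w : Perm A} (hw : ∀ a, blk (w a) = blk a) {a : A} (ha : w a = a) (y : E) :
    L.ρ w (L.θt a y) = L.θt a (L.ρ w y) := by
  simp only [θt, LinearMap.sub_apply, LinearMap.smul_apply, map_sub, map_smul, L.ρ_θ w hw, ha,
    L.ρ_pB hw]

/-- The reduced Dunkl operators, linear over the field of block averages. -/
def θK (hs : Function.Surjective blk) (a : A) : E →ₗ[KB] E where
  toFun := L.θt a
  map_add' := map_add _
  map_smul' k y := map_smul_of_avg hK (L.θt a).toAddMonoidHom (fun g y => L.θt_avg hs a g y) k y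

include hK in
theorem exists_sum_chi_ne_of_module [Nontrivial E] [FiniteDimensional KB E]
    (hs : Function.Surjective blk) (M : Finset A) (hc : c ≠ 0)
    (hκ1 : ∀ (b : B) (k : ℕ), (bN blk b : ℂ) * c + k ≠ 0)
    (hκ2 : ∀ (b : B) (k : ℕ), k < (M.filter (fun a => blk a = b)).card → (bN blk b : ℂ) * c ≠ k) :
    ∃ y, ∑ w ∈ Finset.univ.filter (fun w : Perm A => ∀ a, blk (w a) = blk a),
      chi M w • L.ρ w y ≠ 0 := by
  by_contra! hcon
  let γ : ℂ →+* KB := (algebraMap (MvPolynomial B ℂ) KB).comp C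
  have hγ : ∀ (z : ℂ) (y : E), γ z • y = z • y := fun z y => by
    change algebraMap (MvPolynomial B ℂ) KB (C z) • y = _
    rw [hK]
    change avg blk (algebraMap ℂ _ z) • y = _
    rw [AlgHom.commutes, algebraMap_smul]
  have := young_sum_ne_zero blk (fun w => LinearMap.trace KB E (L.ρK hK w)) M
    (fun b => γ ((bN blk b : ℂ) * c)) ?_ ?_ ?_ ?_ ?_
  · apply this
    have h1 : ∑ w ∈ Finset.univ.filter (fun w : Perm A => ∀ a, blk (w a) = blk a),
        (chi M w : KB) • L.ρK hK w = 0 := by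
      ext y
      rw [LinearMap.sum_apply, LinearMap.zero_apply, ← hcon y]
      refine Finset.sum_congr rfl fun w hw => ?_
      rw [LinearMap.smul_apply, L.ρK_apply hK (Finset.mem_filter.1 hw).2, Int.cast_smul_eq_zsmul]
    have h2 := congrArg (LinearMap.trace KB E) h1
    simpa only [map_sum, map_smul, map_zero, smul_eq_mul] using h2
  · intro g a b hg hga hab hb
    have hsw := blk_swap hb
    have e1 : L.ρK hK (g * swap a b) = L.ρK hK g ∘ₗ L.ρK hK (swap a b) := by
      ext y
      rw [L.ρK_apply hK (fun x => by rw [Perm.mul_apply, hg, hsw]), L.ρ_mul _ _ hg hsw,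
        LinearMap.comp_apply, L.ρK_apply hK hg, L.ρK_apply hK hsw]
      rfl
    have e2 : γ c • L.ρK hK (swap a b) = L.θK hK hs a ∘ₗ mulK hK (X b) -
        mulK hK (X b) ∘ₗ L.θK hK hs a + γ (bN blk (blk a) : ℂ)⁻¹ • LinearMap.id := by
      ext y
      simp only [LinearMap.add_apply, LinearMap.sub_apply, LinearMap.smul_apply,
        LinearMap.comp_apply, L.ρK_apply hK hsw, hγ, LinearMap.id_apply]
      change _ = L.θt a ((X b : MvPolynomial A ℂ) • y) - (X b : MvPolynomial A ℂ) • L.θt a y + _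
      rw [L.θt_X hab hb]
      abel
    have e3 : L.ρK hK g ∘ₗ L.θK hK hs a = L.θK hK hs a ∘ₗ L.ρK hK g := by
      ext y
      simp only [LinearMap.comp_apply, L.ρK_apply hK hg]
      exact L.ρ_θt hg hga y
    have e4 : γ c * LinearMap.trace KB E (L.ρK hK (g * swap a b)) =
        γ (bN blk (blk a) : ℂ)⁻¹ * LinearMap.trace KB E (L.ρK hK g) := by
      rw [e1, ← smul_eq_mul, ← map_smul, ← LinearMap.comp_smul, e2, LinearMap.comp_add,
        LinearMap.comp_sub, ← LinearMap.comp_assoc, e3, LinearMap.comp_smul, LinearMap.comp_id,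
        map_add, map_sub, map_smul, smul_eq_mul, ← LinearMap.comp_assoc]
      have e5 := LinearMap.trace_mul_comm KB (L.θK hK hs a) (L.ρK hK g ∘ₗ mulK hK (X b))
      change LinearMap.trace KB E (L.θK hK hs a ∘ₗ (L.ρK hK g ∘ₗ mulK hK (X b))) =
        LinearMap.trace KB E ((L.ρK hK g ∘ₗ mulK hK (X b)) ∘ₗ L.θK hK hs a) at e5
      rw [LinearMap.comp_assoc, e5, sub_self, zero_add]
    have h0 := bN_ne hs (blk a)
    change LinearMap.trace KB E (L.ρK hK (g * swap a b)) * γ ((bN blk (blk a) : ℂ) * c) = _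
    rw [map_mul, mul_comm, mul_assoc, e4, ← mul_assoc, ← map_mul, mul_inv_cancel₀ h0, map_one,
      one_mul]
  · have : L.ρK hK 1 = LinearMap.id := by
      ext y
      rw [L.ρK_apply hK (fun x => rfl), L.ρ_one]; rfl
    change LinearMap.trace KB E (L.ρK hK 1) ≠ 0
    rw [this, LinearMap.trace_id, Nat.cast_ne_zero]
    exact Module.finrank_pos.ne'
  · intro b
    exact (map_ne_zero γ).2 (mul_ne_zero (bN_ne hs b) hc)
  · intro b k h
    apply hκ1 b k
    apply γ.injective
    rw [map_add, map_natCast, map_zero]; exact h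
  · intro b k hk h
    apply hκ2 b k hk
    apply γ.injective
    rw [map_natCast]; exact h

end Kmod

theorem exists_sum_chi_ne [Nontrivial E]
    (hs : Function.Surjective blk)
    (hblk : ∀ a b, blk a = blk b ↔ (X a - X b : MvPolynomial A ℂ) ∈ P)
    (F : Finset E) (hF : ∀ y : E, ∃ f, f ∉ P ∧ f • y ∈
      Submodule.span (MvPolynomial A ℂ) (F : Set E)) (M : Finset A) (hc : c ≠ 0)
    (hκ1 : ∀ (b : B) (k : ℕ), (bN blk b : ℂ) * c + k ≠ 0)
    (hκ2 : ∀ (b : B) (k : ℕ), k < (M.filter (fun a => blk a = b)).card → (bN blk b : ℂ) * c ≠ k) :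
    ∃ y, ∑ w ∈ Finset.univ.filter (fun w : Perm A => ∀ a, blk (w a) = blk a),
      chi M w • L.ρ w y ≠ 0 := by
  obtain ⟨inst, hK⟩ := exists_fractionRing_module (E := E) (avg blk).toRingHom
    (L.avg_smul_bijective hs hblk)
  have := L.finiteDimensional hK hs hblk F hF
  exact L.exists_sum_chi_ne_of_module hK hs M hc hκ1 hκ2
end LRep

section Choice
variable {A B : Type*} [Fintype A] [DecidableEq A] [Fintype B] [DecidableEq B]

lemma exists_good_subset (blk : A → B) (m r s : ℕ) (hs : s < m)
    (hA : Fintype.card A = m * r + s) : ∃ M : Finset A, M.card = r + s ∧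
      ∀ b, m ∣ LRep.bN blk b → m * (M.filter (fun a => blk a = b)).card ≤ LRep.bN blk b := by
  set N := LRep.bN blk with hN
  let cap : B → ℕ := fun b => if m ∣ N b then N b / m else N b
  have hcap : ∀ b, cap b ≤ N b := fun b => by
    simp only [cap]; split_ifs
    · exact Nat.div_le_self _ _
    · exact le_rfl
  have hC : ∀ b, ∃ C ⊆ Finset.univ.filter (fun a => blk a = b), C.card = cap b := fun b =>
    Finset.exists_subset_card_eq (hcap b)
  choose C hC hCc using hC
  have hdisj : ∀ b b', b ≠ b' → Disjoint (C b) (C b') := by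
    intro b b' hbb
    rw [Finset.disjoint_left]
    intro a ha ha'
    exact hbb ((Finset.mem_filter.1 (hC b ha)).2.symm.trans (Finset.mem_filter.1 (hC b' ha')).2)
  have hcard : (Finset.univ.biUnion C).card = ∑ b, cap b := by
    rw [Finset.card_biUnion (fun b _ b' _ h => hdisj b b' h)]
    simp [hCc]
  have hsum : ∑ b, N b = m * r + s := by
    rw [← hA, ← Finset.card_univ, Finset.card_eq_sum_card_fiberwise (f := blk) (t := Finset.univ)
      (fun _ _ => Finset.mem_coe.2 (Finset.mem_univ _))]
    rfl
  have hm : 0 < m := by omega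
  have hge : r + s ≤ ∑ b, cap b := by
    rw [← Finset.sum_filter_add_sum_filter_not Finset.univ (fun b => m ∣ N b)] at hsum ⊢
    have e1 : ∑ b ∈ Finset.univ.filter (fun b => m ∣ N b), N b =
        m * ∑ b ∈ Finset.univ.filter (fun b => m ∣ N b), cap b := by
      rw [Finset.mul_sum]
      refine Finset.sum_congr rfl fun b hb => ?_
      have := (Finset.mem_filter.1 hb).2
      simp only [cap, if_pos this, Nat.mul_div_cancel' this]
    have e2 : ∑ b ∈ Finset.univ.filter (fun b => ¬ m ∣ N b), N b =
        ∑ b ∈ Finset.univ.filter (fun b => ¬ m ∣ N b), cap b := by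
      refine Finset.sum_congr rfl fun b hb => ?_
      have := (Finset.mem_filter.1 hb).2
      simp only [cap, if_neg this]
    rw [e1, e2] at hsum
    set D := ∑ b ∈ Finset.univ.filter (fun b => m ∣ N b), cap b
    set U := ∑ b ∈ Finset.univ.filter (fun b => ¬ m ∣ N b), cap b
    have hD : D ≤ r := by
      by_contra h
      have : m * (r + 1) ≤ m * D := Nat.mul_le_mul_left m (by omega)
      rw [mul_add] at this
      omega
    obtain ⟨t, rfl⟩ := Nat.exists_eq_add_of_le hD
    have : t ≤ m * t := Nat.le_mul_of_pos_left t hm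
    rw [mul_add] at hsum
    omega
  obtain ⟨M, hM, hMc⟩ := Finset.exists_subset_card_eq (hge.trans hcard.ge)
  refine ⟨M, hMc, fun b hb => ?_⟩
  have : M.filter (fun a => blk a = b) ⊆ C b := by
    intro a ha
    obtain ⟨ha, hab⟩ := Finset.mem_filter.1 ha
    obtain ⟨b', _, hb'⟩ := Finset.mem_biUnion.1 (hM ha)
    have := (Finset.mem_filter.1 (hC b' hb')).2
    rwa [← hab, this]
  calc m * _ ≤ m * cap b := Nat.mul_le_mul_left m ((Finset.card_le_card this).trans (hCc b).le)
    _ = N b := by simp only [cap, if_pos hb, Nat.mul_div_cancel' hb]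

end Choice

section Kill
variable {A B V E : Type*} [Fintype A] [DecidableEq A] [DecidableEq B] [AddCommGroup V] [Module ℂ V]
    [Module (MvPolynomial A ℂ) V] [IsScalarTower ℂ (MvPolynomial A ℂ) V]
    [AddCommGroup E] [Module (MvPolynomial A ℂ) E] [Module ℂ E]
    [IsScalarTower ℂ (MvPolynomial A ℂ) E]
    {c : ℂ} (H : HRep A V c)
    {P : Ideal (MvPolynomial A ℂ)} [hP : P.IsPrime] {blk : A → B} (L : LRep P blk c E)
    (l : V →ₗ[MvPolynomial A ℂ] E)

include L in
lemma exists_sub_rename_not_mem [Nontrivial E] (hs : Function.Surjective blk)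
    (hblk : ∀ a b, blk a = blk b ↔ (X a - X b : MvPolynomial A ℂ) ∈ P)
    {w₀ : Perm A} (hw₀ : ¬ ∀ a, blk (w₀ a) = blk a) :
    ∃ f : MvPolynomial A ℂ, f - rename w₀ f ∉ P ∧
      ∀ w : Perm A, (∀ a, blk (w a) = blk a) → rename w f = f := by
  push Not at hw₀
  obtain ⟨a₀, ha₀⟩ := hw₀
  set f : MvPolynomial A ℂ := ∑ a ∈ Finset.univ.filter (fun a => blk a = blk a₀), X a with hf
  refine ⟨f, ?_, fun w hw => ?_⟩
  · rw [L.mem_iff hs hblk]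
    intro h
    have h1 := congrArg (eval (fun b => if b = blk a₀ then (0 : ℂ) else 1)) h
    simp only [hf, map_sub, map_sum, rename_X, eval_X, map_zero] at h1
    rw [Finset.sum_eq_zero (fun a ha => if_pos (Finset.mem_filter.1 ha).2), zero_sub,
      neg_eq_zero] at h1
    have h2 : ((∑ a ∈ Finset.univ.filter (fun a => blk a = blk a₀),
      if blk (w₀ a) = blk a₀ then (0 : ℕ) else 1 : ℕ) : ℂ) = 0 := by
      rw [← h1]; push_cast; rfl
    rw [Nat.cast_eq_zero, Finset.sum_eq_zero_iff] at h2
    have := h2 a₀ (by simp)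
    rw [if_neg ha₀] at this
    exact one_ne_zero this
  · rw [hf, map_sum]
    simp only [rename_X]
    refine Finset.sum_bij (fun a _ => w a) ?_ ?_ ?_ ?_
    · intro a ha; simpa [hw] using ha
    · intro a _ b _ h; exact w.injective h
    · intro a ha
      exact ⟨w.symm a, by rw [Finset.mem_filter, ← hw]; simpa using ha, by simp⟩
    · intro a _; rfl

include L in
/-- Linear independence over distinct cosets: a vanishing combination of permutations restricts
to the block-preserving ones. -/
lemma sum_blk_eq_zero [Nontrivial E] (hs : Function.Surjective blk)
    (hblk : ∀ a b, blk a = blk b ↔ (X a - X b : MvPolynomial A ℂ) ∈ P)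
    (χ : Perm A → ℤ) (h : ∀ v, ∑ w, χ w • H.ρ w v = 0) (v : V) :
    ∑ w ∈ Finset.univ.filter (fun w : Perm A => ∀ a, blk (w a) = blk a),
      χ w • l (H.ρ w v) = 0 := by
  set W := Finset.univ.filter (fun w : Perm A => ∀ a, blk (w a) = blk a) with hW
  have key : ∀ U : Finset (Perm A), Disjoint U W → ∃ (d : Perm A → MvPolynomial A ℂ)
      (d₀ : MvPolynomial A ℂ), d₀ ∉ P ∧ (∀ w ∈ W, d w = d₀) ∧
      ∀ v, ∑ w ∈ Finset.univ \ U, d w • χ w • l (H.ρ w v) = 0 := by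
    intro U
    induction U using Finset.induction_on with
    | empty =>
      intro _
      refine ⟨fun _ => 1, 1, fun h => hP.ne_top ((Ideal.eq_top_iff_one _).2 h), fun _ _ => rfl,
        fun v => ?_⟩
      have := congrArg l (h v)
      simpa [map_sum, map_zsmul] using this
    | insert w₀ U hw₀ ih =>
      intro hd
      rw [Finset.disjoint_insert_left] at hd
      obtain ⟨d, d₀, hd₀, hdW, hsum⟩ := ih hd.2
      obtain ⟨f, hf, hfW⟩ := exists_sub_rename_not_mem L hs hblk
        (w₀ := w₀) (fun h => hd.1 (by simpa [hW] using h))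
      refine ⟨fun w => (rename w f - rename w₀ f) * d w, (f - rename w₀ f) * d₀,
        fun h => (hP.mem_or_mem h).elim hf hd₀, fun w hw => ?_, fun v => ?_⟩
      · change _ * _ = _
        rw [hdW w hw, hfW w (by simpa [hW] using hw)]
      · have h1 := hsum (f • v)
        have h2 := congrArg (fun y => rename w₀ f • y) (hsum v)
        simp only [Finset.smul_sum, smul_zero] at h2
        have h3 : ∑ w ∈ Finset.univ \ U, ((rename w f - rename w₀ f) * d w) • χ w • l (H.ρ w v)
            = 0 := by
          rw [← sub_zero (0 : E)]
          nth_rw 1 [← h1]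
          rw [← h2, ← Finset.sum_sub_distrib]
          refine Finset.sum_congr rfl fun w _ => ?_
          rw [H.ρ_smul, map_smul, sub_mul, sub_smul, mul_smul, mul_smul, smul_comm (χ w),
            smul_comm (d w) (rename w f)]
        have h4 : Finset.univ \ U = insert w₀ (Finset.univ \ insert w₀ U) := by
          ext x
          simp only [Finset.mem_sdiff, Finset.mem_univ, true_and, Finset.mem_insert]
          by_cases hx : x = w₀
          · subst hx; simp [hw₀]
          · simp [hx]
        rw [h4, Finset.sum_insert (by simp)] at h3
        simpa using h3
  obtain ⟨d, d₀, hd₀, hdW, hsum⟩ := key (Finset.univ \ W) (Finset.sdiff_disjoint)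
  have h1 := hsum v
  rw [Finset.sdiff_sdiff_eq_self (Finset.subset_univ W),
    Finset.sum_congr rfl (fun w hw => by rw [hdW w hw]), ← Finset.smul_sum] at h1
  exact (L.unit d₀ hd₀).1 (h1.trans (smul_zero d₀).symm)

end Kill

theorem HRep.false_of_vanishing {A V : Type*} [Fintype A] [DecidableEq A] [AddCommGroup V]
    [Module ℂ V] [Module (MvPolynomial A ℂ) V] [IsScalarTower ℂ (MvPolynomial A ℂ) V]
    [Module.Finite (MvPolynomial A ℂ) V] [Nontrivial V]
    (m r s : ℕ) (hs : s < m) (hA : Fintype.card A = m * r + s) (H : HRep A V ((m : ℂ)⁻¹))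
    (hvan : ∀ M : Finset A, M.card = r + s → ∀ v, ∑ w, chi M w • H.ρ w v = 0) : False := by
  classical
  obtain ⟨P, hPmin⟩ := Ideal.nonempty_minimalPrimes
    (I := Module.annihilator (MvPolynomial A ℂ) V) (by
      intro h
      have := (Module.annihilator_eq_top_iff (R := MvPolynomial A ℂ) (M := V)).1 h
      exact not_subsingleton V this)
  have hP : P.IsPrime := hPmin.1.1
  let st : Setoid A :=
    { r := fun a b => (X a - X b : MvPolynomial A ℂ) ∈ P
      iseqv := ⟨fun a => by simp, fun {a b} h => by simpa using neg_mem h,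
        fun {a b c} h h' => by simpa using add_mem h h'⟩ }
  let blk : A → Quotient st := Quotient.mk st
  have hbs : Function.Surjective blk := Quotient.mk_surjective
  have hblk : ∀ a b, blk a = blk b ↔ (X a - X b : MvPolynomial A ℂ) ∈ P := fun a b =>
    Quotient.eq (r := st)
  let S := invSub P blk
  let E := LocalizedModule S V
  let l : V →ₗ[MvPolynomial A ℂ] E := LocalizedModule.mkLinearMap S V
  have : IsScalarTower ℂ (MvPolynomial A ℂ) E := inferInstance
  obtain ⟨L, hL⟩ := exists_LRep H P hPmin blk hblk l
  obtain ⟨F, hF⟩ := Module.Finite.fg_top (R := MvPolynomial A ℂ) (M := V)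
  have hE : Nontrivial E := by
    by_contra hne
    rw [not_nontrivial_iff_subsingleton] at hne
    have h1 : ∀ v : V, ∃ f ∈ S, f • v = 0 := fun v => by
      have := (IsLocalizedModule.eq_zero_iff S l (m := v)).1 (Subsingleton.elim _ _)
      obtain ⟨⟨f, hf⟩, h⟩ := this
      exact ⟨f, hf, h⟩
    choose f hf hfv using h1
    have : ∏ v ∈ F, f v ∈ Module.annihilator (MvPolynomial A ℂ) V := by
      rw [Module.mem_annihilator]
      intro v
      have hv : v ∈ Submodule.span (MvPolynomial A ℂ) (F : Set V) := by rw [hF]; trivial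
      induction hv using Submodule.span_induction with
      | mem x hx => rw [← Finset.prod_erase_mul F f hx, mul_smul, hfv, smul_zero]
      | zero => simp
      | add x y _ _ hx hy => rw [smul_add, hx, hy, add_zero]
      | smul a x _ hx => rw [smul_comm, hx, smul_zero]
    exact (S.prod_mem (fun v _ => hf v)).1 (hPmin.1.2 this)
  obtain ⟨M, hM, hMb⟩ := exists_good_subset blk m r s hs hA
  have hm : (m : ℂ) ≠ 0 := Nat.cast_ne_zero.2 (by omega)
  have hsurj : ∀ y : E, ∃ f ∈ S, ∃ v, f • y = l v := fun y => by
    obtain ⟨⟨v, f⟩, hx⟩ := IsLocalizedModule.surj S l y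
    exact ⟨f, f.2, v, hx⟩
  obtain ⟨y, hy⟩ := L.exists_sum_chi_ne hbs hblk (F.image l) (fun y => by
      obtain ⟨f, hf, v, h⟩ := hsurj y
      refine ⟨f, hf.1, ?_⟩
      rw [h, Finset.coe_image, Submodule.span_image, hF]
      exact ⟨v, trivial, rfl⟩) M (inv_ne_zero hm) (fun b k h => by
      have : (LRep.bN blk b : ℂ) + m * k = 0 := by
        field_simp at h
        linear_combination h
      have : ((LRep.bN blk b + m * k : ℕ) : ℂ) = 0 := by push_cast; exact this
      rw [Nat.cast_eq_zero] at this
      exact LRep.bN_ne hbs b (by rw [Nat.cast_eq_zero]; omega)) (fun b k hk h => by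
      have : ((LRep.bN blk b : ℕ) : ℂ) = ((m * k : ℕ) : ℂ) := by
        push_cast
        field_simp at h
        linear_combination h
      rw [Nat.cast_inj] at this
      have h2 := hMb b ⟨k, this⟩
      rw [this] at h2
      have := Nat.le_of_mul_le_mul_left h2 (by omega)
      omega)
  apply hy
  obtain ⟨f, hf, v, h⟩ := hsurj y
  apply (L.unit f hf.1).1
  change f • _ = f • _
  rw [smul_zero, Finset.smul_sum, ← sum_blk_eq_zero H L l hbs hblk (chi M) (hvan M hM) v]
  refine Finset.sum_congr rfl fun w hw => ?_
  have hw' := (Finset.mem_filter.1 hw).2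
  rw [smul_comm, ← hL w hw', ← h, L.ρ_smul w hw', hf.2 w hw']


open scoped IsMulCommutative in
/-- Commuting operators define an action of the polynomial ring. -/
lemma exists_aeval_of_commute {A R : Type*} [Ring R] [Algebra ℂ R] (D : A → R)
    (h : ∀ a b, D a * D b = D b * D a) :
    ∃ φ : MvPolynomial A ℂ →ₐ[ℂ] R, ∀ a, φ (X a) = D a := by
  have hc : ∀ x ∈ Set.range D, ∀ y ∈ Set.range D, x * y = y * x := by
    rintro _ ⟨a, rfl⟩ _ ⟨b, rfl⟩; exact h a b
  have : IsMulCommutative (Algebra.adjoin ℂ (Set.range D)) :=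
    Algebra.isMulCommutative_adjoin ℂ hc
  refine ⟨(Algebra.adjoin ℂ (Set.range D)).val.comp (aeval fun a => (⟨D a, Algebra.subset_adjoin ⟨a, rfl⟩⟩ :
    Algebra.adjoin ℂ (Set.range D))), fun a => ?_⟩
  simp

/-- A representation of the rational Cherednik algebra of type `A`, presented by the action of
permutations, coordinates and Dunkl operators. -/
structure DRep (A Γ : Type*) [Fintype A] [DecidableEq A] [AddCommGroup Γ] [Module ℂ Γ]
    (c : ℂ) where
  ρ : Perm A →* Module.End ℂ Γ
  x : A → Module.End ℂ Γ
  D : A → Module.End ℂ Γ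
  x_comm : ∀ a b v, x a (x b v) = x b (x a v)
  D_comm : ∀ a b v, D a (D b v) = D b (D a v)
  ρ_x : ∀ w a v, ρ w (x a v) = x (w a) (ρ w v)
  ρ_D : ∀ w a v, ρ w (D a v) = D (w a) (ρ w v)
  D_x_ne : ∀ a b v, a ≠ b → D a (x b v) = x b (D a v) + c • ρ (swap a b) v
  D_x_self : ∀ a v, D a (x a v) = x a (D a v) + v - c • ∑ b ∈ Finset.univ.erase a,
    ρ (swap a b) v

theorem DRep.false_of_vanishing {A Γ : Type*} [Fintype A] [DecidableEq A] [AddCommGroup Γ]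
    [Module ℂ Γ] (m r s : ℕ) (hs : s < m) (hA : Fintype.card A = m * r + s)
    (H : DRep A Γ ((m : ℂ)⁻¹))
    (hvan : ∀ M : Finset A, M.card = r + s → ∀ v, ∑ w, chi M w • H.ρ w v = 0)
    (U : Submodule ℂ Γ) [FiniteDimensional ℂ U] (hU : U ≠ ⊥)
    (hUx : ∀ a, ∀ u ∈ U, H.x a u ∈ U) (hUρ : ∀ w, ∀ u ∈ U, H.ρ w u ∈ U) : False := by
  obtain ⟨φ, hφ⟩ := exists_aeval_of_commute H.D (fun a b => LinearMap.ext (H.D_comm a b))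
  let : Module (MvPolynomial A ℂ) Γ := Module.compHom Γ φ.toRingHom
  have hX : ∀ a (v : Γ), (X a : MvPolynomial A ℂ) • v = H.D a v := fun a v => by
    change φ (X a) v = _
    rw [hφ]
  have : IsScalarTower ℂ (MvPolynomial A ℂ) Γ := ⟨fun z f v => by
    change φ (z • f) v = z • φ f v
    rw [map_smul]; rfl⟩
  have hC : ∀ z (v : Γ), (C z : MvPolynomial A ℂ) • v = z • v := fun z v => by
    rw [← algebraMap_eq, algebraMap_smul]
  have hρ : ∀ w (f : MvPolynomial A ℂ) v, H.ρ w (f • v) = rename w f • H.ρ w v := by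
    intro w f
    induction f using MvPolynomial.induction_on with
    | C z => intro v; rw [rename_C, hC, hC, map_smul]
    | add p q hp hq => intro v; rw [add_smul, map_add, map_add, add_smul, hp, hq]
    | mul_X p a hp =>
      intro v
      rw [mul_smul, hp, map_mul, rename_X, mul_smul, hX, hX, H.ρ_D]
  let V : Submodule (MvPolynomial A ℂ) Γ := Submodule.span (MvPolynomial A ℂ) (U : Set Γ)
  have hVρ : ∀ w, ∀ v ∈ V, H.ρ w v ∈ V := by
    intro w v hv
    induction hv using Submodule.span_induction with
    | mem x hx => exact Submodule.subset_span (hUρ w x hx)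
    | zero => rw [map_zero]; exact V.zero_mem
    | add p q _ _ hp hq => rw [map_add]; exact V.add_mem hp hq
    | smul f p _ hp => rw [hρ]; exact V.smul_mem _ hp
  have hVc : ∀ (z : ℂ), ∀ v ∈ V, z • v ∈ V := fun z v hv => by
    rw [← hC]; exact V.smul_mem _ hv
  have hVx : ∀ a, ∀ v ∈ V, H.x a v ∈ V := by
    intro a v hv
    induction hv using Submodule.span_induction with
    | mem x hx => exact Submodule.subset_span (hUx a x hx)
    | zero => rw [map_zero]; exact V.zero_mem
    | add p q _ _ hp hq => rw [map_add]; exact V.add_mem hp hq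
    | smul f p hp0 hp =>
      induction f using MvPolynomial.induction_on with
      | C z => rw [hC, map_smul]; exact hVc z _ hp
      | add f g hf hg => rw [add_smul, map_add]; exact V.add_mem hf hg
      | mul_X f b hf =>
        have hfp : f • p ∈ V := V.smul_mem _ hp0
        rw [mul_comm, mul_smul, hX]
        by_cases hab : b = a
        · subst hab
          have : H.x b (H.D b (f • p)) = (X b : MvPolynomial A ℂ) • H.x b (f • p) - f • p +
              ((m : ℂ)⁻¹) • ∑ e ∈ Finset.univ.erase b, H.ρ (swap b e) (f • p) := by
            rw [hX, H.D_x_self]; abel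
          rw [this]
          exact V.add_mem (V.sub_mem (V.smul_mem _ hf) hfp)
            (hVc _ _ (V.sum_mem fun e _ => hVρ _ _ hfp))
        · have : H.x a (H.D b (f • p)) = (X b : MvPolynomial A ℂ) • H.x a (f • p) -
              ((m : ℂ)⁻¹) • H.ρ (swap b a) (f • p) := by
            rw [hX, H.D_x_ne b a _ hab]; abel
          rw [this]
          exact V.sub_mem (V.smul_mem _ hf) (hVc _ _ (hVρ _ _ hfp))
  let H' : HRep A V ((m : ℂ)⁻¹) :=
    { ρ :=
        { toFun := fun w => (H.ρ w).restrict (p := V.restrictScalars ℂ)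
            (q := V.restrictScalars ℂ) (hVρ w)
          map_one' := by ext v; change H.ρ 1 (v : Γ) = v; rw [map_one]; rfl
          map_mul' := fun w w' => by ext v; change H.ρ (w * w') (v : Γ) = _; rw [map_mul]; rfl }
      T := fun a => - (H.x a).restrict (p := V.restrictScalars ℂ)
            (q := V.restrictScalars ℂ) (hVx a)
      ρ_smul := fun w f v => Subtype.ext (hρ w f v)
      ρ_T := fun w a v => Subtype.ext (by
        change H.ρ w (- H.x a v) = - H.x (w a) (H.ρ w v)
        rw [map_neg, H.ρ_x])
      T_ne := fun a b v hab => Subtype.ext (by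
        change - H.x a ((X b : MvPolynomial A ℂ) • (v : Γ)) =
          (X b : MvPolynomial A ℂ) • (- H.x a v) + ((m : ℂ)⁻¹) • H.ρ (swap a b) v
        rw [smul_neg, hX, hX, H.D_x_ne b a _ hab.symm, swap_comm]; abel)
      T_self := fun a v => Subtype.ext (by
        rw [← V.subtype_apply, ← V.subtype_apply]
        simp only [map_add, map_sub, map_smul, map_sum, LinearMap.map_smul_of_tower]
        change - H.x a ((X a : MvPolynomial A ℂ) • (v : Γ)) = (X a : MvPolynomial A ℂ) • (- H.x a v) + (v : Γ) -
          ((m : ℂ)⁻¹) • ∑ e ∈ Finset.univ.erase a, H.ρ (swap a e) v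
        rw [smul_neg, hX, hX, H.D_x_self]; abel) }
  have hfin : Module.Finite (MvPolynomial A ℂ) V := by
    obtain ⟨F, hF⟩ := (Submodule.fg_iff_finiteDimensional U).2 inferInstance
    refine Module.Finite.of_fg ⟨F, le_antisymm ?_ ?_⟩
    · exact Submodule.span_mono (by rw [← hF]; exact Submodule.subset_span)
    · rw [Submodule.span_le, ← hF]
      intro x hx
      refine (Submodule.span_le_restrictScalars ℂ (MvPolynomial A ℂ) (F : Set Γ)) hx
  have hnt : Nontrivial V := by
    obtain ⟨u, hu, hu0⟩ := Submodule.exists_mem_ne_zero_of_ne_bot hU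
    exact ⟨⟨⟨u, Submodule.subset_span hu⟩, 0, fun h => hu0 (congrArg Subtype.val h)⟩⟩
  refine HRep.false_of_vanishing m r s hs hA H' fun M hM v => Subtype.ext ?_
  have := hvan M hM v
  change V.subtype _ = 0
  rw [← this, map_sum]
  simp only [map_zsmul]
  rfl


/-- An ambient representation: a commutative algebra on which the coordinates act by
multiplication, together with further multiplication operators `κ`. -/
structure Amb (A ι 𝔽 : Type*) [Fintype A] [DecidableEq A] [CommRing 𝔽] [Algebra ℂ 𝔽]
    (c : ℂ) extends DRep A 𝔽 c where
  ξ : A → 𝔽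
  κ : ι → 𝔽
  x_eq : ∀ a v, x a v = ξ a * v
  ρ_κ : ∀ w l v, ρ w (κ l * v) = κ l * ρ w v
  D_κ : ∀ a l, ∃ ψ ∈ Algebra.adjoin ℂ (Set.range ξ ∪ Set.range κ),
    ∀ v, D a (κ l * v) = κ l * D a v + ψ * v
  unit : ∀ l (z : ℂ), IsUnit (κ l - algebraMap ℂ 𝔽 z)
  integral : ∀ a, IsIntegral (Algebra.adjoin ℂ (Set.range κ)) (ξ a)

namespace Amb
variable {A ι 𝔽 : Type*} [Fintype A] [DecidableEq A] [CommRing 𝔽] [Algebra ℂ 𝔽] {c : ℂ}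
  (H : Amb A ι 𝔽 c)

/-- The algebra generated by the coordinates and the extra multiplication operators. -/
def alg : Subalgebra ℂ 𝔽 := Algebra.adjoin ℂ (Set.range H.ξ ∪ Set.range H.κ)

lemma ξ_mem (a : A) : H.ξ a ∈ H.alg := Algebra.subset_adjoin (Or.inl ⟨a, rfl⟩)
lemma κ_mem (l : ι) : H.κ l ∈ H.alg := Algebra.subset_adjoin (Or.inr ⟨l, rfl⟩)

/-- Subspaces stable under all operators. -/
structure Stable (N : Submodule ℂ 𝔽) : Prop where
  ρ : ∀ w, ∀ v ∈ N, H.ρ w v ∈ N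
  D : ∀ a, ∀ v ∈ N, H.D a v ∈ N
  ξ : ∀ a, ∀ v ∈ N, H.ξ a * v ∈ N
  κ : ∀ l, ∀ v ∈ N, H.κ l * v ∈ N

variable {H} in
lemma Stable.alg {N : Submodule ℂ 𝔽} (h : H.Stable N) {g : 𝔽} (hg : g ∈ H.alg) :
    ∀ v ∈ N, g * v ∈ N := by
  induction hg using Algebra.adjoin_induction with
  | mem x hx =>
    rcases hx with ⟨a, rfl⟩ | ⟨l, rfl⟩
    · exact h.ξ a
    · exact h.κ l
  | algebraMap z => intro v hv; rw [← Algebra.smul_def]; exact N.smul_mem _ hv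
  | add p q _ _ hp hq => intro v hv; rw [add_mul]; exact N.add_mem (hp v hv) (hq v hv)
  | mul p q _ _ hp hq => intro v hv; rw [mul_assoc]; exact hp _ (hq v hv)

/-- Multiplication operators which commute with permutations and whose commutators with the
Dunkl operators are multiplication operators. -/
structure IsGood (g : 𝔽) : Prop where
  mem : g ∈ H.alg
  ρ : ∀ w v, H.ρ w (g * v) = g * H.ρ w v
  D : ∀ a, ∃ ψ ∈ H.alg, ∀ v, H.D a (g * v) = g * H.D a v + ψ * v

lemma isGood_κ (l : ι) : H.IsGood (H.κ l) := ⟨H.κ_mem l, fun w v => H.ρ_κ w l v, fun a => H.D_κ a l⟩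

lemma isGood_algebraMap (z : ℂ) : H.IsGood (algebraMap ℂ 𝔽 z) :=
  ⟨H.alg.algebraMap_mem z, fun w v => by rw [← Algebra.smul_def, map_smul, Algebra.smul_def],
    fun a => ⟨0, zero_mem _, fun v => by
      rw [← Algebra.smul_def, map_smul, Algebra.smul_def, zero_mul, add_zero]⟩⟩

variable {H}

lemma IsGood.mul {f g : 𝔽} (hf : H.IsGood f) (hg : H.IsGood g) : H.IsGood (f * g) :=
  ⟨mul_mem hf.mem hg.mem, fun w v => by rw [mul_assoc, hf.ρ, hg.ρ, mul_assoc], fun a => by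
    obtain ⟨ψ, hψ, h1⟩ := hf.D a
    obtain ⟨χ, hχ, h2⟩ := hg.D a
    refine ⟨f * χ + ψ * g, add_mem (mul_mem hf.mem hχ) (mul_mem hψ hg.mem), fun v => ?_⟩
    rw [mul_assoc, h1, h2]; ring⟩

lemma IsGood.sub {f g : 𝔽} (hf : H.IsGood f) (hg : H.IsGood g) : H.IsGood (f - g) :=
  ⟨sub_mem hf.mem hg.mem, fun w v => by rw [sub_mul, map_sub, hf.ρ, hg.ρ, sub_mul], fun a => by
    obtain ⟨ψ, hψ, h1⟩ := hf.D a
    obtain ⟨χ, hχ, h2⟩ := hg.D a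
    refine ⟨ψ - χ, sub_mem hψ hχ, fun v => ?_⟩
    rw [sub_mul, map_sub, h1, h2]; ring⟩

lemma isGood_one : H.IsGood 1 := by simpa using H.isGood_algebraMap 1

lemma isGood_prod (S : Finset ι) : H.IsGood (∏ l ∈ S, H.κ l) := by
  classical
  induction S using Finset.induction_on with
  | empty => exact isGood_one
  | insert l S hl ih => rw [Finset.prod_insert hl]; exact (H.isGood_κ l).mul ih

lemma IsGood.pow {g : 𝔽} (hg : H.IsGood g) (k : ℕ) : H.IsGood (g ^ k) := by
  induction k with
  | zero => rw [pow_zero]; exact isGood_one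
  | succ k ih => rw [pow_succ]; exact ih.mul hg

/-- `D_a (g ^ (k+1) v)` up to `g ^ k`. -/
lemma IsGood.D_pow {g : 𝔽} (hg : H.IsGood g) (a : A) (k : ℕ) : ∃ ψ ∈ H.alg, ∀ v,
    H.D a (g ^ (k + 1) * v) = g ^ (k + 1) * H.D a v + ψ * (g ^ k * v) := by
  obtain ⟨ψ, hψ, h⟩ := hg.D a
  induction k with
  | zero => exact ⟨ψ, hψ, fun v => by simp [h]⟩
  | succ k ih =>
    obtain ⟨χ, hχ, h'⟩ := ih
    refine ⟨χ + ψ, add_mem hχ hψ, fun v => ?_⟩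
    rw [pow_succ' g (k + 1), mul_assoc, h, h', pow_succ]; ring

end Amb

/-- Vectors which a power of `g` moves into `N`. -/
def Loc {𝔽 : Type*} [CommRing 𝔽] [Algebra ℂ 𝔽] (N : Submodule ℂ 𝔽) (g : 𝔽)
    (hN : ∀ v ∈ N, g * v ∈ N) : Submodule ℂ 𝔽 where
  carrier := {v | ∃ k : ℕ, g ^ k * v ∈ N}
  zero_mem' := ⟨0, by simp⟩
  add_mem' := by
    have up : ∀ (j : ℕ) (v : 𝔽), v ∈ N → g ^ j * v ∈ N := by
      intro j
      induction j with
      | zero => intro v hv; simpa using hv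
      | succ j ih => intro v hv; rw [pow_succ, mul_assoc]; exact ih _ (hN v hv)
    rintro u v ⟨j, hj⟩ ⟨k, hk⟩
    refine ⟨j + k, ?_⟩
    have h1 := up k _ hj
    have h2 := up j _ hk
    have := N.add_mem h1 h2
    convert this using 1
    ring
  smul_mem' := by
    rintro z v ⟨k, hk⟩
    exact ⟨k, by rw [mul_smul_comm]; exact N.smul_mem z hk⟩

namespace Amb
variable {A ι 𝔽 : Type*} [Fintype A] [DecidableEq A] [CommRing 𝔽] [Algebra ℂ 𝔽] {c : ℂ}
  {H : Amb A ι 𝔽 c}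

lemma Stable.loc {N : Submodule ℂ 𝔽} (hN : H.Stable N) {g : 𝔽} (hg : H.IsGood g) :
    H.Stable (Loc N g (hN.alg hg.mem)) where
  ρ := by
    rintro w v ⟨k, hk⟩
    exact ⟨k, by rw [← (hg.pow k).ρ]; exact hN.ρ w _ hk⟩
  D := by
    rintro a v ⟨k, hk⟩
    obtain ⟨ψ, hψ, h⟩ := hg.D_pow a k
    refine ⟨k + 1, ?_⟩
    have := h v
    rw [← sub_eq_iff_eq_add] at this
    rw [← this]
    refine N.sub_mem (hN.D a _ ?_) (hN.alg hψ _ hk)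
    rw [pow_succ', mul_assoc]
    exact hN.alg hg.mem _ hk
  ξ := by
    rintro a v ⟨k, hk⟩
    exact ⟨k, by rw [mul_left_comm]; exact hN.ξ a _ hk⟩
  κ := by
    rintro a v ⟨k, hk⟩
    exact ⟨k, by rw [mul_left_comm]; exact hN.κ a _ hk⟩

lemma Stable.inf {M N : Submodule ℂ 𝔽} (hM : H.Stable M) (hN : H.Stable N) : H.Stable (M ⊓ N) :=
  ⟨fun w v hv => ⟨hM.ρ w v hv.1, hN.ρ w v hv.2⟩, fun w v hv => ⟨hM.D w v hv.1, hN.D w v hv.2⟩,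
    fun w v hv => ⟨hM.ξ w v hv.1, hN.ξ w v hv.2⟩, fun w v hv => ⟨hM.κ w v hv.1, hN.κ w v hv.2⟩⟩

lemma sup_map_mem {M N : Submodule ℂ 𝔽} (φ : 𝔽 →ₗ[ℂ] 𝔽) (hM : ∀ v ∈ M, φ v ∈ M)
    (hN : ∀ v ∈ N, φ v ∈ N) : ∀ v ∈ M ⊔ N, φ v ∈ M ⊔ N := by
  intro v hv
  obtain ⟨a, ha, b, hb, rfl⟩ := Submodule.mem_sup.1 hv
  rw [map_add]
  exact Submodule.add_mem_sup (hM a ha) (hN b hb)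

lemma Stable.sup {M N : Submodule ℂ 𝔽} (hM : H.Stable M) (hN : H.Stable N) : H.Stable (M ⊔ N) :=
  ⟨fun w => sup_map_mem (H.ρ w) (hM.ρ w) (hN.ρ w), fun w => sup_map_mem (H.D w) (hM.D w) (hN.D w),
    fun w => sup_map_mem (LinearMap.mulLeft ℂ (H.ξ w)) (hM.ξ w) (hN.ξ w),
    fun w => sup_map_mem (LinearMap.mulLeft ℂ (H.κ w)) (hM.κ w) (hN.κ w)⟩

end Amb

/-- A linearly independent family in a space spanned by a countable set is countable. -/
lemma countable_of_linearIndependent {W T : Type} [AddCommGroup W] [Module ℂ W] {u : T → W}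
    (hu : LinearIndependent ℂ u) {C : Set W} (hC : C.Countable)
    (h : ∀ t, u t ∈ Submodule.span ℂ C) : Countable T := by
  have h1 : LinearIndependent ℂ (fun t => (⟨u t, h t⟩ : Submodule.span ℂ C)) :=
    LinearIndependent.of_comp (Submodule.span ℂ C).subtype hu
  have h2 := h1.cardinal_le_rank.trans (rank_span_le C)
  rw [← Cardinal.mk_le_aleph0_iff]
  exact h2.trans ((Cardinal.le_aleph0_iff_set_countable).2 hC)

/-- An operator on a space of countable dimension whose nontrivial shifts are all bijective. -/
lemma exists_not_bijective {𝔽 : Type} [CommRing 𝔽] [Algebra ℂ 𝔽] {N Z : Submodule ℂ 𝔽}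
    (κ : 𝔽) (hκN : ∀ v ∈ N, κ * v ∈ N) (hκZ : ∀ v ∈ Z, κ * v ∈ Z)
    {v₀ : 𝔽} (hv₀ : v₀ ∈ N) (hv₀' : v₀ ∉ Z) {C : Set 𝔽} (hC : C.Countable)
    (hNC : N ≤ Submodule.span ℂ C) : ∃ z : ℂ,
    (∃ v ∈ N, v ∉ Z ∧ (κ - algebraMap ℂ 𝔽 z) * v ∈ Z) ∨
    (∃ v ∈ N, ∀ u ∈ N, v - (κ - algebraMap ℂ 𝔽 z) * u ∉ Z) := by
  classical
  by_contra! hcon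
  have hinj := fun z => (hcon z).1
  choose u huN hu using fun z => (hcon z).2 v₀ hv₀
  have hpN : ∀ (p : Polynomial ℂ), ∀ v ∈ N, Polynomial.aeval κ p * v ∈ N := by
    intro p
    induction p using Polynomial.induction_on' with
    | add p q hp hq => intro v hv; rw [map_add, add_mul]; exact N.add_mem (hp v hv) (hq v hv)
    | monomial n a =>
      intro v hv
      rw [Polynomial.aeval_monomial, mul_assoc, ← Algebra.smul_def]
      refine N.smul_mem _ ?_
      induction n with
      | zero => simpa using hv
      | succ n ih => rw [pow_succ', mul_assoc]; exact hκN _ ih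
  have hpZ : ∀ (p : Polynomial ℂ), ∀ v ∈ Z, Polynomial.aeval κ p * v ∈ Z := by
    intro p
    induction p using Polynomial.induction_on' with
    | add p q hp hq => intro v hv; rw [map_add, add_mul]; exact Z.add_mem (hp v hv) (hq v hv)
    | monomial n a =>
      intro v hv
      rw [Polynomial.aeval_monomial, mul_assoc, ← Algebra.smul_def]
      refine Z.smul_mem _ ?_
      induction n with
      | zero => simpa using hv
      | succ n ih => rw [pow_succ', mul_assoc]; exact hκZ _ ih
  have hlin : ∀ z, Polynomial.aeval κ (Polynomial.X - Polynomial.C z) = κ - algebraMap ℂ 𝔽 z := by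
    intro z; simp
  have hpinj : ∀ (n : ℕ) (p : Polynomial ℂ), p.natDegree = n → p ≠ 0 → ∀ v ∈ N,
      Polynomial.aeval κ p * v ∈ Z → v ∈ Z := by
    intro n
    induction n with
    | zero =>
      intro p hp hp0 v hv h
      rw [Polynomial.eq_C_of_natDegree_eq_zero hp] at h hp0
      rw [Polynomial.aeval_C, ← Algebra.smul_def] at h
      exact (Z.smul_mem_iff (fun h0 => hp0 (by rw [h0, map_zero]))).1 h
    | succ n ih =>
      intro p hp hp0 v hv h
      obtain ⟨z, hz⟩ := IsAlgClosed.exists_root p (by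
        rw [Polynomial.degree_eq_natDegree hp0, hp]; exact_mod_cast Nat.succ_ne_zero n)
      obtain ⟨q, rfl⟩ := Polynomial.dvd_iff_isRoot.2 hz
      have hq0 : q ≠ 0 := right_ne_zero_of_mul hp0
      refine ih q ?_ hq0 v hv ?_
      · rw [Polynomial.natDegree_mul (Polynomial.X_sub_C_ne_zero z) hq0,
          Polynomial.natDegree_X_sub_C] at hp
        omega
      · rw [map_mul, hlin, mul_assoc] at h
        exact not_not.1 fun h' => hinj z _ (hpN q v hv) h' h
  have hli : LinearIndependent ℂ (fun z => Z.mkQ (u z)) := by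
    rw [linearIndependent_iff']
    intro S c hc z hz
    let p : Polynomial ℂ := ∑ i ∈ S, Polynomial.C (c i) * ∏ j ∈ S.erase i, (Polynomial.X - Polynomial.C j)
    have hp : p = 0 := by
      by_contra hp
      refine hv₀' (hpinj _ p rfl hp v₀ hv₀ ?_)
      have h1 : ∑ i ∈ S, c i • u i ∈ Z := by
        rw [← Submodule.Quotient.mk_eq_zero, ← Submodule.mkQ_apply, map_sum]
        simpa using hc
      have h2 := hpZ (∏ j ∈ S, (Polynomial.X - Polynomial.C j)) _ h1
      have h3 : Polynomial.aeval κ p * v₀ - Polynomial.aeval κ (∏ j ∈ S, (Polynomial.X - Polynomial.C j)) *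
          ∑ i ∈ S, c i • u i ∈ Z := by
        rw [map_sum, Finset.sum_mul, Finset.mul_sum, ← Finset.sum_sub_distrib]
        refine Z.sum_mem fun i hi => ?_
        have := hpZ (Polynomial.C (c i) * ∏ j ∈ S.erase i, (Polynomial.X - Polynomial.C j)) _ (hu i)
        convert this using 1
        rw [← Finset.mul_prod_erase S _ hi, map_mul, map_mul, hlin, Polynomial.aeval_C,
          Algebra.smul_def]
        ring
      simpa using Z.add_mem h3 h2
    have := congrArg (Polynomial.eval z) hp
    simp only [p, Polynomial.eval_finsetSum, Polynomial.eval_mul, Polynomial.eval_C,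
      Polynomial.eval_prod, Polynomial.eval_sub, Polynomial.eval_X, Polynomial.eval_zero] at this
    rw [Finset.sum_eq_single z] at this
    · refine (mul_eq_zero.1 this).resolve_right (Finset.prod_ne_zero_iff.2 fun j hj => ?_)
      exact sub_ne_zero.2 (Finset.ne_of_mem_erase hj).symm
    · intro b _ hb
      rw [Finset.prod_eq_zero (Finset.mem_erase.2 ⟨hb.symm, hz⟩) (sub_self z), mul_zero]
    · exact fun h => absurd hz h
  have := countable_of_linearIndependent hli (hC.image Z.mkQ) (fun z => by
    rw [← Submodule.map_span]
    exact Submodule.mem_map_of_mem (hNC (huN z)))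
  have h1 := Cardinal.mk_le_aleph0_iff.2 this
  rw [Cardinal.mk_complex] at h1
  exact absurd h1 (not_le.2 Cardinal.aleph0_lt_continuum)

namespace Amb
variable {A ι 𝔽 : Type} [Fintype A] [DecidableEq A] [CommRing 𝔽] [Algebra ℂ 𝔽] {c : ℂ}
  (H : Amb A ι 𝔽 c)

/-- A nontrivial stable subquotient of countable dimension on which the partial
antisymmetrisers of size `n` vanish. -/
structure Pair (n : ℕ) (N Z : Submodule ℂ 𝔽) : Prop where
  stN : H.Stable N
  stZ : H.Stable Z
  le : Z ≤ N
  ne : ∃ v ∈ N, v ∉ Z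
  cnt : ∃ C : Set 𝔽, C.Countable ∧ N ≤ Submodule.span ℂ C
  van : ∀ M : Finset A, M.card = n → ∀ v ∈ N, ∑ w, chi M w • H.ρ w v ∈ Z

variable {H} {n : ℕ} {N Z : Submodule ℂ 𝔽}

lemma Stable.pow_mem (h : H.Stable N) {g : 𝔽} (hg : H.IsGood g) (k : ℕ) {v : 𝔽} (hv : v ∈ N) :
    g ^ k * v ∈ N := h.alg (hg.pow k).mem v hv

lemma Pair.torsion (P : H.Pair n N Z) {g : 𝔽} (hg : H.IsGood g)
    (h : ∃ v ∈ N, v ∉ Z ∧ g * v ∈ Z) : ∃ N' Z', H.Pair n N' Z' ∧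
      (∀ v ∈ N', ∃ k, g ^ k * v ∈ Z') ∧
      ∀ h, (∀ v ∈ N, ∃ k, h ^ k * v ∈ Z) → ∀ v ∈ N', ∃ k, h ^ k * v ∈ Z' := by
  obtain ⟨v, hv, hvZ, hgv⟩ := h
  refine ⟨N ⊓ Loc Z g (P.stZ.alg hg.mem), Z, ⟨P.stN.inf (P.stZ.loc hg), P.stZ, ?_, ?_, ?_, ?_⟩,
    fun v hv => hv.2, fun h hh v hv => hh v hv.1⟩
  · exact fun v hv => ⟨P.le hv, 0, by simpa using hv⟩
  · exact ⟨v, ⟨hv, 1, by simpa using hgv⟩, hvZ⟩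
  · obtain ⟨C, hC, h⟩ := P.cnt
    exact ⟨C, hC, inf_le_left.trans h⟩
  · exact fun M hM v hv => P.van M hM v hv.1

lemma Pair.localise (P : H.Pair n N Z) {g : 𝔽} (hg : H.IsGood g) (hu : IsUnit g)
    (hinj : ∀ v ∈ N, g * v ∈ Z → v ∈ Z)
    (h : ∃ v ∈ N, ∀ u ∈ N, v - g * u ∉ Z) : ∃ N' Z', H.Pair n N' Z' ∧
      (∀ v ∈ N', ∃ k, g ^ k * v ∈ Z') ∧
      ∀ h, (∀ v ∈ N, ∃ k, h ^ k * v ∈ Z) → ∀ v ∈ N', ∃ k, h ^ k * v ∈ Z' := by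
  obtain ⟨v, hv, hvg⟩ := h
  obtain ⟨g', rfl⟩ := hu
  set g : 𝔽 := (g' : 𝔽) with hgg
  have hinj' : ∀ (k : ℕ), ∀ v ∈ N, g ^ k * v ∈ Z → v ∈ Z := by
    intro k
    induction k with
    | zero => intro v _ h; simpa using h
    | succ k ih => 
      intro v hv h
      rw [pow_succ, mul_assoc] at h
      exact hinj v hv (ih _ (P.stN.alg hg.mem v hv) h)
  refine ⟨Loc N g (P.stN.alg hg.mem), N ⊔ Loc Z g (P.stZ.alg hg.mem), ⟨P.stN.loc hg,
    P.stN.sup (P.stZ.loc hg), ?_, ?_, ?_, ?_⟩, ?_, ?_⟩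
  · refine sup_le (fun v hv => ⟨0, by simpa using hv⟩) ?_
    rintro v ⟨k, hk⟩
    exact ⟨k, P.le hk⟩
  · refine ⟨(g'⁻¹ : 𝔽ˣ) * v, ⟨1, by simpa [hgg] using hv⟩, fun hmem => ?_⟩
    obtain ⟨a, ha, b, ⟨k, hk⟩, hab⟩ := Submodule.mem_sup.1 hmem
    have h1 : v - g * a = g * b := by
      have := congrArg (g * ·) hab
      simp only [hgg, Units.mul_inv_cancel_left, mul_add] at this
      rw [← this]; ring
    refine hvg a ha (hinj' k _ (N.sub_mem hv (P.stN.alg hg.mem a ha)) ?_)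
    rw [h1, mul_left_comm]
    exact P.stZ.alg hg.mem _ hk
  · obtain ⟨C, hC, h⟩ := P.cnt
    refine ⟨⋃ k : ℕ, (((g'⁻¹ : 𝔽ˣ) : 𝔽) ^ k * ·) '' C, Set.countable_iUnion fun k => hC.image _, ?_⟩
    rintro v ⟨k, hk⟩
    have h2 : (LinearMap.mulLeft ℂ (((g'⁻¹ : 𝔽ˣ) : 𝔽) ^ k)) (g ^ k * v) ∈
        Submodule.span ℂ ((LinearMap.mulLeft ℂ (((g'⁻¹ : 𝔽ˣ) : 𝔽) ^ k)) '' C) := by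
      rw [← Submodule.map_span]
      exact Submodule.mem_map_of_mem (h hk)
    rw [LinearMap.mulLeft_apply, ← mul_assoc, ← mul_pow, hgg, Units.inv_mul, one_pow, one_mul] at h2
    exact Submodule.span_mono (Set.subset_iUnion_of_subset k fun _ h => h) h2
  · rintro M hM v ⟨k, hk⟩
    refine Submodule.mem_sup_right ⟨k, ?_⟩
    have := P.van M hM _ hk
    convert this using 1
    rw [Finset.mul_sum]
    exact Finset.sum_congr rfl fun w _ => by rw [(hg.pow k).ρ, mul_smul_comm]
  · rintro v ⟨k, hk⟩
    exact ⟨k, Submodule.mem_sup_left hk⟩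
  · rintro h hh v ⟨k, hk⟩
    obtain ⟨j, hj⟩ := hh _ hk
    exact ⟨j, Submodule.mem_sup_right ⟨k, by rwa [mul_left_comm]⟩⟩

lemma Pair.exists_nilpotent (P : H.Pair n N Z) (S : Finset ι) : ∃ N' Z', H.Pair n N' Z' ∧
    ∀ l ∈ S, ∃ z : ℂ, ∀ v ∈ N', ∃ k : ℕ, (H.κ l - algebraMap ℂ 𝔽 z) ^ k * v ∈ Z' := by
  classical
  induction S using Finset.induction_on with
  | empty => exact ⟨N, Z, P, by simp⟩
  | insert l S hl ih =>
    obtain ⟨N₁, Z₁, P₁, hS⟩ := ih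
    obtain ⟨v, hv, hvZ⟩ := P₁.ne
    obtain ⟨C, hC, hNC⟩ := P₁.cnt
    obtain ⟨z, hz⟩ := exists_not_bijective (H.κ l) (P₁.stN.κ l) (P₁.stZ.κ l) hv hvZ hC hNC
    have hg : H.IsGood (H.κ l - algebraMap ℂ 𝔽 z) := (H.isGood_κ l).sub (H.isGood_algebraMap z)
    have key : ∃ N' Z', H.Pair n N' Z' ∧
      (∀ v ∈ N', ∃ k, (H.κ l - algebraMap ℂ 𝔽 z) ^ k * v ∈ Z') ∧
      ∀ h, (∀ v ∈ N₁, ∃ k, h ^ k * v ∈ Z₁) → ∀ v ∈ N', ∃ k, h ^ k * v ∈ Z' := by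
      by_cases h1 : ∃ v ∈ N₁, v ∉ Z₁ ∧ (H.κ l - algebraMap ℂ 𝔽 z) * v ∈ Z₁
      · exact P₁.torsion hg h1
      · refine P₁.localise hg (H.unit l z) ?_ (hz.resolve_left h1)
        intro v hv h
        by_contra hvZ
        exact h1 ⟨v, hv, hvZ, h⟩
    obtain ⟨N', Z', P', h1, h2⟩ := key
    refine ⟨N', Z', P', fun l' hl' => ?_⟩
    rcases Finset.mem_insert.1 hl' with rfl | hl'
    · exact ⟨z, h1⟩
    · obtain ⟨z', hz'⟩ := hS l' hl'
      exact ⟨z', h2 _ hz'⟩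

end Amb

/-- The operator induced on a subquotient. -/
def subquot {W : Type*} [AddCommGroup W] [Module ℂ W] (N Z : Submodule ℂ W) (φ : Module.End ℂ W)
    (hN : ∀ v ∈ N, φ v ∈ N) (hZ : ∀ v ∈ Z, φ v ∈ Z) : Module.End ℂ (N ⧸ Z.submoduleOf N) :=
  Submodule.mapQ _ _ (φ.restrict hN) fun v hv => hZ v.1 hv

lemma subquot_mk {W : Type*} [AddCommGroup W] [Module ℂ W] (N Z : Submodule ℂ W)
    (φ : Module.End ℂ W) (hN : ∀ v ∈ N, φ v ∈ N) (hZ : ∀ v ∈ Z, φ v ∈ Z) (v : N) :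
    subquot N Z φ hN hZ (Submodule.Quotient.mk v) = Submodule.Quotient.mk ⟨φ v, hN v v.2⟩ := rfl

namespace Amb
variable {A ι 𝔽 : Type} [Fintype A] [DecidableEq A] [CommRing 𝔽] [Algebra ℂ 𝔽] {c : ℂ}
  {H : Amb A ι 𝔽 c} {n : ℕ} {N Z : Submodule ℂ 𝔽}

lemma Stable.x (h : H.Stable N) (a : A) : ∀ v ∈ N, H.x a v ∈ N := fun v hv => by
  rw [H.x_eq]; exact h.ξ a v hv

/-- The representation on a stable subquotient. -/
def quotRep (hN : H.Stable N) (hZ : H.Stable Z) : DRep A (N ⧸ Z.submoduleOf N) c where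
  ρ :=
    { toFun := fun w => subquot N Z (H.ρ w) (hN.ρ w) (hZ.ρ w)
      map_one' := by
        ext v
        refine congrArg Submodule.Quotient.mk (Subtype.ext ?_)
        change H.ρ 1 v = v
        rw [map_one]; rfl
      map_mul' := fun w w' => by
        ext v
        refine congrArg Submodule.Quotient.mk (Subtype.ext ?_)
        change H.ρ (w * w') v = H.ρ w (H.ρ w' v)
        rw [map_mul]; rfl }
  x := fun a => subquot N Z (H.x a) (hN.x a) (hZ.x a)
  D := fun a => subquot N Z (H.D a) (hN.D a) (hZ.D a)
  x_comm := fun a b v => by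
    induction v using Submodule.Quotient.induction_on with | H v
    exact congrArg Submodule.Quotient.mk (Subtype.ext (H.x_comm a b v))
  D_comm := fun a b v => by
    induction v using Submodule.Quotient.induction_on with | H v
    exact congrArg Submodule.Quotient.mk (Subtype.ext (H.D_comm a b v))
  ρ_x := fun a b v => by
    induction v using Submodule.Quotient.induction_on with | H v
    exact congrArg Submodule.Quotient.mk (Subtype.ext (H.ρ_x a b v))
  ρ_D := fun a b v => by
    induction v using Submodule.Quotient.induction_on with | H v
    exact congrArg Submodule.Quotient.mk (Subtype.ext (H.ρ_D a b v))
  D_x_ne := fun a b v hab => by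
    induction v using Submodule.Quotient.induction_on with | H v
    exact congrArg Submodule.Quotient.mk (Subtype.ext (H.D_x_ne a b v hab))
  D_x_self := fun a v => by
    induction v using Submodule.Quotient.induction_on with | H v
    have : (H.D a (H.x a v) : 𝔽) = _ := H.D_x_self a v
    simp only [MonoidHom.coe_mk, OneHom.coe_mk, subquot_mk]
    have h2 : (⟨H.D a (H.x a v), hN.D a _ (hN.x a _ v.2)⟩ : N) =
        ⟨H.x a (H.D a v), hN.x a _ (hN.D a _ v.2)⟩ + v -
          c • ∑ b ∈ Finset.univ.erase a, ⟨H.ρ (swap a b) v, hN.ρ _ _ v.2⟩ := by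
      apply Subtype.ext
      rw [AddSubgroupClass.coe_sub, Submodule.coe_add, Submodule.coe_smul, Submodule.coe_sum]
      exact this
    refine (congrArg (Submodule.mkQ (Z.submoduleOf N)) h2).trans ?_
    rw [map_sub, map_add, map_smul, map_sum]
    rfl

lemma exists_ρ_alg {b : 𝔽} (hb : b ∈ H.alg) (w : Perm A) :
    ∃ b' ∈ H.alg, ∀ v, H.ρ w (b * v) = b' * H.ρ w v := by
  induction hb using Algebra.adjoin_induction with
  | mem x hx =>
    rcases hx with ⟨a, rfl⟩ | ⟨l, rfl⟩
    · exact ⟨_, H.ξ_mem (w a), fun v => by rw [← H.x_eq, H.ρ_x, H.x_eq]⟩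
    · exact ⟨_, H.κ_mem l, H.ρ_κ w l⟩
  | algebraMap z =>
    exact ⟨_, H.alg.algebraMap_mem z, fun v => by
      rw [← Algebra.smul_def, map_smul, Algebra.smul_def]⟩
  | add p q _ _ hp hq =>
    obtain ⟨p', hp, h1⟩ := hp
    obtain ⟨q', hq, h2⟩ := hq
    exact ⟨p' + q', add_mem hp hq, fun v => by rw [add_mul, map_add, h1, h2, add_mul]⟩
  | mul p q _ _ hp hq =>
    obtain ⟨p', hp, h1⟩ := hp
    obtain ⟨q', hq, h2⟩ := hq
    exact ⟨p' * q', mul_mem hp hq, fun v => by rw [mul_assoc, h1, h2, mul_assoc]⟩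

/-- The cyclic submodule generated by a vector of a stable subquotient. -/
def cyc (hN : H.Stable N) (v : N) : H.alg →ₗ[ℂ] (N ⧸ Z.submoduleOf N) :=
  (Z.submoduleOf N).mkQ ∘ₗ LinearMap.codRestrict N (LinearMap.mulRight ℂ (v : 𝔽) ∘ₗ H.alg.val.toLinearMap)
    fun b => hN.alg b.2 v v.2

lemma cyc_apply (hN : H.Stable N) (v : N) (b : H.alg) :
    cyc (Z := Z) hN v b = Submodule.Quotient.mk ⟨b * v, hN.alg b.2 v v.2⟩ := rfl

/-- The annihilator of a vector of a stable subquotient. -/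
def ann (hZ : H.Stable Z) (v : 𝔽) : Ideal H.alg where
  carrier := {b | (b : 𝔽) * v ∈ Z}
  zero_mem' := by simp
  add_mem' := fun {a b} ha hb => by
    have := Z.add_mem ha hb
    rw [← add_mul] at this
    exact this
  smul_mem' := fun a b hb => by
    have := hZ.alg a.2 _ hb
    rw [← mul_assoc] at this
    exact this

lemma finite_quot_ann [Finite ι] (hZ : H.Stable Z) (v : 𝔽)
    (hnil : ∀ l, ∃ z : ℂ, ∃ k : ℕ, (H.κ l - algebraMap ℂ 𝔽 z) ^ k * v ∈ Z) :
    Module.Finite ℂ (H.alg ⧸ ann hZ v) := by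
  let I := ann hZ v
  let π : H.alg →ₐ[ℂ] H.alg ⧸ I := Ideal.Quotient.mkₐ ℂ I
  have hκ : ∀ l, IsIntegral ℂ (π ⟨H.κ l, H.κ_mem l⟩) := by
    intro l
    obtain ⟨z, k, h⟩ := hnil l
    refine ⟨(Polynomial.X - Polynomial.C z) ^ k, (Polynomial.monic_X_sub_C z).pow k, ?_⟩
    rw [← Polynomial.aeval_def, map_pow, map_sub, Polynomial.aeval_X, Polynomial.aeval_C,
      ← π.commutes, ← map_sub, ← map_pow]
    exact Ideal.Quotient.eq_zero_iff_mem.2 h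
  let K := integralClosure ℂ (H.alg ⧸ I)
  have hsub : Algebra.adjoin ℂ (Set.range H.κ) ≤ H.alg :=
    Algebra.adjoin_mono Set.subset_union_right
  have hK : ∀ b (hb : b ∈ Algebra.adjoin ℂ (Set.range H.κ)), π ⟨b, hsub hb⟩ ∈ K := by
    intro b hb
    induction hb using Algebra.adjoin_induction with
    | mem x hx => obtain ⟨l, rfl⟩ := hx; exact hκ l
    | algebraMap z => exact (π.commutes z).symm ▸ K.algebraMap_mem z
    | add p q hp hq h1 h2 => exact add_mem h1 h2
    | mul p q hp hq h1 h2 => exact mul_mem h1 h2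
  have hξ : ∀ a, π ⟨H.ξ a, H.ξ_mem a⟩ ∈ K := by
    intro a
    obtain ⟨p, hp, h⟩ := H.integral a
    let f : Algebra.adjoin ℂ (Set.range H.κ) →+* K :=
      (((π.comp (Subalgebra.inclusion hsub)) : _ →ₐ[ℂ] _).codRestrict K fun b => hK b b.2).toRingHom
    have : IsIntegral K (π ⟨H.ξ a, H.ξ_mem a⟩) := by
      refine ⟨p.map f, hp.map f, ?_⟩
      rw [Polynomial.eval₂_map]
      have h3 : Polynomial.eval₂ (Subalgebra.inclusion hsub).toRingHom ⟨H.ξ a, H.ξ_mem a⟩ p = 0 := by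
        apply Subtype.ext
        change H.alg.val.toRingHom _ = _
        rw [Polynomial.hom_eval₂]
        exact h
      have h4 := congrArg π.toRingHom h3
      rw [Polynomial.hom_eval₂, map_zero] at h4
      exact h4
    exact isIntegral_trans (A := K) _ this
  have hall : ∀ b (hb : b ∈ H.alg), π ⟨b, hb⟩ ∈ K := by
    intro b hb
    induction hb using Algebra.adjoin_induction with
    | mem x hx =>
      rcases hx with ⟨a, rfl⟩ | ⟨l, rfl⟩
      · exact hξ a
      · exact hκ l
    | algebraMap z => exact (π.commutes z).symm ▸ K.algebraMap_mem z
    | add p q hp hq h1 h2 => exact add_mem h1 h2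
    | mul p q hp hq h1 h2 => exact mul_mem h1 h2
  have : Algebra.IsIntegral ℂ (H.alg ⧸ I) := ⟨fun b => by
    obtain ⟨b, rfl⟩ := Ideal.Quotient.mk_surjective b
    exact hall b b.2⟩
  have : Algebra.FiniteType ℂ H.alg :=
    (Subalgebra.fg_iff_finiteType _).1 (Subalgebra.fg_def.2
      ⟨_, (Set.finite_range _).union (Set.finite_range _), rfl⟩)
  have : Algebra.FiniteType ℂ (H.alg ⧸ I) := Algebra.FiniteType.of_surjective π
    Ideal.Quotient.mk_surjective
  exact Algebra.IsIntegral.finite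

lemma finite_range_cyc [Finite ι] (hN : H.Stable N) (hZ : H.Stable Z)
    (v : N) (hnil : ∀ l, ∃ z : ℂ, ∃ k : ℕ, (H.κ l - algebraMap ℂ 𝔽 z) ^ k * v ∈ Z) :
    FiniteDimensional ℂ (LinearMap.range (cyc (Z := Z) hN v)) := by
  have := finite_quot_ann hZ (v : 𝔽) hnil
  let f : (H.alg ⧸ (ann hZ (v : 𝔽)).restrictScalars ℂ) →ₗ[ℂ] (N ⧸ Z.submoduleOf N) :=
    Submodule.liftQ _ (cyc (Z := Z) hN v) (fun b hb => by
      rw [LinearMap.mem_ker, cyc_apply, Submodule.Quotient.mk_eq_zero]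
      exact hb)
  have h : LinearMap.range (cyc (Z := Z) hN v) = LinearMap.range f := by
    rw [Submodule.range_liftQ]
  rw [h]
  have : Module.Finite ℂ (H.alg ⧸ (ann hZ (v : 𝔽)).restrictScalars ℂ) := this
  infer_instance

theorem Pair.false {m r s : ℕ} (hs : s < m) (hA : Fintype.card A = m * r + s) [Finite ι]
    {H : Amb A ι 𝔽 ((m : ℂ)⁻¹)} (P : H.Pair (r + s) N Z) : False := by
  cases nonempty_fintype ι
  obtain ⟨N, Z, P, hnil⟩ := P.exists_nilpotent Finset.univ
  obtain ⟨v, hv, hvZ⟩ := P.ne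
  let u : Perm A → N := fun w => ⟨H.ρ w v, P.stN.ρ w v hv⟩
  let U : Submodule ℂ (N ⧸ Z.submoduleOf N) := ⨆ w, LinearMap.range (cyc (Z := Z) P.stN (u w))
  have hfin : ∀ w, FiniteDimensional ℂ (LinearMap.range (cyc (Z := Z) P.stN (u w))) := fun w =>
    finite_range_cyc P.stN P.stZ _ fun l => by
      obtain ⟨z, hz⟩ := hnil l (Finset.mem_univ l)
      exact ⟨z, hz _ (u w).2⟩
  have hUfin : FiniteDimensional ℂ U := Submodule.finiteDimensional_iSup _
  have hle : ∀ w, LinearMap.range (cyc (Z := Z) P.stN (u w)) ≤ U := fun w =>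
    le_iSup (fun w => LinearMap.range (cyc (Z := Z) P.stN (u w))) w
  have hind : ∀ φ : Module.End ℂ (N ⧸ Z.submoduleOf N),
      (∀ w b, φ (cyc (Z := Z) P.stN (u w) b) ∈ U) → ∀ y ∈ U, φ y ∈ U := by
    intro φ hφ y hy
    have : U ≤ U.comap φ := iSup_le fun w => by
      rintro _ ⟨b, rfl⟩
      exact hφ w b
    exact this hy
  refine (quotRep P.stN P.stZ).false_of_vanishing m r s hs hA ?_ U ?_ ?_ ?_
  · intro M hM v
    induction v using Submodule.Quotient.induction_on with | H v
    have h1 := P.van M hM v v.2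
    have h2 : (∑ w, chi M w • (⟨H.ρ w v, P.stN.ρ w v v.2⟩ : N)) ∈ Z.submoduleOf N := by
      change N.subtype _ ∈ Z
      rw [map_sum]
      exact h1
    rw [← Submodule.Quotient.mk_eq_zero, ← Submodule.mkQ_apply, map_sum] at h2
    simp only [map_zsmul] at h2
    exact h2
  · intro h0
    have h1 : cyc (Z := Z) P.stN (u 1) 1 ∈ U := hle 1 ⟨1, rfl⟩
    rw [h0, Submodule.mem_bot, cyc_apply, Submodule.Quotient.mk_eq_zero] at h1
    change (((1 : H.alg) : 𝔽) * H.ρ 1 v) ∈ Z at h1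
    refine hvZ ?_
    simpa using h1
  · intro a
    refine hind _ fun w b => hle w ⟨⟨H.ξ a, H.ξ_mem a⟩ * b, ?_⟩
    refine congrArg Submodule.Quotient.mk (Subtype.ext ?_)
    change (H.ξ a * b) * H.ρ w v = H.x a (b * H.ρ w v)
    rw [H.x_eq, mul_assoc]
  · intro w'
    refine hind _ fun w b => ?_
    obtain ⟨b', hb', h⟩ := exists_ρ_alg b.2 w'
    refine hle (w' * w) ⟨⟨b', hb'⟩, ?_⟩
    refine congrArg Submodule.Quotient.mk (Subtype.ext ?_)
    change b' * H.ρ (w' * w) v = H.ρ w' (b * H.ρ w v)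
    rw [h, map_mul]; rfl

/-- A stable subquotient of countable dimension on which all partial antisymmetrisers vanish is
zero. -/
theorem le_of_vanishing {m r s : ℕ} (hs : s < m) (hA : Fintype.card A = m * r + s) [Finite ι]
    {H : Amb A ι 𝔽 ((m : ℂ)⁻¹)} (hN : H.Stable N) (hZ : H.Stable Z) (hle : Z ≤ N)
    (hcnt : ∃ C : Set 𝔽, C.Countable ∧ N ≤ Submodule.span ℂ C)
    (hvan : ∀ M : Finset A, M.card = r + s → ∀ v ∈ N, ∑ w, chi M w • H.ρ w v ∈ Z) : N ≤ Z := by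
  by_contra h
  obtain ⟨v, hv, hvZ⟩ := Set.not_subset.1 h
  exact Pair.false hs hA (N := N) (Z := Z) ⟨hN, hZ, hle, ⟨v, hv, hvZ⟩, hcnt, hvan⟩

end Amb

section
variable {ι W W' : Type} [DecidableEq ι] [CommRing W] [Algebra ℂ W] [CommRing W'] [Algebra ℂ W']

/-- Stability under multiplication by the `q l`. -/
def QStable (q : ι → W) (M : Submodule ℂ W) : Prop := ∀ l, ∀ v ∈ M, q l * v ∈ M

/-- `∑_{l ∈ S} q_l ^ k_l M`. -/
def powSum (q : ι → W) (M : Submodule ℂ W) (S : Finset ι) (k : ι → ℕ) : Submodule ℂ W :=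
  ⨆ l ∈ S, M.map (LinearMap.mulLeft ℂ (q l ^ k l))

/-- Regularity of the `q l`, in all orders and with all exponents. -/
def PowReg (q : ι → W) (M : Submodule ℂ W) : Prop :=
  ∀ (S : Finset ι) (k : ι → ℕ) (j : ι), j ∉ S → ∀ v ∈ M, q j * v ∈ powSum q M S k →
    v ∈ powSum q M S k

variable {q : ι → W} {M : Submodule ℂ W} {q' : ι → W'} {M' : Submodule ℂ W'}

lemma mem_powSum {S : Finset ι} {k : ι → ℕ} {v : W} :
    v ∈ powSum q M S k ↔ ∃ u : ι → W, (∀ l, u l ∈ M) ∧ v = ∑ l ∈ S, q l ^ k l * u l := by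
  unfold powSum
  rw [Submodule.mem_iSup_finset_iff_exists_sum]
  constructor
  · rintro ⟨μ, hμ⟩
    choose u hu hu' using fun l => (μ l).2
    exact ⟨u, hu, by rw [← hμ]; exact Finset.sum_congr rfl fun l _ => (hu' l).symm⟩
  · rintro ⟨u, hu, rfl⟩
    exact ⟨fun l => ⟨_, u l, hu l, rfl⟩, rfl⟩

lemma mem_powSum_of_mem {S : Finset ι} {k : ι → ℕ} {l : ι} (hl : l ∈ S) {u : W} (hu : u ∈ M) :
    q l ^ k l * u ∈ powSum q M S k :=
  Submodule.mem_iSup_of_mem l (Submodule.mem_iSup_of_mem hl ⟨u, hu, rfl⟩)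

lemma QStable.pow (hM : QStable q M) (l : ι) (k : ℕ) {v : W} (hv : v ∈ M) : q l ^ k * v ∈ M := by
  induction k with
  | zero => simpa using hv
  | succ k ih => rw [pow_succ', mul_assoc]; exact hM l _ ih

lemma QStable.prod_pow (hM : QStable q M) (S : Finset ι) (k : ι → ℕ) {v : W} (hv : v ∈ M) :
    (∏ l ∈ S, q l ^ k l) * v ∈ M := by
  induction S using Finset.induction_on with
  | empty => simpa using hv
  | insert l S hl ih => rw [Finset.prod_insert hl, mul_assoc]; exact hM.pow l _ ih

lemma QStable.prod (hM : QStable q M) (S : Finset ι) : ∀ v ∈ M, (∏ l ∈ S, q l) * v ∈ M :=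
  fun v hv => by simpa using hM.prod_pow S (fun _ => 1) hv

lemma QStable.prod_pow' (hM : QStable q M) (S : Finset ι) (k : ℕ) {v : W} (hv : v ∈ M) :
    (∏ l ∈ S, q l) ^ k * v ∈ M := by
  rw [← Finset.prod_pow]; exact hM.prod_pow S _ hv

lemma qStable_powSum (hM : QStable q M) (S : Finset ι) (k : ι → ℕ) :
    QStable q (powSum q M S k) := by
  intro l v hv
  obtain ⟨u, hu, rfl⟩ := mem_powSum.1 hv
  refine mem_powSum.2 ⟨fun i => q l * u i, fun i => hM l _ (hu i), ?_⟩
  rw [Finset.mul_sum]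
  exact Finset.sum_congr rfl fun _ _ => by ring

/-- `∑_{l ∈ S} M[1 / ∏_{l' ∈ S \ l} q_l']`. -/
def bdry (q : ι → W) (M : Submodule ℂ W) (hM : QStable q M) (S : Finset ι) : Submodule ℂ W :=
  ⨆ l ∈ S, Loc M (∏ i ∈ S.erase l, q i) (hM.prod _)

/-- Regularity of the `q l` expressed through localisations. -/
def RegLoc (q : ι → W) (M : Submodule ℂ W) (hM : QStable q M) : Prop :=
  ∀ (S : Finset ι) (j : ι), j ∉ S → ∀ v ∈ Loc M (∏ i ∈ S, q i) (hM.prod _),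
    q j * v ∈ bdry q M hM S → v ∈ bdry q M hM S

lemma mem_bdry {hM : QStable q M} {S : Finset ι} {v : W} : v ∈ bdry q M hM S ↔
    ∃ (u : ι → W) (N : ℕ), (∀ l ∈ S, ∀ k, N ≤ k → (∏ i ∈ S.erase l, q i) ^ k * u l ∈ M) ∧
      v = ∑ l ∈ S, u l := by
  unfold bdry
  rw [Submodule.mem_iSup_finset_iff_exists_sum]
  constructor
  · rintro ⟨μ, hμ⟩
    choose K hK using fun l => (μ l).2
    refine ⟨fun l => μ l, ∑ l ∈ S, K l, fun l hl k hk => ?_, hμ.symm⟩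
    have h1 : K l ≤ k := (Finset.single_le_sum (fun _ _ => Nat.zero_le _) hl).trans hk
    obtain ⟨d, rfl⟩ := Nat.exists_eq_add_of_le h1
    rw [add_comm, pow_add, mul_assoc]
    exact hM.prod_pow' _ _ (hK l)
  · rintro ⟨u, N, hu, rfl⟩
    have hmem : ∀ l ∈ S, u l ∈ Loc M (∏ i ∈ S.erase l, q i) (hM.prod _) := fun l h =>
      ⟨N, hu l h N le_rfl⟩
    refine ⟨fun l => if h : l ∈ S then ⟨u l, hmem l h⟩ else 0, ?_⟩
    exact Finset.sum_congr rfl fun l hl => by simp only [dif_pos hl]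

lemma bdry_le (hM : QStable q M) (S : Finset ι) :
    bdry q M hM S ≤ Loc M (∏ i ∈ S, q i) (hM.prod _) := by
  refine iSup₂_le fun l hl => ?_
  rintro v ⟨k, hk⟩
  refine ⟨k, ?_⟩
  rw [← Finset.mul_prod_erase S q hl, mul_pow, mul_assoc]
  exact hM.pow l k hk

lemma Loc_map (f : W →ₗ[ℂ] W') {g : W} {g' : W'} (hf : ∀ v, f (g * v) = g' * f v) {hN hN'}
    (hM : ∀ v ∈ M, f v ∈ M') {v : W} (hv : v ∈ Loc M g hN) : f v ∈ Loc M' g' hN' := by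
  obtain ⟨k, hk⟩ := hv
  refine ⟨k, ?_⟩
  have : f (g ^ k * v) = g' ^ k * f v := by
    clear hk
    induction k with
    | zero => simp
    | succ k ih => rw [pow_succ', mul_assoc, hf, ih, pow_succ', mul_assoc]
  rw [← this]
  exact hM _ hk

lemma map_prod_mul (f : W →ₗ[ℂ] W') (hf : ∀ l v, f (q l * v) = q' l * f v) (S : Finset ι) (v : W) :
    f ((∏ i ∈ S, q i) * v) = (∏ i ∈ S, q' i) * f v := by
  induction S using Finset.induction_on with
  | empty => simp
  | insert l S hl ih => rw [Finset.prod_insert hl, Finset.prod_insert hl, mul_assoc, hf, ih, mul_assoc]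

lemma bdry_map (f : W →ₗ[ℂ] W') (hf : ∀ l v, f (q l * v) = q' l * f v)
    (hM : QStable q M) (hM' : QStable q' M') (h : ∀ v ∈ M, f v ∈ M') {S : Finset ι} {v : W}
    (hv : v ∈ bdry q M hM S) : f v ∈ bdry q' M' hM' S := by
  have : bdry q M hM S ≤ (bdry q' M' hM' S).comap f := by
    refine iSup₂_le fun l hl v hv => ?_
    exact Submodule.mem_iSup_of_mem l (Submodule.mem_iSup_of_mem hl
      (Loc_map f (map_prod_mul f hf _) h hv))
  exact this hv

/-- `RegLoc` passes to retracts. -/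
lemma RegLoc.retract (hM : QStable q M) (hM' : QStable q' M') (h : RegLoc q' M' hM')
    (i : W →ₗ[ℂ] W') (e : W' →ₗ[ℂ] W) (hi : ∀ l v, i (q l * v) = q' l * i v)
    (he : ∀ l v, e (q' l * v) = q l * e v) (hei : ∀ v, e (i v) = v) (hiM : ∀ v ∈ M, i v ∈ M')
    (heM : ∀ v ∈ M', e v ∈ M) : RegLoc q M hM := by
  intro S j hj v hv hjv
  rw [← hei v]
  refine bdry_map e he hM' hM heM (h S j hj _ (Loc_map i (map_prod_mul i hi _) hiM hv) ?_)
  rw [← hi]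
  exact bdry_map i hi hM hM' hiM hjv

lemma RegLoc.pow {hM : QStable q M} (h : RegLoc q M hM) {S : Finset ι} {j : ι} (hj : j ∉ S) (a : ℕ) :
    ∀ v ∈ Loc M (∏ i ∈ S, q i) (hM.prod _), q j ^ a * v ∈ bdry q M hM S → v ∈ bdry q M hM S := by
  induction a with
  | zero => intro v _ h; simpa using h
  | succ a ih =>
    intro v hv hjv
    refine ih v hv (h S j hj _ ?_ (by rwa [← mul_assoc, ← pow_succ']))
    obtain ⟨k, hk⟩ := hv
    exact ⟨k, by rw [mul_left_comm]; exact hM.pow j a hk⟩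

lemma PowReg.regLoc (hM : QStable q M) (hq : ∀ l, IsUnit (q l)) (h : PowReg q M) :
    RegLoc q M hM := by
  rintro S j hj v ⟨a, ha⟩ hjv
  obtain ⟨w, N, hw, hjw⟩ := mem_bdry.1 hjv
  have hup : ∀ k, a ≤ k → (∏ i ∈ S, q i) ^ k * v ∈ M := by
    intro k hk
    obtain ⟨d, rfl⟩ := Nat.exists_eq_add_of_le hk
    rw [add_comm, pow_add, mul_assoc]
    exact hM.prod_pow' _ _ ha
  have h1 : (∏ i ∈ S, q i) ^ (a + N) * v ∈ powSum q M S (fun _ => a + N) := by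
    refine h S _ j hj _ (hup _ (by omega)) ?_
    rw [mul_left_comm, hjw, Finset.mul_sum]
    refine Submodule.sum_mem _ fun l hl => ?_
    rw [← Finset.mul_prod_erase S q hl, mul_pow, mul_assoc]
    exact mem_powSum_of_mem (k := fun _ => a + N) hl (hw l hl _ (by omega))
  obtain ⟨u, hu, huv⟩ := mem_powSum.1 h1
  choose q' hq' using fun l => (hq l).exists_right_inv
  have hinv : (∏ i ∈ S, q' i) ^ (a + N) * (∏ i ∈ S, q i) ^ (a + N) = 1 := by
    rw [← mul_pow, ← Finset.prod_mul_distrib, Finset.prod_congr rfl fun l _ => by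
      rw [mul_comm, hq' l], Finset.prod_const_one, one_pow]
  have hv : v = ∑ l ∈ S, (∏ i ∈ S, q' i) ^ (a + N) * (q l ^ (a + N) * u l) := by
    rw [← Finset.mul_sum, ← huv, ← mul_assoc, hinv, one_mul]
  rw [hv]
  refine Submodule.sum_mem _ fun l hl => ?_
  refine Submodule.mem_iSup_of_mem l (Submodule.mem_iSup_of_mem hl ⟨a + N, ?_⟩)
  have : (∏ i ∈ S.erase l, q i) ^ (a + N) * ((∏ i ∈ S, q' i) ^ (a + N) * (q l ^ (a + N) * u l)) =
      u l := by
    calc _ = ((∏ i ∈ S, q' i) ^ (a + N) * (q l * ∏ i ∈ S.erase l, q i) ^ (a + N)) * u l := by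
          rw [mul_pow]; ring
      _ = u l := by rw [Finset.mul_prod_erase S q hl, hinv, one_mul]
  rw [this]
  exact hu l

/-- Peeling off powers. -/
lemma powSum_peel (hM : QStable q M) (S : Finset ι)
    (ih : ∀ l ∈ S, ∀ (k : ι → ℕ), ∀ v ∈ M, q l * v ∈ powSum q M (S.erase l) k →
      v ∈ powSum q M (S.erase l) k) (N : ℕ) (k : ι → ℕ) {u : W} (hu : u ∈ M) (R : Finset ι) :
    R ⊆ S → (∏ l ∈ R, q l ^ N) * u ∈ powSum q M S (fun l => k l + if l ∈ R then N else 0) →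
      u ∈ powSum q M S k := by
  induction R using Finset.induction_on with
  | empty => intro _ h; simpa using h
  | insert l R hl ihR =>
    intro hR h
    have hlS : l ∈ S := hR (Finset.mem_insert_self l R)
    refine ihR ((Finset.subset_insert l R).trans hR) ?_
    obtain ⟨w, hw, hw'⟩ := mem_powSum.1 h
    rw [← Finset.add_sum_erase S _ hlS, Finset.prod_insert hl] at hw'
    simp only [Finset.mem_insert_self, if_true] at hw'
    set k' : ι → ℕ := fun l => k l + if l ∈ R then N else 0 with hk'
    have hstep : ∀ (n : ℕ), ∀ v ∈ M, q l ^ n * v ∈ powSum q M (S.erase l) k' →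
        v ∈ powSum q M (S.erase l) k' := by
      intro n
      induction n with
      | zero => intro v _ h; simpa using h
      | succ n ihn =>
        intro v hv h
        rw [pow_succ', mul_assoc] at h
        exact ihn v hv (ih l hlS k' _ (hM.pow l n hv) h)
    have h1 : (∏ l ∈ R, q l ^ N) * u - q l ^ k l * w l ∈ powSum q M (S.erase l) k' := by
      refine hstep N _ (M.sub_mem (hM.prod_pow _ _ hu) (hM.pow l _ (hw l))) ?_
      refine mem_powSum.2 ⟨w, hw, ?_⟩
      have h2 : q l ^ N * ((∏ l ∈ R, q l ^ N) * u - q l ^ k l * w l) =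
          ∑ x ∈ S.erase l, q x ^ (k x + if x ∈ insert l R then N else 0) * w x := by
        rw [mul_sub, ← mul_assoc, hw']; ring
      rw [h2]
      refine Finset.sum_congr rfl fun x hx => ?_
      simp only [hk', Finset.mem_insert, Finset.ne_of_mem_erase hx, false_or]
    have h2 : powSum q M (S.erase l) k' ≤ powSum q M S k' := 
      biSup_mono fun _ h => Finset.mem_of_mem_erase h
    have h3 := mem_powSum_of_mem (q := q) (k := k') hlS (hw l)
    have hkl : k' l = k l := by simp [hk', hl]
    rw [hkl] at h3
    have := Submodule.add_mem _ (h2 h1) h3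
    rwa [sub_add_cancel] at this

theorem RegLoc.powReg (hM : QStable q M) (hq : ∀ l, IsUnit (q l)) (h : RegLoc q M hM) :
    PowReg q M := by
  intro S
  induction hn : S.card using Nat.strong_induction_on generalizing S with | _ n ih
  intro k j hj v hv hjv
  have ih' : ∀ l ∈ S, ∀ (k : ι → ℕ), ∀ v ∈ M, q l * v ∈ powSum q M (S.erase l) k →
      v ∈ powSum q M (S.erase l) k := fun l hl k v hv h =>
    ih _ (by rw [← hn]; exact Finset.card_erase_lt_of_mem hl) (S.erase l) rfl k l
      (Finset.notMem_erase l S) v hv h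
  choose q' hq' using fun l => (hq l).exists_right_inv
  have hinv : ∀ (T : Finset ι) (k : ι → ℕ), (∏ i ∈ T, q' i ^ k i) * (∏ i ∈ T, q i ^ k i) = 1 := by
    intro T k
    rw [← Finset.prod_mul_distrib]
    exact Finset.prod_eq_one fun l _ => by rw [← mul_pow, mul_comm, hq' l, one_pow]
  have hK : ∀ (T : Finset ι), T ⊆ S → ∀ l, l ∈ T → k l ≤ ∑ i ∈ S, k i := fun T hT l hl =>
    Finset.single_le_sum (f := k) (fun _ _ => Nat.zero_le _) (hT hl)
  have hloc : ∀ (T : Finset ι) (hT : T ⊆ S) (u : W), u ∈ M →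
      (∏ i ∈ T, q' i ^ k i) * u ∈ Loc M (∏ i ∈ T, q i) (hM.prod _) := by
    intro T hT u hu
    refine ⟨∑ i ∈ S, k i, ?_⟩
    have : (∏ i ∈ T, q i) ^ (∑ i ∈ S, k i) * ((∏ i ∈ T, q' i ^ k i) * u) =
        (∏ i ∈ T, q i ^ (∑ i ∈ S, k i - k i)) * u := by
      have h1 : (∏ i ∈ T, q i) ^ (∑ i ∈ S, k i) =
          (∏ i ∈ T, q i ^ k i) * ∏ i ∈ T, q i ^ (∑ i ∈ S, k i - k i) := by
        rw [← Finset.prod_pow, ← Finset.prod_mul_distrib]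
        refine Finset.prod_congr rfl fun l hl => ?_
        rw [← pow_add, Nat.add_sub_cancel' (hK T hT l hl)]
      calc _ = ((∏ i ∈ T, q' i ^ k i) * ∏ i ∈ T, q i ^ k i) *
            ((∏ i ∈ T, q i ^ (∑ i ∈ S, k i - k i)) * u) := by rw [h1]; ring
        _ = _ := by rw [hinv, one_mul]
    rw [this]
    exact hM.prod_pow _ _ hu
  have hw : (∏ i ∈ S, q' i ^ k i) * v ∈ bdry q M hM S := by
    refine h S j hj _ (hloc S subset_rfl v hv) ?_
    obtain ⟨u, hu, hu'⟩ := mem_powSum.1 hjv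
    rw [mul_left_comm, hu', Finset.mul_sum]
    refine Submodule.sum_mem _ fun l hl => ?_
    refine Submodule.mem_iSup_of_mem l (Submodule.mem_iSup_of_mem hl ?_)
    have : (∏ i ∈ S, q' i ^ k i) * (q l ^ k l * u l) = (∏ i ∈ S.erase l, q' i ^ k i) * u l := by
      rw [← Finset.mul_prod_erase S _ hl]
      calc _ = (q l * q' l) ^ k l * ((∏ i ∈ S.erase l, q' i ^ k i) * u l) := by rw [mul_pow]; ring
        _ = _ := by rw [hq', one_pow, one_mul]
    rw [this]
    exact hloc _ (Finset.erase_subset l S) _ (hu l)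
  obtain ⟨u, N, hu, huv⟩ := mem_bdry.1 hw
  have hv' : v = ∑ l ∈ S, (∏ i ∈ S, q i ^ k i) * u l := by
    rw [← Finset.mul_sum, ← huv, ← mul_assoc, mul_comm (∏ i ∈ S, q i ^ k i), hinv, one_mul]
  refine powSum_peel hM S ih' N k hv S subset_rfl ?_
  rw [hv', Finset.mul_sum]
  refine Submodule.sum_mem _ fun l hl => ?_
  have h5 : (∏ i ∈ S, q i ^ N) * ((∏ i ∈ S, q i ^ k i) * u l) = q l ^ (k l + if l ∈ S then N else 0) *
      ((∏ i ∈ S.erase l, q i ^ k i) * ((∏ i ∈ S.erase l, q i) ^ N * u l)) := by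
    rw [if_pos hl, ← Finset.mul_prod_erase S (fun i => q i ^ N) hl,
      ← Finset.mul_prod_erase S (fun i => q i ^ k i) hl, Finset.prod_pow]
    ring
  rw [h5]
  exact mem_powSum_of_mem (k := fun l => k l + if l ∈ S then N else 0) hl
    (hM.prod_pow _ _ (hu l hl N le_rfl))

end

lemma exists_countable_Loc {𝔽 : Type} [CommRing 𝔽] [Algebra ℂ 𝔽] {N : Submodule ℂ 𝔽} {g : 𝔽}
    (hg : IsUnit g) (hN : ∀ v ∈ N, g * v ∈ N)
    (h : ∃ C : Set 𝔽, C.Countable ∧ N ≤ Submodule.span ℂ C) :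
    ∃ C : Set 𝔽, C.Countable ∧ Loc N g hN ≤ Submodule.span ℂ C := by
  obtain ⟨C, hC, h⟩ := h
  obtain ⟨g', hg'⟩ := hg.exists_left_inv
  refine ⟨⋃ k : ℕ, (g' ^ k * ·) '' C, Set.countable_iUnion fun k => hC.image _, ?_⟩
  rintro v ⟨k, hk⟩
  have h2 : (LinearMap.mulLeft ℂ (g' ^ k)) (g ^ k * v) ∈
      Submodule.span ℂ ((LinearMap.mulLeft ℂ (g' ^ k)) '' C) := by
    rw [← Submodule.map_span]
    exact Submodule.mem_map_of_mem (h hk)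
  rw [LinearMap.mulLeft_apply, ← mul_assoc, ← mul_pow, hg', one_pow, one_mul] at h2
  exact Submodule.span_mono (Set.subset_iUnion_of_subset k fun _ h => h) h2

namespace Amb
variable {A ι 𝔽 W : Type} [Fintype A] [DecidableEq A] [DecidableEq ι] [CommRing 𝔽] [Algebra ℂ 𝔽]
  [CommRing W] [Algebra ℂ W]

lemma Stable.iSup {c : ℂ} {H : Amb A ι 𝔽 c} {T : Sort*} {N : T → Submodule ℂ 𝔽}
    (h : ∀ t, H.Stable (N t)) : H.Stable (⨆ t, N t) := by
  have key : ∀ φ : Module.End ℂ 𝔽, (∀ t, ∀ v ∈ N t, φ v ∈ N t) → ∀ v ∈ ⨆ t, N t, φ v ∈ ⨆ t, N t := by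
    intro φ hφ v hv
    have : ⨆ t, N t ≤ (⨆ t, N t).comap φ :=
      iSup_le fun t v hv => Submodule.mem_iSup_of_mem t (hφ t v hv)
    exact this hv
  exact ⟨fun w => key (H.ρ w) fun t => (h t).ρ w, fun a => key (H.D a) fun t => (h t).D a,
    fun a => key (LinearMap.mulLeft ℂ (H.ξ a)) fun t => (h t).ξ a,
    fun l => key (LinearMap.mulLeft ℂ (H.κ l)) fun t => (h t).κ l⟩

theorem regLoc_of_regLoc {m r s : ℕ} (hs : s < m) (hA : Fintype.card A = m * r + s) [Finite ι]
    (H : Amb A ι 𝔽 ((m : ℂ)⁻¹)) {L : Submodule ℂ 𝔽} (hL : H.Stable L)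
    (hcnt : ∃ C : Set 𝔽, C.Countable ∧ L ≤ Submodule.span ℂ C)
    {q' : ι → W} {T : Submodule ℂ W} (hT : QStable q' T) (hreg : RegLoc q' T hT)
    (hM : ∀ M : Finset A, M.card = r + s → ∃ (f : 𝔽 →ₗ[ℂ] W) (g : W →ₗ[ℂ] 𝔽),
      (∀ l v, f (H.κ l * v) = q' l * f v) ∧ (∀ l v, g (q' l * v) = H.κ l * g v) ∧
      (∀ v ∈ L, f v ∈ T) ∧ (∀ v ∈ T, g v ∈ L) ∧ ∀ v, ∑ w, chi M w • H.ρ w v = g (f v)) :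
    RegLoc H.κ L hL.κ := by
  intro S j hj v hv hjv
  have hLoc := hL.loc (H.isGood_prod S)
  have hZ : H.Stable (bdry H.κ L hL.κ S) :=
    Stable.iSup fun l => Stable.iSup fun _ => hL.loc (H.isGood_prod _)
  have hZj := hZ.loc (H.isGood_κ j)
  have hu : ∀ S : Finset ι, IsUnit (∏ l ∈ S, H.κ l) := fun S => by
    refine Finset.prod_induction _ IsUnit (fun _ _ => IsUnit.mul) isUnit_one fun l _ => ?_
    simpa using H.unit l 0
  have hZle : bdry H.κ L hL.κ S ≤ Loc (bdry H.κ L hL.κ S) (H.κ j) (hZ.alg (H.κ_mem j)) :=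
    fun v hv => ⟨0, by simpa using hv⟩
  refine le_of_vanishing hs hA (hLoc.inf hZj) hZ (le_inf (bdry_le _ _) hZle) ?_ ?_ ⟨hv, 1, ?_⟩
  · obtain ⟨C, hC, h⟩ := exists_countable_Loc (hu S) (hL.alg (H.isGood_prod S).mem) hcnt
    exact ⟨C, hC, inf_le_left.trans h⟩
  · rintro M hMc u ⟨hu, a, ha⟩
    obtain ⟨f, g, hf, hg, hfT, hgL, hfg⟩ := hM M hMc
    rw [hfg]
    refine bdry_map g hg hT hL.κ hgL (hreg.pow hj a _ (Loc_map f (map_prod_mul f hf S) hfT hu) ?_)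
    have h1 := bdry_map f hf hL.κ hT hfT ha
    have h2 : ∀ k : ℕ, f (H.κ j ^ k * u) = q' j ^ k * f u := by
      intro k
      induction k with
      | zero => simp
      | succ k ih => rw [pow_succ', mul_assoc, hf, ih, pow_succ', mul_assoc]
    rwa [h2] at h1
  · simpa using hjv

end Amb

section
variable {ι J W : Type} [DecidableEq ι] [CommRing W] [Algebra ℂ W]

/-- The map from the free module with basis `b` over the polynomials in `q`. -/
def theta (q : ι → W) (b : J → W) : (J →₀ MvPolynomial ι ℂ) →ₗ[ℂ] W :=
  Finsupp.lsum ℂ fun k => LinearMap.mulRight ℂ (b k) ∘ₗ (aeval q).toLinearMap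

variable {q : ι → W} {b : J → W}

lemma theta_apply (c : J →₀ MvPolynomial ι ℂ) :
    theta q b c = c.sum fun k p => aeval q p * b k := rfl

lemma theta_single (k : J) (p : MvPolynomial ι ℂ) :
    theta q b (Finsupp.single k p) = aeval q p * b k := by
  rw [theta_apply, Finsupp.sum_single_index (by simp)]

lemma theta_smul (p : MvPolynomial ι ℂ) (c : J →₀ MvPolynomial ι ℂ) :
    theta q b (p • c) = aeval q p * theta q b c := by
  induction c using Finsupp.induction_linear with
  | zero => simp
  | add c d hc hd => rw [smul_add, map_add, hc, hd, map_add, mul_add]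
  | single k f => rw [Finsupp.smul_single, theta_single, theta_single, smul_eq_mul, map_mul, mul_assoc]

lemma mem_monomial_of_X_mul {S : Finset ι} {k : ι → ℕ} {j : ι} (hj : j ∉ S) {p : MvPolynomial ι ℂ}
    (h : X j * p ∈ Ideal.span ((fun l => (X l ^ k l : MvPolynomial ι ℂ)) '' S)) :
    p ∈ Ideal.span ((fun l => (X l ^ k l : MvPolynomial ι ℂ)) '' S) := by
  have heq : ((fun l => (X l ^ k l : MvPolynomial ι ℂ)) '' S) = (fun s => monomial s (1 : ℂ)) ''
      ((fun l => Finsupp.single l (k l)) '' S) := by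
    rw [Set.image_image]
    exact Set.image_congr fun l _ => X_pow_eq_monomial
  rw [heq, mem_ideal_span_monomial_image] at h ⊢
  intro α hα
  obtain ⟨_, ⟨l, hl, rfl⟩, hle⟩ := h (Finsupp.single j 1 + α) (by
    rw [mem_support_iff, coeff_X_mul]; exact mem_support_iff.1 hα)
  refine ⟨_, ⟨l, hl, rfl⟩, ?_⟩
  rw [Finsupp.single_le_iff] at hle ⊢
  have : j ≠ l := fun h => hj (h ▸ hl)
  simpa [Finsupp.single_apply, this] using hle

/-- Free modules over the polynomials in `q` are regular. -/
theorem powReg_of_theta {M : Submodule ℂ W} (hM : QStable q M)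
    (hinj : Function.Injective (theta q b)) (hrange : LinearMap.range (theta q b) = M) :
    PowReg q M := by
  classical
  rintro S k j hj v hv hjv
  rw [← hrange] at hv
  obtain ⟨c, rfl⟩ := hv
  obtain ⟨u, hu, huv⟩ := mem_powSum.1 hjv
  have hu' : ∀ l, ∃ d, theta q b d = u l := fun l => by
    have := hu l; rw [← hrange] at this; exact this
  choose d hd using hu'
  have h1 : (X j : MvPolynomial ι ℂ) • c = ∑ l ∈ S, (X l ^ k l : MvPolynomial ι ℂ) • d l := by
    apply hinj
    rw [theta_smul, aeval_X, huv, map_sum]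
    exact Finset.sum_congr rfl fun l _ => by rw [theta_smul, map_pow, aeval_X, hd]
  set I := Ideal.span ((fun l => (X l ^ k l : MvPolynomial ι ℂ)) '' S)
  have h2 : ∀ i, c i ∈ I := by
    intro i
    apply mem_monomial_of_X_mul hj
    have := DFunLike.congr_fun h1 i
    rw [Finsupp.smul_apply, smul_eq_mul, Finsupp.finsetSum_apply] at this
    rw [this]
    refine Ideal.sum_mem _ fun l hl => ?_
    rw [Finsupp.smul_apply, smul_eq_mul]
    exact Ideal.mul_mem_right _ _ (Ideal.subset_span ⟨l, hl, rfl⟩)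
  have h3 : ∀ p ∈ I, ∀ i, theta q b (Finsupp.single i p) ∈ powSum q M S k := by
    intro p hp i
    induction hp using Submodule.span_induction with
    | zero => simp
    | add x y _ _ hx hy => rw [Finsupp.single_add, map_add]; exact Submodule.add_mem _ hx hy
    | mem x hx =>
      obtain ⟨l, hl, rfl⟩ := hx
      have : Finsupp.single i (X l ^ k l : MvPolynomial ι ℂ) =
        (X l ^ k l : MvPolynomial ι ℂ) • Finsupp.single i 1 := by simp
      simp only [this]
      rw [theta_smul, map_pow, aeval_X]
      refine mem_powSum_of_mem hl ?_
      rw [← hrange]; exact ⟨_, rfl⟩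
    | smul a x _ hx =>
      have : Finsupp.single i (a • x) = a • Finsupp.single i x := by simp
      rw [this, theta_smul]
      have key : ∀ (a : MvPolynomial ι ℂ), ∀ v ∈ powSum q M S k, aeval q a * v ∈ powSum q M S k := by
        intro a
        induction a using MvPolynomial.induction_on with
        | C z =>
          intro v hv
          rw [aeval_C, ← Algebra.smul_def]
          exact Submodule.smul_mem _ _ hv
        | add p q hp hq => intro v hv; rw [map_add, add_mul]; exact Submodule.add_mem _ (hp v hv) (hq v hv)
        | mul_X p l hp =>
          intro v hv
          rw [map_mul, aeval_X, mul_assoc]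
          exact hp _ (qStable_powSum hM S k l v hv)
      exact key a _ hx
  rw [← Finsupp.sum_single c, Finsupp.sum, map_sum]
  exact Submodule.sum_mem _ fun i _ => h3 _ (h2 i) i

end

section
variable {V J : Type} {n : ℕ}

lemma homogeneousComponent_mul_of_isHomogeneous {e : ℕ} {f : MvPolynomial V ℂ} (hf : f.IsHomogeneous e)
    (g : MvPolynomial V ℂ) (d : ℕ) : homogeneousComponent (e + d) (f * g) =
      f * homogeneousComponent d g := by
  conv_lhs => rw [← sum_homogeneousComponent g, Finset.mul_sum, map_sum]
  have h1 : ∀ i, homogeneousComponent (e + d) (f * homogeneousComponent i g) =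
      if i = d then f * homogeneousComponent d g else 0 := by
    intro i
    rw [homogeneousComponent_of_mem (hf.mul (homogeneousComponent_isHomogeneous i g))]
    by_cases h : i = d
    · subst h; simp
    · rw [if_neg (by omega), if_neg h]
  rw [Finset.sum_congr rfl fun i _ => h1 i, Finset.sum_ite_eq']
  split_ifs with h
  · rfl
  · rw [Finset.mem_range, not_lt] at h
    rw [homogeneousComponent_eq_zero _ _ (by omega), mul_zero]

lemma homogeneousComponent_mul_eq_zero {e : ℕ} {f : MvPolynomial V ℂ} (hf : f.IsHomogeneous e)
    (g : MvPolynomial V ℂ) {d : ℕ} (h : d < e) : homogeneousComponent d (f * g) = 0 := by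
  conv_lhs => rw [← sum_homogeneousComponent g, Finset.mul_sum, map_sum]
  refine Finset.sum_eq_zero fun i _ => ?_
  rw [homogeneousComponent_of_mem (hf.mul (homogeneousComponent_isHomogeneous i g)),
    if_neg (by omega)]

/-- Subspaces containing the homogeneous components of their elements. -/
def Graded (M : Submodule ℂ (MvPolynomial V ℂ)) : Prop :=
  ∀ f ∈ M, ∀ d, homogeneousComponent d f ∈ M

variable {M : Submodule ℂ (MvPolynomial V ℂ)} {q : Fin n → MvPolynomial V ℂ}

lemma exists_homogeneous_family (hM : Graded M) (I : Submodule ℂ (MvPolynomial V ℂ)) :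
    ∃ (J : Type) (b : J → MvPolynomial V ℂ) (e : J → ℕ), (∀ k, b k ∈ M) ∧
      (∀ k, (b k).IsHomogeneous (e k)) ∧ LinearIndependent ℂ (fun k => I.mkQ (b k)) ∧
      M ≤ Submodule.span ℂ (Set.range b) ⊔ I := by
  obtain ⟨B, hB, hspan, hli⟩ := exists_linearIndependent ℂ
    (I.mkQ '' {f | f ∈ M ∧ ∃ d, f.IsHomogeneous d})
  choose b hb hb' using fun k : B => hB k.2
  choose hbM e he using hb
  have hbe : (fun k => I.mkQ (b k)) = ((↑) : B → _) := funext hb'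
  refine ⟨B, b, e, hbM, he, by rw [hbe]; exact hli, fun v hv => ?_⟩
  have h1 : I.mkQ v ∈ (Submodule.span ℂ (Set.range b)).map I.mkQ := by
    rw [Submodule.map_span, ← Set.range_comp]
    change _ ∈ Submodule.span ℂ (Set.range fun k => I.mkQ (b k))
    rw [hbe, Subtype.range_coe, hspan, ← sum_homogeneousComponent v, map_sum]
    exact Submodule.sum_mem _ fun d _ => Submodule.subset_span ⟨_, ⟨hM v hv d, d,
      homogeneousComponent_isHomogeneous d v⟩, rfl⟩
  obtain ⟨u, hu, huv⟩ := h1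
  rw [Submodule.mem_sup]
  refine ⟨u, hu, v - u, ?_, by ring⟩
  rw [← Submodule.Quotient.mk_eq_zero, ← Submodule.mkQ_apply, map_sub, huv, sub_self]

lemma theta_mem (hst : QStable q M) {b : J → MvPolynomial V ℂ} (hb : ∀ k, b k ∈ M)
    (c : J →₀ MvPolynomial (Fin n) ℂ) : theta q b c ∈ M := by
  have key : ∀ (a : MvPolynomial (Fin n) ℂ), ∀ v ∈ M, aeval q a * v ∈ M := by
    intro a
    induction a using MvPolynomial.induction_on with
    | C z =>
      intro v hv
      rw [aeval_C, ← Algebra.smul_def]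
      exact Submodule.smul_mem _ _ hv
    | add p q hp hq => intro v hv; rw [map_add, add_mul]; exact Submodule.add_mem _ (hp v hv) (hq v hv)
    | mul_X p l hp =>
      intro v hv
      rw [map_mul, aeval_X, mul_assoc]
      exact hp _ (hst l v hv)
  exact M.sum_mem fun k _ => key _ _ (hb k)

lemma le_range_theta {dq : Fin n → ℕ} (hdq : ∀ l, 0 < dq l)
    (hq : ∀ l, (q l).IsHomogeneous (dq l)) {b : J → MvPolynomial V ℂ} {e : J → ℕ}
    (he : ∀ k, (b k).IsHomogeneous (e k))
    (hspan : M ≤ Submodule.span ℂ (Set.range b) ⊔ powSum q M Finset.univ fun _ => 1) :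
    M ≤ LinearMap.range (theta q b) := by
  have hb' : ∀ k, b k ∈ LinearMap.range (theta q b) := fun k =>
    ⟨Finsupp.single k 1, by rw [theta_single, map_one, one_mul]⟩
  have hhom : ∀ (d : ℕ), ∀ v ∈ M, homogeneousComponent d v ∈ LinearMap.range (theta q b) := by
    intro d
    induction d using Nat.strong_induction_on with | _ d ih
    intro v hv
    obtain ⟨u, hu, w, hw, rfl⟩ := Submodule.mem_sup.1 (hspan hv)
    rw [map_add]
    refine Submodule.add_mem _ ?_ ?_
    · have h1 : Submodule.span ℂ (Set.range b) ≤
          (LinearMap.range (theta q b)).comap (homogeneousComponent d) := by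
        rw [Submodule.span_le]
        rintro _ ⟨k, rfl⟩
        change homogeneousComponent d (b k) ∈ LinearMap.range (theta q b)
        rw [homogeneousComponent_of_mem (he k)]
        split_ifs
        · exact hb' k
        · exact Submodule.zero_mem _
      exact h1 hu
    · obtain ⟨x, hx, rfl⟩ := mem_powSum.1 hw
      rw [map_sum]
      refine Submodule.sum_mem _ fun l _ => ?_
      rw [pow_one]
      by_cases hl : d < dq l
      · rw [homogeneousComponent_mul_eq_zero (hq l) _ hl]; exact Submodule.zero_mem _
      · obtain ⟨d', rfl⟩ := Nat.exists_eq_add_of_le (not_lt.1 hl)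
        rw [homogeneousComponent_mul_of_isHomogeneous (hq l)]
        obtain ⟨c, hc⟩ := ih d' (by have := hdq l; omega) (x l) (hx l)
        exact ⟨(X l : MvPolynomial (Fin n) ℂ) • c, by rw [theta_smul, aeval_X, hc]⟩
  intro v hv
  rw [← sum_homogeneousComponent v]
  exact Submodule.sum_mem _ fun d _ => hhom d v hv

/-- A graded subspace on which `q` is a regular sequence is free over the polynomials in `q`. -/
theorem exists_theta_injective (hM : Graded M) (hst : QStable q M) {dq : Fin n → ℕ}
    (hdq : ∀ l, 0 < dq l) (hq : ∀ l, (q l).IsHomogeneous (dq l))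
    (hreg : ∀ (j : Fin n), ∀ v ∈ M, q j * v ∈ powSum q M (Finset.Iio j) (fun _ => 1) →
      v ∈ powSum q M (Finset.Iio j) (fun _ => 1)) :
    ∃ (J : Type) (b : J → MvPolynomial V ℂ), Function.Injective (theta q b) ∧
      LinearMap.range (theta q b) = M := by
  classical
  obtain ⟨J, b, e, hb, he, hli, hspan⟩ := exists_homogeneous_family hM
    (powSum q M Finset.univ fun _ => 1)
  refine ⟨J, b, ?_, le_antisymm ?_ (le_range_theta hdq hq he hspan)⟩
  swap
  · rintro _ ⟨c, rfl⟩; exact theta_mem hst hb c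
  let P : ℕ → Submodule ℂ (MvPolynomial V ℂ) := fun j =>
    powSum q M (Finset.univ.filter fun l : Fin n => l.val < j) fun _ => 1
  have key : ∀ i j : ℕ, i + j = n → ∀ c : J →₀ MvPolynomial (Fin n) ℂ,
      (∀ k, ∀ α ∈ (c k).support, ∀ l : Fin n, l.val < j → α l = 0) → theta q b c ∈ P j → c = 0 := by
    intro i
    induction i with
    | zero =>
      intro j hj c hc h
      have hC : ∀ k, c k = C (coeff 0 (c k)) := fun k => by
        ext α
        rw [coeff_C]
        split_ifs with h0
        · rw [h0]
        · by_contra h1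
          exact h0 (Finsupp.ext fun l => (hc k α (mem_support_iff.2 h1) l (by omega)).symm)
      have h1 : ∑ k ∈ c.support, coeff 0 (c k) • (powSum q M Finset.univ fun _ => 1).mkQ (b k) = 0 := by
        have hP : P j = powSum q M Finset.univ fun _ => 1 := by
          simp only [P]
          congr 1
          ext l; simp; omega
        rw [hP, ← Submodule.Quotient.mk_eq_zero, ← Submodule.mkQ_apply, theta_apply, Finsupp.sum,
          map_sum] at h
        rw [← h]
        refine Finset.sum_congr rfl fun k _ => ?_
        rw [← map_smul]
        conv_rhs => rw [hC k, aeval_C, ← Algebra.smul_def]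
      ext1 k
      rw [hC k]
      by_cases hk : k ∈ c.support
      · rw [linearIndependent_iff'.1 hli c.support _ h1 k hk]; simp
      · rw [Finsupp.notMem_support_iff.1 hk]; simp
    | succ i ih =>
      intro j hj
      have hjn : j < n := by omega
      let jj : Fin n := ⟨j, hjn⟩
      have hP : P j = powSum q M (Finset.Iio jj) fun _ => 1 := by
        simp only [P]
        congr 1
        ext l; simp [jj, Fin.lt_def]
      have bnd : ∀ N : ℕ, ∀ c : J →₀ MvPolynomial (Fin n) ℂ,
          (∀ k, ∀ α ∈ (c k).support, ∀ l : Fin n, l.val < j → α l = 0) →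
          (∀ k, ∀ α ∈ (c k).support, α jj < N) → theta q b c ∈ P j → c = 0 := by
        intro N
        induction N with
        | zero =>
          intro c _ hN _
          ext1 k
          rw [Finsupp.zero_apply, ← support_eq_empty]
          exact Finset.eq_empty_of_forall_notMem fun α hα => by simpa using hN k α hα
        | succ N ihN =>
          intro c hc hN h
          let c₀ : J →₀ MvPolynomial (Fin n) ℂ :=
            c.mapRange (fun p => modMonomial p (Finsupp.single jj 1)) (by
              ext α; by_cases hle : Finsupp.single jj 1 ≤ α
              · rw [coeff_modMonomial_of_le _ hle, coeff_zero]
              · rw [coeff_modMonomial_of_not_le _ hle])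
          let c₁ : J →₀ MvPolynomial (Fin n) ℂ :=
            c.mapRange (fun p => divMonomial p (Finsupp.single jj 1)) (by simp)
          have hcc : c = (X jj : MvPolynomial (Fin n) ℂ) • c₁ + c₀ := by
            ext1 k
            exact (divMonomial_add_modMonomial_single (c k) jj).symm
          have hth : theta q b c = q jj * theta q b c₁ + theta q b c₀ := by
            conv_lhs => rw [hcc]
            rw [map_add, theta_smul, aeval_X]
          have h0 : c₀ = 0 := by
            refine ih (j + 1) (by omega) c₀ ?_ ?_
            · intro k α hα l hl
              have h2 : ¬ Finsupp.single jj 1 ≤ α := fun hle => by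
                rw [mem_support_iff] at hα
                exact hα (coeff_modMonomial_of_le (c k) hle)
              have h3 : α ∈ (c k).support := by
                rw [mem_support_iff] at hα ⊢
                rwa [← coeff_modMonomial_of_not_le (c k) h2]
              rcases Nat.lt_succ_iff_lt_or_eq.1 hl with hl | hl
              · exact hc k α h3 l hl
              · rw [Finsupp.single_le_iff] at h2
                have : l = jj := Fin.ext hl
                rw [this]; omega
            · have h4 : theta q b c₀ = theta q b c - q jj ^ 1 * theta q b c₁ := by rw [hth]; ring
              rw [h4]
              refine Submodule.sub_mem _ ?_ ?_
              · refine (biSup_mono fun l hl => ?_ : P j ≤ P (j + 1)) h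
                simp only [Finset.mem_filter, Finset.mem_univ, true_and] at hl ⊢
                omega
              · exact mem_powSum_of_mem (k := fun _ => 1) (by simp [jj]) (theta_mem hst hb c₁)
          have h1 : c₁ = 0 := by
            refine ihN c₁ ?_ ?_ ?_
            · intro k α hα l hl
              rw [mem_support_iff] at hα
              have h3 : coeff (Finsupp.single jj 1 + α) (c k) ≠ 0 := by
                rw [← coeff_divMonomial]; exact hα
              have := hc k _ (mem_support_iff.2 h3) l hl
              simp only [Finsupp.add_apply] at this
              omega
            · intro k α hα
              rw [mem_support_iff] at hα
              have h3 : coeff (Finsupp.single jj 1 + α) (c k) ≠ 0 := by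
                rw [← coeff_divMonomial]; exact hα
              have := hN k _ (mem_support_iff.2 h3)
              simp only [Finsupp.add_apply, Finsupp.single_eq_same] at this
              omega
            · rw [hP]
              refine hreg jj _ (theta_mem hst hb c₁) ?_
              rw [← hP]
              rw [hth, h0, map_zero, add_zero] at h
              exact h
          rw [hcc, h0, h1]; simp
      intro c hc h
      refine bnd (∑ k ∈ c.support, (c k).totalDegree + 1) c hc ?_ h
      intro k α hα
      by_cases hk : k ∈ c.support
      · have h1 : α jj ≤ (c k).totalDegree := by
          refine le_trans ?_ (le_totalDegree hα)
          rw [Finsupp.sum_fintype _ _ (fun _ => rfl)]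
          exact Finset.single_le_sum (f := fun i => α i) (fun _ _ => Nat.zero_le _) (Finset.mem_univ jj)
        have h2 := Finset.single_le_sum (f := fun k => (c k).totalDegree) (fun _ _ => Nat.zero_le _) hk
        omega
      · rw [Finsupp.notMem_support_iff.1 hk] at hα; simp at hα
  rw [injective_iff_map_eq_zero]
  intro c hc
  exact key n 0 (by simp) c (by simp) (by rw [hc]; exact Submodule.zero_mem _)

end

section
variable {V : Type} [Fintype V] [DecidableEq V] (w : V → ℕ)

/-- The weighted power sums. -/
def wpsum (i : ℕ) : MvPolynomial V ℂ := ∑ v, C (w v : ℂ) * X v ^ i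

lemma wpsum_isHomogeneous (i : ℕ) : (wpsum w i).IsHomogeneous i := by
  refine IsHomogeneous.sum _ _ _ fun v _ => ?_
  simpa using (isHomogeneous_C V (w v : ℂ)).mul ((isHomogeneous_X ℂ v).pow i)

/-- The ideal of the first `j` weighted power sums and the variables outside `S`. -/
def wideal (S : Finset V) (j : ℕ) : Ideal (MvPolynomial V ℂ) :=
  Ideal.span ((fun l => wpsum w (l + 1)) '' Set.Iio j ∪ X '' (Sᶜ : Set V))

variable {w}

lemma wpsum_mem_wideal (S : Finset V) {l j : ℕ} (h : l < j) : wpsum w (l + 1) ∈ wideal w S j :=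
  Ideal.subset_span (Or.inl ⟨l, h, rfl⟩)

lemma X_mem_wideal {S : Finset V} {a : V} (h : a ∉ S) (j : ℕ) : X a ∈ wideal w S j :=
  Ideal.subset_span (Or.inr ⟨a, h, rfl⟩)

lemma wideal_insert {S : Finset V} {a : V} (ha : a ∉ S) (j : ℕ) :
    wideal w S j = wideal w (insert a S) j ⊔ Ideal.span {X a} := by
  rw [wideal, wideal, ← Ideal.span_union]
  congr 1
  have : ((S : Set V)ᶜ) = ((insert a S : Finset V) : Set V)ᶜ ∪ {a} := by
    ext x; simp only [Set.mem_compl_iff, Finset.mem_coe, Finset.mem_insert, Set.mem_union, Set.mem_singleton_iff]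
    by_cases hx : x = a
    · subst hx; simp [ha]
    · simp [hx]
  rw [this, Set.image_union, Set.image_singleton, Set.union_assoc]

lemma wideal_succ (S : Finset V) (j : ℕ) :
    wideal w S (j + 1) = wideal w S j ⊔ Ideal.span {wpsum w (j + 1)} := by
  rw [wideal, wideal, ← Ideal.span_union]
  congr 1
  have : Set.Iio (j + 1) = Set.Iio j ∪ {j} := by ext x; simp [le_iff_lt_or_eq]
  rw [this, Set.image_union, Set.image_singleton]
  exact Set.union_right_comm _ _ _

lemma graded_span {B : Set (MvPolynomial V ℂ)} (hB : ∀ f ∈ B, ∃ d, f.IsHomogeneous d) :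
    Graded ((Ideal.span B).restrictScalars ℂ) := by
  intro f hf d
  rw [Submodule.restrictScalars_mem] at hf ⊢
  have h1 : ∀ g ∈ B, ∀ a : MvPolynomial V ℂ, homogeneousComponent d (a * g) ∈ Ideal.span B := by
    intro g hg a
    obtain ⟨e, he⟩ := hB g hg
    rw [mul_comm]
    by_cases h : d < e
    · rw [homogeneousComponent_mul_eq_zero he _ h]; exact Submodule.zero_mem _
    · obtain ⟨d', rfl⟩ := Nat.exists_eq_add_of_le (not_lt.1 h)
      rw [homogeneousComponent_mul_of_isHomogeneous he]
      exact Ideal.mul_mem_right _ _ (Ideal.subset_span hg)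
  obtain ⟨n, a, g, rfl⟩ := Submodule.mem_span_set'.1 hf
  rw [map_sum]
  exact Ideal.sum_mem _ fun i _ => h1 _ (g i).2 _

lemma graded_wideal (S : Finset V) (j : ℕ) : Graded ((wideal w S j).restrictScalars ℂ) := by
  apply graded_span
  rintro _ (⟨l, _, rfl⟩ | ⟨a, _, rfl⟩)
  · exact ⟨_, wpsum_isHomogeneous _ _⟩
  · exact ⟨1, isHomogeneous_X ℂ a⟩

lemma mem_of_forall_pow {I : Ideal (MvPolynomial V ℂ)} (hI : Graded (I.restrictScalars ℂ)) {a : V}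
    {v : MvPolynomial V ℂ} (h : ∀ K : ℕ, ∃ x, v - X a ^ K * x ∈ I) : v ∈ I := by
  obtain ⟨x, hx⟩ := h (v.totalDegree + 1)
  rw [← sum_homogeneousComponent v]
  refine Ideal.sum_mem _ fun d hd => ?_
  have h1 := hI _ hx d
  rw [map_sub, homogeneousComponent_mul_eq_zero ((isHomogeneous_X ℂ a).pow _) _
    (by rw [one_mul]; exact Finset.mem_range.1 hd), sub_zero] at h1
  exact h1

lemma eq_zero_of_wpsum (hw : ∀ v, 0 < w v) (S : Finset V) {p : V → ℂ} (hp : ∀ a ∉ S, p a = 0)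
    (h : ∀ l < S.card, eval p (wpsum w (l + 1)) = 0) (a : V) : p a = 0 := by
  by_contra ha
  set D := (S.image p).erase (p a)
  have haS : a ∈ S := by by_contra h; exact ha (hp a h)
  have hD : D.card + 1 ≤ S.card := by
    rw [Finset.card_erase_add_one (Finset.mem_image_of_mem _ haS)]
    exact Finset.card_image_le
  let g : Polynomial ℂ := ∏ d ∈ D, (Polynomial.X - Polynomial.C d)
  have hg : g.natDegree = D.card := Polynomial.natDegree_finsetProd_X_sub_C_eq_card D id
  have h1 : ∑ v, (w v : ℂ) * (p v * g.eval (p v)) = 0 := by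
    have h2 : ∀ l ∈ Finset.range (g.natDegree + 1), g.coeff l * eval p (wpsum w (l + 1)) = 0 := by
      intro l hl
      rw [h l (by rw [Finset.mem_range] at hl; omega), mul_zero]
    have h3 := Finset.sum_eq_zero h2
    rw [← h3]
    simp only [wpsum, map_sum, map_mul, eval_C, map_pow, eval_X, Finset.mul_sum]
    rw [Finset.sum_comm]
    refine Finset.sum_congr rfl fun v _ => ?_
    rw [Polynomial.eval_eq_sum_range, Finset.mul_sum, Finset.mul_sum]
    exact Finset.sum_congr rfl fun l _ => by ring
  have h2 : ∀ v, (w v : ℂ) * (p v * g.eval (p v)) = 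
      if p v = p a then (w v : ℂ) * (p a * g.eval (p a)) else 0 := by
    intro v
    split_ifs with hv
    · rw [hv]
    · by_cases hvS : v ∈ S
      · have : g.eval (p v) = 0 := by
          rw [Polynomial.eval_prod]
          refine Finset.prod_eq_zero (Finset.mem_erase.2 ⟨hv, Finset.mem_image_of_mem _ hvS⟩) (by simp)
        rw [this, mul_zero, mul_zero]
      · rw [hp v hvS, zero_mul, mul_zero]
  rw [Finset.sum_congr rfl fun v _ => h2 v, ← Finset.sum_filter, ← Finset.sum_mul] at h1
  rcases mul_eq_zero.1 h1 with h1 | h1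
  · rw [← Nat.cast_sum, Nat.cast_eq_zero, Finset.sum_eq_zero_iff] at h1
    have := h1 a (by simp)
    have := hw a
    omega
  · rcases mul_eq_zero.1 h1 with h1 | h1
    · exact ha h1
    · rw [Polynomial.eval_prod, Finset.prod_eq_zero_iff] at h1
      obtain ⟨d, hd, h1⟩ := h1
      simp only [Polynomial.eval_sub, Polynomial.eval_X, Polynomial.eval_C] at h1
      exact (Finset.mem_erase.1 hd).1 (sub_eq_zero.1 h1).symm

lemma exists_X_pow_mem_wideal (hw : ∀ v, 0 < w v) (S : Finset V) (a : V) :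
    ∃ e : ℕ, X a ^ e ∈ wideal w S S.card := by
  change X a ∈ (wideal w S S.card).radical
  rw [← vanishingIdeal_zeroLocus_eq_radical (k := ℂ) (K := ℂ), mem_vanishingIdeal_iff]
  intro p hp
  rw [mem_zeroLocus_iff] at hp
  rw [aeval_X]
  refine eq_zero_of_wpsum hw S (fun b hb => ?_) (fun l hl => ?_) a
  · simpa using hp _ (X_mem_wideal hb _)
  · simpa [aeval_def, coe_aeval_eq_eval] using hp _ (wpsum_mem_wideal S hl)

lemma mem_sup_span {I : Ideal (MvPolynomial V ℂ)} {f v : MvPolynomial V ℂ} :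
    v ∈ I ⊔ Ideal.span {f} ↔ ∃ h, v - f * h ∈ I := by
  rw [sup_comm, Ideal.mem_span_singleton_sup]
  constructor
  · rintro ⟨h, y, hy, rfl⟩; exact ⟨h, by ring_nf; exact hy⟩
  · rintro ⟨h, hh⟩; exact ⟨h, _, hh, by ring⟩

lemma wpsum_regular (hw : ∀ v, 0 < w v) (S : Finset V) : ∀ j < S.card, ∀ v : MvPolynomial V ℂ,
    wpsum w (j + 1) * v ∈ wideal w S j → v ∈ wideal w S j := by
  induction S using Finset.induction_on with
  | empty => intro j hj; simp at hj
  | insert a S ha ih =>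
    have hX : ∀ j ≤ S.card, ∀ v : MvPolynomial V ℂ, X a * v ∈ wideal w (insert a S) j →
        v ∈ wideal w (insert a S) j := by
      intro j
      induction j with
      | zero =>
        intro _ v hv
        have h0 : wideal w (insert a S) 0 =
            Ideal.span ((fun l => (X l ^ 1 : MvPolynomial V ℂ)) '' ((insert a S)ᶜ : Finset V)) := by
          have : Set.Iio 0 = (∅ : Set ℕ) := by ext; simp
          rw [wideal, this, Set.image_empty, Set.empty_union, Finset.coe_compl]
          simp only [pow_one]
        rw [h0] at hv ⊢
        exact mem_monomial_of_X_mul (k := fun _ => 1) (by simp) hv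
      | succ j ihj =>
        intro hj v hv
        rw [wideal_succ, mem_sup_span] at hv ⊢
        obtain ⟨h, hh⟩ := hv
        have h1 : wpsum w (j + 1) * h ∈ wideal w S j := by
          have : wpsum w (j + 1) * h = X a * v - (X a * v - wpsum w (j + 1) * h) := by ring
          rw [this]
          refine sub_mem (Ideal.mul_mem_right _ _ (X_mem_wideal ha j)) ?_
          rw [wideal_insert ha]; exact Ideal.mem_sup_left hh
        have h2 := ih j (by omega) h h1
        rw [wideal_insert ha, mem_sup_span] at h2
        obtain ⟨h', hh'⟩ := h2
        refine ⟨h', ihj (by omega) _ ?_⟩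
        have : X a * (v - wpsum w (j + 1) * h') = (X a * v - wpsum w (j + 1) * h) +
          wpsum w (j + 1) * (h - X a * h') := by ring
        rw [this]
        exact add_mem hh (Ideal.mul_mem_left _ _ hh')
    intro j hj v hv
    rw [Finset.card_insert_of_notMem ha] at hj
    rcases Nat.lt_succ_iff_lt_or_eq.1 hj with hj | rfl
    · refine mem_of_forall_pow (a := a) (graded_wideal _ _) fun K => ?_
      suffices ∃ x, v - X a ^ K * x ∈ wideal w (insert a S) j ∧
          wpsum w (j + 1) * x ∈ wideal w (insert a S) j by
        obtain ⟨x, hx, _⟩ := this; exact ⟨x, hx⟩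
      induction K with
      | zero => exact ⟨v, by simp, hv⟩
      | succ K ihK =>
        obtain ⟨x, hx, hqx⟩ := ihK
        have h1 := ih j hj x (by rw [wideal_insert ha]; exact Ideal.mem_sup_left hqx)
        rw [wideal_insert ha, mem_sup_span] at h1
        obtain ⟨y, hy⟩ := h1
        refine ⟨y, ?_, hX j hj.le _ ?_⟩
        · have : v - X a ^ (K + 1) * y = (v - X a ^ K * x) + X a ^ K * (x - X a * y) := by ring
          rw [this]
          exact add_mem hx (Ideal.mul_mem_left _ _ hy)
        · have : X a * (wpsum w (j + 1) * y) = wpsum w (j + 1) * x -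
            wpsum w (j + 1) * (x - X a * y) := by ring
          rw [this]
          exact sub_mem hqx (Ideal.mul_mem_left _ _ hy)
    · obtain ⟨e, he⟩ := exists_X_pow_mem_wideal hw (insert a S) a
      rw [Finset.card_insert_of_notMem ha, wideal_succ, mem_sup_span] at he
      obtain ⟨h, hh⟩ := he
      have h1 : X a ^ e * v ∈ wideal w (insert a S) S.card := by
        have : X a ^ e * v = v * (X a ^ e - wpsum w (S.card + 1) * h) +
          h * (wpsum w (S.card + 1) * v) := by ring
        rw [this]
        exact add_mem (Ideal.mul_mem_left _ _ hh) (Ideal.mul_mem_left _ _ hv)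
      clear hh
      induction e with
      | zero => simpa using h1
      | succ e ihe =>
        refine ihe (hX _ le_rfl _ ?_)
        rw [← mul_assoc, ← pow_succ']; exact h1

end

section
variable {V : Type} [Fintype V] [DecidableEq V] {w : V → ℕ}

variable (w) in
/-- The first weighted power sums, as many as there are variables. -/
def wp (l : Fin (Fintype.card V)) : MvPolynomial V ℂ := wpsum w (l + 1)

lemma powSum_top_eq_wideal (j : ℕ) :
    powSum (wp w) ⊤ (Finset.univ.filter fun l => l.val < j) (fun _ => 1) ≤
      (wideal w Finset.univ j).restrictScalars ℂ := by
  intro v hv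
  obtain ⟨u, -, rfl⟩ := mem_powSum.1 hv
  rw [Submodule.restrictScalars_mem]
  refine Ideal.sum_mem _ fun l hl => Ideal.mul_mem_right _ _ ?_
  rw [pow_one]
  exact wpsum_mem_wideal _ (Finset.mem_filter.1 hl).2

lemma wideal_le_powSum_top {j : ℕ} (hj : j ≤ Fintype.card V) : 
    (wideal w Finset.univ j).restrictScalars ℂ ≤
      powSum (wp w) ⊤ (Finset.univ.filter fun l => l.val < j) (fun _ => 1) := by
  intro v hv
  rw [Submodule.restrictScalars_mem] at hv
  obtain ⟨n, a, g, rfl⟩ := Submodule.mem_span_set'.1 hv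
  refine Submodule.sum_mem _ fun i _ => ?_
  rcases (g i).2 with ⟨l, hl, h⟩ | ⟨a, ha, -⟩
  · rw [← h, smul_eq_mul, mul_comm]
    have hl : l < j := hl
    have := mem_powSum_of_mem (q := wp w) (M := ⊤) (k := fun _ => 1)
      (S := Finset.univ.filter fun l => l.val < j) (l := ⟨l, by omega⟩) (u := a i) (by simpa using hl) trivial
    simpa [wp] using this
  · simp at ha

lemma qStable_top {ι : Type} {W : Type} [CommRing W] [Algebra ℂ W] (q : ι → W) :
    QStable q (⊤ : Submodule ℂ W) := fun _ _ _ => trivial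

theorem powReg_wp_top (hw : ∀ v, 0 < w v) : PowReg (wp w) ⊤ := by
  obtain ⟨J, b, hinj, hr⟩ := exists_theta_injective (M := (⊤ : Submodule ℂ (MvPolynomial V ℂ)))
    (q := wp w) (fun _ _ _ => trivial) (qStable_top _) (dq := fun l => l + 1)
    (fun _ => Nat.succ_pos _) (fun l => wpsum_isHomogeneous w _) (by
      intro j v _ hv
      have h0 : Finset.Iio j = Finset.univ.filter fun l => l.val < j.val := by ext; simp
      rw [h0] at hv ⊢
      refine wideal_le_powSum_top j.2.le ?_
      exact wpsum_regular hw _ j.val (by simp) v (powSum_top_eq_wideal _ hv))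
  exact powReg_of_theta (qStable_top _) hinj hr

lemma exists_finite_theta (hw : ∀ v, 0 < w v) : ∃ (J : Type) (_ : Finite J)
    (b : J → MvPolynomial V ℂ), LinearMap.range (theta (wp w) b) = ⊤ := by
  choose e he using exists_X_pow_mem_wideal hw Finset.univ
  let b : (∀ a : V, Fin (e a)) → MvPolynomial V ℂ := fun k => ∏ a, X a ^ (k a).val
  refine ⟨∀ a : V, Fin (e a), inferInstance, b, top_le_iff.1 ?_⟩
  refine le_range_theta (dq := fun l => l + 1) (fun _ => Nat.succ_pos _)
    (fun l => wpsum_isHomogeneous w _) (e := fun k => ∑ a, (k a).val) (fun k => ?_) ?_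
  · exact IsHomogeneous.prod _ _ _ fun a _ => by simpa using (isHomogeneous_X ℂ a).pow (k a).val
  · intro f _
    rw [f.as_sum]
    refine Submodule.sum_mem _ fun α _ => ?_
    rw [← mul_one (coeff α f), ← smul_eq_mul, ← smul_monomial]
    refine Submodule.smul_mem _ _ ?_
    rw [monomial_eq, C_1, one_mul, Finsupp.prod_fintype _ _ (fun _ => pow_zero _)]
    by_cases h : ∀ a, α a < e a
    · exact Submodule.mem_sup_left (Submodule.subset_span ⟨fun a => ⟨α a, h a⟩, rfl⟩)
    · push Not at h
      obtain ⟨a, ha⟩ := h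
      refine Submodule.mem_sup_right ?_
      have h1 : (∏ a, X a ^ α a : MvPolynomial V ℂ) ∈ wideal w Finset.univ (Finset.univ : Finset V).card := by
        rw [← Finset.prod_erase_mul _ _ (Finset.mem_univ a), ← Nat.sub_add_cancel ha, pow_add]
        exact Ideal.mul_mem_left _ _ (Ideal.mul_mem_left _ _ (he a))
      have h2 := wideal_le_powSum_top (by simp) h1
      have h3 : (Finset.univ.filter fun l : Fin (Fintype.card V) => l.val < (Finset.univ : Finset V).card) =
        Finset.univ := by ext; simp
      rwa [h3] at h2

lemma finite_adjoin_wp (hw : ∀ v, 0 < w v) :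
    Module.Finite (Algebra.adjoin ℂ (Set.range (wp w))) (MvPolynomial V ℂ) := by
  obtain ⟨J, _, b, hb⟩ := exists_finite_theta hw
  refine ⟨Submodule.fg_def.2 ⟨Set.range b, Set.finite_range b, top_le_iff.1 fun f _ => ?_⟩⟩
  have hf : f ∈ LinearMap.range (theta (wp w) b) := by rw [hb]; trivial
  obtain ⟨c, rfl⟩ := hf
  rw [theta_apply]
  refine Submodule.sum_mem _ fun k _ => ?_
  have h1 : aeval (wp w) (c k) ∈ Algebra.adjoin ℂ (Set.range (wp w)) := by
    rw [Algebra.adjoin_range_eq_range_aeval]; exact ⟨_, rfl⟩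
  exact Submodule.smul_mem _ (⟨_, h1⟩ : Algebra.adjoin ℂ (Set.range (wp w))) (Submodule.subset_span ⟨k, rfl⟩)

lemma isIntegral_wp (hw : ∀ v, 0 < w v) (f : MvPolynomial V ℂ) :
    IsIntegral (Algebra.adjoin ℂ (Set.range (wp w))) f :=
  have := finite_adjoin_wp hw
  Algebra.IsIntegral.isIntegral f

lemma wp_sub_ne_zero [Nonempty V] (hw : ∀ v, 0 < w v) (l : Fin (Fintype.card V)) (z : ℂ) :
    wp w l - C z ≠ 0 := by
  intro h
  obtain ⟨a⟩ := ‹Nonempty V›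
  have h1 := congrArg (coeff (Finsupp.single a (l.val + 1))) h
  rw [coeff_sub, coeff_C, if_neg (by intro h; simpa using DFunLike.congr_fun h a), sub_zero, coeff_zero,
    wp, wpsum, coeff_sum, Finset.sum_eq_single a] at h1
  · rw [coeff_C_mul, coeff_X_pow, if_pos rfl, mul_one, Nat.cast_eq_zero] at h1
    have := hw a
    omega
  · intro b _ hb
    rw [coeff_C_mul, coeff_X_pow, if_neg, mul_zero]
    intro h
    have := DFunLike.congr_fun h a
    simp [hb] at this
  · simp

end

section
variable {ι W W' : Type} [DecidableEq ι] [CommRing W] [Algebra ℂ W] [CommRing W'] [Algebra ℂ W']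
  {q : ι → W} {M : Submodule ℂ W} (g : W →ₐ[ℂ] W')

lemma QStable.map (h : QStable q M) : QStable (fun l => g (q l)) (M.map g.toLinearMap) := by
  rintro l _ ⟨v, hv, rfl⟩
  exact ⟨_, h l v hv, by simp⟩

lemma PowReg.map (hg : Function.Injective g) (h : PowReg q M) :
    PowReg (fun l => g (q l)) (M.map g.toLinearMap) := by
  have h1 : ∀ S k, powSum (fun l => g (q l)) (M.map g.toLinearMap) S k =
      (powSum q M S k).map g.toLinearMap := by
    intro S k
    rw [powSum, powSum, Submodule.map_iSup]
    refine iSup_congr fun l => ?_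
    rw [Submodule.map_iSup]
    refine iSup_congr fun _ => ?_
    rw [← Submodule.map_comp, ← Submodule.map_comp]
    congr 1
    ext v; simp
  rintro S k j hj _ ⟨v, hv, rfl⟩ hjv
  rw [h1] at hjv ⊢
  obtain ⟨u, hu, huv⟩ := hjv
  have : u = q j * v := hg (by simpa using huv)
  exact ⟨v, h S k j hj v hv (this ▸ hu), rfl⟩

end

section field
variable {V K : Type} [Field K] [Algebra (MvPolynomial V ℂ) K] [IsFractionRing (MvPolynomial V ℂ) K]
  [Algebra ℂ K] [IsScalarTower ℂ (MvPolynomial V ℂ) K]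

variable (K) in
/-- Embedding of polynomials into the field of rational functions. -/
def jK : MvPolynomial V ℂ →ₐ[ℂ] K := IsScalarTower.toAlgHom ℂ (MvPolynomial V ℂ) K

variable (V K) in
/-- The variables as rational functions. -/
def uK (v : V) : K := jK K (X v)

lemma jK_injective : Function.Injective (jK K : MvPolynomial V ℂ → K) :=
  IsFractionRing.injective (MvPolynomial V ℂ) K

lemma jK_ne_zero {f : MvPolynomial V ℂ} (hf : f ≠ 0) : jK K f ≠ 0 := fun h =>
  hf (jK_injective (h.trans (map_zero (jK K)).symm))

variable (V) in
lemma exists_frac (x : K) : ∃ a b : MvPolynomial V ℂ, b ≠ 0 ∧ x = jK K a / jK K b := by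
  obtain ⟨a, b, hb, h⟩ := IsFractionRing.div_surjective (A := MvPolynomial V ℂ) x
  exact ⟨a, b, nonZeroDivisors.ne_zero hb, h.symm⟩

lemma uK_sub_ne_zero {a b : V} (h : a ≠ b) : uK V K a - uK V K b ≠ 0 := by
  rw [uK, uK, ← map_sub]
  exact jK_ne_zero (sub_ne_zero.2 fun e => h (X_injective e))

variable (K) in
lemma exists_derivation (v : V) : ∃ D : Derivation ℂ K K, ∀ f, D (jK K f) = jK K (pderiv v f) := by
  let φ : MvPolynomial V ℂ →+* DualNumber K :=
    { toFun := fun f => (jK K f, jK K (pderiv v f))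
      map_one' := by
        apply TrivSqZeroExt.ext
        · change jK K 1 = 1; simp
        · change jK K (pderiv v 1) = 0; simp
      map_mul' := fun f g => by
        apply TrivSqZeroExt.ext
        · change jK K (f * g) = jK K f * jK K g; simp
        · change jK K (pderiv v (f * g)) = jK K f * jK K (pderiv v g) + jK K (pderiv v f) * jK K g
          simp [mul_comm]
      map_zero' := by
        apply TrivSqZeroExt.ext
        · change jK K 0 = 0; simp
        · change jK K (pderiv v 0) = 0; simp
      map_add' := fun f g => by
        apply TrivSqZeroExt.ext
        · change jK K (f + g) = jK K f + jK K g; simp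
        · change jK K (pderiv v (f + g)) = jK K (pderiv v f) + jK K (pderiv v g); simp }
  have hu : ∀ y : nonZeroDivisors (MvPolynomial V ℂ), IsUnit (φ y) := fun y => by
    rw [TrivSqZeroExt.isUnit_iff_isUnit_fst]
    exact (jK_ne_zero (nonZeroDivisors.ne_zero y.2)).isUnit
  let L : K →+* DualNumber K := IsLocalization.lift (M := nonZeroDivisors (MvPolynomial V ℂ)) hu
  have hL : ∀ f, L (jK K f) = φ f := fun f => IsLocalization.lift_eq hu f
  have hfst : ∀ x, (L x).fst = x := by
    have : (TrivSqZeroExt.fstHom K K K).toRingHom.comp L = RingHom.id K := by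
      refine IsLocalization.ringHom_ext (nonZeroDivisors (MvPolynomial V ℂ)) (RingHom.ext fun f => ?_)
      change (L (jK K f)).fst = jK K f
      rw [hL]; rfl
    exact fun x => congrArg (fun g : K →+* K => g x) this
  have hmul : ∀ x y, (L (x * y)).snd = x * (L y).snd + y * (L x).snd := fun x y => by
    rw [map_mul, TrivSqZeroExt.snd_mul, hfst, hfst, op_smul_eq_smul]; rfl
  have hC : ∀ z : ℂ, (L (algebraMap ℂ K z)).snd = 0 := fun z => by
    have : algebraMap ℂ K z = jK K (C z : MvPolynomial V ℂ) := by
      rw [← algebraMap_eq, AlgHom.commutes]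
    rw [this, hL]
    change jK K (pderiv v (C z)) = 0
    simp
  refine ⟨⟨⟨⟨fun x => (L x).snd, fun x y => by rw [map_add]; rfl⟩, fun z x => ?_⟩, ?_, ?_⟩, ?_⟩
  · change (L (z • x)).snd = z • (L x).snd
    rw [Algebra.smul_def, hmul, hC, mul_zero, add_zero, ← Algebra.smul_def]
  · change (L 1).snd = 0
    rw [map_one]; rfl
  · exact hmul
  · intro f
    change (L (jK K f)).snd = _
    rw [hL]; rfl

variable (K) in
/-- Partial derivatives of rational functions. -/
def dK (v : V) : Derivation ℂ K K := (exists_derivation K v).choose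

lemma dK_jK (v : V) (f : MvPolynomial V ℂ) : dK K v (jK K f) = jK K (pderiv v f) :=
  (exists_derivation K v).choose_spec f

lemma dK_uK_self (v : V) : dK K v (uK V K v) = 1 := by
  rw [uK, dK_jK]; simp

lemma dK_uK_ne {v w : V} (h : v ≠ w) : dK K v (uK V K w) = 0 := by
  rw [uK, dK_jK, pderiv_X_of_ne h.symm, map_zero]

lemma derivation_ext {D D' : Derivation ℂ K K} (h : ∀ f : MvPolynomial V ℂ, D (jK K f) = D' (jK K f)) :
    D = D' := by
  ext x
  obtain ⟨a, b, hb, rfl⟩ := exists_frac V x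
  rw [Derivation.leibniz_div, Derivation.leibniz_div, h, h]

lemma pderiv_comm (v w : V) (f : MvPolynomial V ℂ) :
    pderiv v (pderiv w f) = pderiv w (pderiv v f) := by
  classical
  have : ⁅pderiv (R := ℂ) v, pderiv (R := ℂ) w⁆ = 0 := by
    refine MvPolynomial.derivation_ext fun i => ?_
    rw [Derivation.commutator_apply, pderiv_X, pderiv_X]
    simp only [Pi.single_apply]
    split_ifs <;> simp
  rw [← sub_eq_zero, ← Derivation.commutator_apply, this]; rfl

lemma dK_comm (v w : V) (x : K) : dK K v (dK K w x) = dK K w (dK K v x) := by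
  have : ⁅dK K v, dK K w⁆ = (0 : Derivation ℂ K K) := derivation_ext (V := V) fun f => by
    rw [Derivation.commutator_apply, dK_jK, dK_jK, dK_jK, dK_jK, pderiv_comm, sub_self]; rfl
  rw [← sub_eq_zero, ← Derivation.commutator_apply, this]; rfl

variable (K) in
/-- Permutations of the variables acting on rational functions. -/
def sK (σ : Perm V) : K ≃ₐ[ℂ] K :=
  IsFractionRing.algEquivOfAlgEquiv (R := ℂ) (A := MvPolynomial V ℂ) (B := MvPolynomial V ℂ)
    (renameEquiv ℂ σ)

lemma sK_jK (σ : Perm V) (f : MvPolynomial V ℂ) : sK K σ (jK K f) = jK K (rename σ f) := 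
  IsFractionRing.algEquivOfAlgEquiv_algebraMap _ f

lemma sK_uK (σ : Perm V) (v : V) : sK K σ (uK V K v) = uK V K (σ v) := by
  rw [uK, sK_jK, rename_X]; rfl

lemma sK_mul (σ τ : Perm V) (x : K) : sK K (σ * τ) x = sK K σ (sK K τ x) := by
  obtain ⟨a, b, hb, rfl⟩ := exists_frac V x
  simp only [map_div₀, sK_jK, rename_rename]
  rfl

lemma sK_one (x : K) : sK K (1 : Perm V) x = x := by
  obtain ⟨a, b, hb, rfl⟩ := exists_frac V x
  simp only [map_div₀, sK_jK, Perm.coe_one, rename_id_apply]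

lemma sK_dK (σ : Perm V) (v : V) (x : K) : sK K σ (dK K v x) = dK K (σ v) (sK K σ x) := by
  obtain ⟨a, b, hb, rfl⟩ := exists_frac V x
  have hp : ∀ f : MvPolynomial V ℂ, rename σ (pderiv v f) = pderiv (σ v) (rename σ f) := fun f =>
    (pderiv_rename σ.injective v f).symm
  rw [Derivation.leibniz_div, map_div₀, Derivation.leibniz_div]
  simp only [sK_jK, dK_jK, hp, map_pow, map_sub, smul_eq_mul, map_mul, map_inv₀]

lemma charZero_K : CharZero K := charZero_of_injective_algebraMap (algebraMap ℂ K).injective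

end field

section loc
variable {V K : Type} [DecidableEq V] [Field K] [Algebra (MvPolynomial V ℂ) K]
  [IsFractionRing (MvPolynomial V ℂ) K] [Algebra ℂ K] [IsScalarTower ℂ (MvPolynomial V ℂ) K]

/-- The substitution `X a ↦ X b`. -/
def subst (a b : V) : MvPolynomial V ℂ →ₐ[ℂ] MvPolynomial V ℂ := rename (Function.update id a b)

lemma dvd_sub_subst (a b : V) (f : MvPolynomial V ℂ) : X a - X b ∣ f - subst a b f := by
  induction f using MvPolynomial.induction_on with
  | C z => simp [subst]
  | add p q hp hq =>
    rw [map_add, add_sub_add_comm]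
    exact dvd_add hp hq
  | mul_X p v hp =>
    have h1 : (X a - X b : MvPolynomial V ℂ) ∣ X v - subst a b (X v) := by
      rw [subst, rename_X]
      by_cases h : v = a
      · subst h; simp
      · simp [h]
    rw [map_mul, show p * X v - subst a b p * subst a b (X v) =
      (p - subst a b p) * X v + subst a b p * (X v - subst a b (X v)) by ring]
    exact dvd_add (hp.mul_right _) (h1.mul_left _)

lemma subst_eq_zero_iff {a b : V} {f : MvPolynomial V ℂ} : subst a b f = 0 ↔ X a - X b ∣ f := by
  constructor
  · intro h
    simpa [h] using dvd_sub_subst a b f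
  · rintro ⟨g, rfl⟩
    rw [map_mul, map_sub]
    have : subst a b (X a) = subst a b (X b) := by
      rw [subst, rename_X, rename_X]
      by_cases h : b = a
      · rw [h]
      · simp [h]
    rw [this, sub_self, zero_mul]

lemma subst_swap (a b : V) (f : MvPolynomial V ℂ) : subst a b (rename (swap a b) f) = subst a b f := by
  rw [subst, rename_rename]
  congr 2
  funext v
  by_cases h : v = a
  · subst h; by_cases h' : b = v <;> simp [h']
  · by_cases h' : v = b
    · subst h'; simp [h]
    · simp [swap_apply_of_ne_of_ne h h', h]

lemma subst_ne_zero {a b e f : V} (hef : e ≠ f) (h1 : ¬(e = a ∧ f = b)) (h2 : ¬(e = b ∧ f = a)) :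
    subst a b (X e - X f) ≠ 0 := by
  rw [map_sub, subst, rename_X, rename_X]
  refine sub_ne_zero.2 fun h => ?_
  have := X_injective h
  simp only [Function.update_apply, id] at this
  split_ifs at this <;> simp_all

variable (K) in
/-- Rational functions regular along the generic point of `u_a = u_b`. -/
def loc (a b : V) : Subalgebra ℂ K where
  carrier := {x | ∃ p q : MvPolynomial V ℂ, subst a b q ≠ 0 ∧ x * jK K q = jK K p}
  mul_mem' := by
    rintro x y ⟨p, q, hq, h⟩ ⟨p', q', hq', h'⟩
    refine ⟨p * p', q * q', by rw [map_mul]; exact mul_ne_zero hq hq', ?_⟩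
    rw [map_mul, map_mul, ← h, ← h']; ring
  add_mem' := by
    rintro x y ⟨p, q, hq, h⟩ ⟨p', q', hq', h'⟩
    refine ⟨p * q' + p' * q, q * q', by rw [map_mul]; exact mul_ne_zero hq hq', ?_⟩
    rw [map_add, map_mul, map_mul, map_mul, ← h, ← h']; ring
  algebraMap_mem' z := ⟨C z, 1, by simp, by rw [map_one, mul_one, ← algebraMap_eq, AlgHom.commutes]⟩

variable (K) in
/-- `t ^ n O` where `t = u_a - u_b` and `O = loc a b`. -/
def TO (a b : V) (n : ℕ) : Submodule ℂ K :=
  (Subalgebra.toSubmodule (loc K a b)).map (LinearMap.mulLeft ℂ ((uK V K a - uK V K b) ^ n))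

variable {a b : V}

lemma mem_TO {n : ℕ} {x : K} : x ∈ TO K a b n ↔ ∃ c ∈ loc K a b, x = (uK V K a - uK V K b) ^ n * c :=
  ⟨fun ⟨c, hc, h⟩ => ⟨c, hc, h.symm⟩, fun ⟨c, hc, h⟩ => ⟨c, hc, h.symm⟩⟩

lemma mul_TO {n : ℕ} {x y : K} (hx : x ∈ loc K a b) (hy : y ∈ TO K a b n) : x * y ∈ TO K a b n := by
  obtain ⟨c, hc, rfl⟩ := mem_TO.1 hy
  exact mem_TO.2 ⟨x * c, mul_mem hx hc, by ring⟩

lemma TO_mul {n : ℕ} {x y : K} (hx : x ∈ TO K a b n) (hy : y ∈ loc K a b) : x * y ∈ TO K a b n := by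
  rw [mul_comm]; exact mul_TO hy hx

lemma jK_mem_loc (f : MvPolynomial V ℂ) : jK K f ∈ loc K a b := ⟨f, 1, by simp, by simp⟩

lemma uK_mem_loc (v : V) : uK V K v ∈ loc K a b := jK_mem_loc _

lemma t_mem_loc : uK V K a - uK V K b ∈ loc K a b := sub_mem (uK_mem_loc a) (uK_mem_loc b)

lemma TO_zero {x : K} : x ∈ TO K a b 0 ↔ x ∈ loc K a b := by
  rw [mem_TO]; simp

lemma TO_mul_TO {n k : ℕ} {x y : K} (hx : x ∈ TO K a b n) (hy : y ∈ TO K a b k) :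
    x * y ∈ TO K a b (n + k) := by
  obtain ⟨c, hc, rfl⟩ := mem_TO.1 hx
  obtain ⟨d, hd, rfl⟩ := mem_TO.1 hy
  exact mem_TO.2 ⟨c * d, mul_mem hc hd, by rw [pow_add]; ring⟩

lemma pow_mul_TO {n k : ℕ} {x : K} (hx : x ∈ TO K a b n) :
    (uK V K a - uK V K b) ^ k * x ∈ TO K a b (k + n) :=
  TO_mul_TO (mem_TO.2 ⟨1, one_mem _, by ring⟩) hx

lemma t_mul_TO {x : K} (hx : x ∈ loc K a b) : (uK V K a - uK V K b) * x ∈ TO K a b 1 :=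
  mem_TO.2 ⟨x, hx, by rw [pow_one]⟩

lemma TO_anti {n k : ℕ} (h : k ≤ n) {x : K} (hx : x ∈ TO K a b n) : x ∈ TO K a b k := by
  obtain ⟨d, rfl⟩ := Nat.exists_eq_add_of_le h
  obtain ⟨c, hc, rfl⟩ := mem_TO.1 hx
  exact mem_TO.2 ⟨_, mul_mem (pow_mem t_mem_loc d) hc, by rw [pow_add]; ring⟩

lemma TO_le_loc {n : ℕ} {x : K} (hx : x ∈ TO K a b n) : x ∈ loc K a b :=
  TO_zero.1 (TO_anti (Nat.zero_le n) hx)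

lemma mem_TO_of_pow_mul (h : a ≠ b) {n k : ℕ} {x : K}
    (hx : (uK V K a - uK V K b) ^ k * x ∈ TO K a b (k + n)) : x ∈ TO K a b n := by
  obtain ⟨c, hc, h'⟩ := mem_TO.1 hx
  refine mem_TO.2 ⟨c, hc, mul_left_cancel₀ (pow_ne_zero k (uK_sub_ne_zero h)) ?_⟩
  rw [h', pow_add]; ring

lemma dK_mem_loc (v : V) {x : K} (hx : x ∈ loc K a b) : dK K v x ∈ loc K a b := by
  obtain ⟨p, q, hq, h⟩ := hx
  refine ⟨pderiv v p * q - p * pderiv v q, q * q, by rw [map_mul]; exact mul_ne_zero hq hq, ?_⟩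
  have h1 := congrArg (dK K v) h
  rw [Derivation.leibniz, dK_jK, dK_jK, smul_eq_mul, smul_eq_mul] at h1
  rw [map_sub, map_mul, map_mul, map_mul, ← h1, ← h]; ring

lemma inv_mem_loc {f : MvPolynomial V ℂ} (hf : subst a b f ≠ 0) : (jK K f)⁻¹ ∈ loc K a b :=
  ⟨1, f, hf, by
    rw [map_one, inv_mul_cancel₀ (jK_ne_zero fun h => hf (by rw [h, map_zero]))]⟩

lemma inv_sub_mem_loc {e f : V} (h1 : ¬(e = a ∧ f = b)) (h2 : ¬(e = b ∧ f = a)) :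
    (uK V K e - uK V K f)⁻¹ ∈ loc K a b := by
  by_cases hef : e = f
  · rw [hef, sub_self, inv_zero]; exact zero_mem _
  · rw [uK, uK, ← map_sub]
    exact inv_mem_loc (subst_ne_zero hef h1 h2)

lemma sK_mem_loc {x : K} (hx : x ∈ loc K a b) : sK K (swap a b) x ∈ loc K a b := by
  obtain ⟨p, q, hq, h⟩ := hx
  refine ⟨rename (swap a b) p, rename (swap a b) q, by rwa [subst_swap], ?_⟩
  rw [← sK_jK, ← sK_jK, ← h, map_mul]

lemma mem_TO_of_subst {p q : MvPolynomial V ℂ} {x : K} (hq : subst a b q ≠ 0)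
    (h : x * jK K q = jK K p) (hp : subst a b p = 0) : x ∈ TO K a b 1 := by
  obtain ⟨g, rfl⟩ := subst_eq_zero_iff.1 hp
  have hq0 : jK K q ≠ 0 := jK_ne_zero fun h => hq (by rw [h, map_zero])
  refine mem_TO.2 ⟨jK K g * (jK K q)⁻¹, mul_mem (jK_mem_loc g) (inv_mem_loc hq), ?_⟩
  rw [eq_comm, ← mul_assoc, mul_inv_eq_iff_eq_mul₀ hq0, h, pow_one, uK, uK, map_mul, map_sub]

lemma sub_sK_mem_TO {x : K} (hx : x ∈ loc K a b) : x - sK K (swap a b) x ∈ TO K a b 1 := by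
  obtain ⟨p, q, hq, h⟩ := hx
  refine mem_TO_of_subst (p := p * rename (swap a b) q - rename (swap a b) p * q)
    (q := q * rename (swap a b) q) ?_ ?_ ?_
  · rw [map_mul, subst_swap]; exact mul_ne_zero hq hq
  · have h1 := congrArg (sK K (swap a b)) h
    rw [map_mul, sK_jK, sK_jK] at h1
    rw [map_mul, map_sub, map_mul, map_mul, ← h, ← h1]; ring
  · rw [map_sub, map_mul, map_mul, subst_swap, subst_swap, mul_comm, sub_self]

lemma odd_mem_TO {x : K} (hx : x ∈ loc K a b) (h : sK K (swap a b) x = -x) : x ∈ TO K a b 1 := by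
  have h1 := sub_sK_mem_TO hx
  rw [h, sub_neg_eq_add, ← two_smul ℂ x] at h1
  exact ((TO K a b 1).smul_mem_iff two_ne_zero).1 h1

lemma jK_mem_TO {n : ℕ} {f : MvPolynomial V ℂ} (h : a ≠ b) :
    jK K f ∈ TO K a b n ↔ (X a - X b) ^ n ∣ f := by
  constructor
  · intro hf
    obtain ⟨c, ⟨p, q, hq, hc⟩, h0⟩ := mem_TO.1 hf
    have h1 : f * q = (X a - X b) ^ n * p := by
      apply jK_injective (K := K)
      rw [map_mul, map_mul, h0, ← hc, map_pow, map_sub]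
      change _ = (uK V K a - uK V K b) ^ n * _
      ring
    clear hf h0 hc
    induction n generalizing f with
    | zero => simp
    | succ n ih =>
      have h2 : subst a b f = 0 := by
        have := congrArg (subst a b) h1
        rw [map_mul, pow_succ', mul_assoc, map_mul, subst_eq_zero_iff.2 dvd_rfl, zero_mul] at this
        exact (mul_eq_zero.1 this).resolve_right hq
      obtain ⟨g, rfl⟩ := subst_eq_zero_iff.1 h2
      rw [pow_succ']
      refine mul_dvd_mul_left _ (ih ?_)
      refine mul_left_cancel₀ (sub_ne_zero.2 fun e => h (X_injective e) : (X a - X b : MvPolynomial V ℂ) ≠ 0) ?_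
      rw [← mul_assoc, h1]; ring
  · rintro ⟨g, rfl⟩
    refine mem_TO.2 ⟨jK K g, jK_mem_loc g, ?_⟩
    rw [map_mul, map_pow, map_sub]; rfl

lemma loc_symm (a b : V) : loc K a b = loc K b a := by
  have key : ∀ (a b : V) (q : MvPolynomial V ℂ), subst a b q = 0 → subst b a q = 0 := by
    intro a b q h
    rw [subst_eq_zero_iff] at h ⊢
    rwa [← neg_sub, neg_dvd]
  ext x
  exact ⟨fun ⟨p, q, hq, h⟩ => ⟨p, q, fun h' => hq (key _ _ _ h'), h⟩,
    fun ⟨p, q, hq, h⟩ => ⟨p, q, fun h' => hq (key _ _ _ h'), h⟩⟩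

/-- A rational function which is regular along all divisors of its denominator is a polynomial. -/
lemma mem_range_of_forall_loc {S : Finset (V × V)} {x : K} (hne : ∀ e ∈ S, e.1 ≠ e.2)
    (hx : x * ∏ e ∈ S, (uK V K e.1 - uK V K e.2) ∈ (jK K : MvPolynomial V ℂ →ₐ[ℂ] K).range)
    (hloc : ∀ e ∈ S, x ∈ loc K e.1 e.2) : x ∈ (jK K : MvPolynomial V ℂ →ₐ[ℂ] K).range := by
  classical
  induction S using Finset.induction_on with
  | empty => simpa using hx
  | insert e S he ih =>
    refine ih (fun e h => hne e (Finset.mem_insert_of_mem h)) ?_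
      fun e h => hloc e (Finset.mem_insert_of_mem h)
    obtain ⟨p, hp⟩ := hx
    have hp : jK K p = _ := hp
    have hloc' : jK K p ∈ TO K e.1 e.2 1 := by
      rw [hp, Finset.prod_insert he, mul_left_comm]
      refine t_mul_TO (mul_mem (hloc e (Finset.mem_insert_self _ _)) (prod_mem fun f _ => ?_))
      exact sub_mem (uK_mem_loc _) (uK_mem_loc _)
    obtain ⟨g, rfl⟩ := (jK_mem_TO (hne e (Finset.mem_insert_self _ _))).1 hloc'
    refine ⟨g, mul_left_cancel₀ (uK_sub_ne_zero (K := K) (hne e (Finset.mem_insert_self _ _))) ?_⟩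
    rw [Finset.prod_insert he, mul_left_comm, pow_one, map_mul, map_sub] at hp
    exact hp

end loc

section cfg
variable (A : Type) {V : Type} [Fintype A] [DecidableEq A] [Fintype V] [DecidableEq V] (wt : V → ℕ)

/-- Configurations: maps `φ : A → V` whose fibres have the prescribed cardinalities. -/
abbrev Cfg := {φ : A → V // ∀ v, (Finset.univ.filter fun i => φ i = v).card = wt v}

variable {A wt}

/-- Relabelling of a configuration. -/
def Cfg.comp (φ : Cfg A wt) (w : Perm A) : Cfg A wt :=
  ⟨fun i => φ.1 (w i), fun v => by
    rw [← φ.2 v]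
    exact Finset.card_bij (fun i _ => w i) (by simp) (by simp)
      (fun b hb => ⟨w⁻¹ b, by simpa using hb, by simp⟩)⟩

@[simp] lemma Cfg.comp_apply (φ : Cfg A wt) (w : Perm A) (i : A) : (φ.comp w).1 i = φ.1 (w i) := rfl

lemma Cfg.comp_comp (φ : Cfg A wt) (w w' : Perm A) : (φ.comp w).comp w' = φ.comp (w * w') := rfl

@[simp] lemma Cfg.comp_one (φ : Cfg A wt) : φ.comp 1 = φ := rfl

@[simp] lemma Cfg.comp_swap_self (φ : Cfg A wt) (i : A) : φ.comp (swap i i) = φ := by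
  rw [swap_self]; rfl

lemma Cfg.comp_swap_of_eq {φ : Cfg A wt} {i j : A} (h : φ.1 i = φ.1 j) : φ.comp (swap i j) = φ := by
  apply Subtype.ext
  funext k
  rw [comp_apply]
  rcases swap_apply_eq_iff.1 (rfl : swap i j k = swap i j k) with _
  by_cases h1 : k = i
  · rw [h1, swap_apply_left, h]
  · by_cases h2 : k = j
    · rw [h2, swap_apply_right, h]
    · rw [swap_apply_of_ne_of_ne h1 h2]

lemma Cfg.wt_pos (φ : Cfg A wt) (i : A) : 0 < wt (φ.1 i) := by
  rw [← φ.2]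
  exact Finset.card_pos.2 ⟨i, by simp⟩

/-- Relabelling as a permutation of the set of configurations. -/
def Cfg.compEquiv (w : Perm A) : Perm (Cfg A wt) :=
  ⟨fun φ => φ.comp w, fun φ => φ.comp w⁻¹, fun φ => by
    change (φ.comp w).comp w⁻¹ = φ
    rw [Cfg.comp_comp, mul_inv_cancel, Cfg.comp_one], fun φ => by
    change (φ.comp w⁻¹).comp w = φ
    rw [Cfg.comp_comp, inv_mul_cancel, Cfg.comp_one]⟩

variable {K : Type} [Field K] [Algebra (MvPolynomial V ℂ) K]
  [IsFractionRing (MvPolynomial V ℂ) K] [Algebra ℂ K] [IsScalarTower ℂ (MvPolynomial V ℂ) K]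

variable (A wt K) in
/-- Constant functions of the configuration. -/
def cst : K →ₐ[ℂ] (Cfg A wt → K) := Pi.constAlgHom ℂ (Cfg A wt) K

@[simp] lemma cst_apply (g : K) (φ : Cfg A wt) : cst A wt K g φ = g := rfl

variable (wt K) in
/-- The coordinate functions. -/
def xi (i : A) : Cfg A wt → K := fun φ => uK V K (φ.1 i)

@[simp] lemma xi_apply (i : A) (φ : Cfg A wt) : xi wt K i φ = uK V K (φ.1 i) := rfl

variable (wt K) in
/-- The action of permutations of the labels. -/
def rhoK : Perm A →* Module.End ℂ (Cfg A wt → K) where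
  toFun w := 
    { toFun := fun F φ => F (φ.comp w)
      map_add' := fun _ _ => rfl
      map_smul' := fun _ _ => rfl }
  map_one' := rfl
  map_mul' _ _ := rfl

@[simp] lemma rhoK_apply (w : Perm A) (F : Cfg A wt → K) (φ : Cfg A wt) :
    rhoK wt K w F φ = F (φ.comp w) := rfl

lemma rhoK_mul (w : Perm A) (F G : Cfg A wt → K) :
    rhoK wt K w (F * G) = rhoK wt K w F * rhoK wt K w G := rfl

variable (wt K) in
/-- Dunkl operators. -/
def Dk (c : ℂ) (i : A) : Module.End ℂ (Cfg A wt → K) where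
  toFun F φ := (wt (φ.1 i) : K)⁻¹ * dK K (φ.1 i) (F φ) - algebraMap ℂ K c *
    ∑ l, (F φ - F (φ.comp (swap i l))) / (uK V K (φ.1 i) - uK V K (φ.1 l))
  map_add' F G := by
    funext φ
    simp only [Pi.add_apply, map_add]
    have : ∀ l, (F φ + G φ - (F (φ.comp (swap i l)) + G (φ.comp (swap i l)))) /
        (uK V K (φ.1 i) - uK V K (φ.1 l)) =
        (F φ - F (φ.comp (swap i l))) / (uK V K (φ.1 i) - uK V K (φ.1 l)) +
        (G φ - G (φ.comp (swap i l))) / (uK V K (φ.1 i) - uK V K (φ.1 l)) := fun l => by ring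
    simp only [this, Finset.sum_add_distrib]
    ring
  map_smul' z F := by
    funext φ
    have : ∀ l, (z • F φ - z • F (φ.comp (swap i l))) / (uK V K (φ.1 i) - uK V K (φ.1 l)) =
        z • ((F φ - F (φ.comp (swap i l))) / (uK V K (φ.1 i) - uK V K (φ.1 l))) := fun l => by
      rw [← smul_sub, smul_div_assoc]
    simp only [Pi.smul_apply, Derivation.map_smul, RingHom.id_apply, this, ← Finset.smul_sum,
      mul_smul_comm, smul_sub]

variable {c : ℂ}

lemma Dk_apply (i : A) (F : Cfg A wt → K) (φ : Cfg A wt) : Dk wt K c i F φ =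
    (wt (φ.1 i) : K)⁻¹ * dK K (φ.1 i) (F φ) - algebraMap ℂ K c *
    ∑ l, (F φ - F (φ.comp (swap i l))) / (uK V K (φ.1 i) - uK V K (φ.1 l)) := rfl

/-- The twisted Leibniz rule. -/
lemma Dk_mul (i : A) (η F : Cfg A wt → K) (φ : Cfg A wt) : Dk wt K c i (η * F) φ =
    η φ * Dk wt K c i F φ + (wt (φ.1 i) : K)⁻¹ * dK K (φ.1 i) (η φ) * F φ - algebraMap ℂ K c *
    ∑ l, (η φ - η (φ.comp (swap i l))) / (uK V K (φ.1 i) - uK V K (φ.1 l)) * 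
      F (φ.comp (swap i l)) := by
  rw [Dk_apply, Dk_apply, Pi.mul_apply, Derivation.leibniz, smul_eq_mul, smul_eq_mul]
  have : ∑ l, ((η * F) φ - (η * F) (φ.comp (swap i l))) / (uK V K (φ.1 i) - uK V K (φ.1 l)) =
      η φ * ∑ l, (F φ - F (φ.comp (swap i l))) / (uK V K (φ.1 i) - uK V K (φ.1 l)) +
      ∑ l, (η φ - η (φ.comp (swap i l))) / (uK V K (φ.1 i) - uK V K (φ.1 l)) * 
      F (φ.comp (swap i l)) := by
    rw [Finset.mul_sum, ← Finset.sum_add_distrib]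
    refine Finset.sum_congr rfl fun l _ => ?_
    rw [Pi.mul_apply, Pi.mul_apply]; ring
  simp only [Pi.mul_apply] at this ⊢
  rw [this]
  ring

variable (wt) in
/-- Weighted derivatives of constants. -/
def dF (i : A) (g : K) : Cfg A wt → K := fun φ => (wt (φ.1 i) : K)⁻¹ * dK K (φ.1 i) g

lemma Dk_cst_mul (i : A) (g : K) (F : Cfg A wt → K) : Dk wt K c i (cst A wt K g * F) =
    cst A wt K g * Dk wt K c i F + dF wt i g * F := by
  funext φ
  rw [Dk_mul]
  simp [dF]

lemma Dk_one (i : A) : Dk wt K c i 1 = 0 := by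
  funext φ
  rw [Dk_apply]
  simp

lemma rhoK_Dk (w : Perm A) (a : A) (F : Cfg A wt → K) :
    rhoK wt K w (Dk wt K c a F) = Dk wt K c (w a) (rhoK wt K w F) := by
  funext φ
  rw [rhoK_apply, Dk_apply, Dk_apply]
  congr 2
  refine (Finset.sum_congr rfl fun l _ => ?_).trans (Equiv.sum_comp w fun l =>
    (rhoK wt K w F φ - rhoK wt K w F (φ.comp (swap (w a) l))) /
      (uK V K (φ.1 (w a)) - uK V K (φ.1 l)))
  rw [rhoK_apply, rhoK_apply, Cfg.comp_comp, Cfg.comp_comp, mul_swap_eq_swap_mul]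
  rfl

lemma Dk_xi_ne (hc : ∀ v, 1 < wt v → (wt v : ℂ) * c = 1) {i j : A} (hij : i ≠ j)
    (F : Cfg A wt → K) : Dk wt K c i (xi wt K j * F) =
      xi wt K j * Dk wt K c i F + c • rhoK wt K (swap i j) F := by
  funext φ
  rw [Dk_mul, Finset.sum_eq_single j]
  · simp only [xi_apply, Cfg.comp_apply, swap_apply_right, Pi.add_apply, Pi.mul_apply, Pi.smul_apply,
      rhoK_apply]
    rw [Algebra.smul_def]
    by_cases h : φ.1 i = φ.1 j
    · have h1 : 1 < wt (φ.1 i) := by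
        rw [← φ.2]
        exact Finset.one_lt_card.2 ⟨i, by simp, j, by simp [h], hij⟩
      have h2 : (wt (φ.1 i) : K)⁻¹ = algebraMap ℂ K c := by
        refine inv_eq_of_mul_eq_one_right ?_
        rw [← map_natCast (algebraMap ℂ K), ← map_mul, hc _ h1, map_one]
      rw [h2, ← h, dK_uK_self, Cfg.comp_swap_of_eq h]
      simp
    · rw [dK_uK_ne h, ← neg_sub (uK V K (φ.1 i)), neg_div, div_self (uK_sub_ne_zero h)]
      ring
  · intro l _ hl
    by_cases h : l = i
    · rw [h]; simp
    · rw [xi_apply, xi_apply, Cfg.comp_apply, swap_apply_of_ne_of_ne hij.symm hl.symm]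
      simp
  · simp

lemma Dk_xi_self (hc : ∀ v, 1 < wt v → (wt v : ℂ) * c = 1) (i : A)
    (F : Cfg A wt → K) : Dk wt K c i (xi wt K i * F) =
      xi wt K i * Dk wt K c i F + F - c • ∑ l ∈ Finset.univ.erase i, rhoK wt K (swap i l) F := by
  have := charZero_K (K := K)
  funext φ
  rw [Dk_mul, ← Finset.add_sum_erase _ _ (Finset.mem_univ i)]
  simp only [xi_apply, Cfg.comp_apply, swap_apply_left, Pi.add_apply, Pi.mul_apply, Pi.smul_apply,
      Pi.sub_apply, Finset.sum_apply, rhoK_apply, dK_uK_self, sub_self, zero_div,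
      zero_mul, zero_add]
  have h1 : ∑ l ∈ Finset.univ.erase i, F (φ.comp (swap i l)) =
      ∑ l ∈ Finset.univ.erase i, (uK V K (φ.1 i) - uK V K (φ.1 l)) /
        (uK V K (φ.1 i) - uK V K (φ.1 l)) * F (φ.comp (swap i l)) +
      ((wt (φ.1 i) - 1 : ℕ) : K) * F φ := by
    have h2 : ((wt (φ.1 i) - 1 : ℕ) : K) * F φ = ∑ l ∈ Finset.univ.erase i,
        if φ.1 l = φ.1 i then F φ else 0 := by
      rw [← Finset.sum_filter, Finset.sum_const, nsmul_eq_mul]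
      congr 2
      rw [← φ.2, Finset.filter_erase, Finset.card_erase_of_mem (by simp)]
    rw [h2, ← Finset.sum_add_distrib]
    refine Finset.sum_congr rfl fun l _ => ?_
    by_cases h : φ.1 l = φ.1 i
    · rw [if_pos h, Cfg.comp_swap_of_eq h.symm, h]; simp
    · rw [if_neg h, div_self (uK_sub_ne_zero (Ne.symm h)), one_mul, add_zero]
  have h3 : (wt (φ.1 i) : K)⁻¹ = 1 - algebraMap ℂ K c * ((wt (φ.1 i) - 1 : ℕ) : K) := by
    have hp := φ.wt_pos i
    rcases Nat.lt_or_ge 1 (wt (φ.1 i)) with h | h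
    · have h0 : (wt (φ.1 i) : K) ≠ 0 := by exact_mod_cast hp.ne'
      have h4 : (wt (φ.1 i) : K) * algebraMap ℂ K c = 1 := by
        rw [← map_natCast (algebraMap ℂ K), ← map_mul, hc _ h, map_one]
      rw [Nat.cast_sub hp, Nat.cast_one, mul_sub, mul_comm _ (wt (φ.1 i) : K), h4]
      rw [mul_one, sub_sub_cancel]
      exact inv_eq_of_mul_eq_one_right h4
    · have : wt (φ.1 i) = 1 := by omega
      rw [this]; simp
  rw [h1, h3, Algebra.smul_def]
  ring

variable (wt K) in
/-- Indicator functions. -/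
def ind (k : A) (e : V) : Cfg A wt → K := fun φ => if φ.1 k = e then 1 else 0

lemma ind_eq_prod (k : A) (e : V) : ind wt K k e = ∏ f ∈ Finset.univ.erase e,
    (cst A wt K (uK V K e - uK V K f)⁻¹ * (xi wt K k - cst A wt K (uK V K f))) := by
  funext φ
  rw [Finset.prod_apply, ind]
  simp only [Pi.mul_apply, Pi.sub_apply, cst_apply, xi_apply]
  split_ifs with h
  · rw [h, eq_comm]
    refine Finset.prod_eq_one fun f hf => inv_mul_cancel₀ (uK_sub_ne_zero (Finset.ne_of_mem_erase hf).symm)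
  · rw [eq_comm]
    exact Finset.prod_eq_zero (Finset.mem_erase.2 ⟨h, Finset.mem_univ (φ.1 k)⟩) (by simp)

lemma cfg_induction {p : (Cfg A wt → K) → Prop} (h1 : ∀ g, p (cst A wt K g)) (h2 : ∀ k, p (xi wt K k))
    (hadd : ∀ F G, p F → p G → p (F + G)) (hmul : ∀ F G, p F → p G → p (F * G))
    (F : Cfg A wt → K) : p F := by
  have hind : ∀ k e, p (ind wt K k e) := fun k e => by
    rw [ind_eq_prod]
    refine Finset.prod_induction _ p hmul (by simpa using h1 1) fun f _ => hmul _ _ (h1 _) ?_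
    rw [sub_eq_add_neg, ← map_neg]
    exact hadd _ _ (h2 _) (h1 _)
  have hF : F = ∑ ψ : Cfg A wt, cst A wt K (F ψ) * ∏ k, ind wt K k (ψ.1 k) := by
    funext φ
    rw [Finset.sum_apply, Finset.sum_eq_single φ]
    · simp [ind]
    · intro ψ _ hψ
      obtain ⟨k, hk⟩ : ∃ k, φ.1 k ≠ ψ.1 k := by
        by_contra! h
        exact hψ (Subtype.ext (funext fun k => (h k).symm))
      rw [Pi.mul_apply, Finset.prod_apply, Finset.prod_eq_zero (Finset.mem_univ k), mul_zero]
      simp [ind, hk]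
    · simp
  rw [hF]
  exact Finset.sum_induction _ p hadd (by simpa using h1 0) fun ψ _ =>
    hmul _ _ (h1 _) (Finset.prod_induction _ p hmul (by simpa using h1 1) fun k _ => hind _ _)

end cfg

section cfg
variable {A V : Type} [Fintype A] [DecidableEq A] [Fintype V] [DecidableEq V] {wt : V → ℕ}
variable {K : Type} [Field K] [Algebra (MvPolynomial V ℂ) K]
  [IsFractionRing (MvPolynomial V ℂ) K] [Algebra ℂ K] [IsScalarTower ℂ (MvPolynomial V ℂ) K]
variable {c : ℂ}

lemma dK_inv_natCast_mul (v : V) (n : ℕ) (x : K) : dK K v ((n : K)⁻¹ * x) = (n : K)⁻¹ * dK K v x := by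
  have : (n : K)⁻¹ = algebraMap ℂ K (n : ℂ)⁻¹ := by rw [map_inv₀, map_natCast]
  rw [this, ← Algebra.smul_def, Derivation.map_smul, Algebra.smul_def]

lemma Dk_dF_mul {i j : A} (hij : i ≠ j) (g : K) (F : Cfg A wt → K) (φ : Cfg A wt) :
    Dk wt K c i (dF wt j g * F) φ = dF wt j g φ * Dk wt K c i F φ +
      (wt (φ.1 i) : K)⁻¹ * (wt (φ.1 j) : K)⁻¹ * dK K (φ.1 i) (dK K (φ.1 j) g) * F φ -
      algebraMap ℂ K c * ((dF wt j g φ - dF wt i g φ) / (uK V K (φ.1 i) - uK V K (φ.1 j)) *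
        F (φ.comp (swap i j))) := by
  rw [Dk_mul, Finset.sum_eq_single j]
  · have h1 : dF wt j g φ = (wt (φ.1 j) : K)⁻¹ * dK K (φ.1 j) g := rfl
    have h2 : dF wt j g (φ.comp (swap i j)) = dF wt i g φ := by
      simp only [dF, Cfg.comp_apply, swap_apply_right]
    rw [h2]
    nth_rw 2 [h1]
    rw [dK_inv_natCast_mul]
    ring
  · intro l _ hl
    have : dF wt j g (φ.comp (swap i l)) = dF wt j g φ := by
      by_cases h : l = i
      · rw [h, Cfg.comp_swap_self]
      · rw [dF, Cfg.comp_apply, swap_apply_of_ne_of_ne hij.symm hl.symm, dF]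
    rw [this]; simp
  · simp

lemma Dk_comm (hc : ∀ v, 1 < wt v → (wt v : ℂ) * c = 1) (i j : A) (F : Cfg A wt → K) :
    Dk wt K c i (Dk wt K c j F) = Dk wt K c j (Dk wt K c i F) := by
  let p (η : Cfg A wt → K) : Prop := ∀ i j, i ≠ j → ∀ F,
    Dk wt K c i (Dk wt K c j (η * F)) - Dk wt K c j (Dk wt K c i (η * F)) =
    η * (Dk wt K c i (Dk wt K c j F) - Dk wt K c j (Dk wt K c i F))
  have key : ∀ η, p η := by
    refine cfg_induction ?_ ?_ ?_ ?_
    · intro g i j hij F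
      simp only [Dk_cst_mul, map_add]
      funext φ
      have hs : swap j i = swap i j := swap_comm j i
      simp only [Pi.sub_apply, Pi.add_apply, Pi.mul_apply, Dk_dF_mul hij, Dk_dF_mul hij.symm,
        dK_comm (φ.1 j) (φ.1 i), hs]
      rw [← neg_sub (uK V K (φ.1 i)), div_neg]
      ring
    · have hjj : ∀ i j, i ≠ j → ∀ F : Cfg A wt → K,
          Dk wt K c i (Dk wt K c j (xi wt K j * F)) - Dk wt K c j (Dk wt K c i (xi wt K j * F)) =
          xi wt K j * (Dk wt K c i (Dk wt K c j F) - Dk wt K c j (Dk wt K c i F)) := by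
        intro i j hij F
        have h1 : ∑ l ∈ Finset.univ.erase j, Dk wt K c i (rhoK wt K (swap j l) F) =
          ∑ l ∈ Finset.univ.erase j, rhoK wt K (swap j l) (Dk wt K c i F) +
            (rhoK wt K (swap i j) (Dk wt K c j F) - Dk wt K c j (rhoK wt K (swap i j) F)) := by
          have hi : i ∈ Finset.univ.erase j := by simp [hij]
          rw [← Finset.add_sum_erase _ _ hi, ← Finset.add_sum_erase _ _ hi, rhoK_Dk, rhoK_Dk,
            swap_apply_right, swap_apply_right, swap_comm j i]
          have : ∑ l ∈ (Finset.univ.erase j).erase i, Dk wt K c i (rhoK wt K (swap j l) F) =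
              ∑ l ∈ (Finset.univ.erase j).erase i, rhoK wt K (swap j l) (Dk wt K c i F) := by
            refine Finset.sum_congr rfl fun l hl => ?_
            rw [rhoK_Dk, swap_apply_of_ne_of_ne hij (Finset.ne_of_mem_erase hl).symm]
          rw [this]
          abel
        rw [Dk_xi_self hc, Dk_xi_ne hc hij, map_sub, map_add, map_add, map_smul, map_smul, map_sum,
          Dk_xi_ne hc hij, Dk_xi_self hc, h1]
        simp only [smul_add, smul_sub, mul_sub]
        abel
      intro k i j hij F
      by_cases hkj : k = j
      · rw [hkj]; exact hjj i j hij F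
      by_cases hki : k = i
      · rw [hki, ← neg_sub, hjj j i hij.symm F, ← mul_neg, neg_sub]
      have h1 : swap j k i = i := swap_apply_of_ne_of_ne hij (Ne.symm hki)
      have h2 : swap i k j = j := swap_apply_of_ne_of_ne hij.symm (Ne.symm hkj)
      rw [Dk_xi_ne hc (Ne.symm hkj), Dk_xi_ne hc (Ne.symm hki), map_add, map_add, map_smul, map_smul,
        Dk_xi_ne hc (Ne.symm hkj), Dk_xi_ne hc (Ne.symm hki), rhoK_Dk, rhoK_Dk, h1, h2, mul_sub]
      abel
    · intro η θ hη hθ i j hij F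
      have h1 := hη i j hij F
      have h2 := hθ i j hij F
      rw [add_mul, map_add, map_add, map_add, map_add, add_mul, ← h1, ← h2]
      abel
    · intro η θ hη hθ i j hij F
      rw [mul_assoc, hη i j hij, hθ i j hij, mul_assoc]
  by_cases hij : i = j
  · rw [hij]
  have := key F i j hij 1
  rw [mul_one, Dk_one, Dk_one, map_zero, map_zero, sub_zero, mul_zero] at this
  exact sub_eq_zero.1 this

variable (A wt K) in
/-- The polynomial representation on configurations. -/
def repK (hc : ∀ v, 1 < wt v → (wt v : ℂ) * c = 1) : DRep A (Cfg A wt → K) c where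
  ρ := rhoK wt K
  x a := LinearMap.mulLeft ℂ (xi wt K a)
  D := Dk wt K c
  x_comm _ _ _ := mul_left_comm _ _ _
  D_comm := Dk_comm hc
  ρ_x _ _ _ := rfl
  ρ_D := rhoK_Dk
  D_x_ne _ _ v hab := Dk_xi_ne hc hab v
  D_x_self := Dk_xi_self hc

lemma xi_eq_sum (a : A) : xi wt K a = ∑ v, cst A wt K (uK V K v) * ind wt K a v := by
  funext φ
  rw [Finset.sum_apply, Finset.sum_eq_single (φ.1 a)]
  · simp [ind]
  · intro b _ hb
    simp [ind, hb.symm]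
  · simp

variable (A wt K) in
/-- The representation together with the weighted power sums. -/
def ambK [Nonempty V] (hc : ∀ v, 1 < wt v → (wt v : ℂ) * c = 1) {W : V → ℕ} (hW : ∀ v, 0 < W v)
    {t : ℂ} (ht : ∀ v, 0 < wt v → (W v : ℂ) = t * wt v) :
    Amb A (Fin (Fintype.card V)) (Cfg A wt → K) c where
  toDRep := repK A wt K hc
  ξ := xi wt K
  κ l := cst A wt K (jK K (wp W l))
  x_eq _ _ := rfl
  ρ_κ _ _ _ := rfl
  D_κ a l := by
    have hξ : xi wt K a ∈ Algebra.adjoin ℂ (Set.range (xi wt K) ∪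
        Set.range fun l => cst A wt K (jK K (wp W l))) := 
      Algebra.subset_adjoin (Or.inl ⟨a, rfl⟩)
    refine ⟨(t * (l + 1)) • xi wt K a ^ (l : ℕ), Subalgebra.smul_mem _ (pow_mem hξ _) _, fun v => ?_⟩
    change Dk wt K c a _ = _ * Dk wt K c a _ + _
    rw [Dk_cst_mul]
    congr 2
    funext φ
    have := charZero_K (K := K)
    have h0 : (wt (φ.1 a) : K) ≠ 0 := by exact_mod_cast (φ.wt_pos a).ne'
    have h1 : pderiv (φ.1 a) (wp W l) = C ((W (φ.1 a) : ℂ) * (l + 1)) * X (φ.1 a) ^ (l : ℕ) := by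
      rw [wp, wpsum, map_sum, Finset.sum_eq_single (φ.1 a)]
      · rw [pderiv_C_mul, Derivation.leibniz_pow]
        simp
        ring
      · intro b _ hb
        rw [pderiv_C_mul, Derivation.leibniz_pow, pderiv_X_of_ne hb]
        simp
      · simp
    rw [dF, dK_jK, h1, ht _ (φ.wt_pos a), map_mul, map_pow, ← algebraMap_eq, AlgHom.commutes]
    simp only [Pi.smul_apply, Pi.pow_apply, xi_apply, Algebra.smul_def, map_mul, map_natCast]
    rw [uK]
    field_simp
  unit l z := by
    rw [Pi.isUnit_iff]
    intro φ
    have : jK K (wp W l - C z) ≠ 0 := jK_ne_zero (wp_sub_ne_zero hW l z)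
    rw [map_sub, ← algebraMap_eq, AlgHom.commutes] at this
    exact isUnit_iff_ne_zero.2 this
  integral a := by
    rw [xi_eq_sum]
    refine IsIntegral.sum _ fun v _ => IsIntegral.mul ?_ ?_
    · have h1 : IsIntegral (Algebra.adjoin ℂ (Set.range (wp W))) (X v : MvPolynomial V ℂ) := 
        isIntegral_wp hW _
      let F : MvPolynomial V ℂ →ₐ[ℂ] (Cfg A wt → K) := (cst A wt K).comp (jK K)
      have h2 : ∀ x : Algebra.adjoin ℂ (Set.range (wp W)), F x ∈ 
          Algebra.adjoin ℂ (Set.range fun l => cst A wt K (jK K (wp W l))) := by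
        intro x
        have : F x ∈ (Algebra.adjoin ℂ (Set.range (wp W))).map F := ⟨x, x.2, rfl⟩
        rw [AlgHom.map_adjoin, ← Set.range_comp] at this
        exact this
      exact h1.map_of_comp_eq ((F.toRingHom.comp (Subalgebra.val _).toRingHom).codRestrict
        (Algebra.adjoin ℂ (Set.range fun l => cst A wt K (jK K (wp W l)))) h2) F.toRingHom rfl
    · refine ⟨Polynomial.X * (Polynomial.X - Polynomial.C 1), ?_, ?_⟩
      · exact Polynomial.monic_X.mul (Polynomial.monic_X_sub_C 1)
      · rw [Polynomial.eval₂_mul, Polynomial.eval₂_sub, Polynomial.eval₂_X, Polynomial.eval₂_C, map_one]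
        funext φ
        simp [ind, sub_eq_zero]

end cfg

section opr
variable {V : Type} [DecidableEq V]
variable {K : Type} [Field K] [Algebra (MvPolynomial V ℂ) K]
  [IsFractionRing (MvPolynomial V ℂ) K] [Algebra ℂ K] [IsScalarTower ℂ (MvPolynomial V ℂ) K]

variable (K) in
/-- The derivation `m ∂_z - ∂_y`. -/
def del (m : ℕ) (y z : V) : Derivation ℂ K K := (m : ℂ) • dK K z - dK K y

variable {m : ℕ} {y z : V}

lemma del_apply (x : K) : del K m y z x = m * dK K z x - dK K y x := by
  rw [del, Derivation.sub_apply, Derivation.smul_apply, Algebra.smul_def, map_natCast]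

lemma del_mem_loc {x : K} (hx : x ∈ loc K y z) : del K m y z x ∈ loc K y z := by
  rw [del_apply]
  exact sub_mem (mul_mem (natCast_mem _ _) (dK_mem_loc z hx)) (dK_mem_loc y hx)

lemma del_uK_left (h : y ≠ z) : del K m y z (uK V K y) = -1 := by
  rw [del_apply, dK_uK_ne h.symm, dK_uK_self]; simp

lemma del_uK_right (h : y ≠ z) : del K m y z (uK V K z) = m := by
  rw [del_apply, dK_uK_ne h, dK_uK_self]; simp

lemma del_uK_ne {f : V} (hy : f ≠ y) (hz : f ≠ z) : del K m y z (uK V K f) = 0 := by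
  rw [del_apply, dK_uK_ne hy.symm, dK_uK_ne hz.symm]; simp

variable (K) in
/-- Elements of the local ring satisfying the mixed quasi-invariance condition. -/
def Opr (m : ℕ) (y z : V) : Subalgebra ℂ K where
  carrier := {x | x ∈ loc K y z ∧ del K m y z x ∈ TO K y z 1}
  mul_mem' := by
    rintro a b ⟨ha, ha'⟩ ⟨hb, hb'⟩
    refine ⟨mul_mem ha hb, ?_⟩
    rw [Derivation.leibniz, smul_eq_mul, smul_eq_mul]
    exact add_mem (mul_TO ha hb') (mul_TO hb ha')
  add_mem' := by
    rintro a b ⟨ha, ha'⟩ ⟨hb, hb'⟩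
    exact ⟨add_mem ha hb, by rw [map_add]; exact add_mem ha' hb'⟩
  algebraMap_mem' r := ⟨algebraMap_mem _ r, by rw [Derivation.map_algebraMap]; exact zero_mem _⟩

lemma mem_Opr {x : K} : x ∈ Opr K m y z ↔ x ∈ loc K y z ∧ del K m y z x ∈ TO K y z 1 := Iff.rfl

lemma TO_two_le_Opr {x : K} (hx : x ∈ TO K y z 2) : x ∈ Opr K m y z := by
  refine ⟨TO_le_loc hx, ?_⟩
  obtain ⟨c, hc, rfl⟩ := mem_TO.1 hx
  rw [pow_two, mul_assoc, Derivation.leibniz, smul_eq_mul, smul_eq_mul]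
  exact add_mem (t_mul_TO (del_mem_loc (mul_mem t_mem_loc hc)))
    (TO_mul (t_mul_TO hc) (del_mem_loc t_mem_loc))

lemma inv_mem_Opr {x : K} (hx : x ∈ Opr K m y z) (hx' : x⁻¹ ∈ loc K y z) : x⁻¹ ∈ Opr K m y z := by
  refine ⟨hx', ?_⟩
  rw [Derivation.leibniz_inv, smul_eq_mul]
  exact mul_TO (neg_mem (pow_mem hx' 2)) hx.2

lemma uK_mem_Opr {f : V} (hy : f ≠ y) (hz : f ≠ z) : uK V K f ∈ Opr K m y z :=
  ⟨uK_mem_loc f, by rw [del_uK_ne hy hz]; exact zero_mem _⟩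

lemma inv_sub_mem_Opr {e f : V} (he : e ≠ y) (he' : e ≠ z) (hf : f ≠ y) (hf' : f ≠ z) :
    (uK V K e - uK V K f)⁻¹ ∈ Opr K m y z :=
  inv_mem_Opr (sub_mem (uK_mem_Opr he he') (uK_mem_Opr hf hf'))
    (inv_sub_mem_loc (fun h => he h.1) (fun h => he' h.1))

lemma center_mem_Opr (h : y ≠ z) : (m * uK V K y + uK V K z) / (m + 1) ∈ Opr K m y z := by
  have h1 : (m * uK V K y + uK V K z : K) ∈ Opr K m y z :=
    ⟨add_mem (mul_mem (natCast_mem _ _) (uK_mem_loc y)) (uK_mem_loc z), by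
      rw [map_add, Derivation.leibniz, Derivation.map_natCast, del_uK_left h, del_uK_right h]
      simp⟩
  have h2 : (m * uK V K y + uK V K z : K) / (m + 1) =
      ((m : ℂ) + 1)⁻¹ • (m * uK V K y + uK V K z : K) := by
    rw [Algebra.smul_def, map_inv₀, map_add, map_natCast, map_one, div_eq_inv_mul]
  rw [h2]
  exact Subalgebra.smul_mem _ h1 _

/-- If `X + Y` and `u_y X + u_z Y` are quasi-invariant, then `X - m Y` vanishes on `y = z`. -/
lemma sub_mul_mem_TO (h : y ≠ z) {P Q : K} (hQ : Q ∈ loc K y z)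
    (h1 : P + Q ∈ Opr K m y z) (h2 : uK V K y * P + uK V K z * Q ∈ Opr K m y z) :
    P - m * Q ∈ TO K y z 1 := by
  have h3 := h2.2
  have h4 := mul_TO (uK_mem_loc y) h1.2
  have h5 := t_mul_TO (del_mem_loc (m := m) hQ)
  simp only [map_add, Derivation.leibniz, smul_eq_mul, del_uK_left h, del_uK_right h] at h3 h4
  have := sub_mem (sub_mem h4 h3) h5
  convert this using 1
  ring

/-- Up to second order, `(x - u_y)^m (x - u_z)` is a power of `x` minus the centre of mass. -/
lemma sub_pow_mem_TO {x : K} (hx : x ∈ loc K y z) (hm : 0 < m) :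
    (x - uK V K y) ^ m * (x - uK V K z) - (x - (m * uK V K y + uK V K z) / (m + 1)) ^ (m + 1) ∈
      TO K y z 2 := by
  have hch := charZero_K (K := K)
  have hm1 : (m : K) + 1 ≠ 0 := by exact_mod_cast Nat.succ_ne_zero m
  have h2 : (m * uK V K y + uK V K z : K) / (m + 1) ∈ loc K y z := by
    have : (m * uK V K y + uK V K z : K) / (m + 1) =
        ((m : ℂ) + 1)⁻¹ • (m * uK V K y + uK V K z : K) := by
      rw [Algebra.smul_def, map_inv₀, map_add, map_natCast, map_one, div_eq_inv_mul]
    rw [this]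
    exact Subalgebra.smul_mem _
      (add_mem (mul_mem (natCast_mem _ _) (uK_mem_loc y)) (uK_mem_loc z)) _
  have h3 : (uK V K y - uK V K z) / (m + 1) ∈ loc K y z := by
    have : (uK V K y - uK V K z) / (m + 1) = ((m : ℂ) + 1)⁻¹ • (uK V K y - uK V K z) := by
      rw [Algebra.smul_def, map_inv₀, map_add, map_natCast, map_one, div_eq_inv_mul]
    rw [this]
    exact Subalgebra.smul_mem _ t_mem_loc _
  obtain ⟨k, hk⟩ := Polynomial.powAddExpansion
    (⟨x, hx⟩ - ⟨_, h2⟩ : loc K y z) (-⟨_, h3⟩) m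
  have hk' := congrArg (Subtype.val) hk
  push_cast at hk'
  set p := (m * uK V K y + uK V K z : K) / (m + 1) with hp
  set a := (uK V K y - uK V K z) / (m + 1) with ha
  have e1 : uK V K y = p + a := by rw [hp, ha]; field_simp; ring
  have e2 : uK V K z = p - m * a := by rw [hp, ha]; field_simp; ring
  have e3 : uK V K y - uK V K z = (m + 1) * a := by rw [ha]; field_simp
  have e4 : x - uK V K y = x - p + -a := by rw [e1]; ring
  rw [e4, hk', e2]
  obtain ⟨n, rfl⟩ : ∃ n, m = n + 1 := ⟨m - 1, by omega⟩
  have e5 : (((n + 1 : ℕ) : ℂ) + 1) ^ 2 ≠ 0 := by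
    have : ((n + 1 : ℕ) : ℂ) + 1 ≠ 0 := by exact_mod_cast Nat.succ_ne_zero (n + 1)
    exact pow_ne_zero 2 this
  refine ((TO K y z 2).smul_mem_iff e5).1 ?_
  have hxp : x - p ∈ loc K y z := sub_mem hx h2
  refine mem_TO.2 ⟨(x - p) * k - ((n + 1 : ℕ) : K) * ((n + 1 : ℕ) : K) * (x - p) ^ n +
    ((n + 1 : ℕ) : K) * a * k, ?_, ?_⟩
  · exact add_mem (sub_mem (mul_mem hxp k.2) (mul_mem (mul_mem (natCast_mem _ _) (natCast_mem _ _))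
      (pow_mem hxp _))) (mul_mem (mul_mem (natCast_mem _ _) h3) k.2)
  · rw [e3, Algebra.smul_def, map_pow, map_add, map_natCast, map_one, Nat.add_sub_cancel]
    ring

lemma dK_mem_Opr {v : V} (hy : v ≠ y) (hz : v ≠ z) {x : K} (hx : x ∈ Opr K m y z) :
    dK K v x ∈ Opr K m y z := by
  refine ⟨dK_mem_loc v hx.1, ?_⟩
  have h1 : del K m y z (dK K v x) = dK K v (del K m y z x) := by
    rw [del_apply, del_apply, map_sub, Derivation.leibniz, Derivation.map_natCast,
      dK_comm z, dK_comm y]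
    simp
  rw [h1]
  obtain ⟨c, hc, h2⟩ := mem_TO.1 hx.2
  refine mem_TO.2 ⟨dK K v c, dK_mem_loc v hc, ?_⟩
  rw [h2, Derivation.leibniz, pow_one, map_sub, dK_uK_ne hy, dK_uK_ne hz]
  simp

lemma add_inv_mem_Opr (h : y ≠ z) {e : V} (hy : e ≠ y) (hz : e ≠ z) :
    m * (uK V K e - uK V K y)⁻¹ + (uK V K e - uK V K z)⁻¹ ∈ Opr K m y z := by
  have h1 : (uK V K e - uK V K y)⁻¹ ∈ loc K y z := inv_sub_mem_loc (fun h => hy h.1) (fun h => hz h.1)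
  have h2 : (uK V K e - uK V K z)⁻¹ ∈ loc K y z := inv_sub_mem_loc (fun h => hy h.1) (fun h => hz h.1)
  refine ⟨add_mem (mul_mem (natCast_mem _ _) h1) h2, ?_⟩
  have h3 := t_mul_TO (mul_mem (mul_mem (natCast_mem (loc K y z) m) (mul_mem h1 h2))
    (add_mem h1 h2))
  rw [← neg_mem_iff]
  convert h3 using 1
  rw [map_add, Derivation.leibniz, Derivation.map_natCast, Derivation.leibniz_inv, 
    Derivation.leibniz_inv, map_sub, map_sub, del_uK_left h, del_uK_right h, del_uK_ne hy hz]
  have := uK_sub_ne_zero (K := K) hy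
  have := uK_sub_ne_zero (K := K) hz
  simp only [smul_eq_mul]
  field_simp
  ring

lemma mem_Opr_of_mul {x : K} (hx : (m + 1) * x ∈ Opr K m y z) : x ∈ Opr K m y z := by
  have h5 : ((m : ℂ) + 1) ≠ 0 := by exact_mod_cast Nat.succ_ne_zero m
  refine ((Subalgebra.toSubmodule (Opr K m y z)).smul_mem_iff h5).1 ?_
  rwa [Algebra.smul_def, map_add, map_natCast, map_one]

lemma cross_mem_Opr (h : y ≠ z) {f : V} (hy : f ≠ y) (hz : f ≠ z) {P Q : K}
    (h1 : P + Q ∈ Opr K m y z) (h2 : P - m * Q ∈ TO K y z 1) :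
    P * (uK V K y - uK V K f)⁻¹ + Q * (uK V K z - uK V K f)⁻¹ ∈ Opr K m y z := by
  have hch := charZero_K (K := K)
  have h3 : (uK V K y - uK V K f)⁻¹ ∈ loc K y z :=
    inv_sub_mem_loc (fun h => hz h.2) (fun h => hy h.2)
  have h4 : (uK V K z - uK V K f)⁻¹ ∈ loc K y z :=
    inv_sub_mem_loc (fun h => hz h.2) (fun h => hy h.2)
  have h6 := TO_mul_TO h2 (t_mul_TO (mul_mem h3 h4))
  have h7 := sub_mem (neg_mem (mul_mem h1 (add_inv_mem_Opr h hy hz))) (TO_two_le_Opr (m := m) h6)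
  refine mem_Opr_of_mul ?_
  convert h7 using 1
  rw [← neg_sub (uK V K f) (uK V K y), ← neg_sub (uK V K f) (uK V K z)]
  have := uK_sub_ne_zero (K := K) hy
  have := uK_sub_ne_zero (K := K) hz
  field_simp
  ring

lemma main_mem_Opr (h : y ≠ z) {P Q : K}
    (h1 : P + Q ∈ Opr K m y z) (h2 : P - m * Q ∈ TO K y z 1) :
    dK K y P + m * dK K z Q - 2 * ((P - m * Q) / (uK V K y - uK V K z)) ∈ Opr K m y z := by
  have hch := charZero_K (K := K)
  have ht := uK_sub_ne_zero (K := K) h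
  obtain ⟨W, hW, hW'⟩ := mem_TO.1 h2
  rw [pow_one] at hW'
  have hd : ∀ v : V, dK K v P - m * dK K v Q = dK K v (uK V K y - uK V K z) * W +
      (uK V K y - uK V K z) * dK K v W := fun v => by
    have := congrArg (dK K v) hW'
    rw [map_sub, Derivation.leibniz, Derivation.leibniz, Derivation.map_natCast] at this
    simp only [smul_eq_mul] at this
    linear_combination this
  have hy := hd y
  have hz := hd z
  rw [map_sub, dK_uK_self, dK_uK_ne h, sub_zero] at hy
  rw [map_sub, dK_uK_self, dK_uK_ne h.symm, zero_sub] at hz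
  have h6 : dK K y (P + Q) + dK K z (P + Q) ∈ Opr K m y z := by
    refine ⟨add_mem (dK_mem_loc y h1.1) (dK_mem_loc z h1.1), ?_⟩
    obtain ⟨c, hc, h7⟩ := mem_TO.1 h1.2
    have h8 : del K m y z (dK K y (P + Q) + dK K z (P + Q)) =
        dK K y (del K m y z (P + Q)) + dK K z (del K m y z (P + Q)) := by
      simp only [del_apply, map_sub, Derivation.leibniz, Derivation.map_natCast, map_add,
        dK_comm z y, smul_eq_mul]
      ring
    rw [h8, h7, pow_one, Derivation.leibniz, Derivation.leibniz, map_sub, map_sub, dK_uK_self,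
      dK_uK_self, dK_uK_ne h, dK_uK_ne h.symm]
    convert t_mul_TO (add_mem (dK_mem_loc y hc) (dK_mem_loc z hc)) using 1
    simp only [smul_eq_mul]
    ring
  have h7 : (m + 1) * W + (uK V K y - uK V K z) * del K m y z W ∈ Opr K m y z := by
    refine ⟨add_mem (mul_mem (add_mem (natCast_mem _ _) (one_mem _)) hW) 
      (mul_mem t_mem_loc (del_mem_loc hW)), ?_⟩
    have := t_mul_TO (del_mem_loc (m := m) (del_mem_loc (m := m) hW))
    convert this using 1
    simp only [map_add, map_sub, Derivation.leibniz, Derivation.map_natCast, smul_eq_mul,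
      del_uK_left h, del_uK_right h, Derivation.map_one_eq_zero]
    ring
  have h8 := sub_mem (mul_mem (natCast_mem (Opr K m y z) m) h6) h7
  refine mem_Opr_of_mul ?_
  convert h8 using 1
  rw [hW', mul_div_cancel_left₀ _ ht]
  rw [map_add, map_add, del_apply]
  linear_combination hy - m * hz
end opr

section pairing
variable {A V : Type} [Fintype A] [DecidableEq A] [Fintype V] [DecidableEq V] {wt : V → ℕ}
variable {K : Type} [Field K] [Algebra (MvPolynomial V ℂ) K]
  [IsFractionRing (MvPolynomial V ℂ) K] [Algebra ℂ K] [IsScalarTower ℂ (MvPolynomial V ℂ) K]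
variable {c : ℂ}

lemma adjoin_Dk_mem {S : Set (Cfg A wt → K)} (hS : ∀ g ∈ S, ∀ F ∈ Algebra.adjoin ℂ S,
      (∀ i, Dk wt K c i F ∈ Algebra.adjoin ℂ S) → ∀ i, Dk wt K c i (g * F) ∈ Algebra.adjoin ℂ S)
    {F : Cfg A wt → K} (hF : F ∈ Algebra.adjoin ℂ S) (i : A) :
    Dk wt K c i F ∈ Algebra.adjoin ℂ S := by
  have key : ∀ G ∈ Algebra.adjoin ℂ S, ∀ F ∈ Algebra.adjoin ℂ S,
      (∀ i, Dk wt K c i F ∈ Algebra.adjoin ℂ S) →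
      ∀ i, Dk wt K c i (G * F) ∈ Algebra.adjoin ℂ S := by
    intro G hG
    induction hG using Algebra.adjoin_induction with
    | mem g hg => exact hS g hg
    | algebraMap z =>
      intro F _ hDF i
      rw [← Algebra.smul_def, map_smul]
      exact Subalgebra.smul_mem _ (hDF i) z
    | add G H _ _ hG hH =>
      intro F hF hDF i
      rw [add_mul, map_add]
      exact add_mem (hG F hF hDF i) (hH F hF hDF i)
    | mul G H _ hH' hG hH =>
      intro F hF hDF i
      rw [mul_assoc]
      exact hG _ (mul_mem hH' hF) (hH F hF hDF) i
  have h1 := key F hF 1 (one_mem _) (fun i => by rw [Dk_one]; exact zero_mem _) i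
  rwa [mul_one] at h1

lemma adjoin_rhoK_mem {S : Set (Cfg A wt → K)} (w : Perm A)
    (hS : ∀ g ∈ S, rhoK wt K w g ∈ Algebra.adjoin ℂ S)
    {F : Cfg A wt → K} (hF : F ∈ Algebra.adjoin ℂ S) : rhoK wt K w F ∈ Algebra.adjoin ℂ S := by
  induction hF using Algebra.adjoin_induction with
  | mem g hg => exact hS g hg
  | algebraMap z => exact algebraMap_mem _ z
  | add G H _ _ hG hH => rw [map_add]; exact add_mem hG hH
  | mul G H _ _ hG hH => rw [rhoK_mul]; exact mul_mem hG hH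

lemma adjoin_Dk_xi_mem (hc : ∀ v, 1 < wt v → (wt v : ℂ) * c = 1) {S : Set (Cfg A wt → K)}
    (hξ : Set.range (xi wt K) ⊆ S) (hρ : ∀ w, ∀ g ∈ S, rhoK wt K w g ∈ Algebra.adjoin ℂ S) (k : A)
    {F : Cfg A wt → K} (hF : F ∈ Algebra.adjoin ℂ S)
    (hD : ∀ i, Dk wt K c i F ∈ Algebra.adjoin ℂ S) (i : A) :
    Dk wt K c i (xi wt K k * F) ∈ Algebra.adjoin ℂ S := by
  have hk : ∀ k, xi wt K k ∈ Algebra.adjoin ℂ S := fun k => Algebra.subset_adjoin (hξ ⟨k, rfl⟩)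
  by_cases h : i = k
  · rw [h, Dk_xi_self hc]
    exact sub_mem (add_mem (mul_mem (hk k) (hD k)) hF) (Subalgebra.smul_mem _
      (sum_mem fun l _ => adjoin_rhoK_mem _ (hρ _) hF) _)
  · rw [Dk_xi_ne hc h]
    exact add_mem (mul_mem (hk k) (hD i)) (Subalgebra.smul_mem _ (adjoin_rhoK_mem _ (hρ _) hF) _)

variable (A wt K) in
/-- The algebra of test functions. -/
def PP : Subalgebra ℂ (Cfg A wt → K) := Algebra.adjoin ℂ (Set.range (xi wt K))

lemma xi_mem_PP (k : A) : xi wt K k ∈ PP A wt K := Algebra.subset_adjoin ⟨k, rfl⟩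

lemma rhoK_mem_PP (w : Perm A) {P : Cfg A wt → K} (hP : P ∈ PP A wt K) :
    rhoK wt K w P ∈ PP A wt K :=
  adjoin_rhoK_mem w (by rintro _ ⟨k, rfl⟩; exact xi_mem_PP (w k)) hP

lemma Dk_mem_PP (hc : ∀ v, 1 < wt v → (wt v : ℂ) * c = 1) (i : A) {P : Cfg A wt → K}
    (hP : P ∈ PP A wt K) : Dk wt K c i P ∈ PP A wt K := by
  refine adjoin_Dk_mem ?_ hP i
  rintro _ ⟨k, rfl⟩ F hF hD i
  exact adjoin_Dk_xi_mem hc subset_rfl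
    (fun w => by rintro _ ⟨k, rfl⟩; exact xi_mem_PP (w k)) k hF hD i

lemma PP_range {P : Cfg A wt → K} (hP : P ∈ PP A wt K) (φ : Cfg A wt) :
    P φ ∈ (jK K : MvPolynomial V ℂ →ₐ[ℂ] K).range := by
  induction hP using Algebra.adjoin_induction with
  | mem g hg => obtain ⟨k, rfl⟩ := hg; exact ⟨X (φ.1 k), rfl⟩
  | algebraMap z => exact algebraMap_mem _ z
  | add G H _ _ hG hH => exact add_mem hG hH
  | mul G H _ _ hG hH => exact mul_mem hG hH

lemma PP_mem_loc {P : Cfg A wt → K} (hP : P ∈ PP A wt K) (φ : Cfg A wt) (a b : V) :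
    P φ ∈ loc K a b := by
  obtain ⟨f, hf⟩ := PP_range hP φ
  rw [← hf]; exact jK_mem_loc f

/-- The sum of the values over configurations with label `i` at `e`. -/
def Gs (i : A) (F : Cfg A wt → K) (e : V) : K := ∑ φ, ind wt K i e φ * F φ

lemma sum_mul_Gs (i : A) (F : Cfg A wt → K) (p : V → K) :
    ∑ e, p e * Gs i F e = ∑ φ, p (φ.1 i) * F φ := by
  simp only [Gs, Finset.mul_sum]
  rw [Finset.sum_comm]
  refine Finset.sum_congr rfl fun φ _ => ?_
  rw [Finset.sum_eq_single (φ.1 i)]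
  · simp [ind]
  · intro e _ he
    simp [ind, he.symm]
  · simp

variable (wt) in
/-- The divergence. -/
def dv (c : ℂ) (G : V → K) : K := ∑ e, ((wt e : K)⁻¹ * dK K e (G e) -
  2 * algebraMap ℂ K c * ∑ f, (wt f : K) * (G e * (uK V K e - uK V K f)⁻¹))

lemma pair_Dk (i : A) (P F : Cfg A wt → K) :
    ∑ φ, P φ * Dk wt K c i F φ = dv wt c (Gs i (P * F)) - ∑ φ, Dk wt K c i P φ * F φ := by
  have h1 : ∑ e, (wt e : K)⁻¹ * dK K e (Gs i (P * F) e) =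
      ∑ φ, (wt (φ.1 i) : K)⁻¹ * dK K (φ.1 i) (P φ * F φ) := by
    have : ∀ e, dK K e (Gs i (P * F) e) = ∑ φ, ind wt K i e φ * dK K e (P φ * F φ) := fun e => by
      rw [Gs, map_sum]
      refine Finset.sum_congr rfl fun φ _ => ?_
      simp only [ind, Pi.mul_apply]
      split_ifs <;> simp
    simp only [this, Finset.mul_sum]
    rw [Finset.sum_comm]
    refine Finset.sum_congr rfl fun φ _ => ?_
    rw [Finset.sum_eq_single (φ.1 i)]
    · simp [ind]
    · intro e _ he
      simp [ind, he.symm]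
    · simp
  have h2 : ∑ e, ∑ f, (wt f : K) * (Gs i (P * F) e * (uK V K e - uK V K f)⁻¹) =
      ∑ φ, ∑ l, (P φ * F φ) * (uK V K (φ.1 i) - uK V K (φ.1 l))⁻¹ := by
    have h3 : ∀ e, ∑ f, (wt f : K) * (Gs i (P * F) e * (uK V K e - uK V K f)⁻¹) =
        (∑ f, (wt f : K) * (uK V K e - uK V K f)⁻¹) * Gs i (P * F) e := fun e => by
      rw [Finset.sum_mul]
      exact Finset.sum_congr rfl fun f _ => by ring
    simp only [h3]
    rw [sum_mul_Gs i (P * F) fun e => ∑ f, (wt f : K) * (uK V K e - uK V K f)⁻¹]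
    refine Finset.sum_congr rfl fun φ _ => ?_
    rw [← Finset.mul_sum, mul_comm, Pi.mul_apply]
    congr 1
    rw [← Finset.sum_fiberwise (s := Finset.univ) (g := φ.1)]
    refine Finset.sum_congr rfl fun f _ => ?_
    rw [← φ.2 f, ← nsmul_eq_mul, ← Finset.sum_const]
    refine Finset.sum_congr rfl fun l hl => ?_
    rw [(Finset.mem_filter.1 hl).2]
  have h4 : ∑ φ : Cfg A wt, ∑ l, P φ * F (φ.comp (swap i l)) *
      (uK V K (φ.1 i) - uK V K (φ.1 l))⁻¹ = - ∑ φ : Cfg A wt, ∑ l, P (φ.comp (swap i l)) * F φ *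
      (uK V K (φ.1 i) - uK V K (φ.1 l))⁻¹ := by
    rw [Finset.sum_comm, Finset.sum_comm (s := Finset.univ (α := Cfg A wt)), ← Finset.sum_neg_distrib]
    refine Finset.sum_congr rfl fun l _ => ?_
    rw [← Equiv.sum_comp (Cfg.compEquiv (swap i l)), ← Finset.sum_neg_distrib]
    refine Finset.sum_congr rfl fun φ _ => ?_
    change P (φ.comp (swap i l)) * F ((φ.comp (swap i l)).comp (swap i l)) *
      (uK V K ((φ.comp (swap i l)).1 i) - uK V K ((φ.comp (swap i l)).1 l))⁻¹ = _
    rw [Cfg.comp_comp, swap_mul_self, Cfg.comp_one, Cfg.comp_apply, Cfg.comp_apply, swap_apply_left,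
      swap_apply_right, ← neg_sub, inv_neg, mul_neg]
  rw [dv, Finset.sum_sub_distrib, h1, ← Finset.mul_sum, h2, eq_sub_iff_add_eq,
    ← Finset.sum_add_distrib]
  have h5 : ∀ φ, P φ * Dk wt K c i F φ + Dk wt K c i P φ * F φ =
      (wt (φ.1 i) : K)⁻¹ * dK K (φ.1 i) (P φ * F φ) - (2 * algebraMap ℂ K c *
      ∑ l, P φ * F φ * (uK V K (φ.1 i) - uK V K (φ.1 l))⁻¹ - algebraMap ℂ K c * 
      (∑ l, P φ * F (φ.comp (swap i l)) * (uK V K (φ.1 i) - uK V K (φ.1 l))⁻¹ +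
      ∑ l, P (φ.comp (swap i l)) * F φ * (uK V K (φ.1 i) - uK V K (φ.1 l))⁻¹)) := fun φ => by
    rw [Dk_apply, Dk_apply, Derivation.leibniz]
    simp only [div_eq_mul_inv, sub_mul, mul_assoc, mul_sub, Finset.sum_sub_distrib,
      ← Finset.mul_sum, smul_eq_mul]
    have : ∑ l, P (φ.comp (swap i l)) * (F φ * (uK V K (φ.1 i) - uK V K (φ.1 l))⁻¹) =
      (∑ l, P (φ.comp (swap i l)) * (uK V K (φ.1 i) - uK V K (φ.1 l))⁻¹) * F φ := by
      rw [Finset.sum_mul]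
      exact Finset.sum_congr rfl fun l _ => by ring
    rw [this]
    ring
  simp only [h5, Finset.sum_sub_distrib, ← Finset.mul_sum, Finset.sum_add_distrib, h4]
  ring

/-- Functions whose pairings with all test functions lie in a given space. -/
def pcl (T : Submodule ℂ K) : Submodule ℂ (Cfg A wt → K) where
  carrier := {F | ∀ P ∈ PP A wt K, ∑ φ, P φ * F φ ∈ T}
  zero_mem' P _ := by simp
  add_mem' {F G} hF hG P hP := by
    simp only [Pi.add_apply, mul_add, Finset.sum_add_distrib]
    exact add_mem (hF P hP) (hG P hP)
  smul_mem' z F hF P hP := by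
    simp only [Pi.smul_apply, mul_smul_comm, ← Finset.smul_sum]
    exact T.smul_mem z (hF P hP)

variable {T : Submodule ℂ K} {F : Cfg A wt → K}

lemma mem_pcl : F ∈ pcl T ↔ ∀ P ∈ PP A wt K, ∑ φ, P φ * F φ ∈ T := Iff.rfl

lemma pcl_mul {P : Cfg A wt → K} (hP : P ∈ PP A wt K) (hF : F ∈ pcl T) : P * F ∈ pcl T := 
  fun Q hQ => by
    convert hF _ (mul_mem hQ hP) using 2 with φ
    exact (mul_assoc _ _ _).symm

lemma pcl_sum (hF : F ∈ pcl T) : ∑ φ, F φ ∈ T := by simpa using hF 1 (one_mem _)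

lemma pcl_cst_mul {x : K} (hx : ∀ t ∈ T, x * t ∈ T) (hF : F ∈ pcl T) : cst A wt K x * F ∈ pcl T := 
  fun P hP => by
    have : ∑ φ, P φ * (cst A wt K x * F) φ = x * ∑ φ, P φ * F φ := by
      rw [Finset.mul_sum]
      exact Finset.sum_congr rfl fun φ _ => mul_left_comm _ _ _
    rw [this]
    exact hx _ (hF P hP)

lemma pcl_rhoK (w : Perm A) (hF : F ∈ pcl T) : rhoK wt K w F ∈ pcl T := fun P hP => by
  have := hF _ (rhoK_mem_PP w⁻¹ hP)
  rw [← Equiv.sum_comp (Cfg.compEquiv w)] at this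
  convert this using 2 with φ
  change P φ * F (φ.comp w) = P ((φ.comp w).comp w⁻¹) * F (φ.comp w)
  rw [Cfg.comp_comp, mul_inv_cancel, Cfg.comp_one]

lemma pcl_Dk (hc : ∀ v, 1 < wt v → (wt v : ℂ) * c = 1) (i : A) (hF : F ∈ pcl T)
    (h : ∀ P ∈ PP A wt K, dv wt c (Gs i (P * F)) ∈ T) : Dk wt K c i F ∈ pcl T := fun P hP => by
  rw [pair_Dk]
  exact sub_mem (h P hP) (hF _ (Dk_mem_PP hc i hP))

end pairing

lemma sum_split {V K : Type*} [Fintype V] [DecidableEq V] [AddCommMonoid K] {y z : V} (h : y ≠ z)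
    (p : V → K) : ∑ e, p e = p y + p z + ∑ e ∈ (Finset.univ.erase y).erase z, p e := by
  rw [add_assoc, Finset.add_sum_erase _ _ (by simp [h.symm]), Finset.add_sum_erase _ _ (by simp)]

section mixed
variable {A V : Type} [Fintype A] [DecidableEq A] [Fintype V] [DecidableEq V] {wt : V → ℕ}
variable {K : Type} [Field K] [Algebra (MvPolynomial V ℂ) K]
  [IsFractionRing (MvPolynomial V ℂ) K] [Algebra ℂ K] [IsScalarTower ℂ (MvPolynomial V ℂ) K]
variable {m : ℕ} {y z : V}

lemma dv_mem_Opr (h : y ≠ z) (hm : 0 < m) (hy : wt y = m) (hz : wt z = 1) {G : V → K}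
    (h1 : ∀ e, e ≠ y → e ≠ z → G e ∈ Opr K m y z) (h2 : G y + G z ∈ Opr K m y z)
    (h3 : G y - m * G z ∈ TO K y z 1) : dv wt ((m : ℂ)⁻¹) G ∈ Opr K m y z := by
  have hch := charZero_K (K := K)
  have hm0 : (m : K) ≠ 0 := by exact_mod_cast hm.ne'
  have hinv : ∀ n : ℕ, (n : K)⁻¹ ∈ Opr K m y z := fun n => by
    have : (n : K)⁻¹ = algebraMap ℂ K (n : ℂ)⁻¹ := by rw [map_inv₀, map_natCast]
    rw [this]; exact algebraMap_mem _ _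
  have ht := uK_sub_ne_zero (K := K) h
  rw [dv, sum_split h]
  refine add_mem ?_ (sum_mem fun e he => ?_)
  · rw [sum_split h, sum_split h]
    have h4 : ∑ f ∈ (Finset.univ.erase y).erase z, (wt f : K) * (G y * (uK V K y - uK V K f)⁻¹ +
        G z * (uK V K z - uK V K f)⁻¹) ∈ Opr K m y z := by
      refine sum_mem fun f hf => mul_mem (natCast_mem _ _) ?_
      simp only [Finset.mem_erase] at hf
      exact cross_mem_Opr h hf.2.1 hf.1 h2 h3
    have h5 := mul_mem (hinv m) (sub_mem (main_mem_Opr h h2 h3)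
      (mul_mem (natCast_mem (Opr K m y z) 2) h4))
    convert h5 using 1
    simp only [mul_add, Finset.sum_add_distrib, hy, hz, map_inv₀, map_natCast]
    rw [← neg_sub (uK V K y) (uK V K z)]
    push_cast
    simp only [sub_self, inv_zero, mul_zero, neg_sub, inv_one, one_mul, zero_add, add_zero]
    have : (uK V K z - uK V K y)⁻¹ = -(uK V K y - uK V K z)⁻¹ := by rw [← inv_neg, neg_sub]
    rw [this]
    field_simp
    ring
  · simp only [Finset.mem_erase] at he
    have h0 := h1 e he.2.1 he.1
    refine sub_mem (mul_mem (hinv _) (dK_mem_Opr he.2.1 he.1 h0)) (mul_mem ?_ ?_)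
    · exact mul_mem (natCast_mem (Opr K m y z) 2) (algebraMap_mem _ _)
    · rw [sum_split h]
      refine add_mem ?_ (sum_mem fun f hf => ?_)
      · convert mul_mem h0 (add_inv_mem_Opr (K := K) (m := m) h he.2.1 he.1) using 1
        rw [hy, hz]; push_cast; ring
      · simp only [Finset.mem_erase] at hf
        exact mul_mem (natCast_mem _ _) (mul_mem h0 (inv_sub_mem_Opr he.2.1 he.1 hf.2.1 hf.1))

variable (A wt K) in
/-- Functions locally quasi-invariant along `y = z`. -/
def Lyz (m : ℕ) (y z : V) : Submodule ℂ (Cfg A wt → K) where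
  carrier := {F | (∀ φ, F φ ∈ loc K y z) ∧ F ∈ pcl (Subalgebra.toSubmodule (Opr K m y z))}
  zero_mem' := ⟨fun _ => zero_mem _, zero_mem _⟩
  add_mem' hF hG := ⟨fun φ => add_mem (hF.1 φ) (hG.1 φ), add_mem hF.2 hG.2⟩
  smul_mem' c _ hF := ⟨fun φ => Subalgebra.smul_mem _ (hF.1 φ) c, Submodule.smul_mem _ c hF.2⟩

variable {F : Cfg A wt → K}

lemma Lyz_of_TO (h : ∀ φ, F φ ∈ TO K y z 2) : F ∈ Lyz A wt K m y z :=
  ⟨fun φ => TO_le_loc (h φ), fun _ hP => sum_mem (S := Opr K m y z) fun _ _ =>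
    TO_two_le_Opr (mul_TO (PP_mem_loc hP _ y z) (h _))⟩

lemma Lyz_mul {P : Cfg A wt → K} (hP : P ∈ PP A wt K) (hF : F ∈ Lyz A wt K m y z) :
    P * F ∈ Lyz A wt K m y z :=
  ⟨fun φ => mul_mem (PP_mem_loc hP φ y z) (hF.1 φ), pcl_mul hP hF.2⟩

lemma Lyz_cst_mul {x : K} (hx : x ∈ Opr K m y z) (hF : F ∈ Lyz A wt K m y z) :
    cst A wt K x * F ∈ Lyz A wt K m y z :=
  ⟨fun φ => mul_mem hx.1 (hF.1 φ), pcl_cst_mul (fun _ ht => (Opr K m y z).mul_mem hx ht) hF.2⟩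

lemma Lyz_rhoK (w : Perm A) (hF : F ∈ Lyz A wt K m y z) : rhoK wt K w F ∈ Lyz A wt K m y z :=
  ⟨fun φ => hF.1 _, pcl_rhoK w hF.2⟩

lemma Lyz_sub_mul {x : K} (hx : x ∈ Opr K m y z) (k : A) (hF : F ∈ Lyz A wt K m y z) :
    (xi wt K k - cst A wt K x) * F ∈ Lyz A wt K m y z := by
  rw [sub_mul]
  exact sub_mem (Lyz_mul (xi_mem_PP k) hF) (Lyz_cst_mul hx hF)

lemma Lyz_ind_mul (h : y ≠ z) (hm : 0 < m) {e : V} (hy : e ≠ y) (hz : e ≠ z) (k : A)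
    (hF : F ∈ Lyz A wt K m y z) : ind wt K k e * F ∈ Lyz A wt K m y z := by
  set p := (m * uK V K y + uK V K z : K) / (m + 1) with hp
  have hpO : p ∈ Opr K m y z := center_mem_Opr h
  set η := (xi wt K k - cst A wt K (uK V K y)) ^ m * (xi wt K k - cst A wt K (uK V K z)) with hη
  have h1 : η * F ∈ Lyz A wt K m y z := by
    have h2 : ∀ n, (xi wt K k - cst A wt K p) ^ n * F ∈ Lyz A wt K m y z := by
      intro n
      induction n with
      | zero => simpa using hF
      | succ n ih => rw [pow_succ', mul_assoc]; exact Lyz_sub_mul hpO k ih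
    have h3 : (η - (xi wt K k - cst A wt K p) ^ (m + 1)) * F ∈ Lyz A wt K m y z :=
      Lyz_of_TO fun φ => TO_mul (sub_pow_mem_TO (uK_mem_loc (φ.1 k)) hm) (hF.1 φ)
    rw [sub_mul] at h3
    simpa using add_mem h3 (h2 (m + 1))
  set v := (uK V K e - uK V K y) ^ m * (uK V K e - uK V K z) with hv
  have hvO : v⁻¹ ∈ Opr K m y z := by
    refine inv_mem_Opr ?_ ?_
    · have := add_mem (TO_two_le_Opr (m := m) (sub_pow_mem_TO (uK_mem_loc (K := K) (a := y) (b := z) e) hm))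
        (pow_mem (sub_mem (uK_mem_Opr (K := K) hy hz) hpO) (m + 1))
      rwa [sub_add_cancel] at this
    · rw [hv, mul_inv, ← inv_pow]
      exact mul_mem (pow_mem (inv_sub_mem_loc (fun h => hy h.1) (fun h => hz h.1)) _)
        (inv_sub_mem_loc (fun h => hy h.1) (fun h => hz h.1))
  have h4 : ind wt K k e = (∏ f ∈ ((Finset.univ.erase y).erase z).erase e,
      (cst A wt K (uK V K e - uK V K f)⁻¹ * (xi wt K k - cst A wt K (uK V K f)))) * 
      (cst A wt K v⁻¹ * η) := by
    funext φ
    simp only [Pi.mul_apply, Finset.prod_apply, Pi.sub_apply, cst_apply, xi_apply, ind, hη, hv,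
      Pi.pow_apply]
    split_ifs with hk
    · rw [hk, Finset.prod_eq_one fun f hf => inv_mul_cancel₀
        (uK_sub_ne_zero (Finset.ne_of_mem_erase hf).symm), one_mul, inv_mul_cancel₀]
      exact mul_ne_zero (pow_ne_zero _ (uK_sub_ne_zero hy)) (uK_sub_ne_zero hz)
    · by_cases h1 : φ.1 k = y
      · rw [h1, sub_self, zero_pow hm.ne']; simp
      by_cases h2 : φ.1 k = z
      · rw [h2, sub_self]; simp
      rw [Finset.prod_eq_zero (i := φ.1 k) (by simp [h1, h2, hk]) (by simp), zero_mul]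
  rw [h4, mul_assoc, mul_assoc]
  have h5 := Lyz_cst_mul hvO h1
  have h6 : ∀ S ⊆ ((Finset.univ.erase y).erase z).erase e, (∏ f ∈ S,
      (cst A wt K (uK V K e - uK V K f)⁻¹ * (xi wt K k - cst A wt K (uK V K f)))) * 
      (cst A wt K v⁻¹ * (η * F)) ∈ Lyz A wt K m y z := by
    intro S
    induction S using Finset.induction_on with
    | empty => intro _; simpa using h5
    | insert f S hf ih =>
      intro hS
      have hf' := hS (Finset.mem_insert_self f S)
      simp only [Finset.mem_erase] at hf'
      rw [Finset.prod_insert hf, mul_assoc, mul_assoc]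
      refine Lyz_cst_mul (inv_sub_mem_Opr hy hz hf'.2.2.1 hf'.2.1) (Lyz_sub_mul 
        (uK_mem_Opr hf'.2.2.1 hf'.2.1) k (ih fun x hx => hS (Finset.mem_insert_of_mem hx)))
  exact h6 _ subset_rfl

lemma Gs_mem_Opr (h : y ≠ z) (hm : 0 < m) (i : A) (hF : F ∈ Lyz A wt K m y z) {e : V}
    (hy : e ≠ y) (hz : e ≠ z) : Gs i F e ∈ Opr K m y z :=
  pcl_sum (Lyz_ind_mul h hm hy hz i hF).2

lemma Gs_mem_loc (i : A) (hF : F ∈ Lyz A wt K m y z) (e : V) : Gs i F e ∈ loc K y z := by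
  refine sum_mem fun φ _ => ?_
  rw [ind]
  split_ifs
  · rw [one_mul]; exact hF.1 φ
  · rw [zero_mul]; exact zero_mem _

lemma Gs_add_mem_Opr (h : y ≠ z) (hm : 0 < m) (i : A) (hF : F ∈ Lyz A wt K m y z) :
    Gs i F y + Gs i F z ∈ Opr K m y z := by
  have h1 := sum_split h (Gs i F)
  have h2 := sum_mul_Gs i F fun _ => 1
  simp only [one_mul] at h2
  rw [eq_sub_of_add_eq h1.symm, h2]
  refine sub_mem (pcl_sum hF.2) (sum_mem fun e he => ?_)
  simp only [Finset.mem_erase] at he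
  exact Gs_mem_Opr h hm i hF he.2.1 he.1

lemma Gs_sub_mem_TO (h : y ≠ z) (hm : 0 < m) (i : A) (hF : F ∈ Lyz A wt K m y z) :
    Gs i F y - m * Gs i F z ∈ TO K y z 1 := by
  refine sub_mul_mem_TO h (Gs_mem_loc i hF z) (Gs_add_mem_Opr h hm i hF) ?_
  have h1 := sum_split h fun e => uK V K e * Gs i F e
  have h2 := sum_mul_Gs i F (uK V K)
  rw [eq_sub_of_add_eq h1.symm, h2]
  refine sub_mem (pcl_sum (Lyz_mul (xi_mem_PP i) hF).2) (sum_mem fun e he => ?_)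
  simp only [Finset.mem_erase] at he
  exact mul_mem (uK_mem_Opr he.2.1 he.1) (Gs_mem_Opr h hm i hF he.2.1 he.1)

lemma Cfg.eq_of_agree {φ ψ : Cfg A wt} (hz : wt z = 1) {j : A} (hj : φ.1 j = z) (hj' : ψ.1 j = z)
    (hag : ∀ k, φ.1 k ≠ y → φ.1 k ≠ z → ψ.1 k = φ.1 k) : ψ = φ := by
  apply Subtype.ext
  have hone : ∀ (χ : Cfg A wt) k, χ.1 j = z → χ.1 k = z → k = j := fun χ k h1 h2 => 
    Finset.card_le_one.1 (le_of_eq ((χ.2 z).trans hz)) k (by simp [h2]) j (by simp [h1])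
  funext k
  by_cases h1 : φ.1 k = z
  · rw [hone φ k hj h1, hj, hj']
  by_cases h2 : φ.1 k = y
  · by_contra h3
    have h4 : ψ.1 k ≠ z := fun h => h1 (by rw [hone ψ k hj' h, hj])
    have h5 : Finset.univ.filter (φ.1 · = ψ.1 k) = Finset.univ.filter (ψ.1 · = ψ.1 k) := by
      refine Finset.eq_of_subset_of_card_le (fun l hl => ?_) (by rw [φ.2, ψ.2])
      simp only [Finset.mem_filter, Finset.mem_univ, true_and] at hl ⊢
      rw [hag l (by rw [hl, ← h2]; exact h3) (by rw [hl]; exact h4), hl]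
    have h6 : k ∈ Finset.univ.filter (φ.1 · = ψ.1 k) := by rw [h5]; simp
    exact h3 (Finset.mem_filter.1 h6).2.symm
  · exact hag k h2 h1

lemma Lyz_sub_mem_TO (h : y ≠ z) (hm : 0 < m) (hz : wt z = 1) (hF : F ∈ Lyz A wt K m y z)
    {φ : Cfg A wt} {i j : A} (hi : φ.1 i = y) (hj : φ.1 j = z) :
    F φ - F (φ.comp (swap i j)) ∈ TO K y z 1 := by
  have hij : i ≠ j := fun e => h (by rw [← hi, ← hj, e])
  set S := Finset.univ.filter fun k => φ.1 k ≠ y ∧ φ.1 k ≠ z with hS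
  set F' := (∏ k ∈ S, ind wt K k (φ.1 k)) * F with hF'
  have h1 : F' ∈ Lyz A wt K m y z := by
    have : ∀ T ⊆ S, (∏ k ∈ T, ind wt K k (φ.1 k)) * F ∈ Lyz A wt K m y z := by
      intro T
      induction T using Finset.induction_on with
      | empty => intro _; simpa using hF
      | insert f T hf ih =>
        intro hT
        have hf' := (Finset.mem_filter.1 (hT (Finset.mem_insert_self f T))).2
        rw [Finset.prod_insert hf, mul_assoc]
        exact Lyz_ind_mul h hm hf'.1 hf'.2 f (ih fun x hx => hT (Finset.mem_insert_of_mem hx))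
    exact this S subset_rfl
  have h2 : ∀ ψ : Cfg A wt, F' ψ ≠ 0 → ∀ k, φ.1 k ≠ y → φ.1 k ≠ z → ψ.1 k = φ.1 k := by
    intro ψ hψ k hk hk'
    by_contra h3
    apply hψ
    rw [hF', Pi.mul_apply, Finset.prod_apply, Finset.prod_eq_zero (i := k) (by simp [hS, hk, hk'])
      (by simp [ind, h3]), zero_mul]
  have h3 : ∀ ψ : Cfg A wt, (∀ k, φ.1 k ≠ y → φ.1 k ≠ z → ψ.1 k = φ.1 k) → F' ψ = F ψ := by
    intro ψ hψ
    rw [hF', Pi.mul_apply, Finset.prod_apply, Finset.prod_eq_one, one_mul]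
    intro k hk
    have := (Finset.mem_filter.1 hk).2
    simp [ind, hψ k this.1 this.2]
  have h4 : ∀ k, (φ.1 k = y ∨ φ.1 k = z) → ∀ e, e ≠ y → e ≠ z → Gs k F' e = 0 := by
    intro k hk e hy hz
    refine Finset.sum_eq_zero fun ψ _ => ?_
    by_cases h5 : F' ψ = 0
    · rw [h5, mul_zero]
    have h6 : Finset.univ.filter (φ.1 · = e) = Finset.univ.filter (ψ.1 · = e) := by
      refine Finset.eq_of_subset_of_card_le (fun l hl => ?_) (by rw [φ.2, ψ.2])
      simp only [Finset.mem_filter, Finset.mem_univ, true_and] at hl ⊢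
      rw [h2 ψ h5 l (by rw [hl]; exact hy) (by rw [hl]; exact hz), hl]
    have h7 : ψ.1 k ≠ e := fun h8 => by
      have : k ∈ Finset.univ.filter (φ.1 · = e) := by rw [h6]; simp [h8]
      have h9 := (Finset.mem_filter.1 this).2
      rcases hk with hk | hk
      · exact hy (by rw [← h9, hk])
      · exact hz (by rw [← h9, hk])
    simp [ind, h7]
  have h5 : ∀ k, (φ.1 k = y ∨ φ.1 k = z) → ∑ ψ, F' ψ - (m + 1) * Gs k F' z ∈ TO K y z 1 := by
    intro k hk
    have h6 := sum_split h (Gs k F')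
    have h7 := sum_mul_Gs k F' fun _ => 1
    simp only [one_mul] at h7
    rw [h7, Finset.sum_eq_zero fun e he => h4 k hk e (by simp at he; exact he.2) (by simp at he; exact he.1),
      add_zero] at h6
    convert Gs_sub_mem_TO h hm k h1 using 1
    rw [h6]; ring
  have h6 : Gs j F' z = F φ := by
    rw [Gs, Finset.sum_eq_single φ]
    · rw [h3 φ fun _ _ _ => rfl]; simp [ind, hj]
    · intro ψ _ hψ
      by_cases h7 : F' ψ = 0
      · rw [h7, mul_zero]
      have : ψ.1 j ≠ z := fun h8 => hψ (Cfg.eq_of_agree hz hj h8 (h2 ψ h7))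
      simp [ind, this]
    · simp
  have hsw : ∀ k, φ.1 k ≠ y → φ.1 k ≠ z → (φ.comp (swap i j)).1 k = φ.1 k := fun k hk hk' => by
    rw [Cfg.comp_apply, swap_apply_of_ne_of_ne (fun e => hk (by rw [e, hi]))
      (fun e => hk' (by rw [e, hj]))]
  have h7 : Gs i F' z = F (φ.comp (swap i j)) := by
    rw [Gs, Finset.sum_eq_single (φ.comp (swap i j))]
    · rw [h3 _ hsw]; simp [ind, hj]
    · intro ψ _ hψ
      by_cases h7 : F' ψ = 0
      · rw [h7, mul_zero]
      have : ψ.1 i ≠ z := fun h8 => hψ (Cfg.eq_of_agree (y := y) hz (j := i) (by simp [hj]) h8 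
        fun k hk hk' => by
          have hki : k ≠ i := fun e => hk' (by rw [e]; simp [hj])
          have hkj : k ≠ j := fun e => hk (by rw [e]; simp [hi])
          rw [Cfg.comp_apply, swap_apply_of_ne_of_ne hki hkj] at hk hk' ⊢
          exact h2 ψ h7 k hk hk')
      simp [ind, this]
    · simp
  have h8 := sub_mem (h5 i (Or.inl hi)) (h5 j (Or.inr hj))
  have h9 : ((m : ℂ) + 1) ≠ 0 := by exact_mod_cast Nat.succ_ne_zero m
  refine ((TO K y z 1).smul_mem_iff h9).1 ?_
  convert h8 using 1
  rw [h6, h7, Algebra.smul_def, map_add, map_natCast, map_one]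
  ring

lemma inv_natCast_mem_loc (n : ℕ) : (n : K)⁻¹ ∈ loc K y z := by
  have : (n : K)⁻¹ = algebraMap ℂ K (n : ℂ)⁻¹ := by rw [map_inv₀, map_natCast]
  rw [this]; exact algebraMap_mem _ _

lemma div_t_mem_loc (h : y ≠ z) {x : K} (hx : x ∈ TO K y z 1) : x / (uK V K y - uK V K z) ∈ loc K y z := by
  obtain ⟨c, hc, rfl⟩ := mem_TO.1 hx
  rwa [pow_one, mul_div_cancel_left₀ _ (uK_sub_ne_zero h)]

/-- Dunkl operators preserve regularity at a generic point of `y = z`. -/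
lemma Dk_mem_loc (h : y ≠ z) {c : ℂ} (hF : ∀ φ, F φ ∈ loc K y z)
    (hs : ∀ (φ : Cfg A wt) i j, φ.1 i = y → φ.1 j = z → F φ - F (φ.comp (swap i j)) ∈ TO K y z 1)
    (i : A) (φ : Cfg A wt) : Dk wt K c i F φ ∈ loc K y z := by
  rw [Dk_apply]
  refine sub_mem (mul_mem (inv_natCast_mem_loc _) (dK_mem_loc _ (hF φ)))
    (mul_mem (algebraMap_mem _ _) (sum_mem fun l _ => ?_))
  by_cases h1 : φ.1 i = y ∧ φ.1 l = z
  · rw [h1.1, h1.2]; exact div_t_mem_loc h (hs φ i l h1.1 h1.2)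
  by_cases h2 : φ.1 i = z ∧ φ.1 l = y
  · rw [h2.1, h2.2, ← neg_sub (uK V K y), div_neg, swap_comm]
    exact neg_mem (div_t_mem_loc h (hs φ l i h2.2 h2.1))
  rw [div_eq_mul_inv]
  exact mul_mem (sub_mem (hF _) (hF _)) (inv_sub_mem_loc h1 h2)

lemma Lyz_Dk (h : y ≠ z) (hm : 0 < m) (hy : wt y = m) (hz : wt z = 1)
    (hc : ∀ v, 1 < wt v → (wt v : ℂ) * (m : ℂ)⁻¹ = 1) (i : A) (hF : F ∈ Lyz A wt K m y z) :
    Dk wt K ((m : ℂ)⁻¹) i F ∈ Lyz A wt K m y z := by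
  refine ⟨Dk_mem_loc h hF.1 (fun φ i j hi hj => Lyz_sub_mem_TO h hm hz hF hi hj) i,
    pcl_Dk hc i hF.2 fun P hP => ?_⟩
  have hPF := Lyz_mul hP hF
  exact dv_mem_Opr h hm hy hz (fun e he he' => Gs_mem_Opr h hm i hPF he he')
    (Gs_add_mem_Opr h hm i hPF) (Gs_sub_mem_TO h hm i hPF)

end mixed

section hat
variable {A V : Type} [Fintype A] [DecidableEq A] [Fintype V] [DecidableEq V] {wt : V → ℕ}
variable {K : Type} [Field K] [Algebra (MvPolynomial V ℂ) K]
  [IsFractionRing (MvPolynomial V ℂ) K] [Algebra ℂ K] [IsScalarTower ℂ (MvPolynomial V ℂ) K]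
variable {a b : V} (h : wt a = wt b)

include h in
lemma wt_swap (v : V) : wt (swap a b v) = wt v := by
  by_cases h1 : v = a
  · rw [h1, swap_apply_left, h]
  by_cases h2 : v = b
  · rw [h2, swap_apply_right, h]
  rw [swap_apply_of_ne_of_ne h1 h2]

/-- Exchange of two points of a configuration. -/
def Cfg.lab (φ : Cfg A wt) : Cfg A wt := ⟨fun i => swap a b (φ.1 i), fun v => by
  rw [← wt_swap h v, ← φ.2 (swap a b v)]
  congr 1
  ext i
  simp only [Finset.mem_filter, Finset.mem_univ, true_and]
  exact ⟨fun e => by rw [← e, swap_apply_self], fun e => by rw [e, swap_apply_self]⟩⟩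

@[simp] lemma Cfg.lab_apply (φ : Cfg A wt) (i : A) : (φ.lab h).1 i = swap a b (φ.1 i) := rfl

@[simp] lemma Cfg.lab_lab (φ : Cfg A wt) : (φ.lab h).lab h = φ := 
  Subtype.ext (funext fun i => by simp)

/-- Exchange of two points as a permutation of configurations. -/
def Cfg.labEquiv : Perm (Cfg A wt) := ⟨Cfg.lab h, Cfg.lab h, Cfg.lab_lab h, Cfg.lab_lab h⟩

variable (K) in
/-- Simultaneous exchange of two points and of the corresponding variables. -/
def hat : (Cfg A wt → K) →ₐ[ℂ] (Cfg A wt → K) where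
  toFun F φ := sK K (swap a b) (F (φ.lab h))
  map_one' := by ext; simp
  map_mul' F G := by ext; simp
  map_zero' := by ext; simp
  map_add' F G := by ext; simp
  commutes' z := by ext; simp

lemma hat_apply (F : Cfg A wt → K) (φ : Cfg A wt) :
    hat K h F φ = sK K (swap a b) (F (φ.lab h)) := rfl

@[simp] lemma sK_swap_swap (x : K) : sK K (swap a b) (sK K (swap a b) x) = x := by
  rw [← sK_mul, swap_mul_self, sK_one]

@[simp] lemma hat_xi (i : A) : hat K h (xi wt K i) = xi wt K i := by
  ext φ; rw [hat_apply, xi_apply, xi_apply, sK_uK, Cfg.lab_apply, swap_apply_self]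

@[simp] lemma hat_cst (x : K) : hat K h (cst A wt K x) = cst A wt K (sK K (swap a b) x) := rfl

lemma hat_rhoK (w : Perm A) (F : Cfg A wt → K) :
    hat K h (rhoK wt K w F) = rhoK wt K w (hat K h F) := rfl

lemma hat_Dk {c : ℂ} (i : A) (F : Cfg A wt → K) :
    hat K h (Dk wt K c i F) = Dk wt K c i (hat K h F) := by
  ext φ
  rw [hat_apply, Dk_apply, Dk_apply, map_sub, map_mul, map_mul, map_sum, map_inv₀, map_natCast,
    sK_dK, AlgEquiv.commutes, Cfg.lab_apply, swap_apply_self, wt_swap h, hat_apply]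
  congr 2
  refine Finset.sum_congr rfl fun l _ => ?_
  rw [map_div₀, map_sub, map_sub, sK_uK, sK_uK, Cfg.lab_apply, swap_apply_self, swap_apply_self]
  rfl

lemma hat_PP {P : Cfg A wt → K} (hP : P ∈ PP A wt K) : hat K h P = P := by
  induction hP using Algebra.adjoin_induction with
  | mem g hg => obtain ⟨k, rfl⟩ := hg; exact hat_xi h k
  | algebraMap z => exact AlgHom.commutes _ z
  | add G H _ _ hG hH => rw [map_add, hG, hH]
  | mul G H _ _ hG hH => rw [map_mul, hG, hH]

lemma sK_Gs (i : A) (F : Cfg A wt → K) : sK K (swap a b) (Gs i F a) = Gs i (hat K h F) b := by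
  rw [Gs, Gs, map_sum, ← Equiv.sum_comp (Cfg.labEquiv h)]
  refine Finset.sum_congr rfl fun φ _ => ?_
  change sK K (swap a b) (ind wt K i a (φ.lab h) * F (φ.lab h)) = _
  rw [map_mul, hat_apply]
  congr 1
  have : (swap a b (φ.1 i) = a) = (φ.1 i = b) := by
    rw [swap_apply_eq_iff, swap_apply_left]
  simp only [ind, Cfg.lab_apply, this]
  split_ifs <;> simp

end hat

section odd
variable {A V : Type} [Fintype A] [DecidableEq A] [Fintype V] [DecidableEq V] {wt : V → ℕ}
variable {K : Type} [Field K] [Algebra (MvPolynomial V ℂ) K]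
  [IsFractionRing (MvPolynomial V ℂ) K] [Algebra ℂ K] [IsScalarTower ℂ (MvPolynomial V ℂ) K]
variable {m n : ℕ} {a b : V}

lemma sum_mem_TO {ι : Type} {s : Finset ι} {f : ι → K} (hf : ∀ i ∈ s, f i ∈ TO K a b n) :
    ∑ i ∈ s, f i ∈ TO K a b n := sum_mem hf

lemma derivation_mem_TO {D : Derivation ℂ K K} (hD : ∀ x ∈ loc K a b, D x ∈ loc K a b)
    (ht : D (uK V K a - uK V K b) = 0) {x : K} (hx : x ∈ TO K a b n) : D x ∈ TO K a b n := by
  obtain ⟨c, hc, rfl⟩ := mem_TO.1 hx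
  rw [Derivation.leibniz, Derivation.leibniz_pow, ht]
  exact mem_TO.2 ⟨_, hD c hc, by simp⟩

lemma dK_mem_TO {e : V} (ha : e ≠ a) (hb : e ≠ b) {x : K} (hx : x ∈ TO K a b n) :
    dK K e x ∈ TO K a b n :=
  derivation_mem_TO (fun _ => dK_mem_loc e) (by rw [map_sub, dK_uK_ne ha, dK_uK_ne hb, sub_zero]) hx

lemma dK_add_dK_mem_TO (h : a ≠ b) {x : K} (hx : x ∈ TO K a b n) :
    dK K a x + dK K b x ∈ TO K a b n :=
  derivation_mem_TO (D := dK K a + dK K b) (fun _ hx => add_mem (dK_mem_loc a hx) (dK_mem_loc b hx)) (by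
    rw [Derivation.add_apply, map_sub, map_sub, dK_uK_self, dK_uK_self, dK_uK_ne h, dK_uK_ne h.symm]
    ring) hx

lemma mem_TO_of_t_mul (h : a ≠ b) {x : K} (hx : (uK V K a - uK V K b) * x ∈ TO K a b (n + 1)) :
    x ∈ TO K a b n :=
  mem_TO_of_pow_mul h (k := 1) (by rwa [pow_one, add_comm])

lemma dv_mem_odd (h : a ≠ b) (hm : 0 < m) (ha : wt a = m) (hb : wt b = m) {G : V → K}
    (h1 : ∀ e, e ≠ a → e ≠ b → G e ∈ TO K a b (2 * m + 1)) (h2 : G a + G b ∈ TO K a b (2 * m + 1))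
    (h3 : uK V K a * G a + uK V K b * G b ∈ TO K a b (2 * m + 1))
    (h4 : sK K (swap a b) (G a) = - G b) : dv wt ((m : ℂ)⁻¹) G ∈ TO K a b (2 * m + 1) := by
  have hch := charZero_K (K := K)
  have hm0 : (m : K) ≠ 0 := by exact_mod_cast hm.ne'
  have ht := uK_sub_ne_zero (K := K) h
  have hGa : G a ∈ TO K a b (2 * m) := mem_TO_of_t_mul h (by
    convert sub_mem h3 (mul_TO (uK_mem_loc b) h2) using 1; ring)
  have hGb : G b ∈ TO K a b (2 * m) := mem_TO_of_t_mul h (by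
    convert sub_mem (mul_TO (uK_mem_loc a) h2) h3 using 1; ring)
  obtain ⟨k, hk, hk'⟩ := mem_TO.1 (sub_mem hGa hGb)
  have h5 : sK K (swap a b) (G b) = - G a := by
    rw [← neg_eq_iff_eq_neg, ← map_neg, ← h4, sK_swap_swap]
  have h6 : sK K (swap a b) k = k := by
    have h7 : sK K (swap a b) (G a - G b) = G a - G b := by rw [map_sub, h4, h5]; ring
    rw [hk', map_mul, map_pow, map_sub, sK_uK, sK_uK, swap_apply_left, swap_apply_right, ← neg_sub,
      Even.neg_pow ⟨m, two_mul m⟩] at h7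
    exact mul_left_cancel₀ (pow_ne_zero _ ht) h7
  have h7 : dK K a k - dK K b k ∈ TO K a b 1 := by
    refine odd_mem_TO (sub_mem (dK_mem_loc a hk) (dK_mem_loc b hk)) ?_
    rw [map_sub, sK_dK, sK_dK, h6, swap_apply_left, swap_apply_right, neg_sub]
  have h8 : dK K a (G a) + dK K b (G b) - 2 * m * ((G a - G b) * (uK V K a - uK V K b)⁻¹) ∈
      TO K a b (2 * m + 1) := by
    have h9 := (TO K a b (2 * m + 1)).smul_mem (2⁻¹ : ℂ) (add_mem (dK_add_dK_mem_TO h h2)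
      (pow_mul_TO (k := 2 * m) h7))
    convert h9 using 1
    have h10 : dK K a (G a - G b) - dK K b (G a - G b) = 
        4 * m * ((G a - G b) * (uK V K a - uK V K b)⁻¹) + (uK V K a - uK V K b) ^ (2 * m) *
        (dK K a k - dK K b k) := by
      obtain ⟨p, rfl⟩ : ∃ p, m = p + 1 := ⟨m - 1, by omega⟩
      rw [hk', Derivation.leibniz, Derivation.leibniz, Derivation.leibniz_pow, Derivation.leibniz_pow,
        map_sub, map_sub, dK_uK_self, dK_uK_self, dK_uK_ne h, dK_uK_ne h.symm]
      have : 2 * (p + 1) - 1 = 2 * p + 1 := by omega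
      rw [this]
      have : (uK V K a - uK V K b) ^ (2 * (p + 1)) = 
        (uK V K a - uK V K b) ^ (2 * p + 1) * (uK V K a - uK V K b) := by ring
      rw [this]
      simp only [smul_eq_mul, nsmul_eq_mul]
      push_cast
      field_simp
      ring
    rw [Algebra.smul_def, map_inv₀, map_ofNat]
    rw [map_sub, map_sub] at h10
    rw [map_add, map_add]
    linear_combination (1 / 2 : K) * h10
  have hinv : ∀ n : ℕ, (n : K)⁻¹ ∈ loc K a b := inv_natCast_mem_loc
  rw [dv, sum_split h]
  refine add_mem ?_ (sum_mem_TO fun e he => ?_)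
  · rw [sum_split h, sum_split h]
    have h10 : ∑ f ∈ (Finset.univ.erase a).erase b, (wt f : K) * (G a * (uK V K a - uK V K f)⁻¹ +
        G b * (uK V K b - uK V K f)⁻¹) ∈ TO K a b (2 * m + 1) := by
      refine sum_mem_TO fun f hf => mul_TO (natCast_mem _ _) ?_
      simp only [Finset.mem_erase] at hf
      have h11 := mul_TO (mul_mem (inv_sub_mem_loc (e := a) (f := f) (by tauto) (by tauto))
        (inv_sub_mem_loc (e := b) (f := f) (by tauto) (by tauto))) (sub_mem (mul_TO (sub_mem (add_mem 
        (uK_mem_loc (K := K) a) (uK_mem_loc b)) (uK_mem_loc f)) h2) h3)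
      convert h11 using 1
      have := uK_sub_ne_zero (K := K) (Ne.symm hf.1)
      have := uK_sub_ne_zero (K := K) (Ne.symm hf.2.1)
      field_simp
      ring
    have h12 := mul_TO (hinv m) (sub_mem h8 (mul_TO (natCast_mem (loc K a b) 2) h10))
    convert h12 using 1
    simp only [mul_add, Finset.sum_add_distrib, ha, hb, map_inv₀, map_natCast]
    have : (uK V K b - uK V K a)⁻¹ = -(uK V K a - uK V K b)⁻¹ := by rw [← inv_neg, neg_sub]
    rw [this]
    push_cast
    simp only [sub_self, inv_zero, mul_zero, zero_add, add_zero]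
    field_simp
    ring
  · simp only [Finset.mem_erase] at he
    have h0 := h1 e he.2.1 he.1
    refine sub_mem (mul_TO (hinv _) (dK_mem_TO he.2.1 he.1 h0)) (mul_TO ?_ (sum_mem_TO fun f _ => ?_))
    · exact mul_mem (natCast_mem (loc K a b) 2) (algebraMap_mem _ _)
    · exact mul_TO (natCast_mem _ _) (TO_mul h0 (inv_sub_mem_loc (by tauto) (by tauto)))

lemma pcl_TO_ind {e : V} (ha : e ≠ a) (hb : e ≠ b) (k : A) {F : Cfg A wt → K}
    (hF : F ∈ pcl (TO K a b n)) : ind wt K k e * F ∈ pcl (TO K a b n) := by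
  rw [ind_eq_prod]
  generalize Finset.univ.erase e = S
  induction S using Finset.induction_on with
  | empty => simpa using hF
  | insert f S hf ih =>
    rw [Finset.prod_insert hf, mul_assoc, mul_assoc, sub_mul]
    exact pcl_cst_mul (fun t ht => mul_TO (inv_sub_mem_loc (by tauto) (by tauto)) ht)
      (sub_mem (pcl_mul (xi_mem_PP k) ih) (pcl_cst_mul (fun t ht => mul_TO (uK_mem_loc f) ht) ih))

lemma pcl_TO_apply (h : a ≠ b) {F : Cfg A wt → K} (hF : F ∈ pcl (TO K a b (wt a + n)))
    (φ : Cfg A wt) : F φ ∈ TO K a b n := by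
  set S := Finset.univ.filter fun k => φ.1 k ≠ a ∧ φ.1 k ≠ b with hS
  set U := Finset.univ.filter fun k => φ.1 k = a with hU
  have h1 : ∀ T ⊆ S, (∏ k ∈ T, ind wt K k (φ.1 k)) * F ∈ pcl (TO K a b (wt a + n)) := by
    intro T
    induction T using Finset.induction_on with
    | empty => intro _; simpa using hF
    | insert f T hf ih =>
      intro hT
      have hf' := (Finset.mem_filter.1 (hT (Finset.mem_insert_self f T))).2
      rw [Finset.prod_insert hf, mul_assoc]
      exact pcl_TO_ind hf'.1 hf'.2 f (ih fun x hx => hT (Finset.mem_insert_of_mem hx))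
  have h2 : ∀ U : Finset A, (∏ k ∈ U, (xi wt K k - cst A wt K (uK V K b))) * 
      ((∏ k ∈ S, ind wt K k (φ.1 k)) * F) ∈ pcl (TO K a b (wt a + n)) := by
    intro U
    induction U using Finset.induction_on with
    | empty => simpa using h1 S subset_rfl
    | insert f T hf ih =>
      rw [Finset.prod_insert hf, mul_assoc, sub_mul]
      exact sub_mem (pcl_mul (xi_mem_PP f) ih) (pcl_cst_mul (fun t ht => mul_TO (uK_mem_loc b) ht) ih)
  have h3 := pcl_sum (h2 U)
  rw [Finset.sum_eq_single φ] at h3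
  · refine mem_TO_of_pow_mul h (k := wt a) ?_
    convert h3 using 1
    simp only [Pi.mul_apply, Finset.prod_apply, Pi.sub_apply, xi_apply, cst_apply]
    rw [Finset.prod_congr rfl fun k hk => by rw [(Finset.mem_filter.1 hk).2], Finset.prod_const, hU,
      φ.2, Finset.prod_eq_one fun k hk => by simp [ind], one_mul]
  · intro ψ _ hψ
    by_contra h4
    simp only [Pi.mul_apply, Finset.prod_apply, Pi.sub_apply, xi_apply, cst_apply, mul_eq_zero,
      not_or, Finset.prod_ne_zero_iff, ind] at h4
    refine hψ (Subtype.ext (funext fun k => ?_))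
    have h5 : ∀ k, φ.1 k ≠ a → φ.1 k ≠ b → ψ.1 k = φ.1 k := fun k hk hk' => by
      by_contra h6
      exact h4.2.1 k (by simp [hS, hk, hk']) (by simp [h6])
    have h5' : ∀ e, e ≠ a → e ≠ b → ∀ k, ψ.1 k = e → φ.1 k = e := fun e ha hb k hk => by
      have h6 : Finset.univ.filter (φ.1 · = e) = Finset.univ.filter (ψ.1 · = e) := by
        refine Finset.eq_of_subset_of_card_le (fun l hl => ?_) (by rw [φ.2, ψ.2])
        simp only [Finset.mem_filter, Finset.mem_univ, true_and] at hl ⊢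
        rw [h5 l (by rw [hl]; exact ha) (by rw [hl]; exact hb), hl]
      have h7 : k ∈ Finset.univ.filter (φ.1 · = e) := by rw [h6]; simp [hk]
      exact (Finset.mem_filter.1 h7).2
    have h6 : ∀ k, φ.1 k = a → ψ.1 k = a := fun k hk => by
      by_contra h6
      by_cases h7 : ψ.1 k = b
      · exact h4.1 k (by simp [hU, hk]) (by rw [h7, sub_self])
      · exact h6 ((h5' _ h6 h7 k rfl).symm.trans hk)
    by_cases h7 : φ.1 k = a
    · rw [h6 k h7, h7]
    by_cases h8 : φ.1 k = b
    · by_contra h9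
      by_cases h10 : ψ.1 k = a
      · have h11 : Finset.univ.filter (φ.1 · = a) = Finset.univ.filter (ψ.1 · = a) := by
          refine Finset.eq_of_subset_of_card_le (fun l hl => ?_) (by rw [φ.2, ψ.2])
          simp only [Finset.mem_filter, Finset.mem_univ, true_and] at hl ⊢
          exact h6 l hl
        have h12 : k ∈ Finset.univ.filter (φ.1 · = a) := by rw [h11]; simp [h10]
        exact h7 (Finset.mem_filter.1 h12).2
      · exact h9 (h5' _ h10 (by rwa [h8] at h9) k rfl).symm
    · exact h5 k h7 h8
  · simp

variable (A K) in
/-- Functions odd with respect to an exchange, with highly divisible pairings. -/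
def Lodd (hab : wt a = wt b) : Submodule ℂ (Cfg A wt → K) where
  carrier := {F | hat K hab F = -F ∧ F ∈ pcl (TO K a b (2 * wt a + 1))}
  zero_mem' := ⟨by simp, zero_mem _⟩
  add_mem' hF hG := ⟨by rw [map_add, hF.1, hG.1, neg_add], add_mem hF.2 hG.2⟩
  smul_mem' c _ hF := ⟨by rw [map_smul, hF.1, smul_neg], Submodule.smul_mem _ c hF.2⟩

variable {hab : wt a = wt b} {F : Cfg A wt → K}

lemma Lodd_mul {P : Cfg A wt → K} (hP : P ∈ PP A wt K) (hF : F ∈ Lodd A K hab) :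
    P * F ∈ Lodd A K hab := ⟨by rw [map_mul, hF.1, hat_PP hab hP, mul_neg], pcl_mul hP hF.2⟩

lemma Lodd_rhoK (w : Perm A) (hF : F ∈ Lodd A K hab) : rhoK wt K w F ∈ Lodd A K hab :=
  ⟨by rw [hat_rhoK, hF.1, map_neg], pcl_rhoK w hF.2⟩

lemma Lodd_cst_mul {x : K} (hx : x ∈ loc K a b) (hs : sK K (swap a b) x = x)
    (hF : F ∈ Lodd A K hab) : cst A wt K x * F ∈ Lodd A K hab :=
  ⟨by rw [map_mul, hF.1, hat_cst, hs, mul_neg], pcl_cst_mul (fun t ht => mul_TO hx ht) hF.2⟩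

lemma Lodd_Dk (h : a ≠ b) (ha : 0 < wt a)
    (hc : ∀ v, 1 < wt v → (wt v : ℂ) * (wt a : ℂ)⁻¹ = 1) (i : A) (hF : F ∈ Lodd A K hab) :
    Dk wt K ((wt a : ℂ)⁻¹) i F ∈ Lodd A K hab := by
  refine ⟨by rw [hat_Dk, hF.1, map_neg], pcl_Dk hc i hF.2 fun P hP => ?_⟩
  have hPF := Lodd_mul hP hF
  have h1 : ∀ e, e ≠ a → e ≠ b → Gs i (P * F) e ∈ TO K a b (2 * wt a + 1) := fun e h1 h2 =>
    pcl_sum (pcl_TO_ind h1 h2 i hPF.2)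
  refine dv_mem_odd h ha rfl hab.symm h1 ?_ ?_ ?_
  · have h3 := sum_split h (Gs i (P * F))
    have h2 := sum_mul_Gs i (P * F) fun _ => 1
    simp only [one_mul] at h2
    rw [eq_sub_of_add_eq h3.symm, h2]
    refine sub_mem (pcl_sum hPF.2) (sum_mem_TO fun e he => ?_)
    simp only [Finset.mem_erase] at he
    exact h1 e he.2.1 he.1
  · have h3 := sum_split h fun e => uK V K e * Gs i (P * F) e
    have h2 := sum_mul_Gs i (P * F) (uK V K)
    rw [eq_sub_of_add_eq h3.symm, h2]
    refine sub_mem (pcl_sum (pcl_mul (xi_mem_PP i) hPF.2)) (sum_mem_TO fun e he => ?_)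
    simp only [Finset.mem_erase] at he
    exact mul_TO (uK_mem_loc e) (h1 e he.2.1 he.1)
  · rw [sK_Gs hab, hPF.1]
    simp [Gs]

lemma Lodd_apply (h : a ≠ b) (hF : F ∈ Lodd A K hab) (φ : Cfg A wt) : F φ ∈ TO K a b (wt a + 1) :=
  pcl_TO_apply h (by convert hF.2 using 3; ring) φ

end odd

section even
variable {A V : Type} [Fintype A] [DecidableEq A] [Fintype V] [DecidableEq V] {wt : V → ℕ}
variable {K : Type} [Field K] [Algebra (MvPolynomial V ℂ) K]
  [IsFractionRing (MvPolynomial V ℂ) K] [Algebra ℂ K] [IsScalarTower ℂ (MvPolynomial V ℂ) K]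
variable {a b : V} {c : ℂ}

variable (A wt K a b) in
/-- Functions generated by the coordinates and the symmetric local functions. -/
def Lev : Subalgebra ℂ (Cfg A wt → K) := Algebra.adjoin ℂ (Set.range (xi wt K) ∪
  cst A wt K '' {x | x ∈ loc K a b ∧ sK K (swap a b) x = x})

lemma xi_mem_Lev (i : A) : xi wt K i ∈ Lev A wt K a b := Algebra.subset_adjoin (Or.inl ⟨i, rfl⟩)

lemma cst_mem_Lev {x : K} (hx : x ∈ loc K a b) (hs : sK K (swap a b) x = x) :
    cst A wt K x ∈ Lev A wt K a b := Algebra.subset_adjoin (Or.inr ⟨x, ⟨hx, hs⟩, rfl⟩)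

lemma PP_le_Lev : PP A wt K ≤ Lev A wt K a b := Algebra.adjoin_mono Set.subset_union_left

lemma Lev_apply {F : Cfg A wt → K} (hF : F ∈ Lev A wt K a b) (φ : Cfg A wt) : F φ ∈ loc K a b := by
  induction hF using Algebra.adjoin_induction with
  | mem g hg =>
    rcases hg with ⟨k, rfl⟩ | ⟨x, hx, rfl⟩
    · exact uK_mem_loc _
    · exact hx.1
  | algebraMap z => exact algebraMap_mem _ z
  | add G H _ _ hG hH => exact add_mem hG hH
  | mul G H _ _ hG hH => exact mul_mem hG hH

lemma Lev_rhoK (w : Perm A) {F : Cfg A wt → K} (hF : F ∈ Lev A wt K a b) :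
    rhoK wt K w F ∈ Lev A wt K a b := by
  refine adjoin_rhoK_mem w ?_ hF
  rintro _ (⟨k, rfl⟩ | ⟨x, hx, rfl⟩)
  · exact xi_mem_Lev (w k)
  · exact cst_mem_Lev hx.1 hx.2

lemma sK_swap_inv_sub {e f : V} (ha : e ≠ a) (hb : e ≠ b) (hfa : f ≠ a) (hfb : f ≠ b) :
    sK K (swap a b) (uK V K e - uK V K f)⁻¹ = (uK V K e - uK V K f)⁻¹ := by
  rw [map_inv₀, map_sub, sK_uK, sK_uK, swap_apply_of_ne_of_ne ha hb, swap_apply_of_ne_of_ne hfa hfb]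

lemma ind_mem_Lev (h : a ≠ b) {e : V} (ha : e ≠ a) (hb : e ≠ b) (k : A) : 
    ind wt K k e ∈ Lev A wt K a b := by
  have h1 : ind wt K k e = (∏ f ∈ ((Finset.univ.erase e).erase a).erase b,
      (cst A wt K (uK V K e - uK V K f)⁻¹ * (xi wt K k - cst A wt K (uK V K f)))) *
      (cst A wt K ((uK V K e - uK V K a)⁻¹ * (uK V K e - uK V K b)⁻¹) * (xi wt K k ^ 2 -
        cst A wt K (uK V K a + uK V K b) * xi wt K k + cst A wt K (uK V K a * uK V K b))) := by
    rw [ind_eq_prod, ← Finset.prod_erase_mul (Finset.univ.erase e) _ (a := a) (by simp [ha.symm]),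
      ← Finset.prod_erase_mul ((Finset.univ.erase e).erase a) _ (a := b) (by simp [hb.symm, h.symm])]
    rw [mul_assoc]
    congr 1
    simp only [map_mul, map_add]
    ring
  rw [h1]
  refine mul_mem (prod_mem fun f hf => ?_) (mul_mem (cst_mem_Lev (mul_mem (inv_sub_mem_loc (by tauto)
    (by tauto)) (inv_sub_mem_loc (by tauto) (by tauto))) ?_) (add_mem (sub_mem (pow_mem (xi_mem_Lev k) 2)
    (mul_mem (cst_mem_Lev (add_mem (uK_mem_loc a) (uK_mem_loc b)) ?_) (xi_mem_Lev k)))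
    (cst_mem_Lev (mul_mem (uK_mem_loc a) (uK_mem_loc b)) ?_)))
  · simp only [Finset.mem_erase] at hf
    refine mul_mem (cst_mem_Lev (inv_sub_mem_loc (by tauto) (by tauto)) (sK_swap_inv_sub ha hb hf.2.1 hf.1))
      (sub_mem (xi_mem_Lev k) (cst_mem_Lev (uK_mem_loc f) ?_))
    rw [sK_uK, swap_apply_of_ne_of_ne hf.2.1 hf.1]
  · rw [map_mul, map_inv₀, map_inv₀, map_sub, map_sub, sK_uK, sK_uK, sK_uK,
      swap_apply_of_ne_of_ne ha hb, swap_apply_left, swap_apply_right, mul_comm]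
  · rw [map_add, sK_uK, sK_uK, swap_apply_left, swap_apply_right, add_comm]
  · rw [map_mul, sK_uK, sK_uK, swap_apply_left, swap_apply_right, mul_comm]

lemma dF_mem_Lev (h : a ≠ b) (hab : wt a = wt b) {x : K} (hx : x ∈ loc K a b)
    (hs : sK K (swap a b) x = x) (i : A) : dF (A := A) wt i x ∈ Lev A wt K a b := by
  have ht := uK_sub_ne_zero (K := K) h
  set η : V → K := fun e => (wt e : K)⁻¹ * dK K e x with hη
  have hηm : ∀ e, η e ∈ loc K a b := fun e => mul_mem (inv_natCast_mem_loc _) (dK_mem_loc e hx)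
  have hησ : ∀ e, sK K (swap a b) (η e) = η (swap a b e) := fun e => by
    rw [hη, map_mul, map_inv₀, map_natCast, sK_dK, hs]
    simp only
    rw [wt_swap hab]
  set β := (η a - η b) / (uK V K a - uK V K b) with hβ
  have hβm : β ∈ loc K a b := div_t_mem_loc h (odd_mem_TO (sub_mem (hηm a) (hηm b)) (by
    rw [map_sub, hησ, hησ, swap_apply_left, swap_apply_right, neg_sub]))
  have hβσ : sK K (swap a b) β = β := by
    rw [hβ, map_div₀, map_sub, map_sub, hησ, hησ, sK_uK, sK_uK, swap_apply_left, swap_apply_right,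
      ← neg_sub, ← neg_sub (uK V K a), neg_div_neg_eq]
  have hγ : η a - β * uK V K a = η b - β * uK V K b := by
    rw [hβ]; field_simp; ring
  have key : dF (A := A) wt i x = ∑ e ∈ (Finset.univ.erase a).erase b, cst A wt K (η e) * ind wt K i e +
      (cst A wt K β * xi wt K i + cst A wt K (η a - β * uK V K a)) *
      (1 - ∑ e ∈ (Finset.univ.erase a).erase b, ind wt K i e) := by
    funext φ
    simp only [Pi.add_apply, Finset.sum_apply, Pi.mul_apply, Pi.sub_apply, Pi.one_apply, cst_apply,
      xi_apply, ind, mul_ite, mul_one, mul_zero, Finset.sum_ite_eq, Finset.mem_erase, Finset.mem_univ,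
      and_true]
    by_cases h1 : φ.1 i = a
    · simp [h1, dF, hη]
    by_cases h2 : φ.1 i = b
    · rw [hγ]; simp [h2, dF, hη]
    simp [h1, h2, dF, hη]
  rw [key]
  have hind : ∀ e ∈ (Finset.univ.erase a).erase b, ind wt K i e ∈ Lev A wt K a b := fun e he => by
    simp only [Finset.mem_erase] at he
    exact ind_mem_Lev h he.2.1 he.1 i
  refine add_mem (sum_mem fun e he => mul_mem (cst_mem_Lev (hηm e) ?_) (hind e he)) (mul_mem (add_mem
    (mul_mem (cst_mem_Lev hβm hβσ) (xi_mem_Lev i)) (cst_mem_Lev (sub_mem (hηm a) (mul_mem hβm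
    (uK_mem_loc a))) ?_)) (sub_mem (one_mem _) (sum_mem hind)))
  · simp only [Finset.mem_erase] at he
    rw [hησ, swap_apply_of_ne_of_ne he.2.1 he.1]
  · rw [map_sub, map_mul _ β, hησ, sK_uK, hβσ, swap_apply_left, hγ]

lemma Lev_Dk (h : a ≠ b) (hab : wt a = wt b) (hc : ∀ v, 1 < wt v → (wt v : ℂ) * c = 1) (i : A)
    {F : Cfg A wt → K} (hF : F ∈ Lev A wt K a b) : Dk wt K c i F ∈ Lev A wt K a b := by
  refine adjoin_Dk_mem ?_ hF i
  rintro _ (⟨k, rfl⟩ | ⟨x, hx, rfl⟩) F hF hD i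
  · refine adjoin_Dk_xi_mem hc Set.subset_union_left (fun w => ?_) k hF hD i
    rintro _ (⟨k, rfl⟩ | ⟨x, hx, rfl⟩)
    · exact xi_mem_Lev (w k)
    · exact cst_mem_Lev hx.1 hx.2
  · rw [Dk_cst_mul]
    exact add_mem (mul_mem (cst_mem_Lev hx.1 hx.2) (hD i)) (mul_mem (dF_mem_Lev h hab hx.1 hx.2 i) hF)

end even

section lattice
variable {A V : Type} [Fintype A] [DecidableEq A] [Fintype V] [DecidableEq V] {wt : V → ℕ}
variable {K : Type} [Field K] [Algebra (MvPolynomial V ℂ) K]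
  [IsFractionRing (MvPolynomial V ℂ) K] [Algebra ℂ K] [IsScalarTower ℂ (MvPolynomial V ℂ) K]
variable {Y Z : Finset V} {m : ℕ}

/-- The weights of the two types of points. -/
structure IsWt (wt : V → ℕ) (Y Z : Finset V) (m : ℕ) : Prop where
  left : ∀ v ∈ Y, wt v = m
  right : ∀ v ∈ Z, wt v = 1
  other : ∀ v, v ∉ Y → v ∉ Z → wt v = 0
  disj : Disjoint Y Z
  pos : 0 < m

lemma IsWt.ne (H : IsWt wt Y Z m) {y z : V} (hy : y ∈ Y) (hz : z ∈ Z) : y ≠ z := fun e =>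
  Finset.disjoint_left.1 H.disj hy (e ▸ hz)

lemma IsWt.hc (H : IsWt wt Y Z m) (v : V) (h : 1 < wt v) : (wt v : ℂ) * (m : ℂ)⁻¹ = 1 := by
  by_cases hy : v ∈ Y
  · rw [H.left v hy, mul_inv_cancel₀]; exact_mod_cast H.pos.ne'
  by_cases hz : v ∈ Z
  · rw [H.right v hz] at h; omega
  rw [H.other v hy hz] at h; omega

variable (A wt K Y Z m) in
/-- The lattice of globally regular functions with prescribed local behaviour. -/
def LL : Submodule ℂ (Cfg A wt → K) where
  carrier := {F | (∀ φ, F φ ∈ (jK K : MvPolynomial V ℂ →ₐ[ℂ] K).range) ∧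
    (∀ a ∈ Z, ∀ b ∈ Z, ∀ h : wt a = wt b, hat K h F = F) ∧
    (∀ y ∈ Y, ∀ z ∈ Z, F ∈ Lyz A wt K m y z) ∧
    (∀ a ∈ Y, ∀ b ∈ Y, a ≠ b → ∀ h : wt a = wt b,
      F + hat K h F ∈ Lev A wt K a b ∧ F - hat K h F ∈ Lodd A K h)}
  zero_mem' := ⟨fun _ => zero_mem _, fun _ _ _ _ _ => map_zero _, fun _ _ _ _ => zero_mem _,
    fun _ _ _ _ _ _ => by simp [zero_mem]⟩
  add_mem' {F G} hF hG := ⟨fun φ => add_mem (hF.1 φ) (hG.1 φ), fun a ha b hb h => by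
    rw [map_add, hF.2.1 a ha b hb h, hG.2.1 a ha b hb h], fun y hy z hz =>
    add_mem (hF.2.2.1 y hy z hz) (hG.2.2.1 y hy z hz), fun a ha b hb hab h => by
      have h1 := hF.2.2.2 a ha b hb hab h
      have h2 := hG.2.2.2 a ha b hb hab h
      rw [map_add, add_add_add_comm, add_sub_add_comm]
      exact ⟨add_mem h1.1 h2.1, add_mem h1.2 h2.2⟩⟩
  smul_mem' c F hF := ⟨fun φ => Subalgebra.smul_mem _ (hF.1 φ) c, fun a ha b hb h => by
    rw [map_smul, hF.2.1 a ha b hb h], fun y hy z hz => Submodule.smul_mem _ c (hF.2.2.1 y hy z hz),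
    fun a ha b hb hab h => by
      have h1 := hF.2.2.2 a ha b hb hab h
      rw [map_smul, ← smul_add, ← smul_sub]
      exact ⟨Subalgebra.smul_mem _ h1.1 c, Submodule.smul_mem _ c h1.2⟩⟩

variable {F : Cfg A wt → K}

lemma LL_mul {P : Cfg A wt → K} (hP : P ∈ PP A wt K) (hF : F ∈ LL A wt K Y Z m) :
    P * F ∈ LL A wt K Y Z m :=
  ⟨fun φ => mul_mem (PP_range hP φ) (hF.1 φ),
    fun a ha b hb h => by rw [map_mul, hat_PP h hP, hF.2.1 a ha b hb h],
    fun y hy z hz => Lyz_mul hP (hF.2.2.1 y hy z hz), fun a ha b hb hab h => by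
      have h1 := hF.2.2.2 a ha b hb hab h
      rw [map_mul, hat_PP h hP, ← mul_add, ← mul_sub]
      exact ⟨mul_mem (PP_le_Lev hP) h1.1, Lodd_mul hP h1.2⟩⟩

lemma LL_rhoK (w : Perm A) (hF : F ∈ LL A wt K Y Z m) : rhoK wt K w F ∈ LL A wt K Y Z m :=
  ⟨fun φ => hF.1 _, fun a ha b hb h => by rw [hat_rhoK, hF.2.1 a ha b hb h],
    fun y hy z hz => Lyz_rhoK w (hF.2.2.1 y hy z hz), fun a ha b hb hab h => by
      have h1 := hF.2.2.2 a ha b hb hab h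
      rw [hat_rhoK, ← map_add, ← map_sub]
      exact ⟨Lev_rhoK w h1.1, Lodd_rhoK w h1.2⟩⟩

lemma LL_cst_mul {x : K} (hx : x ∈ (jK K : MvPolynomial V ℂ →ₐ[ℂ] K).range)
    (hZ : ∀ a ∈ Z, ∀ b ∈ Z, sK K (swap a b) x = x) (hYZ : ∀ y ∈ Y, ∀ z ∈ Z, x ∈ Opr K m y z)
    (hY : ∀ a ∈ Y, ∀ b ∈ Y, sK K (swap a b) x = x) (hF : F ∈ LL A wt K Y Z m) :
    cst A wt K x * F ∈ LL A wt K Y Z m :=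
  ⟨fun φ => mul_mem hx (hF.1 φ),
    fun a ha b hb h => by rw [map_mul, hat_cst, hF.2.1 a ha b hb h, hZ a ha b hb],
    fun y hy z hz => Lyz_cst_mul (hYZ y hy z hz) (hF.2.2.1 y hy z hz), fun a ha b hb hab h => by
      have h1 := hF.2.2.2 a ha b hb hab h
      have h2 : x ∈ loc K a b := by obtain ⟨f, rfl⟩ := hx; exact jK_mem_loc f
      rw [map_mul, hat_cst, hY a ha b hb, ← mul_add, ← mul_sub]
      exact ⟨mul_mem (cst_mem_Lev h2 (hY a ha b hb)) h1.1, Lodd_cst_mul h2 (hY a ha b hb) h1.2⟩⟩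

lemma LL_mem_loc (hF : F ∈ LL A wt K Y Z m) (φ : Cfg A wt) (a b : V) : F φ ∈ loc K a b := by
  obtain ⟨f, hf⟩ := hF.1 φ
  rw [← hf]; exact jK_mem_loc f

lemma Cfg.comp_swap_eq_lab {a b : V} (h : wt a = wt b) (hb : wt b = 1) {φ : Cfg A wt} {i j : A}
    (hi : φ.1 i = a) (hj : φ.1 j = b) : φ.comp (swap i j) = φ.lab h := by
  have h1 : ∀ v, wt v = 1 → ∀ k l, φ.1 k = v → φ.1 l = v → k = l := fun v hv k l hk hl =>
    Finset.card_le_one.1 (le_of_eq ((φ.2 v).trans hv)) k (by simp [hk]) l (by simp [hl])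
  refine Subtype.ext (funext fun k => ?_)
  rw [Cfg.comp_apply, Cfg.lab_apply]
  by_cases hki : k = i
  · rw [hki, swap_apply_left, hi, swap_apply_left, hj]
  by_cases hkj : k = j
  · rw [hkj, swap_apply_right, hj, swap_apply_right, hi]
  rw [swap_apply_of_ne_of_ne hki hkj, swap_apply_of_ne_of_ne]
  · exact fun e => hki (h1 a (h.trans hb) k i e hi)
  · exact fun e => hkj (h1 b hb k j e hj)

lemma LL_Dk_mem_loc (H : IsWt wt Y Z m) (i : A) (hF : F ∈ LL A wt K Y Z m) {a b : V} (hab : a ≠ b)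
    (φ : Cfg A wt) : Dk wt K ((m : ℂ)⁻¹) i F φ ∈ loc K a b := by
  have hzero : ∀ a b : V, a ≠ b → wt b = 0 → Dk wt K ((m : ℂ)⁻¹) i F φ ∈ loc K a b := fun a b hab hb =>
    Dk_mem_loc hab (fun φ => LL_mem_loc hF φ a b)
      (fun φ i j _ hj => absurd (φ.wt_pos j) (by rw [hj, hb]; exact lt_irrefl 0)) i φ
  have hyz : ∀ y ∈ Y, ∀ z ∈ Z, Dk wt K ((m : ℂ)⁻¹) i F φ ∈ loc K y z := fun y hy z hz =>
    (Lyz_Dk (H.ne hy hz) H.pos (H.left y hy) (H.right z hz) H.hc i (hF.2.2.1 y hy z hz)).1 φ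
  by_cases ha : a ∈ Y
  · by_cases hb : b ∈ Y
    · have h : wt a = wt b := (H.left a ha).trans (H.left b hb).symm
      have h1 := hF.2.2.2 a ha b hb hab h
      have h2 := Lev_apply (Lev_Dk hab h H.hc i h1.1) φ
      have hc := H.hc
      rw [← H.left a ha] at hc
      have h3 := TO_le_loc (Lodd_apply hab (Lodd_Dk hab (by rw [H.left a ha]; exact H.pos) hc i h1.2) φ)
      rw [H.left a ha] at h3
      have h4 := Subalgebra.smul_mem _ (add_mem h2 h3) (2⁻¹ : ℂ)
      convert h4 using 1
      rw [← Pi.add_apply, ← map_add, add_add_sub_cancel, ← two_smul ℂ F, map_smul, Pi.smul_apply,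
        smul_smul, inv_mul_cancel₀ two_ne_zero, one_smul]
    by_cases hb' : b ∈ Z
    · exact hyz a ha b hb'
    · exact hzero a b hab (H.other b hb hb')
  by_cases ha' : a ∈ Z
  · by_cases hb : b ∈ Y
    · rw [loc_symm]; exact hyz b hb a ha'
    by_cases hb' : b ∈ Z
    · have h : wt a = wt b := (H.right a ha').trans (H.right b hb').symm
      refine Dk_mem_loc hab (fun φ => LL_mem_loc hF φ a b) (fun φ i j hi hj => ?_) i φ
      rw [Cfg.comp_swap_eq_lab h (H.right b hb') hi hj]
      have h1 := congrFun (hF.2.1 a ha' b hb' h) (φ.lab h)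
      rw [hat_apply, Cfg.lab_lab] at h1
      rw [← h1]
      exact sub_sK_mem_TO (LL_mem_loc hF φ a b)
    · exact hzero a b hab (H.other b hb hb')
  · rw [loc_symm]; exact hzero b a hab.symm (H.other a ha ha')

lemma LL_Dk (H : IsWt wt Y Z m) (i : A) (hF : F ∈ LL A wt K Y Z m) :
    Dk wt K ((m : ℂ)⁻¹) i F ∈ LL A wt K Y Z m := by
  refine ⟨fun φ => ?_, fun a ha b hb h => by rw [hat_Dk, hF.2.1 a ha b hb h],
    fun y hy z hz => Lyz_Dk (H.ne hy hz) H.pos (H.left y hy) (H.right z hz) H.hc i (hF.2.2.1 y hy z hz), 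
    fun a ha b hb hab h => ?_⟩
  · refine mem_range_of_forall_loc (S := Finset.univ.filter fun e : V × V => e.1 ≠ e.2)
      (fun e he => (Finset.mem_filter.1 he).2) ?_
      fun e he => LL_Dk_mem_loc H i hF (Finset.mem_filter.1 he).2 φ
    have hu : ∀ v, uK V K v ∈ (jK K : MvPolynomial V ℂ →ₐ[ℂ] K).range := fun v => ⟨X v, rfl⟩
    rw [Dk_apply, sub_mul]
    refine sub_mem (mul_mem (mul_mem ?_ ?_) (prod_mem fun e _ => sub_mem (hu _) (hu _))) ?_
    · have : (wt (φ.1 i) : K)⁻¹ = algebraMap ℂ K (wt (φ.1 i) : ℂ)⁻¹ := by rw [map_inv₀, map_natCast]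
      rw [this]; exact algebraMap_mem _ _
    · obtain ⟨f, hf⟩ := hF.1 φ
      exact ⟨pderiv (φ.1 i) f, by rw [← hf]; exact (dK_jK _ _).symm⟩
    · rw [mul_assoc, Finset.sum_mul]
      refine mul_mem (algebraMap_mem _ _) (sum_mem fun l _ => ?_)
      by_cases h : φ.1 i = φ.1 l
      · rw [h, sub_self, div_zero, zero_mul]; exact zero_mem _
      · rw [← Finset.mul_prod_erase (a := (φ.1 i, φ.1 l)) _ _ (by simpa using h), ← mul_assoc,
          div_mul_cancel₀ _ (uK_sub_ne_zero h)]
        exact mul_mem (sub_mem (hF.1 _) (hF.1 _)) (prod_mem fun e _ => sub_mem (hu _) (hu _))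
  · have h1 := hF.2.2.2 a ha b hb hab h
    have hc := H.hc
    rw [← H.left a ha] at hc
    have h2 := Lodd_Dk hab (by rw [H.left a ha]; exact H.pos) hc i h1.2
    rw [H.left a ha] at h2
    rw [hat_Dk, ← map_add, ← map_sub]
    exact ⟨Lev_Dk hab h H.hc i h1.1, h2⟩

end lattice

section unit
variable {A V : Type} [Fintype A] [DecidableEq A] [Fintype V] [DecidableEq V] {wt : V → ℕ}
variable {K : Type} [Field K] [Algebra (MvPolynomial V ℂ) K]
  [IsFractionRing (MvPolynomial V ℂ) K] [Algebra ℂ K] [IsScalarTower ℂ (MvPolynomial V ℂ) K]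
variable {m : ℕ} {P : Cfg A wt → K}

/-- The chain rule for values of polynomial functions of the coordinates. -/
lemma PP_derivation (hP : P ∈ PP A wt K) : ∃ Q : A → Cfg A wt → K, (∀ k, Q k ∈ PP A wt K) ∧
    ∀ (δ : Derivation ℂ K K) φ, δ (P φ) = ∑ k, δ (uK V K (φ.1 k)) * Q k φ := by
  induction hP using Algebra.adjoin_induction with
  | mem g hg =>
    obtain ⟨i, rfl⟩ := hg
    refine ⟨fun k => if k = i then 1 else 0, fun k => ?_, fun δ φ => ?_⟩
    · by_cases h : k = i
      · simp [h, one_mem]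
      · simp [h, zero_mem]
    · rw [Finset.sum_eq_single i (fun k _ hk => by simp [hk]) (by simp)]
      simp
  | algebraMap z => exact ⟨fun _ => 0, fun _ => zero_mem _, fun δ φ => by simp⟩
  | add P P' _ _ h h' =>
    obtain ⟨Q, h1, h2⟩ := h
    obtain ⟨Q', h1', h2'⟩ := h'
    refine ⟨fun k => Q k + Q' k, fun k => add_mem (h1 k) (h1' k), fun δ φ => ?_⟩
    rw [Pi.add_apply, map_add, h2, h2', ← Finset.sum_add_distrib]
    exact Finset.sum_congr rfl fun k _ => (mul_add _ _ _).symm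
  | mul P P' hP hP' h h' =>
    obtain ⟨Q, h1, h2⟩ := h
    obtain ⟨Q', h1', h2'⟩ := h'
    refine ⟨fun k => P * Q' k + P' * Q k, fun k => add_mem (mul_mem hP (h1' k)) (mul_mem hP' (h1 k)),
      fun δ φ => ?_⟩
    rw [Pi.mul_apply, Derivation.leibniz, h2, h2', smul_eq_mul, smul_eq_mul, Finset.mul_sum,
      Finset.mul_sum, ← Finset.sum_add_distrib]
    exact Finset.sum_congr rfl fun k _ => by simp only [Pi.add_apply, Pi.mul_apply]; ring

lemma PP_sub_mem_TO {a b : V} (hP : P ∈ PP A wt K) {φ : Cfg A wt} {i j : A} (hi : φ.1 i = a)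
    (hj : φ.1 j = b) : P φ - P (φ.comp (swap i j)) ∈ TO K a b 1 := by
  induction hP using Algebra.adjoin_induction with
  | mem g hg =>
    obtain ⟨k, rfl⟩ := hg
    rw [xi_apply, xi_apply, Cfg.comp_apply]
    by_cases hki : k = i
    · rw [hki, swap_apply_left, hi, hj]
      simpa using t_mul_TO (K := K) (a := a) (b := b) (one_mem _)
    by_cases hkj : k = j
    · rw [hkj, swap_apply_right, hi, hj]
      simpa using t_mul_TO (K := K) (a := a) (b := b) (neg_mem (one_mem _))
    · rw [swap_apply_of_ne_of_ne hki hkj, sub_self]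
      exact zero_mem _
  | algebraMap z => simp [zero_mem]
  | add P P' _ _ h h' =>
    rw [Pi.add_apply, Pi.add_apply, add_sub_add_comm]
    exact add_mem h h'
  | mul P P' hP hP' h h' =>
    have : (P * P') φ - (P * P') (φ.comp (swap i j)) = P φ * (P' φ - P' (φ.comp (swap i j))) +
        (P φ - P (φ.comp (swap i j))) * P' (φ.comp (swap i j)) := by
      simp only [Pi.mul_apply]; ring
    rw [this]
    exact add_mem (mul_TO (PP_mem_loc hP _ _ _) h') (TO_mul h (PP_mem_loc hP' _ _ _))

lemma sum_ite_fiber (φ : Cfg A wt) (v : V) : ∑ i, (if φ.1 i = v then (1 : K) else 0) = wt v := by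
  rw [Finset.sum_boole, φ.2 v]

lemma one_mem_Lyz {y z : V} (h : y ≠ z) (hy : wt y = m) (hz : wt z = 1) :
    (1 : Cfg A wt → K) ∈ Lyz A wt K m y z := by
  refine ⟨fun _ => one_mem _, mem_pcl.2 fun P hP => ?_⟩
  simp only [Pi.one_apply, mul_one]
  refine mem_Opr.2 ⟨sum_mem fun φ _ => PP_mem_loc hP φ y z, ?_⟩
  obtain ⟨Q, hQ, hδ⟩ := PP_derivation hP
  have hval : ∀ φ : Cfg A wt, ∀ k, del K m y z (uK V K (φ.1 k)) =
      m * (if φ.1 k = z then 1 else 0) - if φ.1 k = y then 1 else 0 := fun φ k => by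
    by_cases h1 : φ.1 k = y
    · rw [h1, del_uK_left h]; simp [h]
    by_cases h2 : φ.1 k = z
    · rw [h2, del_uK_right h]; simp [h.symm]
    · rw [del_uK_ne h1 h2]; simp [h1, h2]
  have key : del K m y z (∑ φ, P φ) = ∑ k, ∑ i, ∑ φ : Cfg A wt, (if φ.1 k = z then (1 : K) else 0) *
      ((if φ.1 i = y then 1 else 0) * (Q k φ - Q k (φ.comp (swap i k)))) := by
    rw [map_sum]
    simp only [hδ, hval]
    rw [Finset.sum_comm]
    refine Finset.sum_congr rfl fun k _ => ?_
    simp only [mul_sub, Finset.sum_sub_distrib, sub_mul]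
    congr 1
    · rw [Finset.sum_comm]
      refine Finset.sum_congr rfl fun φ _ => ?_
      rw [← Finset.mul_sum, ← Finset.sum_mul, sum_ite_fiber, hy]
      ring
    · have h2 : ∀ i : A, ∑ φ : Cfg A wt, (if φ.1 k = z then (1 : K) else 0) *
          ((if φ.1 i = y then 1 else 0) * Q k (φ.comp (swap i k))) =
          ∑ φ : Cfg A wt, (if φ.1 i = z then (1 : K) else 0) *
          ((if φ.1 k = y then 1 else 0) * Q k φ) := fun i => by
        rw [← Equiv.sum_comp (Cfg.compEquiv (swap i k))]
        refine Finset.sum_congr rfl fun φ _ => ?_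
        change (if (φ.comp (swap i k)).1 k = z then (1 : K) else 0) *
          ((if (φ.comp (swap i k)).1 i = y then 1 else 0) *
            Q k ((φ.comp (swap i k)).comp (swap i k))) = _
        rw [Cfg.comp_comp, swap_mul_self, Cfg.comp_one, Cfg.comp_apply, Cfg.comp_apply,
          swap_apply_left, swap_apply_right]
      simp only [h2]
      rw [Finset.sum_comm]
      refine Finset.sum_congr rfl fun φ _ => ?_
      rw [← Finset.sum_mul, sum_ite_fiber, hz, Nat.cast_one, one_mul]
  rw [key]
  refine sum_mem_TO fun k _ => sum_mem_TO fun i _ => sum_mem_TO fun φ _ => ?_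
  by_cases h1 : φ.1 k = z
  · by_cases h2 : φ.1 i = y
    · simpa [h1, h2] using PP_sub_mem_TO (hQ k) h2 h1
    · simp [h2, zero_mem]
  · simp [h1, zero_mem]

end unit

section spaces
variable {V : Type} [DecidableEq V]
variable {K : Type} [Field K] [Algebra (MvPolynomial V ℂ) K]
  [IsFractionRing (MvPolynomial V ℂ) K] [Algebra ℂ K] [IsScalarTower ℂ (MvPolynomial V ℂ) K]
variable {Y Z : Finset V} {m n : ℕ}

variable (K Y Z n) in
/-- Polynomials, symmetric in `Z` and quasi-invariant of order `n` in `Y`. -/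
def TK : Submodule ℂ K where
  carrier := {x | x ∈ (jK K : MvPolynomial V ℂ →ₐ[ℂ] K).range ∧
    (∀ a ∈ Z, ∀ b ∈ Z, sK K (swap a b) x = x) ∧
    ∀ a ∈ Y, ∀ b ∈ Y, a ≠ b → x - sK K (swap a b) x ∈ TO K a b n}
  zero_mem' := ⟨zero_mem _, fun _ _ _ _ => map_zero _, fun _ _ _ _ _ => by simp [zero_mem]⟩
  add_mem' hx hx' := ⟨add_mem hx.1 hx'.1, fun a ha b hb => by
    rw [map_add, hx.2.1 a ha b hb, hx'.2.1 a ha b hb], fun a ha b hb h => by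
    rw [map_add, add_sub_add_comm]; exact add_mem (hx.2.2 a ha b hb h) (hx'.2.2 a ha b hb h)⟩
  smul_mem' c x hx := ⟨Subalgebra.smul_mem _ hx.1 c, fun a ha b hb => by
    rw [map_smul, hx.2.1 a ha b hb], fun a ha b hb h => by
    rw [map_smul, ← smul_sub]; exact Submodule.smul_mem _ c (hx.2.2 a ha b hb h)⟩

variable (K Y Z m) in
/-- Quasi-invariants as elements of the field of fractions. -/
def LamK : Submodule ℂ K where
  carrier := {x | x ∈ TK K Y Z (2 * m + 1) ∧ ∀ y ∈ Y, ∀ z ∈ Z, x ∈ Opr K m y z}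
  zero_mem' := ⟨zero_mem _, fun _ _ _ _ => zero_mem _⟩
  add_mem' hx hx' := ⟨add_mem hx.1 hx'.1, fun y hy z hz => add_mem (hx.2 y hy z hz) (hx'.2 y hy z hz)⟩
  smul_mem' c x hx := ⟨Submodule.smul_mem _ c hx.1,
    fun y hy z hz => Subalgebra.smul_mem _ (hx.2 y hy z hz) c⟩

lemma TK_mul {q x : K} (hq : q ∈ (jK K : MvPolynomial V ℂ →ₐ[ℂ] K).range)
    (hZ : ∀ a ∈ Z, ∀ b ∈ Z, sK K (swap a b) q = q) (hY : ∀ a ∈ Y, ∀ b ∈ Y, sK K (swap a b) q = q)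
    (hx : x ∈ TK K Y Z n) : q * x ∈ TK K Y Z n :=
  ⟨mul_mem hq hx.1, fun a ha b hb => by rw [map_mul, hZ a ha b hb, hx.2.1 a ha b hb],
    fun a ha b hb h => by
      rw [map_mul, hY a ha b hb, ← mul_sub]
      refine mul_TO ?_ (hx.2.2 a ha b hb h)
      obtain ⟨f, rfl⟩ := hq
      exact jK_mem_loc f⟩

lemma sK_wp [Fintype V] {W : V → ℕ} {a b : V} (h : W a = W b) (l : Fin (Fintype.card V)) :
    sK K (swap a b) (jK K (wp W l)) = jK K (wp W l) := by
  rw [sK_jK, wp, wpsum, map_sum, ← Equiv.sum_comp (swap a b)]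
  congr 1
  refine Finset.sum_congr rfl fun v _ => ?_
  rw [map_mul, map_pow, rename_X, rename_C, wt_swap h, swap_apply_self]

lemma pow_sub_pow_mem_TO (a b : V) (n : ℕ) : uK V K a ^ n - uK V K b ^ n ∈ TO K a b 1 := by
  obtain ⟨q, hq⟩ := sub_dvd_pow_sub_pow (X a : MvPolynomial V ℂ) (X b) n
  have h1 := congrArg (jK K) hq
  simp only [map_sub, map_mul, map_pow] at h1
  exact h1 ▸ t_mul_TO (jK_mem_loc q)

lemma wp_mem_Opr [Fintype V] {W : V → ℕ} {y z : V} (h : y ≠ z) {t : ℂ} (hy : (W y : ℂ) = t * m)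
    (hz : (W z : ℂ) = t) (l : Fin (Fintype.card V)) : jK K (wp W l) ∈ Opr K m y z := by
  refine mem_Opr.2 ⟨jK_mem_loc _, ?_⟩
  have hd : ∀ (v : V), del K m y z (jK K (C (W v : ℂ) * X v ^ (l.val + 1))) =
      (W v : ℂ) • (((l.val : ℂ) + 1) • (uK V K v ^ l.val * del K m y z (uK V K v))) := fun v => by
    rw [← smul_eq_C_mul, map_smul, Derivation.map_smul, map_pow, Derivation.leibniz_pow]
    simp only [Nat.add_sub_cancel, smul_eq_mul]
    congr 1
    rw [← Nat.cast_smul_eq_nsmul ℂ, Nat.cast_add, Nat.cast_one]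
    rfl
  rw [wp, wpsum, map_sum, map_sum]
  simp only [hd]
  rw [sum_split h, del_uK_left h, del_uK_right h, Finset.sum_eq_zero, add_zero, hy, hz]
  · have : (t * (m : ℂ)) • (((l.val : ℂ) + 1) • (uK V K y ^ l.val * -1)) +
        t • (((l.val : ℂ) + 1) • (uK V K z ^ l.val * (m : K))) =
        -((t * (m : ℂ) * ((l.val : ℂ) + 1)) • (uK V K y ^ l.val - uK V K z ^ l.val)) := by
      have hm : (m : K) = algebraMap ℂ K m := by simp
      rw [hm]
      simp only [Algebra.smul_def, map_mul]
      ring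
    rw [this]
    exact neg_mem (Submodule.smul_mem _ _ (pow_sub_pow_mem_TO y z l.val))
  · intro v hv
    simp only [Finset.mem_erase] at hv
    rw [del_uK_ne hv.2.1 hv.1]; simp

end spaces

section stable
variable {A V : Type} [Fintype A] [DecidableEq A] [Fintype V] [DecidableEq V] {wt : V → ℕ}
variable {K : Type} [Field K] [Algebra (MvPolynomial V ℂ) K]
  [IsFractionRing (MvPolynomial V ℂ) K] [Algebra ℂ K] [IsScalarTower ℂ (MvPolynomial V ℂ) K]
variable {Y Z : Finset V} {m : ℕ} {W : V → ℕ} {t : ℂ}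

lemma IsWt.weight_eq (H : IsWt wt Y Z m) (ht : ∀ v, 0 < wt v → (W v : ℂ) = t * wt v) {a b : V}
    (h : wt a = wt b) (ha : 0 < wt a) : W a = W b := by
  have : (W a : ℂ) = W b := by rw [ht a ha, ht b (h ▸ ha), h]
  exact_mod_cast this

lemma IsWt.weight_left (H : IsWt wt Y Z m) (ht : ∀ v, 0 < wt v → (W v : ℂ) = t * wt v) {a b : V}
    (ha : a ∈ Y) (hb : b ∈ Y) : W a = W b :=
  H.weight_eq ht ((H.left a ha).trans (H.left b hb).symm) ((H.left a ha).symm ▸ H.pos)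

lemma IsWt.weight_right (H : IsWt wt Y Z m) (ht : ∀ v, 0 < wt v → (W v : ℂ) = t * wt v) {a b : V}
    (ha : a ∈ Z) (hb : b ∈ Z) : W a = W b :=
  H.weight_eq ht ((H.right a ha).trans (H.right b hb).symm) ((H.right a ha).symm ▸ one_pos)

lemma IsWt.wp_mem_Opr (H : IsWt wt Y Z m) (ht : ∀ v, 0 < wt v → (W v : ℂ) = t * wt v) {y z : V}
    (hy : y ∈ Y) (hz : z ∈ Z) (l : Fin (Fintype.card V)) : jK K (wp W l) ∈ Opr K m y z :=
  QI.wp_mem_Opr (H.ne hy hz) (by rw [ht y ((H.left y hy).symm ▸ H.pos), H.left y hy])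
    (by rw [ht z ((H.right z hz).symm ▸ one_pos), H.right z hz, Nat.cast_one, mul_one]) l

lemma LL_stable [Nonempty V] (H : IsWt wt Y Z m) (hW : ∀ v, 0 < W v)
    (ht : ∀ v, 0 < wt v → (W v : ℂ) = t * wt v) :
    (ambK A wt K H.hc hW ht).Stable (LL A wt K Y Z m) where
  ρ w _ hF := LL_rhoK w hF
  D a _ hF := LL_Dk H a hF
  ξ a _ hF := LL_mul (xi_mem_PP a) hF
  κ l _ hF := LL_cst_mul ⟨_, rfl⟩ (fun _ ha _ hb => sK_wp (H.weight_right ht ha hb) l)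
    (fun _ hy _ hz => H.wp_mem_Opr ht hy hz l) (fun _ ha _ hb => sK_wp (H.weight_left ht ha hb) l) hF

lemma qStable_TK (H : IsWt wt Y Z m) (ht : ∀ v, 0 < wt v → (W v : ℂ) = t * wt v) (n : ℕ) :
    QStable (fun l => jK K (wp W l)) (TK K Y Z n) := fun l _ hx =>
  TK_mul ⟨_, rfl⟩ (fun _ ha _ hb => sK_wp (H.weight_right ht ha hb) l)
    (fun _ ha _ hb => sK_wp (H.weight_left ht ha hb) l) hx

lemma qStable_LamK (H : IsWt wt Y Z m) (ht : ∀ v, 0 < wt v → (W v : ℂ) = t * wt v) :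
    QStable (fun l => jK K (wp W l)) (LamK K Y Z m) := fun l x hx =>
  ⟨qStable_TK H ht _ l x hx.1, fun y hy z hz => mul_mem (H.wp_mem_Opr ht hy hz l) (hx.2 y hy z hz)⟩

lemma LL_countable : ∃ C : Set (Cfg A wt → K), C.Countable ∧
    LL A wt K Y Z m ≤ Submodule.span ℂ C := by
  refine ⟨Set.range fun p : Cfg A wt × (V →₀ ℕ) => Pi.single p.1 (jK K (monomial p.2 1)),
    Set.countable_range _, fun F hF => ?_⟩
  rw [← Finset.univ_sum_single F]
  refine sum_mem fun φ _ => ?_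
  obtain ⟨f, hf⟩ := hF.1 φ
  have h1 : Pi.single φ (F φ) = ∑ e ∈ f.support, coeff e f •
      (Pi.single φ (jK K (monomial e 1)) : Cfg A wt → K) := by
    have h2 : jK K f = ∑ e ∈ f.support, coeff e f • jK K (monomial e 1) := by
      conv_lhs => rw [f.as_sum]
      rw [map_sum]
      refine Finset.sum_congr rfl fun e _ => ?_
      rw [← map_smul, smul_monomial, smul_eq_mul, mul_one]
    rw [← hf]
    change (Pi.single φ (jK K f) : Cfg A wt → K) = _
    rw [h2]
    change LinearMap.single ℂ (fun _ => K) φ _ = _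
    rw [map_sum]
    exact Finset.sum_congr rfl fun e _ => map_smul (LinearMap.single ℂ (fun _ => K) φ) _ _
  rw [h1]
  exact sum_mem fun e _ => Submodule.smul_mem _ _ (Submodule.subset_span ⟨(φ, e), rfl⟩)

lemma cst_mem_LL (H : IsWt wt Y Z m) {x : K} (hx : x ∈ LamK K Y Z m) :
    cst A wt K x ∈ LL A wt K Y Z m := by
  have hloc : ∀ a b, x ∈ loc K a b := fun a b => by obtain ⟨f, hf⟩ := hx.1.1; exact hf ▸ jK_mem_loc f
  refine ⟨fun _ => hx.1.1, fun a ha b hb h => by rw [hat_cst, hx.1.2.1 a ha b hb],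
    fun y hy z hz => ?_, fun a ha b hb hab h => ?_⟩
  · rw [← mul_one (cst A wt K x)]
    exact Lyz_cst_mul (hx.2 y hy z hz) (one_mem_Lyz (H.ne hy hz) (H.left y hy) (H.right z hz))
  · rw [hat_cst, ← map_add, ← map_sub]
    refine ⟨cst_mem_Lev (add_mem (hloc a b) (sK_mem_loc (hloc a b))) ?_, ?_, mem_pcl.2 fun P hP => ?_⟩
    · rw [map_add, sK_swap_swap, add_comm]
    · rw [hat_cst, map_sub, sK_swap_swap, ← map_neg, neg_sub]
    · refine sum_mem_TO fun φ _ => mul_TO (PP_mem_loc hP φ a b) ?_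
      rw [H.left a ha]
      exact hx.1.2.2 a ha b hb hab

variable (A wt K) in
/-- Average over all configurations. -/
def avg : (Cfg A wt → K) →ₗ[ℂ] K :=
  (Fintype.card (Cfg A wt) : ℂ)⁻¹ • ∑ φ, LinearMap.proj (R := ℂ) (φ := fun _ : Cfg A wt => K) φ

lemma avg_apply (F : Cfg A wt → K) :
    avg A wt K F = (Fintype.card (Cfg A wt) : ℂ)⁻¹ • ∑ φ, F φ := by simp [avg]

lemma avg_cst_mul (x : K) (F : Cfg A wt → K) : avg A wt K (cst A wt K x * F) = x * avg A wt K F := by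
  rw [avg_apply, avg_apply, mul_smul_comm, Finset.mul_sum]
  rfl

lemma avg_cst [Nonempty (Cfg A wt)] (x : K) : avg A wt K (cst A wt K x) = x := by
  rw [avg_apply]
  have : (Fintype.card (Cfg A wt) : ℂ) ≠ 0 := by exact_mod_cast Fintype.card_ne_zero
  simp only [cst_apply, Finset.sum_const, Finset.card_univ, ← Nat.cast_smul_eq_nsmul ℂ]
  rw [smul_smul, inv_mul_cancel₀ this, one_smul]

lemma sum_hat {a b : V} (h : wt a = wt b) (F : Cfg A wt → K) :
    ∑ φ, hat K h F φ = sK K (swap a b) (∑ φ, F φ) := by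
  rw [map_sum, ← Equiv.sum_comp (Cfg.labEquiv h) fun φ => sK K (swap a b) (F φ)]
  rfl

lemma avg_mem_LamK (H : IsWt wt Y Z m) {F : Cfg A wt → K} (hF : F ∈ LL A wt K Y Z m) :
    avg A wt K F ∈ LamK K Y Z m := by
  rw [avg_apply]
  refine Submodule.smul_mem _ _ ⟨⟨sum_mem fun φ _ => hF.1 φ, fun a ha b hb => ?_, 
    fun a ha b hb hab => ?_⟩, fun y hy z hz => pcl_sum (hF.2.2.1 y hy z hz).2⟩
  · have h := (H.right a ha).trans (H.right b hb).symm
    rw [← sum_hat h, hF.2.1 a ha b hb h]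
  · have h := (H.left a ha).trans (H.left b hb).symm
    rw [← sum_hat h, ← Finset.sum_sub_distrib]
    have := pcl_sum (hF.2.2.2 a ha b hb hab h).2.2
    rwa [H.left a ha] at this

end stable

lemma exists_perm_of_card_fiber {A B : Type} [Fintype A] [DecidableEq B] (p q : A → B)
    (h : ∀ b, (Finset.univ.filter fun i => p i = b).card = (Finset.univ.filter fun i => q i = b).card) :
    ∃ w : Perm A, ∀ i, q (w i) = p i := by
  have e : ∀ b, {i // p i = b} ≃ {i // q i = b} := fun b => Fintype.equivOfCardEq (by
    rw [Fintype.card_subtype, Fintype.card_subtype, h])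
  refine ⟨(Equiv.sigmaFiberEquiv p).symm.trans ((Equiv.sigmaCongrRight e).trans
    (Equiv.sigmaFiberEquiv q)), fun i => ?_⟩
  exact (e (p i) ⟨i, rfl⟩).2

section chi
variable {A : Type} [Fintype A] [DecidableEq A] {M : Finset A}

lemma mul_chi {v : Perm A} (hv : ∀ a, v a ∈ M ↔ a ∈ M) (w : Perm A) :
    chi M (v * w) = chi M v * chi M w := by
  by_cases hw : ∀ a, w a ∈ M ↔ a ∈ M
  · exact chi_mul v hw
  · obtain ⟨a, ha⟩ := not_forall.1 hw
    rw [chi_of_not (M := M) (w := w) ha, chi_of_not (a := a), mul_zero]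
    rwa [Perm.mul_apply, hv]

lemma chi_mul_chi {v : Perm A} (hv : ∀ a, v a ∈ M ↔ a ∈ M) : chi M v * chi M v = 1 := by
  unfold chi
  rw [dif_pos hv, ← Units.val_mul, Int.units_mul_self, Units.val_one]

end chi

section alt
variable {A V : Type} [Fintype A] [DecidableEq A] [Fintype V] [DecidableEq V] {wt : V → ℕ}
variable {K : Type} [Field K] [Algebra (MvPolynomial V ℂ) K]
  [IsFractionRing (MvPolynomial V ℂ) K] [Algebra ℂ K] [IsScalarTower ℂ (MvPolynomial V ℂ) K]
variable (M : Finset A)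

variable (wt K) in
/-- Antisymmetrisation with respect to the labels in `M`. -/
def alt : Module.End ℂ (Cfg A wt → K) := ∑ w, chi M w • rhoK wt K w

lemma alt_eq (F : Cfg A wt → K) : alt wt K M F = ∑ w, chi M w • rhoK wt K w F := by simp [alt]

lemma alt_apply (F : Cfg A wt → K) (φ : Cfg A wt) :
    alt wt K M F φ = ∑ w, chi M w • F (φ.comp w) := by simp [alt_eq]

/-- A function which is antisymmetric in the labels in `M`. -/
def IsAlt (F : Cfg A wt → K) : Prop :=
  ∀ v : Perm A, (∀ a, v a ∈ M ↔ a ∈ M) → ∀ φ : Cfg A wt, F (φ.comp v) = chi M v • F φ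

variable {M}

lemma isAlt_alt (F : Cfg A wt → K) : IsAlt M (alt wt K M F) := fun v hv φ => by
  rw [alt_apply, alt_apply, Finset.smul_sum, ← Equiv.sum_comp (Equiv.mulLeft v)
    fun w => chi M v • chi M w • F (φ.comp w)]
  refine Finset.sum_congr rfl fun w _ => ?_
  rw [Equiv.coe_mulLeft, mul_chi hv, smul_smul, ← mul_assoc, chi_mul_chi hv, one_mul]
  rfl

lemma IsAlt.swap {F : Cfg A wt → K} (hF : IsAlt M F) {i j : A} (hi : i ∈ M) (hj : j ∈ M) (h : i ≠ j)
    (φ : Cfg A wt) : F (φ.comp (swap i j)) = - F φ := by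
  rw [hF _ (swap_mem_iff (by simp [hi, hj])), chi_swap_mem hi hj h, neg_one_smul]

lemma IsAlt.eq_zero {F : Cfg A wt → K} (hF : IsAlt M F) {φ : Cfg A wt} (h : ¬ Set.InjOn φ.1 M) :
    F φ = 0 := by
  simp only [Set.InjOn, not_forall] at h
  obtain ⟨i, hi, j, hj, hij, hne⟩ := h
  have h1 := hF.swap hi hj hne φ
  rw [Cfg.comp_swap_of_eq hij] at h1
  have := charZero_K (K := K)
  exact self_eq_neg.1 h1

lemma IsAlt.mem_TO {P : Cfg A wt → K} (hF : IsAlt M P) (hP : P ∈ PP A wt K) {φ : Cfg A wt} {i j : A}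
    (hi : i ∈ M) (hj : j ∈ M) (h : i ≠ j) : P φ ∈ TO K (φ.1 i) (φ.1 j) 1 := by
  have h1 := PP_sub_mem_TO hP (φ := φ) (i := i) (j := j) rfl rfl
  rw [hF.swap hi hj h, sub_neg_eq_add] at h1
  have h2 : P φ = (2 : ℂ)⁻¹ • (P φ + P φ) := by
    rw [← two_smul ℂ, smul_smul]; norm_num
  rw [h2]
  exact Submodule.smul_mem _ _ h1

lemma alt_mem_PP {P : Cfg A wt → K} (hP : P ∈ PP A wt K) : alt wt K M P ∈ PP A wt K := by
  rw [alt_eq]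
  exact sum_mem fun w _ => zsmul_mem (rhoK_mem_PP w hP) _

lemma hat_alt {a b : V} (h : wt a = wt b) (F : Cfg A wt → K) :
    hat K h (alt wt K M F) = alt wt K M (hat K h F) := by
  simp only [alt_eq, map_sum, map_zsmul, hat_rhoK]

variable (M) in
/-- The number of permutations preserving `M`. -/
def altCount : ℕ := (Finset.univ.filter fun w : Perm A => ∀ a, w a ∈ M ↔ a ∈ M).card

lemma altCount_pos : 0 < altCount M := Finset.card_pos.2 ⟨1, by simp⟩

/-- Antisymmetrisation is self-adjoint. -/
lemma sum_mul_alt {D : Cfg A wt → K} (hD : IsAlt M D) (F : Cfg A wt → K) :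
    ∑ φ, D φ * alt wt K M F φ = altCount M • ∑ φ, D φ * F φ := by
  simp only [alt_apply, Finset.mul_sum]
  rw [Finset.sum_comm, altCount, ← Finset.sum_const, Finset.sum_filter]
  refine Finset.sum_congr rfl fun w _ => ?_
  split_ifs with hw
  · rw [← Equiv.sum_comp (Cfg.compEquiv w) fun φ => D φ * F φ]
    refine Finset.sum_congr rfl fun φ _ => ?_
    change _ = D (φ.comp w) * F (φ.comp w)
    rw [hD w hw, smul_mul_assoc, mul_smul_comm]
  · obtain ⟨a, ha⟩ := not_forall.1 hw
    exact Finset.sum_eq_zero fun φ _ => by rw [chi_of_not ha, zero_smul, mul_zero]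

variable (wt K M) in
/-- The Vandermonde function of the labels in `M`. -/
def vdm : Cfg A wt → K := ∏ i, ∏ j ∈ Finset.Ioi i,
  (xi wt K (M.equivFin.symm j : A) - xi wt K (M.equivFin.symm i : A))

lemma vdm_apply (φ : Cfg A wt) : vdm wt K M φ =
    ∏ i, ∏ j ∈ Finset.Ioi i, (uK V K (φ.1 (M.equivFin.symm j)) - uK V K (φ.1 (M.equivFin.symm i))) := by
  simp [vdm, Finset.prod_apply]

lemma vdm_mem_PP : vdm wt K M ∈ PP A wt K :=
  prod_mem fun _ _ => prod_mem fun _ _ => sub_mem (xi_mem_PP _) (xi_mem_PP _)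

lemma isAlt_vdm : IsAlt M (vdm wt K M) := fun v hv φ => by
  rw [vdm_apply, vdm_apply, ← Matrix.det_vandermonde fun k => uK V K (φ.1 (M.equivFin.symm k)),
    ← Matrix.det_vandermonde fun k => uK V K ((φ.comp v).1 (M.equivFin.symm k))]
  set π : Perm (Fin M.card) := (M.equivFin.symm.trans (v.subtypePerm (p := (· ∈ M)) hv)).trans
    M.equivFin with hπ
  have h1 : Matrix.vandermonde (fun k => uK V K ((φ.comp v).1 (M.equivFin.symm k))) =
      (Matrix.vandermonde fun k => uK V K (φ.1 (M.equivFin.symm k))).submatrix π id := by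
    ext k l
    simp [Matrix.vandermonde_apply, hπ]
  rw [h1, Matrix.det_permute, hπ, Perm.sign_symm_trans_trans, chi, dif_pos hv, zsmul_eq_mul]

lemma vdm_ne_zero {φ : Cfg A wt} (h : Set.InjOn φ.1 M) : vdm wt K M φ ≠ 0 := by
  rw [vdm_apply]
  refine Finset.prod_ne_zero_iff.2 fun i _ => Finset.prod_ne_zero_iff.2 fun j hj =>
    uK_sub_ne_zero fun e => ?_
  have := M.equivFin.symm.injective (Subtype.ext (h (Subtype.coe_prop _) (Subtype.coe_prop _) e))
  exact (Finset.mem_Ioi.1 hj).ne this.symm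

/-- Isolating one factor of the Vandermonde function. -/
lemma div_vdm_mem_loc {φ : Cfg A wt} (h : Set.InjOn φ.1 M) {i j : A} (hi : i ∈ M) (hj : j ∈ M)
    (hij : i ≠ j) : (uK V K (φ.1 i) - uK V K (φ.1 j)) / vdm wt K M φ ∈ loc K (φ.1 i) (φ.1 j) := by
  have hinj : ∀ k l : Fin M.card, φ.1 (M.equivFin.symm k) = φ.1 (M.equivFin.symm l) → k = l :=
    fun k l e => M.equivFin.symm.injective (Subtype.ext (h (Subtype.coe_prop _) (Subtype.coe_prop _) e))
  have key : ∀ k l : Fin M.card, k < l → (uK V K (φ.1 (M.equivFin.symm l)) -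
      uK V K (φ.1 (M.equivFin.symm k))) / vdm wt K M φ ∈
      loc K (φ.1 (M.equivFin.symm l)) (φ.1 (M.equivFin.symm k)) := fun k l hkl => by
    rw [vdm_apply, Finset.prod_sigma', ← Finset.mul_prod_erase _ _ (a := ⟨k, l⟩) (by simpa using hkl),
      div_mul_cancel_left₀ (uK_sub_ne_zero fun e => hkl.ne (hinj _ _ e).symm), ← Finset.prod_inv_distrib]
    refine prod_mem fun p hp => inv_sub_mem_loc ?_ ?_
    · rintro ⟨e1, e2⟩
      rw [Finset.mem_erase] at hp
      exact hp.1 (by cases p; simp only at e1 e2; rw [hinj _ _ e1, hinj _ _ e2])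
    · rintro ⟨e1, e2⟩
      have h1 := Finset.mem_Ioi.1 (Finset.mem_sigma.1 (Finset.mem_erase.1 hp).2).2
      rw [hinj _ _ e1, hinj _ _ e2] at h1
      exact lt_asymm hkl h1
  have hi' : (M.equivFin.symm (M.equivFin ⟨i, hi⟩) : A) = i := by simp
  have hj' : (M.equivFin.symm (M.equivFin ⟨j, hj⟩) : A) = j := by simp
  rcases lt_trichotomy (M.equivFin ⟨i, hi⟩) (M.equivFin ⟨j, hj⟩) with h1 | h1 | h1
  · have := key _ _ h1
    rw [hi', hj', loc_symm] at this
    rw [← neg_sub, neg_div]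
    exact neg_mem this
  · exact absurd (congrArg Subtype.val (M.equivFin.injective h1)) hij
  · have := key _ _ h1
    rwa [hi', hj'] at this

end alt

section factor
variable {A V : Type} [Fintype A] [DecidableEq A] [Fintype V] [DecidableEq V] {wt : V → ℕ}
variable {K : Type} [Field K] [Algebra (MvPolynomial V ℂ) K]
  [IsFractionRing (MvPolynomial V ℂ) K] [Algebra ℂ K] [IsScalarTower ℂ (MvPolynomial V ℂ) K]
variable {Y Z : Finset V} {m : ℕ} {M : Finset A} {φ φ₀ : Cfg A wt}

lemma IsWt.mem_union (H : IsWt wt Y Z m) (φ : Cfg A wt) (i : A) : φ.1 i ∈ Y ∪ Z := by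
  by_contra h
  rw [Finset.mem_union, not_or] at h
  exact (φ.wt_pos i).ne' (H.other _ h.1 h.2)

lemma IsWt.image_eq (H : IsWt wt Y Z m) (hM : M.card = Y.card + Z.card) (h : Set.InjOn φ.1 M) :
    M.image φ.1 = Y ∪ Z := by
  refine Finset.eq_of_subset_of_card_le (fun v hv => ?_) ?_
  · obtain ⟨i, _, rfl⟩ := Finset.mem_image.1 hv
    exact H.mem_union φ i
  · rw [Finset.card_image_of_injOn h, hM, Finset.card_union_of_disjoint H.disj]

lemma IsWt.exists_perm (H : IsWt wt Y Z m) (hM : M.card = Y.card + Z.card) (h₀ : Set.InjOn φ₀.1 M)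
    (h : Set.InjOn φ.1 M) : ∃ w : Perm A, (∀ a, w a ∈ M ↔ a ∈ M) ∧ φ = φ₀.comp w := by
  have key : ∀ ψ : Cfg A wt, Set.InjOn ψ.1 M → ∀ v, (Finset.univ.filter fun i => ψ.1 i = v ∧ i ∈ M).card =
      if v ∈ Y ∪ Z then 1 else 0 := fun ψ hψ v => by
    split_ifs with hv
    · rw [← H.image_eq hM hψ] at hv
      obtain ⟨i, hi, rfl⟩ := Finset.mem_image.1 hv
      refine Finset.card_eq_one.2 ⟨i, ?_⟩
      ext j
      simp only [Finset.mem_filter, Finset.mem_univ, true_and, Finset.mem_singleton]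
      exact ⟨fun hj => hψ hj.2 hi hj.1, by rintro rfl; exact ⟨rfl, hi⟩⟩
    · rw [Finset.card_eq_zero, Finset.filter_eq_empty_iff]
      rintro i _ ⟨rfl, _⟩
      exact hv (H.mem_union ψ i)
  have key' : ∀ ψ : Cfg A wt, Set.InjOn ψ.1 M → ∀ v, (Finset.univ.filter fun i => ψ.1 i = v ∧ i ∉ M).card =
      wt v - if v ∈ Y ∪ Z then 1 else 0 := fun ψ hψ v => by
    rw [← key ψ hψ v, ← ψ.2 v, ← Finset.card_filter_add_card_filter_not
      (s := Finset.univ.filter fun i => ψ.1 i = v) (fun i => i ∈ M),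
      Finset.filter_filter, Finset.filter_filter, Nat.add_sub_cancel_left]
  obtain ⟨w, hw⟩ := exists_perm_of_card_fiber (fun i => (φ.1 i, decide (i ∈ M)))
    (fun i => (φ₀.1 i, decide (i ∈ M))) (by
      rintro ⟨v, b⟩
      cases b
      · simpa using (key' φ h v).trans (key' φ₀ h₀ v).symm
      · simpa using (key φ h v).trans (key φ₀ h₀ v).symm)
  simp only [Prod.mk.injEq, decide_eq_decide] at hw
  exact ⟨w, fun a => (hw a).2, Subtype.ext (funext fun i => (hw i).1.symm)⟩

/-- The coefficient of the Vandermonde function in an antisymmetric function. -/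
def altCoeff (K : Type) [Field K] [Algebra (MvPolynomial V ℂ) K] [IsFractionRing (MvPolynomial V ℂ) K]
    [Algebra ℂ K] [IsScalarTower ℂ (MvPolynomial V ℂ) K] (M : Finset A) (φ₀ : Cfg A wt) :
    (Cfg A wt → K) →ₗ[ℂ] K :=
  LinearMap.mulLeft ℂ (vdm wt K M φ₀)⁻¹ ∘ₗ LinearMap.proj φ₀ ∘ₗ alt wt K M

lemma altCoeff_apply (F : Cfg A wt → K) :
    altCoeff K M φ₀ F = (vdm wt K M φ₀)⁻¹ * alt wt K M F φ₀ := rfl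

variable (H : IsWt wt Y Z m) (hM : M.card = Y.card + Z.card) (h₀ : Set.InjOn φ₀.1 M)
include H hM h₀

lemma IsAlt.eq_vdm_mul {F : Cfg A wt → K} (hF : IsAlt M F) :
    F = vdm wt K M * cst A wt K ((vdm wt K M φ₀)⁻¹ * F φ₀) := by
  funext φ
  rw [Pi.mul_apply, cst_apply]
  by_cases h : Set.InjOn φ.1 M
  · obtain ⟨w, hw, rfl⟩ := H.exists_perm hM h₀ h
    rw [hF w hw, isAlt_vdm w hw, smul_mul_assoc, mul_inv_cancel_left₀ (vdm_ne_zero h₀)]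
  · rw [hF.eq_zero h, isAlt_vdm.eq_zero h, zero_mul]

lemma alt_eq_vdm_mul (F : Cfg A wt → K) :
    alt wt K M F = vdm wt K M * cst A wt K (altCoeff K M φ₀ F) :=
  (isAlt_alt F).eq_vdm_mul H hM h₀

lemma altCoeff_hat {a b : V} (h : wt a = wt b) (F : Cfg A wt → K) :
    altCoeff K M φ₀ (hat K h F) = sK K (swap a b) (altCoeff K M φ₀ F) := by
  have h1 := alt_eq_vdm_mul H hM h₀ (hat K h F)
  rw [← hat_alt, alt_eq_vdm_mul H hM h₀ F, map_mul, hat_cst, hat_PP h vdm_mem_PP] at h1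
  exact (mul_left_cancel₀ (vdm_ne_zero h₀) (congrFun h1 φ₀)).symm

/-- The pairing of the Vandermonde function with `F` in terms of `altCoeff`. -/
lemma sq_mul_altCoeff_mem {T : Submodule ℂ K} {F : Cfg A wt → K} (hF : F ∈ pcl T) :
    vdm wt K M φ₀ ^ 2 * altCoeff K M φ₀ F ∈ T := by
  have h1 := sum_mul_alt (isAlt_vdm (wt := wt) (K := K) (M := M)) F
  rw [alt_eq_vdm_mul H hM h₀ F] at h1
  set S := Finset.univ.filter fun φ : Cfg A wt => Set.InjOn φ.1 M
  have h2 : ∑ φ, vdm wt K M φ * (vdm wt K M * cst A wt K (altCoeff K M φ₀ F)) φ =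
      S.card • (vdm wt K M φ₀ ^ 2 * altCoeff K M φ₀ F) := by
    rw [← Finset.sum_const, Finset.sum_filter]
    refine Finset.sum_congr rfl fun φ _ => ?_
    rw [Pi.mul_apply, cst_apply]
    split_ifs with h
    · obtain ⟨w, hw, rfl⟩ := H.exists_perm hM h₀ h
      rw [isAlt_vdm w hw, zsmul_eq_mul]
      have : (chi M w : K) * chi M w = 1 := by exact_mod_cast congrArg (Int.cast : ℤ → K) (chi_mul_chi hw)
      linear_combination (vdm wt K M φ₀ ^ 2 * altCoeff K M φ₀ F) * this
    · rw [isAlt_vdm.eq_zero h, zero_mul]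
  rw [h2] at h1
  have hS : (S.card : ℂ) ≠ 0 := by
    exact_mod_cast (Finset.card_pos.2 ⟨φ₀, by simpa [S] using h₀⟩).ne'
  have h3 : vdm wt K M φ₀ ^ 2 * altCoeff K M φ₀ F =
      (S.card : ℂ)⁻¹ • (altCount M • ∑ φ, vdm wt K M φ * F φ) := by
    rw [← h1, ← Nat.cast_smul_eq_nsmul ℂ, smul_smul, inv_mul_cancel₀ hS, one_smul]
  rw [h3]
  exact T.smul_mem _ (T.nsmul_mem (mem_pcl.1 hF _ vdm_mem_PP) _)

omit h₀ in
/-- Pairings with the Vandermonde function vanish to second order on the diagonals. -/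
lemma sum_mul_vdm_mem_TO {P : Cfg A wt → K} (hP : P ∈ PP A wt K) {a b : V} (ha : a ∈ Y ∪ Z)
    (hb : b ∈ Y ∪ Z) (hab : a ≠ b) : ∑ φ, P φ * vdm wt K M φ ∈ TO K a b 2 := by
  have h1 := sum_mul_alt (isAlt_vdm (wt := wt) (K := K) (M := M)) P
  have h0 : (altCount M : ℂ) ≠ 0 := by exact_mod_cast (altCount_pos (M := M)).ne'
  have h2 : ∑ φ, P φ * vdm wt K M φ = (altCount M : ℂ)⁻¹ • ∑ φ, vdm wt K M φ * alt wt K M P φ := by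
    rw [h1, ← Nat.cast_smul_eq_nsmul ℂ, smul_smul, inv_mul_cancel₀ h0, one_smul]
    exact Finset.sum_congr rfl fun φ _ => mul_comm _ _
  rw [h2]
  refine Submodule.smul_mem _ _ (sum_mem_TO fun φ _ => ?_)
  by_cases h : Set.InjOn φ.1 M
  · rw [← H.image_eq hM h] at ha hb
    obtain ⟨i, hi, rfl⟩ := Finset.mem_image.1 ha
    obtain ⟨j, hj, rfl⟩ := Finset.mem_image.1 hb
    have hij : i ≠ j := fun e => hab (by rw [e])
    exact TO_mul_TO (isAlt_vdm.mem_TO vdm_mem_PP hi hj hij)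
      ((isAlt_alt P).mem_TO (alt_mem_PP hP) hi hj hij)
  · rw [isAlt_vdm.eq_zero h, zero_mul]
    exact zero_mem _

omit h₀ in
lemma vdm_mul_cst_mem_LL {x : K} (hx : x ∈ TK K Y Z (2 * m - 1)) :
    vdm wt K M * cst A wt K x ∈ LL A wt K Y Z m := by
  have hloc : ∀ a b, x ∈ loc K a b := fun a b => by obtain ⟨f, hf⟩ := hx.1; exact hf ▸ jK_mem_loc f
  refine ⟨fun φ => mul_mem (PP_range vdm_mem_PP φ) hx.1, fun a ha b hb h => ?_, fun y hy z hz =>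
    ⟨fun φ => mul_mem (PP_mem_loc vdm_mem_PP φ y z) (hloc y z), mem_pcl.2 fun P hP => ?_⟩,
    fun a ha b hb hab h => ?_⟩
  · rw [map_mul, hat_cst, hx.2.1 a ha b hb, hat_PP h vdm_mem_PP]
  · simp only [Pi.mul_apply, cst_apply, ← mul_assoc]
    rw [← Finset.sum_mul]
    exact TO_two_le_Opr (TO_mul (sum_mul_vdm_mem_TO H hM hP (Finset.mem_union_left _ hy)
      (Finset.mem_union_right _ hz) (H.ne hy hz)) (hloc y z))
  · rw [map_mul, hat_cst, hat_PP h vdm_mem_PP, ← mul_add, ← mul_sub, ← map_add, ← map_sub]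
    refine ⟨mul_mem (PP_le_Lev vdm_mem_PP) (cst_mem_Lev (add_mem (hloc a b) (sK_mem_loc (hloc a b))) ?_),
      ?_, mem_pcl.2 fun P hP => ?_⟩
    · rw [map_add, sK_swap_swap, add_comm]
    · rw [map_mul, hat_cst, hat_PP h vdm_mem_PP, map_sub, sK_swap_swap, ← mul_neg, ← map_neg, neg_sub]
    · simp only [Pi.mul_apply, cst_apply, ← mul_assoc]
      rw [← Finset.sum_mul]
      have h1 := TO_mul_TO (sum_mul_vdm_mem_TO H hM hP (Finset.mem_union_left _ ha)
        (Finset.mem_union_left _ hb) hab) (hx.2.2 a ha b hb hab)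
      have := H.pos
      rwa [show 2 + (2 * m - 1) = 2 * wt a + 1 by rw [H.left a ha]; omega] at h1

/-- On each diagonal the Vandermonde function has exactly a simple zero. -/
lemma exists_vdm_eq {a b : V} (ha : a ∈ Y ∪ Z) (hb : b ∈ Y ∪ Z) (hab : a ≠ b) : ∃ v ∈ loc K a b,
    v⁻¹ ∈ loc K a b ∧ v ≠ 0 ∧ vdm wt K M φ₀ = (uK V K a - uK V K b) * v := by
  have hd := vdm_ne_zero (K := K) h₀
  rw [← H.image_eq hM h₀] at ha hb
  obtain ⟨i, hi, rfl⟩ := Finset.mem_image.1 ha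
  obtain ⟨j, hj, rfl⟩ := Finset.mem_image.1 hb
  have hij : i ≠ j := fun e => hab (by rw [e])
  have ht := uK_sub_ne_zero (K := K) hab
  refine ⟨vdm wt K M φ₀ / (uK V K (φ₀.1 i) - uK V K (φ₀.1 j)), div_t_mem_loc hab
    (isAlt_vdm.mem_TO vdm_mem_PP hi hj hij), ?_, div_ne_zero hd ht, ?_⟩
  · rw [inv_div]
    exact div_vdm_mem_loc h₀ hi hj hij
  · rw [mul_div_cancel₀ _ ht]

lemma t_mul_altCoeff_mem_loc {a b : V} (ha : a ∈ Y ∪ Z) (hb : b ∈ Y ∪ Z) (hab : a ≠ b)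
    {F : Cfg A wt → K} (hF : ∀ φ, F φ ∈ loc K a b) :
    (uK V K a - uK V K b) * altCoeff K M φ₀ F ∈ loc K a b := by
  obtain ⟨v, hv, hv', hv0, h⟩ := exists_vdm_eq (K := K) H hM h₀ ha hb hab
  have ht := uK_sub_ne_zero (K := K) hab
  have h1 : alt wt K M F φ₀ ∈ loc K a b := by
    rw [alt_apply]; exact sum_mem fun w _ => zsmul_mem (hF _) _
  have h2 : (uK V K a - uK V K b) * altCoeff K M φ₀ F = v⁻¹ * alt wt K M F φ₀ := by
    rw [altCoeff_apply, h]
    field_simp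
  rw [h2]
  exact mul_mem hv' h1

omit H hM h₀ in
lemma mem_loc_of_even {a b : V} (hab : a ≠ b) {x : K} (hx : (uK V K a - uK V K b) * x ∈ loc K a b)
    (hs : sK K (swap a b) x = x) : x ∈ loc K a b := by
  refine TO_zero.1 (mem_TO_of_t_mul hab (odd_mem_TO hx ?_))
  rw [map_mul, hs, map_sub, sK_uK, sK_uK, swap_apply_left, swap_apply_right]
  ring

lemma altCoeff_mem_loc_mixed {y z : V} (hy : y ∈ Y) (hz : z ∈ Z) {F : Cfg A wt → K}
    (hF : F ∈ Lyz A wt K m y z) : altCoeff K M φ₀ F ∈ loc K y z := by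
  have hyz := H.ne hy hz
  have hy' := Finset.mem_union_left Z hy
  have hz' := Finset.mem_union_right Y hz
  obtain ⟨v, hv, hv', hv0, h⟩ := exists_vdm_eq (K := K) H hM h₀ hy' hz' hyz
  have h1 := t_mul_altCoeff_mem_loc H hM h₀ hy' hz' hyz hF.1
  have h2 := sq_mul_altCoeff_mem H hM h₀ hF.2
  set t := uK V K y - uK V K z with ht
  set x := altCoeff K M φ₀ F
  have h3 : t * (v ^ 2 * (t * x)) ∈ Opr K m y z := by
    have : t * (v ^ 2 * (t * x)) = vdm wt K M φ₀ ^ 2 * x := by rw [h]; ring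
    rw [this]; exact h2
  have hq : v ^ 2 * (t * x) ∈ loc K y z := mul_mem (pow_mem hv 2) h1
  have h4 := (mem_Opr.1 h3).2
  rw [Derivation.leibniz, smul_eq_mul, smul_eq_mul, ht, map_sub, del_uK_left hyz, del_uK_right hyz,
    ← ht] at h4
  have h5 : v ^ 2 * (t * x) ∈ TO K y z 1 := by
    have h6 := sub_mem h4 (t_mul_TO (del_mem_loc (m := m) hq))
    rw [← ht, add_sub_cancel_left] at h6
    have h7 := charZero_K (K := K)
    have h8 : ((m : K) + 1) ≠ 0 := by exact_mod_cast m.succ_ne_zero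
    have h9 : v ^ 2 * (t * x) = (-((m + 1 : ℕ) : K)⁻¹) * (v ^ 2 * (t * x) * (-1 - (m : K))) := by
      push_cast
      field_simp
      ring
    rw [h9]
    exact mul_TO (neg_mem (inv_natCast_mem_loc _)) h6
  have h6 : t * x ∈ TO K y z 1 := by
    have : t * x = (v⁻¹) ^ 2 * (v ^ 2 * (t * x)) := by field_simp
    rw [this]; exact mul_TO (pow_mem hv' 2) h5
  exact TO_zero.1 (mem_TO_of_t_mul hyz h6)

lemma altCoeff_sub_mem {a b : V} (ha : a ∈ Y) (hb : b ∈ Y) (hab : a ≠ b) {F : Cfg A wt → K}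
    (hF : F ∈ LL A wt K Y Z m) : altCoeff K M φ₀ F - sK K (swap a b) (altCoeff K M φ₀ F) ∈
      TO K a b (2 * m - 1) := by
  have h := (H.left a ha).trans (H.left b hb).symm
  have h1 := sq_mul_altCoeff_mem H hM h₀ (hF.2.2.2 a ha b hb hab h).2.2
  rw [map_sub, altCoeff_hat H hM h₀] at h1
  obtain ⟨v, hv, hv', hv0, hd⟩ := exists_vdm_eq (K := K) H hM h₀ (Finset.mem_union_left Z ha)
    (Finset.mem_union_left Z hb) hab
  refine mem_TO_of_pow_mul hab (k := 2) ?_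
  have h2 := mul_TO (pow_mem hv' 2) h1
  rw [hd] at h2
  have := H.pos
  rw [show 2 + (2 * m - 1) = 2 * wt a + 1 by rw [H.left a ha]; omega]
  convert h2 using 1
  field_simp

lemma altCoeff_mem_loc {a b : V} (ha : a ∈ Y ∪ Z) (hb : b ∈ Y ∪ Z) (hab : a ≠ b) {F : Cfg A wt → K}
    (hF : F ∈ LL A wt K Y Z m) : altCoeff K M φ₀ F ∈ loc K a b := by
  have ht := t_mul_altCoeff_mem_loc H hM h₀ ha hb hab fun φ => LL_mem_loc hF φ a b
  rcases Finset.mem_union.1 ha with hy | hz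
  · rcases Finset.mem_union.1 hb with hy' | hz'
    · have h := (H.left a hy).trans (H.left b hy').symm
      have h1 := TO_le_loc (altCoeff_sub_mem H hM h₀ hy hy' hab hF)
      have h2 := t_mul_altCoeff_mem_loc H hM h₀ ha hb hab fun φ => 
        Lev_apply (hF.2.2.2 a hy b hy' hab h).1 φ
      rw [map_add, altCoeff_hat H hM h₀] at h2
      have h3 := mem_loc_of_even hab h2 (by rw [map_add, sK_swap_swap, add_comm])
      have h4 : altCoeff K M φ₀ F = (2 : ℂ)⁻¹ • ((altCoeff K M φ₀ F - sK K (swap a b) (altCoeff K M φ₀ F)) +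
          (altCoeff K M φ₀ F + sK K (swap a b) (altCoeff K M φ₀ F))) := by
        rw [sub_add_add_cancel, ← two_smul ℂ, smul_smul]; norm_num
      rw [h4]
      exact Subalgebra.smul_mem _ (add_mem h1 h3) _
    · exact altCoeff_mem_loc_mixed H hM h₀ hy hz' (hF.2.2.1 a hy b hz')
  · rcases Finset.mem_union.1 hb with hy' | hz'
    · rw [loc_symm]
      exact altCoeff_mem_loc_mixed H hM h₀ hy' hz (hF.2.2.1 b hy' a hz)
    · refine mem_loc_of_even hab ht ?_
      have h := (H.right a hz).trans (H.right b hz').symm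
      rw [← altCoeff_hat H hM h₀ h, hF.2.1 a hz b hz' h]

lemma altCoeff_mem_TK {F : Cfg A wt → K} (hF : F ∈ LL A wt K Y Z m) :
    altCoeff K M φ₀ F ∈ TK K Y Z (2 * m - 1) := by
  refine ⟨?_, fun a ha b hb => ?_, fun a ha b hb hab => altCoeff_sub_mem H hM h₀ ha hb hab hF⟩
  · have hinj : ∀ k l : Fin M.card, φ₀.1 (M.equivFin.symm k) = φ₀.1 (M.equivFin.symm l) → k = l :=
      fun k l e => M.equivFin.symm.injective
        (Subtype.ext (h₀ (Subtype.coe_prop _) (Subtype.coe_prop _) e))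
    set S := (Finset.univ.sigma fun i : Fin M.card => Finset.Ioi i).image fun p =>
      (φ₀.1 (M.equivFin.symm p.2 : A), φ₀.1 (M.equivFin.symm p.1 : A)) with hS
    have hne : ∀ e ∈ S, e.1 ≠ e.2 := fun e he => by
      obtain ⟨p, hp, rfl⟩ := Finset.mem_image.1 he
      exact fun e => (Finset.mem_Ioi.1 (Finset.mem_sigma.1 hp).2).ne (hinj _ _ e).symm
    have hd : vdm wt K M φ₀ = ∏ e ∈ S, (uK V K e.1 - uK V K e.2) := by
      rw [hS, Finset.prod_image, Finset.prod_sigma, vdm_apply]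
      rintro ⟨i, j⟩ _ ⟨k, l⟩ _ e
      rw [Prod.mk.injEq] at e
      simp only at e
      rw [hinj _ _ e.1, hinj _ _ e.2]
    refine mem_range_of_forall_loc hne ?_ fun e he => altCoeff_mem_loc H hM h₀ ?_ ?_ (hne e he) hF
    · rw [← hd, altCoeff_apply, mul_comm, mul_inv_cancel_left₀ (vdm_ne_zero h₀), alt_apply]
      exact sum_mem fun w _ => zsmul_mem (hF.1 _) _
    · obtain ⟨p, hp, rfl⟩ := Finset.mem_image.1 he
      exact H.mem_union φ₀ _
    · obtain ⟨p, hp, rfl⟩ := Finset.mem_image.1 he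
      exact H.mem_union φ₀ _
  · have h := (H.right a ha).trans (H.right b hb).symm
    rw [← altCoeff_hat H hM h₀ h, hF.2.1 a ha b hb h]

end factor

section framework
variable {V : Type} [Fintype V] [DecidableEq V] {wt : V → ℕ}
variable {K : Type} [Field K] [Algebra (MvPolynomial V ℂ) K]
  [IsFractionRing (MvPolynomial V ℂ) K] [Algebra ℂ K] [IsScalarTower ℂ (MvPolynomial V ℂ) K]
variable {Y Z : Finset V} {m : ℕ} {W : V → ℕ} {t : ℂ}

lemma alt_cst_mul {A : Type} [Fintype A] [DecidableEq A] (M : Finset A) (x : K) (F : Cfg A wt → K) :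
    alt wt K M (cst A wt K x * F) = cst A wt K x * alt wt K M F := by
  simp only [alt_eq, Finset.mul_sum, mul_smul_comm]
  rfl

lemma IsWt.card_sigma (H : IsWt wt Y Z m) :
    Fintype.card (Σ v, Fin (wt v)) = m * Y.card + Z.card := by
  rw [Fintype.card_sigma]
  simp only [Fintype.card_fin]
  rw [← Finset.sum_subset (Finset.subset_univ (Y ∪ Z)) fun v _ hv => by
    rw [Finset.mem_union, not_or] at hv; exact H.other v hv.1 hv.2, Finset.sum_union H.disj,
    Finset.sum_congr rfl H.left, Finset.sum_congr rfl H.right]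
  simp [mul_comm]

lemma nonempty_cfg_sigma : Nonempty (Cfg (Σ v, Fin (wt v)) wt) := by
  refine ⟨⟨Sigma.fst, fun v => ?_⟩⟩
  rw [← Fintype.card_subtype, Fintype.card_congr (Equiv.sigmaSubtype v), Fintype.card_fin]

theorem regLoc_LamK [Nonempty V] (H : IsWt wt Y Z m) (hZ : Z.card < m) (hW : ∀ v, 0 < W v)
    (ht : ∀ v, 0 < wt v → (W v : ℂ) = t * wt v)
    (h : RegLoc (fun l => jK K (wp W l)) (TK K Y Z (2 * m - 1)) (qStable_TK H ht _)) :
    RegLoc (fun l => jK K (wp W l)) (LamK K Y Z m) (qStable_LamK H ht) := by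
  have := nonempty_cfg_sigma (wt := wt)
  set A := Σ v, Fin (wt v)
  have key := (ambK A wt K H.hc hW ht).regLoc_of_regLoc hZ H.card_sigma (LL_stable H hW ht)
    LL_countable (qStable_TK H ht _) h fun M hM => ?_
  · exact RegLoc.retract _ _ key (cst A wt K).toLinearMap (avg A wt K) (fun l v => map_mul (cst A wt K) _ _)
      (fun l v => avg_cst_mul _ _) avg_cst (fun v hv => cst_mem_LL H hv)
      (fun v hv => avg_mem_LamK H hv)
  · by_cases h₀ : ∃ φ₀ : Cfg A wt, Set.InjOn φ₀.1 M
    · obtain ⟨φ₀, h₀⟩ := h₀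
      refine ⟨altCoeff K M φ₀, LinearMap.mulLeft ℂ (vdm wt K M) ∘ₗ (cst A wt K).toLinearMap,
        fun l v => ?_, fun l v => ?_, fun v hv => altCoeff_mem_TK H hM h₀ hv,
        fun v hv => vdm_mul_cst_mem_LL H hM hv, fun v => ?_⟩
      · change altCoeff K M φ₀ (cst A wt K _ * v) = _
        rw [altCoeff_apply, alt_cst_mul, altCoeff_apply]
        exact mul_left_comm _ _ _
      · change vdm wt K M * cst A wt K _ = cst A wt K _ * (vdm wt K M * cst A wt K v)
        exact (congrArg _ (map_mul (cst A wt K) _ _)).trans (mul_left_comm _ _ _)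
      · exact (alt_eq M v).symm.trans (alt_eq_vdm_mul H hM h₀ v)
    · refine ⟨0, 0, by simp, by simp, fun _ _ => zero_mem _, fun _ _ => zero_mem _, fun v => ?_⟩
      refine (alt_eq M v).symm.trans (funext fun φ => ?_)
      exact (isAlt_alt v).eq_zero fun h => h₀ ⟨φ, h⟩

end framework

section
variable {ι W : Type} [DecidableEq ι] [CommRing W] [Algebra ℂ W]

lemma RegLoc.of_projection {q : ι → W} {M M' : Submodule ℂ W} (hM : QStable q M)
    (hM' : QStable q M') (h : RegLoc q M' hM') (hq : ∀ l, IsUnit (q l)) (e : W →ₗ[ℂ] W)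
    (he : ∀ l v, e (q l * v) = q l * e v) (hei : ∀ v ∈ M, e v = v) (hMM' : ∀ v ∈ M, v ∈ M')
    (heM : ∀ v ∈ M', e v ∈ M) : RegLoc q M hM := by
  intro S j hj v hv hjv
  have hev : e v = v := by
    obtain ⟨k, hk⟩ := hv
    have hu : IsUnit (∏ i ∈ S, q i) := (Submonoid.prod_mem (IsUnit.submonoid W) fun i _ => hq i)
    have hp : ∀ k v, e ((∏ i ∈ S, q i) ^ k * v) = (∏ i ∈ S, q i) ^ k * e v := fun k => by
      induction k with
      | zero => simp
      | succ k ih => intro v; rw [pow_succ, mul_assoc, ih, map_prod_mul e he, mul_assoc]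
    exact (hu.pow k).mul_left_cancel ((hp k v).symm.trans (hei _ hk))
  rw [← hev]
  refine bdry_map e he hM' hM heM (h S j hj _ (Loc_map LinearMap.id (fun _ => rfl) hMM' hv) ?_)
  exact bdry_map LinearMap.id (fun _ _ => rfl) hM hM' hMM' hjv

end

section chain
variable {V : Type} [Fintype V] [DecidableEq V]
variable {K : Type} [Field K] [Algebra (MvPolynomial V ℂ) K]
  [IsFractionRing (MvPolynomial V ℂ) K] [Algebra ℂ K] [IsScalarTower ℂ (MvPolynomial V ℂ) K]
variable {Y Z : Finset V} {m : ℕ} {W : V → ℕ}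

lemma isUnit_jK_wp [Nonempty V] (hW : ∀ v, 0 < W v) (l : Fin (Fintype.card V)) :
    IsUnit (jK K (wp W l)) :=
  (jK_ne_zero (by simpa using wp_sub_ne_zero hW l 0)).isUnit

lemma isWt_ite {k : ℕ} (hk : 0 < k) : IsWt (fun v => if v ∈ Y then k else 0) Y ∅ k :=
  ⟨fun _ hv => if_pos hv, fun v hv => absurd hv (Finset.notMem_empty v), fun _ hv _ => if_neg hv,
    Finset.disjoint_empty_right _, hk⟩

lemma TK_empty_one : TK K Y ∅ 1 = (⊤ : Submodule ℂ (MvPolynomial V ℂ)).map (jK K).toLinearMap := by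
  ext x
  constructor
  · rintro ⟨⟨f, rfl⟩, _⟩
    exact ⟨f, trivial, rfl⟩
  · rintro ⟨f, _, rfl⟩
    exact ⟨⟨f, rfl⟩, by simp, fun a _ b _ _ => sub_sK_mem_TO (jK_mem_loc f)⟩

lemma LamK_empty (k : ℕ) : LamK K Y ∅ k = TK K Y ∅ (2 * k + 1) := by
  ext x
  exact ⟨fun h => h.1, fun h => ⟨h, by simp⟩⟩

lemma exists_regLoc_TK_empty [Nonempty V] (hW : ∀ v, 0 < W v) {w₀ : ℕ} (hY : ∀ v ∈ Y, W v = w₀)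
    (k : ℕ) : ∃ h, RegLoc (fun l => jK K (wp W l)) (TK K Y ∅ (2 * k + 1)) h := by
  induction k with
  | zero =>
    have hst := (qStable_top (wp W)).map (jK K : MvPolynomial V ℂ →ₐ[ℂ] K)
    have h := (powReg_wp_top hW).map (jK K : MvPolynomial V ℂ →ₐ[ℂ] K) jK_injective
    rw [← TK_empty_one (Y := Y)] at h hst
    exact ⟨hst, h.regLoc hst (isUnit_jK_wp hW)⟩
  | succ k ih =>
    obtain ⟨h, hreg⟩ := ih
    rw [← LamK_empty]
    have hk : ((k + 1 : ℕ) : ℂ) ≠ 0 := by exact_mod_cast k.succ_ne_zero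
    refine ⟨_, regLoc_LamK (t := w₀ / (k + 1 : ℕ)) (isWt_ite k.succ_pos) (by simp) hW
      (fun v hv => ?_) hreg⟩
    have hvY : v ∈ Y := by_contra fun h => hv.ne' (if_neg h)
    rw [if_pos hvY, hY v hvY, div_mul_cancel₀ _ hk]

variable (Z) in
/-- The group generated by the transpositions of elements of `Z`. -/
def symGroup : Subgroup (Perm V) := Subgroup.closure {σ | ∃ a ∈ Z, ∃ b ∈ Z, σ = swap a b}

open Classical in
variable (K Z) in
/-- Symmetrisation in the variables indexed by `Z`. -/
def reynolds : K →ₗ[ℂ] K :=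
  (Fintype.card (symGroup Z) : ℂ)⁻¹ • ∑ σ : symGroup Z, (sK K σ.1).toLinearMap

open Classical in
lemma reynolds_apply (x : K) :
    reynolds K Z x = (Fintype.card (symGroup Z) : ℂ)⁻¹ • ∑ σ : symGroup Z, sK K σ.1 x := by
  simp [reynolds]

lemma sK_eq_of_mem_symGroup {x : K} (hx : ∀ a ∈ Z, ∀ b ∈ Z, sK K (swap a b) x = x) {σ : Perm V}
    (hσ : σ ∈ symGroup Z) : sK K σ x = x := by
  induction hσ using Subgroup.closure_induction with
  | mem σ h =>
    obtain ⟨a, ha, b, hb, rfl⟩ := h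
    exact hx a ha b hb
  | one => exact sK_one x
  | mul σ τ _ _ h h' => rw [sK_mul, h', h]
  | inv σ _ h => nth_rewrite 1 [← h]; rw [← sK_mul, inv_mul_cancel, sK_one]

lemma apply_eq_of_mem_symGroup {v : V} (hv : v ∉ Z) {σ : Perm V} (hσ : σ ∈ symGroup Z) : σ v = v := by
  induction hσ using Subgroup.closure_induction with
  | mem σ h =>
    obtain ⟨a, ha, b, hb, rfl⟩ := h
    exact swap_apply_of_ne_of_ne (fun h => hv (h ▸ ha)) fun h => hv (h ▸ hb)
  | one => rfl
  | mul σ τ _ _ h h' => rw [Perm.mul_apply, h', h]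
  | inv σ _ h => rw [Perm.inv_eq_iff_eq, h]

lemma reynolds_mul {q : K} (hq : ∀ a ∈ Z, ∀ b ∈ Z, sK K (swap a b) q = q) (x : K) :
    reynolds K Z (q * x) = q * reynolds K Z x := by
  simp only [reynolds_apply, map_mul, fun σ : symGroup Z => sK_eq_of_mem_symGroup hq σ.2,
    mul_smul_comm, Finset.mul_sum]

open Classical in
lemma reynolds_of_fixed {x : K} (hx : ∀ a ∈ Z, ∀ b ∈ Z, sK K (swap a b) x = x) :
    reynolds K Z x = x := by
  have : (Fintype.card (symGroup Z) : ℂ) ≠ 0 := by exact_mod_cast Fintype.card_ne_zero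
  simp only [reynolds_apply, fun σ : symGroup Z => sK_eq_of_mem_symGroup hx σ.2]
  rw [Finset.sum_const, Finset.card_univ, ← Nat.cast_smul_eq_nsmul ℂ, smul_smul]
  rw [inv_mul_cancel₀ this, one_smul]

lemma reynolds_mem_TK (hYZ : Disjoint Y Z) {n : ℕ} {x : K} (hx : x ∈ TK K Y ∅ n) :
    reynolds K Z x ∈ TK K Y Z n := by
  classical
  obtain ⟨⟨f, hfx⟩, -, hf⟩ := hx
  change jK K f = x at hfx
  subst hfx
  rw [reynolds_apply]
  refine ⟨?_, fun a ha b hb => ?_, fun a ha b hb hab => ?_⟩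
  · refine Subalgebra.smul_mem _ (sum_mem fun σ _ => ?_) _
    exact ⟨rename σ.1 f, (sK_jK _ f).symm⟩
  · rw [map_smul, map_sum]
    congr 1
    have hs : swap a b ∈ symGroup Z := Subgroup.subset_closure ⟨a, ha, b, hb, rfl⟩
    rw [← Equiv.sum_comp (Equiv.mulLeft (⟨swap a b, hs⟩ : symGroup Z)) fun σ => sK K σ.1 (jK K f)]
    exact Finset.sum_congr rfl fun σ _ => (sK_mul _ _ _).symm
  · rw [map_smul, map_sum, ← smul_sub, ← Finset.sum_sub_distrib]
    refine Submodule.smul_mem _ _ (sum_mem_TO fun σ _ => ?_)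
    have hσ : ∀ v ∈ Y, σ.1 v = v := fun v hv =>
      apply_eq_of_mem_symGroup (Finset.disjoint_left.1 hYZ hv) σ.2
    have h := hf a ha b hb hab
    rw [sK_jK, ← map_sub, jK_mem_TO hab] at h
    have h1 := map_dvd (rename (R := ℂ) σ.1) h
    rw [map_pow, map_sub, rename_X, rename_X, hσ a ha, hσ b hb] at h1
    have h2 : swap a b * σ.1 = σ.1 * swap a b := by
      rw [mul_swap_eq_swap_mul, hσ a ha, hσ b hb]
    rw [← sK_mul, h2, sK_mul, ← map_sub, sK_jK, ← map_sub, sK_jK, jK_mem_TO hab]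
    exact h1

theorem regLoc_LamK_top [Nonempty V] {wt : V → ℕ} (H : IsWt wt Y Z m) (hZ : Z.card < m)
    (hwt : ∀ v, 0 < wt v) :
    RegLoc (fun l => jK K (wp wt l)) (LamK K Y Z m)
      (qStable_LamK H fun _ _ => (one_mul _).symm) := by
  refine regLoc_LamK H hZ hwt (fun _ _ => (one_mul _).symm) ?_
  obtain ⟨k, rfl⟩ : ∃ k, m = k + 1 := ⟨m - 1, by have := H.pos; omega⟩
  obtain ⟨h, hreg⟩ := exists_regLoc_TK_empty (K := K) hwt H.left k
  have hfix : ∀ l, ∀ a ∈ Z, ∀ b ∈ Z, sK K (swap a b) (jK K (wp wt l)) = jK K (wp wt l) :=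
    fun l a ha b hb => sK_wp (by rw [H.right a ha, H.right b hb]) l
  exact hreg.of_projection _ _ (isUnit_jK_wp hwt) (reynolds K Z)
    (fun l v => reynolds_mul (hfix l) v) (fun v hv => reynolds_of_fixed hv.2.1)
    (fun v hv => ⟨hv.1, by simp, hv.2.2⟩) (fun v hv => reynolds_mem_TK H.disj hv)

end chain

section graded
variable {V : Type}

lemma homogeneousComponent_linearMap (L : MvPolynomial V ℂ →ₗ[ℂ] MvPolynomial V ℂ) {e : ℕ}
    (hL : ∀ d f, f.IsHomogeneous (d + e) → (L f).IsHomogeneous d)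
    (h0 : ∀ d < e, ∀ f, f.IsHomogeneous d → L f = 0) (f : MvPolynomial V ℂ) (d : ℕ) :
    homogeneousComponent d (L f) = L (homogeneousComponent (d + e) f) := by
  have key : ∀ i, homogeneousComponent d (L (homogeneousComponent i f)) =
      if i = d + e then L (homogeneousComponent i f) else 0 := fun i => by
    rcases lt_or_ge i e with hi | hi
    · rw [h0 i hi _ (homogeneousComponent_isHomogeneous i f), map_zero, ite_self]
    · obtain ⟨k, rfl⟩ := Nat.exists_eq_add_of_le' hi
      rw [homogeneousComponent_of_mem (hL k _ (homogeneousComponent_isHomogeneous _ f))]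
      simp [eq_comm]
  nth_rewrite 1 [← sum_homogeneousComponent f]
  rw [map_sum, map_sum, Finset.sum_congr rfl fun i _ => key i, Finset.sum_ite_eq']
  split_ifs with h
  · rfl
  · rw [homogeneousComponent_eq_zero, map_zero]
    simpa [Nat.lt_succ_iff] using h

lemma dvd_homogeneousComponent {p : MvPolynomial V ℂ} {n : ℕ} (hp : p.IsHomogeneous n)
    {f : MvPolynomial V ℂ} (h : p ∣ f) (d : ℕ) : p ∣ homogeneousComponent d f := by
  obtain ⟨g, rfl⟩ := h
  rcases lt_or_ge d n with hd | hd
  · rw [homogeneousComponent_mul_eq_zero hp g hd]; exact dvd_zero p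
  · obtain ⟨k, rfl⟩ := Nat.exists_eq_add_of_le hd
    rw [homogeneousComponent_mul_of_isHomogeneous hp]; exact dvd_mul_right _ _

lemma isHomogeneous_X_sub_X (a b : V) : (X a - X b : MvPolynomial V ℂ).IsHomogeneous 1 :=
  (isHomogeneous_X ℂ a).sub (isHomogeneous_X ℂ b)

end graded

section pullback
variable {V : Type} [Fintype V] [DecidableEq V]
variable {K : Type} [Field K] [Algebra (MvPolynomial V ℂ) K]
  [IsFractionRing (MvPolynomial V ℂ) K] [Algebra ℂ K] [IsScalarTower ℂ (MvPolynomial V ℂ) K]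
variable {Y Z : Finset V} {m : ℕ}

lemma jK_mem_LamK (hYZ : Disjoint Y Z) {f : MvPolynomial V ℂ} : jK K f ∈ LamK K Y Z m ↔
    (∀ a ∈ Z, ∀ b ∈ Z, rename (swap a b) f = f) ∧
    (∀ a ∈ Y, ∀ b ∈ Y, a ≠ b → (X a - X b) ^ (2 * m + 1) ∣ f - rename (swap a b) f) ∧
    ∀ y ∈ Y, ∀ z ∈ Z, X y - X z ∣ C (m : ℂ) * pderiv z f - pderiv y f := by
  have h1 : ∀ σ : Perm V, sK K σ (jK K f) = jK K f ↔ rename σ f = f := fun σ => by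
    rw [sK_jK, jK_injective.eq_iff]
  have h2 : ∀ {a b : V}, a ≠ b → (jK K f - sK K (swap a b) (jK K f) ∈ TO K a b (2 * m + 1) ↔
      (X a - X b) ^ (2 * m + 1) ∣ f - rename (swap a b) f) := fun h => by
    rw [sK_jK, ← map_sub, jK_mem_TO h]
  have h3 : ∀ {y z : V}, y ≠ z → (jK K f ∈ Opr K m y z ↔
      X y - X z ∣ C (m : ℂ) * pderiv z f - pderiv y f) := fun {y z} h => by
    have : del K m y z (jK K f) = jK K (C (m : ℂ) * pderiv z f - pderiv y f) := by
      rw [del_apply, dK_jK, dK_jK, map_sub, map_mul]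
      congr 2
      rw [← algebraMap_eq, AlgHom.commutes, map_natCast]
    rw [mem_Opr, this, jK_mem_TO h, pow_one]
    exact and_iff_right (jK_mem_loc f)
  constructor
  · rintro ⟨⟨-, hZ, hY⟩, hm⟩
    exact ⟨fun a ha b hb => (h1 _).1 (hZ a ha b hb),
      fun a ha b hb hab => (h2 hab).1 (hY a ha b hb hab),
      fun y hy z hz => (h3 (Finset.disjoint_iff_ne.1 hYZ y hy z hz)).1 (hm y hy z hz)⟩
  · rintro ⟨hZ, hY, hm⟩
    exact ⟨⟨⟨f, rfl⟩, fun a ha b hb => (h1 _).2 (hZ a ha b hb),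
      fun a ha b hb hab => (h2 hab).2 (hY a ha b hb hab)⟩,
      fun y hy z hz => (h3 (Finset.disjoint_iff_ne.1 hYZ y hy z hz)).2 (hm y hy z hz)⟩

variable (K Y Z m) in
/-- Quasi-invariants as polynomials. -/
def LamR : Submodule ℂ (MvPolynomial V ℂ) := (LamK K Y Z m).comap (jK K).toLinearMap

lemma mem_LamR {f : MvPolynomial V ℂ} : f ∈ LamR K Y Z m ↔ jK K f ∈ LamK K Y Z m := Iff.rfl

lemma graded_LamR (hYZ : Disjoint Y Z) : Graded (LamR K Y Z m) := by
  intro f hf d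
  rw [mem_LamR, jK_mem_LamK hYZ] at hf ⊢
  have hren : ∀ σ : Perm V, homogeneousComponent d (rename σ f) =
      rename σ (homogeneousComponent d f) := fun σ =>
    homogeneousComponent_linearMap (rename σ).toLinearMap (e := 0)
      (fun d f hf => IsHomogeneous.rename_isHomogeneous hf) (by simp) f d
  refine ⟨fun a ha b hb => ?_, fun a ha b hb hab => ?_, fun y hy z hz => ?_⟩
  · rw [← hren, hf.1 a ha b hb]
  · rw [← hren, ← map_sub]
    have := (isHomogeneous_X_sub_X a b).pow (2 * m + 1)
    exact dvd_homogeneousComponent this (hf.2.1 a ha b hb hab) d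
  · let L : MvPolynomial V ℂ →ₗ[ℂ] MvPolynomial V ℂ :=
      LinearMap.mulLeft ℂ (C (m : ℂ)) ∘ₗ (pderiv z).toLinearMap - (pderiv y).toLinearMap
    have hL : ∀ f, L f = C (m : ℂ) * pderiv z f - pderiv y f := fun _ => rfl
    have h0 : ∀ f, f.IsHomogeneous 0 → L f = 0 := fun f hf => by
      rw [hL, totalDegree_eq_zero_iff_eq_C.1 (Nat.le_zero.1 hf.totalDegree_le)]; simp
    rw [← hL]
    rcases d with _ | d
    · rw [h0 _ (homogeneousComponent_isHomogeneous 0 f)]; exact dvd_zero _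
    · rw [← homogeneousComponent_linearMap L (e := 1) (fun d f hf => ?_) (fun d hd f hf => ?_)]
      · exact dvd_homogeneousComponent (isHomogeneous_X_sub_X y z) (hf.2.2 y hy z hz) d
      · rw [hL]
        have h1 := (isHomogeneous_C V (m : ℂ)).mul (hf.pderiv (i := z))
        rw [zero_add] at h1
        exact h1.sub hf.pderiv
      · obtain rfl : d = 0 := by omega
        exact h0 f hf

lemma PowReg_LamR [Nonempty V] {wt : V → ℕ} (H : IsWt wt Y Z m) (hZ : Z.card < m)
    (hwt : ∀ v, 0 < wt v) : QStable (wp wt) (LamR K Y Z m) ∧ PowReg (wp wt) (LamR K Y Z m) := by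
  have hst := qStable_LamK (K := K) (W := wt) (t := 1) H fun _ _ => (one_mul _).symm
  have h := (regLoc_LamK_top (K := K) H hZ hwt).powReg _ (isUnit_jK_wp hwt)
  refine ⟨fun l v hv => ?_, fun S k j hj v hv hjv => ?_⟩
  · rw [mem_LamR, map_mul]
    exact hst l _ hv
  · rw [mem_powSum] at hjv
    obtain ⟨u, hu, hju⟩ := hjv
    have h1 := h S k j hj (jK K v) hv (mem_powSum.2 ⟨fun l => jK K (u l), hu, by
      rw [← map_mul, hju, map_sum]
      simp only [map_mul, map_pow]⟩)
    obtain ⟨u', hu', hv'⟩ := mem_powSum.1 h1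
    choose g hg using fun l => (hu' l).1.1
    have hg' : ∀ l, jK K (g l) = u' l := hg
    refine mem_powSum.2 ⟨g, fun l => ?_, jK_injective (K := K) ?_⟩
    · rw [mem_LamR, hg']; exact hu' l
    · rw [hv', map_sum]
      simp only [map_mul, map_pow, hg']

end pullback

section final
variable {r s m : ℕ}

lemma swap_inr (i j : Fin s) : ⇑(swap (Sum.inr i : Fin r ⊕ Fin s) (Sum.inr j)) =
    Sum.map id (swap i j) := by
  rw [← Perm.sumCongr_refl_swap]; rfl

lemma swap_inl (i j : Fin r) : ⇑(swap (Sum.inl i : Fin r ⊕ Fin s) (Sum.inl j)) =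
    Sum.map (swap i j) id := by
  rw [← Perm.sumCongr_swap_refl]; rfl

variable (r s m) in
/-- Multiplicities of the variables. -/
def wtQ : Fin r ⊕ Fin s → ℕ := Sum.elim (fun _ => m) fun _ => 1

variable (r s) in
/-- The indices of the variables `y`. -/
def setY : Finset (Fin r ⊕ Fin s) := Finset.univ.map .inl

variable (r s) in
/-- The indices of the variables `z`. -/
def setZ : Finset (Fin r ⊕ Fin s) := Finset.univ.map .inr

lemma forall_setY {p : Fin r ⊕ Fin s → Prop} : (∀ v ∈ setY r s, p v) ↔ ∀ j, p (.inl j) := by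
  simp [setY]

lemma forall_setZ {p : Fin r ⊕ Fin s → Prop} : (∀ v ∈ setZ r s, p v) ↔ ∀ l, p (.inr l) := by
  simp [setZ]

lemma isWt_wtQ (hm : 0 < m) : IsWt (wtQ r s m) (setY r s) (setZ r s) m where
  left := forall_setY.2 fun _ => rfl
  right := forall_setZ.2 fun _ => rfl
  other v hY hZ := by rcases v with j | l <;> simp [setY, setZ] at hY hZ
  disj := by rw [Finset.disjoint_left]; exact forall_setY.2 fun j => by simp [setZ]
  pos := hm

lemma X_sub_X_dvd_iff {V : Type} [DecidableEq V] {a b : V} {f : MvPolynomial V ℂ} :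
    X a - X b ∣ f ↔ ∀ v : V → ℂ, v a = v b → eval v f = 0 := by
  constructor
  · rintro ⟨g, rfl⟩ v h
    rw [map_mul, map_sub, eval_X, eval_X, h, sub_self, zero_mul]
  · intro h
    rw [← subst_eq_zero_iff]
    refine MvPolynomial.funext fun v => ?_
    rw [subst, eval_rename, map_zero]
    refine h _ ?_
    rw [Function.comp_apply, Function.comp_apply, Function.update_self]
    by_cases hab : b = a
    · rw [hab, Function.update_self]
    · rw [Function.update_of_ne hab]; rfl

lemma mem_LamR_iff {K : Type} [Field K] [Algebra (Rrs r s) K] [IsFractionRing (Rrs r s) K]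
    [Algebra ℂ K] [IsScalarTower ℂ (Rrs r s) K] (hm : 0 < m) {f : Rrs r s} :
    f ∈ LamR K (setY r s) (setZ r s) m ↔ f ∈ QIset r s m := by
  rw [mem_LamR, jK_mem_LamK (isWt_wtQ hm).disj]
  simp only [forall_setY, forall_setZ, swap_inr, swap_inl, X_sub_X_dvd_iff (V := Fin r ⊕ Fin s)]
  constructor
  · rintro ⟨h1, h2, h3⟩
    refine ⟨fun τ => ?_, h3, fun j k hjk => h2 j k (by simpa using hjk)⟩
    induction τ using Perm.swap_induction_on with
    | one => simp
    | swap_mul τ i j _ h =>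
      nth_rewrite 2 [← h1 i j, ← h]
      rw [rename_rename, Sum.map_comp_map]
      rfl
  · rintro ⟨h1, h2, h3⟩
    exact ⟨fun i j => h1 _, fun j k hjk => h3 j k (by simpa using hjk), h2⟩

lemma wp_wtQ (l : Fin (Fintype.card (Fin r ⊕ Fin s))) : wp (wtQ r s m) l = Qm r s m (l + 1) := by
  rw [wp, wpsum, Fintype.sum_sum_type, Qm, Finset.mul_sum]
  simp [wtQ]

lemma Bm_eq : Bm r s m = Algebra.adjoin ℂ (Set.range (wp (wtQ r s m))) := by
  rw [Bm]
  congr 1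
  ext f
  constructor
  · rintro ⟨i, h1, h2, rfl⟩
    refine ⟨⟨i - 1, by simp; omega⟩, ?_⟩
    rw [wp_wtQ, Nat.sub_add_cancel h1]
  · rintro ⟨l, rfl⟩
    have := l.2
    simp only [Fintype.card_sum, Fintype.card_fin] at this
    exact ⟨l + 1, by omega, by omega, wp_wtQ l⟩

lemma exists_aeval_eq {x : Rrs r s} (hx : x ∈ Bm r s m) :
    ∃ p : MvPolynomial (Fin (Fintype.card (Fin r ⊕ Fin s))) ℂ, aeval (wp (wtQ r s m)) p = x := by
  rw [Bm_eq, Algebra.adjoin_range_eq_range_aeval] at hx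
  exact hx

lemma aeval_mem_Bm (p : MvPolynomial (Fin (Fintype.card (Fin r ⊕ Fin s))) ℂ) :
    aeval (wp (wtQ r s m)) p ∈ Bm r s m := by
  rw [Bm_eq, Algebra.adjoin_range_eq_range_aeval]
  exact ⟨p, rfl⟩

lemma linearIndependent_of_theta {J : Type} {b : J → Rrs r s}
    (hb : Function.Injective (theta (wp (wtQ r s m)) b)) : LinearIndependent (Bm r s m) b := by
  rw [linearIndependent_iff]
  intro c hc
  choose g hg using fun x : Bm r s m => exists_aeval_eq x.2
  let c' : J →₀ MvPolynomial (Fin (Fintype.card (Fin r ⊕ Fin s))) ℂ :=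
    Finsupp.onFinset c.support (fun k => if c k = 0 then 0 else g (c k)) fun k hk => by
      rw [Finsupp.mem_support_iff]; exact fun h => hk (if_pos h)
  have hc' : ∀ k, aeval (wp (wtQ r s m)) (c' k) = (c k : Rrs r s) := fun k => by
    rw [Finsupp.onFinset_apply]
    split_ifs with h
    · rw [h, map_zero]; rfl
    · exact hg _
  have h0 : c' = 0 := hb (by
    rw [map_zero, theta_apply, Finsupp.sum_of_support_subset _ Finsupp.support_onFinset_subset _ (by simp),
      ← hc, Finsupp.linearCombination_apply, Finsupp.sum]
    exact Finset.sum_congr rfl fun k _ => congrArg (· * b k) (hc' k))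
  ext k : 1
  apply Subtype.ext
  rw [← hc', h0]
  simp

lemma span_eq_QImod {J : Type} {b : J → Rrs r s} (hb : ∀ k, b k ∈ QIset r s m)
    (hr : ∀ f ∈ QIset r s m, f ∈ LinearMap.range (theta (wp (wtQ r s m)) b)) :
    Submodule.span (Bm r s m) (Set.range b) = QImod r s m := by
  refine le_antisymm (Submodule.span_mono ?_) (Submodule.span_le.2 fun f hf => ?_)
  · rintro _ ⟨k, rfl⟩
    exact hb k
  · obtain ⟨c, rfl⟩ := hr f hf
    rw [theta_apply]
    refine sum_mem fun k _ => ?_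
    exact Submodule.smul_mem _ (⟨_, aeval_mem_Bm (c k)⟩ : Bm r s m) (Submodule.subset_span ⟨k, rfl⟩)

lemma finite_QImod (hm : 0 < m) : Module.Finite (Bm r s m) (QImod r s m) := by
  have h1 : Module.Finite (Bm r s m) (Rrs r s) := by
    rw [Bm_eq]
    refine finite_adjoin_wp fun v => ?_
    rcases v with j | l
    · exact hm
    · exact one_pos
  have h2 : IsNoetherianRing (Bm r s m) := by
    apply isNoetherianRing_of_fg
    rw [Bm_eq]
    obtain ⟨S, hS⟩ := (Set.finite_range (wp (wtQ r s m))).exists_finset_coe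
    exact ⟨S, by rw [hS]⟩
  infer_instance

end final
end QI

/-- (M. Feigin) If `r ≥ 2`, `s ≥ 1` and `m > s`, then the algebra `Λ_{r,s}(m)` of
`m`-quasi-invariants is Cohen–Macaulay: it is a free module of finite rank over its
polynomial subalgebra `ℂ[Q_1,...,Q_{r+s}]`. -/
theorem quasiInvariants_CM (r s m : ℕ) (hr : 2 ≤ r) (hs : 1 ≤ s) (hm : s < m) :
    Module.Finite ↥(Bm r s m) ↥(QImod r s m) ∧
    Module.Free ↥(Bm r s m) ↥(QImod r s m) := by
  have hm0 : 0 < m := by omega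
  refine ⟨QI.finite_QImod hm0, ?_⟩
  have : Nonempty (Fin r ⊕ Fin s) := ⟨.inr ⟨0, hs⟩⟩
  have H := QI.isWt_wtQ (r := r) (s := s) hm0
  obtain ⟨hst, hreg⟩ := QI.PowReg_LamR (K := FractionRing (Rrs r s)) H (by simpa [QI.setZ] using hm)
    fun v => by
      rcases v with j | l
      · exact hm0
      · exact one_pos
  obtain ⟨J, b, hb, hrange⟩ := QI.exists_theta_injective (QI.graded_LamR H.disj) hst
    (dq := fun l => l + 1) (fun l => Nat.succ_pos _) (fun l => QI.wpsum_isHomogeneous _ _)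
    fun j v hv => hreg _ _ j (by simp) v hv
  have hmem : ∀ f, f ∈ QIset r s m ↔ f ∈ LinearMap.range (QI.theta (QI.wp (QI.wtQ r s m)) b) :=
    fun f => by rw [hrange, QI.mem_LamR_iff hm0]
  rw [← QI.span_eq_QImod (b := b) (fun k => ?_) fun f hf => (hmem f).1 hf]
  · exact Module.Free.of_basis (Module.Basis.span (QI.linearIndependent_of_theta hb))
  · rw [hmem]
    exact ⟨Finsupp.single k 1, by rw [QI.theta_single, map_one, one_mul]⟩
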